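/- Let Ω ⊂ ℝ³ be a bounded open set with Lipschitz boundary, let 0 ≤ α < 2, and let F : Ω → ℝ^{3×3} be measurable with ∫_Ω d^{−α/2} |F|^{3/2} dx < ∞. Then there exists v ∈ W^{1,3}_{0,σ}(Ω, d^α), with ω = curl v, which is a weak solution of div(v ⊗ v) + curl(d^α |ω| ω) + ∇π = div F, div v = 0, v|_{∂Ω} = 0, in the sense that for every φ ∈ C^∞_{0,σ}(Ω): −∫_Ω (v ⊗ v) : ∇φ dx + ∫_Ω d^α |ω| ω · curl φ dx = −∫_Ω F : ∇φ dx. -/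

import Mathlib

noncomputable section

open MeasureTheory Real Filter Topology Bornology ENNReal NNReal

/-- Euclidean 3-space. -/
abbrev E3 : Type := EuclideanSpace ℝ (Fin 3)

/-- Euclidean 2-space. -/
abbrev E2 : Type := EuclideanSpace ℝ (Fin 2)

/-- The `i`-th standard basis vector of `E3`. -/
def ee (i : Fin 3) : E3 := EuclideanSpace.single i 1

/-- Partial derivative `∂ᵢ f` of a scalar function. -/
def pds (f : E3 → ℝ) (i : Fin 3) (x : E3) : ℝ := fderiv ℝ f x (ee i)

/-- Partial derivative `∂ᵢ vⱼ` of a vector field. -/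
def pd (v : E3 → E3) (i j : Fin 3) (x : E3) : ℝ := fderiv ℝ v x (ee i) j

/-- Build a vector of `E3` from coordinates. -/
def mk3 (a b c : ℝ) : E3 := (WithLp.equiv 2 (Fin 3 → ℝ)).symm ![a, b, c]

/-- Build a vector of `E2` from coordinates. -/
def mk2 (a b : ℝ) : E2 := (WithLp.equiv 2 (Fin 2 → ℝ)).symm ![a, b]

/-- First two coordinates `x'` of a point of `E3`. -/
def proj12 (y : E3) : E2 := mk2 (y 0) (y 1)

/-- Gradient of a scalar function, as a vector field. -/
def grad3 (f : E3 → ℝ) (x : E3) : E3 := mk3 (pds f 0 x) (pds f 1 x) (pds f 2 x)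

/-- Gradient matrix `(∇v)ᵢⱼ = ∂ᵢ vⱼ` of a vector field. -/
def gradv (v : E3 → E3) (x : E3) (i j : Fin 3) : ℝ := pd v i j x

/-- Divergence of a vector field. -/
def vdiv (v : E3 → E3) (x : E3) : ℝ := ∑ i, pd v i i x

/-- Curl `∇ × v` of a vector field. -/
def vcurl (v : E3 → E3) (x : E3) : E3 :=
  mk3 (pd v 1 2 x - pd v 2 1 x) (pd v 2 0 x - pd v 0 2 x) (pd v 0 1 x - pd v 1 0 x)

/-- Curl computed from a (weak) gradient matrix `G`, `(curl v)₁ = G₂₃ - G₃₂` etc. -/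
def curlOf (G : E3 → Fin 3 → Fin 3 → ℝ) (x : E3) : E3 :=
  mk3 (G x 1 2 - G x 2 1) (G x 2 0 - G x 0 2) (G x 0 1 - G x 1 0)

/-- Divergence computed from a (weak) gradient matrix. -/
def divOf (G : E3 → Fin 3 → Fin 3 → ℝ) (x : E3) : ℝ := ∑ i, G x i i

/-- Cross product on `E3`. -/
def cross3 (a b : E3) : E3 :=
  mk3 (a 1 * b 2 - a 2 * b 1) (a 2 * b 0 - a 0 * b 2) (a 0 * b 1 - a 1 * b 0)

/-- Euclidean dot product on `E3`. -/
def dot3 (a b : E3) : ℝ := ∑ i, a i * b i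

/-- Frobenius (double-dot) product of two 3×3 matrices. -/
def mdot (A B : Fin 3 → Fin 3 → ℝ) : ℝ := ∑ i, ∑ j, A i j * B i j

/-- Frobenius (Euclidean) norm of a 3×3 matrix. -/
def frob (M : Fin 3 → Fin 3 → ℝ) : ℝ := Real.sqrt (∑ i, ∑ j, (M i j) ^ 2)

/-- Symmetric part of a 3×3 matrix. -/
def symm3 (M : Fin 3 → Fin 3 → ℝ) (i j : Fin 3) : ℝ := (M i j + M j i) / 2

/-- Distance to the boundary of `Ω`. -/
def dB (Ω : Set E3) (x : E3) : ℝ := Metric.infDist x (frontier Ω)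

/-- Scalar test functions: smooth compactly supported inside `Ω`. -/
structure IsTestS (Ω : Set E3) (ψ : E3 → ℝ) : Prop where
  smooth : ContDiff ℝ (⊤ : ℕ∞) ψ
  compsupp : HasCompactSupport ψ
  suppin : tsupport ψ ⊆ Ω

/-- Vector test functions: smooth compactly supported inside `Ω`. -/
structure IsTest (Ω : Set E3) (φ : E3 → E3) : Prop where
  smooth : ContDiff ℝ (⊤ : ℕ∞) φ
  compsupp : HasCompactSupport φ
  suppin : tsupport φ ⊆ Ω

/-- Solenoidal (divergence-free) vector test functions `C^∞_{0,σ}(Ω)`. -/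
structure IsTestSol (Ω : Set E3) (φ : E3 → E3) extends IsTest Ω φ : Prop where
  sol : ∀ x, vdiv φ x = 0

/-- `G` is the distributional gradient of the vector field `v` on `Ω`. -/
def HasWeakGrad (Ω : Set E3) (v : E3 → E3) (G : E3 → Fin 3 → Fin 3 → ℝ) : Prop :=
  ∀ ψ : E3 → ℝ, IsTestS Ω ψ → ∀ i j,
    ∫ x in Ω, v x j * pds ψ i x = - ∫ x in Ω, G x i j * ψ x

/-- `G` is the distributional gradient of the scalar function `u` on `Ω`. -/
def HasWeakGradS (Ω : Set E3) (u : E3 → ℝ) (G : E3 → E3) : Prop :=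
  ∀ ψ : E3 → ℝ, IsTestS Ω ψ → ∀ i,
    ∫ x in Ω, u x * pds ψ i x = - ∫ x in Ω, G x i * ψ x

/-- Membership `v ∈ W^{1,p}_{0,σ}(Ω, d^α)` (with distributional gradient `G`):
`v` is measurable, `G` is its distributional gradient, the weighted norm is finite and
`v` is approximated by smooth compactly supported *solenoidal* fields in the weighted norm.
The unweighted space corresponds to `α = 0`. -/
structure MemW1pSigma (Ω : Set E3) (p α : ℝ) (v : E3 → E3)
    (G : E3 → Fin 3 → Fin 3 → ℝ) : Prop where
  meas : AEStronglyMeasurable v (volume.restrict Ω)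
  weak_grad : HasWeakGrad Ω v G
  finite : IntegrableOn (fun x => dB Ω x ^ α * (‖v x‖ ^ p + frob (G x) ^ p)) Ω
  approx : ∃ φ : ℕ → E3 → E3, (∀ n, IsTestSol Ω (φ n)) ∧
    Tendsto (fun n => ∫ x in Ω, dB Ω x ^ α *
        (‖v x - φ n x‖ ^ p + frob (fun i j => G x i j - gradv (φ n) x i j) ^ p))
      atTop (nhds 0)

/-- Membership `v ∈ W^{1,p}_0(Ω, d^α)` (with distributional gradient `G`):
as `MemW1pSigma` but approximating fields need not be divergence free. -/
structure MemW1p0 (Ω : Set E3) (p α : ℝ) (v : E3 → E3)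
    (G : E3 → Fin 3 → Fin 3 → ℝ) : Prop where
  meas : AEStronglyMeasurable v (volume.restrict Ω)
  weak_grad : HasWeakGrad Ω v G
  finite : IntegrableOn (fun x => dB Ω x ^ α * (‖v x‖ ^ p + frob (G x) ^ p)) Ω
  approx : ∃ φ : ℕ → E3 → E3, (∀ n, IsTest Ω (φ n)) ∧
    Tendsto (fun n => ∫ x in Ω, dB Ω x ^ α *
        (‖v x - φ n x‖ ^ p + frob (fun i j => G x i j - gradv (φ n) x i j) ^ p))
      atTop (nhds 0)

/-- A bounded open set of `ℝ³` with Lipschitz (`C^{0,1}`) boundary: near every boundary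
point, after a rigid change of coordinates, the boundary is the graph of a Lipschitz
function `a` (with Lipschitz constant `r < 1`) and `Ω` lies locally above the graph. -/
structure IsLipschitzDomain (Ω : Set E3) : Prop where
  nonempty : Ω.Nonempty
  isOpen : IsOpen Ω
  isBounded : IsBounded Ω
  charts : ∀ P ∈ frontier Ω, ∃ (f : E3 ≃ᵢ E3) (R R' r : ℝ) (a : E2 → ℝ),
    f P = 0 ∧ 0 < R ∧ 0 < R' ∧ 0 < r ∧ r < 1 ∧
    LipschitzWith (Real.toNNReal r) a ∧
    (∀ x' : E2, ‖x'‖ < R → |a x'| < R') ∧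
    (∀ y : E3, ‖proj12 y‖ < R → |y 2| < R' →
      (f.symm y ∈ frontier Ω ↔ y 2 = a (proj12 y))) ∧
    (∀ y : E3, ‖proj12 y‖ < R →
      a (proj12 y) < y 2 → y 2 < a (proj12 y) + R' → f.symm y ∈ Ω)

/-- A bounded open set of `ℝ³` with smooth (`C^∞`) boundary. -/
structure IsSmoothDomain (Ω : Set E3) : Prop where
  nonempty : Ω.Nonempty
  isOpen : IsOpen Ω
  isBounded : IsBounded Ω
  charts : ∀ P ∈ frontier Ω, ∃ (f : E3 ≃ᵢ E3) (R R' : ℝ) (a : E2 → ℝ),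
    f P = 0 ∧ 0 < R ∧ 0 < R' ∧ ContDiff ℝ (⊤ : ℕ∞) a ∧
    (∀ x' : E2, ‖x'‖ < R → |a x'| < R') ∧
    (∀ y : E3, ‖proj12 y‖ < R → |y 2| < R' →
      (f.symm y ∈ frontier Ω ↔ y 2 = a (proj12 y))) ∧
    (∀ y : E3, ‖proj12 y‖ < R →
      a (proj12 y) < y 2 → y 2 < a (proj12 y) + R' → f.symm y ∈ Ω)

/-- The axis-parallel closed cube with center `c` and half side-length `h`. -/
def cube (c : E3) (h : ℝ) : Set E3 := {x | ∀ i, |x i - c i| ≤ h}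

/-- Average of (the nonnegative part of) `f` over a set, valued in `ℝ≥0∞`. -/
def lavg (s : Set E3) (f : E3 → ℝ) : ℝ≥0∞ :=
  (∫⁻ x in s, ENNReal.ofReal (f x)) / volume s

/-- The Muckenhoupt `A_p` condition for a weight `w` on `ℝ³`:
`(⨍_Q w)(⨍_Q w^{-1/(p-1)})^{p-1} ≤ C` uniformly over all cubes `Q`. -/
def IsMuckenhouptAp (w : E3 → ℝ) (p : ℝ) : Prop :=
  ∃ C : ℝ, ∀ (c : E3) (h : ℝ), 0 < h →
    lavg (cube c h) w * (lavg (cube c h) (fun x => w x ^ (-1 / (p - 1)))) ^ (p - 1)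
      ≤ ENNReal.ofReal C

section
/-- Smooth compactly supported scalar functions. -/
structure CC (f : E3 → ℝ) : Prop where
  sm : ContDiff ℝ (⊤ : ℕ∞) f
  cs : HasCompactSupport f

lemma pds_eq (f : E3 → ℝ) (i : Fin 3) : pds f i = fun x => fderiv ℝ f x (ee i) := rfl

lemma CC.cont {f : E3 → ℝ} (h : CC f) : Continuous f := h.sm.continuous

lemma CC.diff {f : E3 → ℝ} (h : CC f) : Differentiable ℝ f :=
  h.sm.differentiable (by simp)

lemma CC.pds {f : E3 → ℝ} (h : CC f) (i : Fin 3) : CC (pds f i) := by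
  refine ⟨?_, ?_⟩
  · have h1 : ContDiff ℝ (⊤ : ℕ∞) (fderiv ℝ f) := h.sm.fderiv_right (by simp)
    exact h1.clm_apply contDiff_const
  · exact h.cs.fderiv_apply ℝ (ee i)

lemma CC.add {f g : E3 → ℝ} (hf : CC f) (hg : CC g) : CC (fun x => f x + g x) :=
  ⟨hf.sm.add hg.sm, hf.cs.add hg.cs⟩

lemma CC.const_mul {f : E3 → ℝ} (hf : CC f) (c : ℝ) : CC (fun x => c * f x) :=
  ⟨contDiff_const.mul hf.sm, hf.cs.mul_left⟩

lemma CC.neg {f : E3 → ℝ} (hf : CC f) : CC (fun x => - f x) :=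
  ⟨hf.sm.neg, hf.cs.neg⟩

lemma CC.sub {f g : E3 → ℝ} (hf : CC f) (hg : CC g) : CC (fun x => f x - g x) :=
  ⟨hf.sm.sub hg.sm, hf.cs.sub hg.cs⟩

lemma CC.mul {f g : E3 → ℝ} (hf : CC f) (hg : CC g) : CC (fun x => f x * g x) :=
  ⟨hf.sm.mul hg.sm, hf.cs.mul_right⟩

lemma CC.integrable {f : E3 → ℝ} (hf : CC f) : Integrable f :=
  hf.cont.integrable_of_hasCompactSupport hf.cs

lemma CC.bdd {f : E3 → ℝ} (hf : CC f) : ∃ C, 0 ≤ C ∧ ∀ x, |f x| ≤ C := by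
  obtain ⟨C, hC⟩ := hf.cs.exists_bound_of_continuous hf.cont
  exact ⟨C, (norm_nonneg _).trans (hC 0), hC⟩

lemma CC.fbdd {f : E3 → ℝ} (hf : CC f) : ∃ C, 0 ≤ C ∧ ∀ x, ‖fderiv ℝ f x‖ ≤ C := by
  have h1 : Continuous (fderiv ℝ f) := hf.sm.continuous_fderiv (by simp)
  obtain ⟨C, hC⟩ := (hf.cs.fderiv ℝ).exists_bound_of_continuous h1
  exact ⟨C, (norm_nonneg _).trans (hC 0), hC⟩

lemma cc_zero : CC (fun _ => 0) := ⟨contDiff_const, HasCompactSupport.zero⟩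

lemma pds_add {f g : E3 → ℝ} (hf : Differentiable ℝ f) (hg : Differentiable ℝ g) (i : Fin 3) :
    pds (fun x => f x + g x) i = fun x => pds f i x + pds g i x := by
  funext x
  simp only [pds]
  rw [fderiv_fun_add (hf x) (hg x)]; rfl

lemma pds_sub {f g : E3 → ℝ} (hf : Differentiable ℝ f) (hg : Differentiable ℝ g) (i : Fin 3) :
    pds (fun x => f x - g x) i = fun x => pds f i x - pds g i x := by
  funext x
  simp only [pds]
  rw [fderiv_fun_sub (hf x) (hg x)]; rfl

lemma pds_const_mul {f : E3 → ℝ} (hf : Differentiable ℝ f) (c : ℝ) (i : Fin 3) :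
    pds (fun x => c * f x) i = fun x => c * pds f i x := by
  funext x
  simp only [pds]
  rw [fderiv_const_mul (hf x)]; rfl

lemma pds_comm {f : E3 → ℝ} (hf : CC f) (i j : Fin 3) :
    pds (pds f i) j = pds (pds f j) i := by
  funext x
  have h1 : ContDiff ℝ (⊤ : ℕ∞) (fderiv ℝ f) := hf.sm.fderiv_right (by simp)
  have h1d : DifferentiableAt ℝ (fderiv ℝ f) x := (h1.differentiable (by simp)) x
  have key : ∀ a b : E3, fderiv ℝ (fun y => fderiv ℝ f y a) x b = fderiv ℝ (fderiv ℝ f) x b a := by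
    intro a b
    rw [fderiv_clm_apply h1d (differentiableAt_const _)]
    simp
  have hs : IsSymmSndFDerivAt ℝ f x :=
    (hf.sm.contDiffAt).isSymmSndFDerivAt (by simp only [minSmoothness_of_isRCLikeNormedField]; exact WithTop.coe_le_coe.2 (le_top : (2:ℕ∞) ≤ ⊤))
  have e1 := key (ee i) (ee j)
  have e2 := key (ee j) (ee i)
  rw [hs] at e1
  exact e1.trans e2.symm

/-- vector decomposition -/
lemma E3_sum (z : E3) : z = ∑ i, z i • ee i := by
  ext j
  simp [ee, Fin.sum_univ_three]
  fin_cases j <;> simp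

lemma fderiv_eq_sum (f : E3 → ℝ) (x z : E3) : fderiv ℝ f x z = ∑ i, z i * pds f i x := by
  conv_lhs => rw [E3_sum z]
  simp [pds, map_sum]

lemma ee_norm (i : Fin 3) : ‖ee i‖ = 1 := by simp [ee]

lemma coord_le (z : E3) (i : Fin 3) : |z i| ≤ ‖z‖ := by
  simpa using PiLp.norm_apply_le (p := 2) z i

/-! ### The Gaussian -/

def gm : ℝ := ∫ z : E3, rexp (-(1/2) * ‖z‖ ^ 2)

def gam (z : E3) : ℝ := rexp (-(1/2) * ‖z‖ ^ 2) / gm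

lemma integrable_exp_sq {b : ℝ} (hb : 0 < b) : Integrable (fun z : E3 => rexp (-b * ‖z‖ ^ 2)) := by
  have := (GaussianFourier.integrable_cexp_neg_mul_sq_norm_add (V := E3) (b := (b : ℂ))
    (by simpa using hb) 0 0).norm
  refine this.congr (Eventually.of_forall fun z => ?_)
  simp only [zero_mul, add_zero, Complex.norm_exp]
  congr 1
  norm_cast

lemma gm_pos : 0 < gm := by
  unfold gm
  rw [GaussianFourier.integral_rexp_neg_mul_sq_norm (by norm_num)]
  positivity

lemma gam_cont : Continuous gam := by unfold gam; fun_prop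

lemma gam_pos (z : E3) : 0 < gam z := div_pos (exp_pos _) gm_pos

lemma gam_le (z : E3) : gam z ≤ 1 / gm := by
  unfold gam
  gcongr
  · exact gm_pos.le
  · rw [Real.exp_le_one_iff]; nlinarith [sq_nonneg ‖z‖]

lemma gam_int : Integrable gam := (integrable_exp_sq (by norm_num : (0:ℝ) < 1/2)).div_const _

lemma gam_one : ∫ z, gam z = 1 := by
  unfold gam
  rw [integral_div]
  exact div_self gm_pos.ne'

lemma gam_norm_int : Integrable (fun z : E3 => ‖z‖ * gam z) := by
  refine Integrable.mono' ((integrable_exp_sq (by norm_num : (0:ℝ) < 1/4)).const_mul (4 / gm))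
    (by have := gam_cont; fun_prop) (Eventually.of_forall fun z => ?_)
  have h1 : ‖z‖ ≤ 4 * rexp (1/4 * ‖z‖^2) := by
    have := Real.add_one_le_exp (1/4 * ‖z‖^2)
    nlinarith [sq_nonneg (‖z‖ - 1)]
  rw [Real.norm_of_nonneg (mul_nonneg (norm_nonneg _) (gam_pos z).le)]
  unfold gam
  have h2 : rexp (-(1/2) * ‖z‖^2) = rexp (-(1/4) * ‖z‖^2) * rexp (-(1/4) * ‖z‖^2) := by
    rw [← Real.exp_add]; ring_nf
  have h3 : rexp (1/4 * ‖z‖^2) * rexp (-(1/4) * ‖z‖^2) = 1 := by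
    rw [← Real.exp_add]; ring_nf; simp
  rw [h2, mul_div_assoc', div_mul_eq_mul_div]
  refine div_le_div_of_nonneg_right ?_ gm_pos.le
  have e1 := (exp_pos (-(1/4) * ‖z‖^2))
  calc ‖z‖ * (rexp (-(1/4) * ‖z‖^2) * rexp (-(1/4) * ‖z‖^2))
      ≤ (4 * rexp (1/4 * ‖z‖^2)) * (rexp (-(1/4) * ‖z‖^2) * rexp (-(1/4) * ‖z‖^2)) := by gcongr
    _ = 4 * (rexp (1/4 * ‖z‖^2) * rexp (-(1/4) * ‖z‖^2)) * rexp (-(1/4) * ‖z‖^2) := by ring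
    _ = _ := by rw [h3]; ring

lemma gam_deriv (z : E3) (i : Fin 3) : pds gam i z = - (z i) * gam z := by
  have h : HasFDerivAt (fun z : E3 => ‖z‖ ^ 2) (2 • (innerSL ℝ z)) z := by
    simpa using (hasStrictFDerivAt_norm_sq z).hasFDerivAt
  have h2 := ((h.const_mul (-(1/2))).exp).const_mul (1/gm)
  have h3 : gam = fun z => 1 / gm * rexp (-(1/2) * ‖z‖^2) := by
    funext z; simp [gam]; ring
  unfold pds
  rw [h3, h2.fderiv]
  simp [ee, EuclideanSpace.inner_single_right]
  ring

lemma gam_diff : Differentiable ℝ gam := by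
  intro z
  unfold gam
  have h : HasFDerivAt (fun z : E3 => ‖z‖ ^ 2) (2 • (innerSL ℝ z)) z := by
    simpa using (hasStrictFDerivAt_norm_sq z).hasFDerivAt
  have h2 := ((h.differentiableAt.const_mul (-(1/2))).exp).mul_const (gm⁻¹)
  simpa only [div_eq_mul_inv] using h2

/-- Gaussian integration by parts. -/
lemma gam_ibp {h : E3 → ℝ} (hd : ContDiff ℝ 1 h) {C D : ℝ} (hC : ∀ z, |h z| ≤ C)
    (i : Fin 3) (hD : ∀ z, |pds h i z| ≤ D) :
    ∫ z, h z * (z i * gam z) = ∫ z, pds h i z * gam z := by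
  have hc : Continuous h := hd.continuous
  have hdc : Continuous (pds h i) := (hd.continuous_fderiv (by simp)).clm_apply continuous_const
  have gi : Integrable (fun z : E3 => z i * gam z) := by
    refine gam_norm_int.mono' (by have := gam_cont; fun_prop) (Eventually.of_forall fun z => ?_)
    rw [norm_mul, Real.norm_of_nonneg (gam_pos z).le]
    exact mul_le_mul_of_nonneg_right (coord_le z i) (gam_pos z).le
  have := integral_mul_fderiv_eq_neg_fderiv_mul_of_integrable (μ := (volume : Measure E3))
    (f := h) (g := gam) (v := ee i)
    (gam_int.bdd_mul (c := D) hdc.aestronglyMeasurable (Eventually.of_forall hD))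
    (by
      have e : (fun x => h x * fderiv ℝ gam x (ee i)) = fun x => h x * (- (x i * gam x)) := by
        funext x
        have := gam_deriv x i
        unfold pds at this
        rw [this]; ring
      rw [e]
      exact gi.neg.bdd_mul (c := C) hc.aestronglyMeasurable (Eventually.of_forall hC))
    (gam_int.bdd_mul (c := C) hc.aestronglyMeasurable (Eventually.of_forall hC))
    (fun x _ => hd.differentiable (by simp) x) (fun x _ => gam_diff x)
  have e : (fun x => h x * fderiv ℝ gam x (ee i)) = fun x => - (h x * (x i * gam x)) := by
    funext x
    have := gam_deriv x i
    unfold pds at this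
    rw [this]; ring
  rw [e, integral_neg] at this
  simpa [pds] using this

/-! ### Heat extension -/

def heat (f : E3 → ℝ) (s : ℝ) (x : E3) : ℝ := ∫ z, f (x + s • z) * gam z

lemma heat_zero (f : E3 → ℝ) (x : E3) : heat f 0 x = f x := by
  simp [heat, integral_const_mul, gam_one]

lemma CC.heat_int {f : E3 → ℝ} (hf : CC f) (s : ℝ) (x : E3) :
    Integrable (fun z => f (x + s • z) * gam z) := by
  obtain ⟨C, _, hC⟩ := hf.bdd
  have := hf.cont
  exact gam_int.bdd_mul (c := C) (by fun_prop) (Eventually.of_forall fun z => hC _)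

lemma heat_abs_le {f : E3 → ℝ} (hf : CC f) {C : ℝ} (hC : ∀ x, |f x| ≤ C) (s : ℝ) (x : E3) :
    |heat f s x| ≤ C := by
  unfold heat
  calc |∫ z, f (x + s • z) * gam z| ≤ ∫ z, |f (x + s • z) * gam z| := abs_integral_le_integral_abs
    _ ≤ ∫ z, C * gam z := by
        apply integral_mono (hf.heat_int s x).abs (gam_int.const_mul C)
        intro z
        simp only [abs_mul, abs_of_pos (gam_pos z)]
        exact mul_le_mul_of_nonneg_right (hC _) (gam_pos z).le
    _ = C := by rw [integral_const_mul, gam_one, mul_one]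

lemma heat_nonneg {f : E3 → ℝ} (h : ∀ x, 0 ≤ f x) (s : ℝ) (x : E3) : 0 ≤ heat f s x :=
  integral_nonneg fun z => mul_nonneg (h _) (gam_pos z).le

lemma heat_cont {f : E3 → ℝ} (hf : CC f) : Continuous (fun p : ℝ × E3 => heat f p.1 p.2) := by
  obtain ⟨C, _, hC⟩ := hf.bdd
  have hc := hf.cont
  have gc := gam_cont
  unfold heat
  refine continuous_of_dominated (bound := fun z => C * gam z) (fun p => by fun_prop) ?_
    (gam_int.const_mul C) (Eventually.of_forall fun z => by fun_prop)
  intro p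
  refine Eventually.of_forall fun z => ?_
  rw [norm_mul, Real.norm_of_nonneg (gam_pos z).le]
  exact mul_le_mul_of_nonneg_right (hC _) (gam_pos z).le

lemma heat_fderiv {f : E3 → ℝ} (hf : CC f) (s : ℝ) (x : E3) :
    HasFDerivAt (heat f s) (∫ z, gam z • fderiv ℝ f (x + s • z)) x := by
  obtain ⟨D, hD0, hD⟩ := hf.fbdd
  have hc := hf.cont
  have gc := gam_cont
  have hfc : Continuous (fderiv ℝ f) := hf.sm.continuous_fderiv (by simp)
  unfold heat
  refine hasFDerivAt_integral_of_dominated_of_fderiv_le (bound := fun z => D * gam z)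
    (s := Set.univ) (F := fun x z => f (x + s • z) * gam z)
    (F' := fun x z => gam z • fderiv ℝ f (x + s • z))
    univ_mem (Eventually.of_forall fun y => by fun_prop) (hf.heat_int s x)
    (by fun_prop) ?_ (gam_int.const_mul D) ?_
  · refine Eventually.of_forall fun z y _ => ?_
    rw [norm_smul, Real.norm_of_nonneg (gam_pos z).le, mul_comm]
    exact mul_le_mul_of_nonneg_right (hD _) (gam_pos z).le
  · refine Eventually.of_forall fun z y _ => ?_
    have h1 : HasFDerivAt (fun y : E3 => f (y + s • z)) (fderiv ℝ f (y + s • z)) y := by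
      have := (hf.diff (y + s • z)).hasFDerivAt
      exact (hasFDerivAt_comp_add_right (s • z)).2 this
    exact h1.mul_const (gam z)

lemma heat_diff {f : E3 → ℝ} (hf : CC f) (s : ℝ) : Differentiable ℝ (heat f s) :=
  fun x => (heat_fderiv hf s x).differentiableAt

lemma heat_pds {f : E3 → ℝ} (hf : CC f) (s : ℝ) (i : Fin 3) :
    pds (heat f s) i = heat (pds f i) s := by
  funext x
  have hfc : Continuous (fderiv ℝ f) := hf.sm.continuous_fderiv (by simp)
  obtain ⟨D, hD0, hD⟩ := hf.fbdd
  have gc := gam_cont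
  unfold pds
  rw [(heat_fderiv hf s x).fderiv, ContinuousLinearMap.integral_apply]
  · unfold heat
    congr 1; funext z; simp [mul_comm, pds]
  · refine (gam_int.const_mul D).mono' (by fun_prop) (Eventually.of_forall fun z => ?_)
    rw [norm_smul, Real.norm_of_nonneg (gam_pos z).le, mul_comm]
    exact mul_le_mul_of_nonneg_right (hD _) (gam_pos z).le

/-- scalar Laplacian -/
def lap (f : E3 → ℝ) (x : E3) : ℝ := ∑ i, pds (pds f i) i x

lemma CC.sum {f : Fin 3 → E3 → ℝ} (hf : ∀ i, CC (f i)) : CC (fun x => ∑ i, f i x) := by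
  simp only [Fin.sum_univ_three]
  exact ((hf 0).add (hf 1)).add (hf 2)

lemma CC.lap {f : E3 → ℝ} (hf : CC f) : CC (lap f) :=
  CC.sum (f := fun i => _root_.pds (_root_.pds f i) i) fun i => (hf.pds i).pds i

lemma heat_sum {f : Fin 3 → E3 → ℝ} (hf : ∀ i, CC (f i)) (s : ℝ) (x : E3) :
    heat (fun x => ∑ i, f i x) s x = ∑ i, heat (f i) s x := by
  unfold heat
  rw [← integral_finsetSum _ fun i _ => (hf i).heat_int s x]
  congr 1; funext z; rw [Finset.sum_mul]

lemma heat_deriv {f : E3 → ℝ} (hf : CC f) (s : ℝ) (x : E3) :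
    HasDerivAt (fun s => heat f s x) (s * heat (lap f) s x) s := by
  obtain ⟨D, hD0, hD⟩ := hf.fbdd
  have hc := hf.cont
  have gc := gam_cont
  have hfc : Continuous (fderiv ℝ f) := hf.sm.continuous_fderiv (by simp)
  have main := hasDerivAt_integral_of_dominated_loc_of_deriv_le
    (μ := (volume : Measure E3)) (bound := fun z => D * (‖z‖ * gam z))
    (s := Set.univ) (x₀ := s) (F := fun s z => f (x + s • z) * gam z)
    (F' := fun s z => fderiv ℝ f (x + s • z) z * gam z)
    univ_mem (Eventually.of_forall fun y => by fun_prop) (hf.heat_int s x)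
    (by fun_prop) ?_ (gam_norm_int.const_mul D) ?_
  · have h2 := main.2
    have e : (∫ z, fderiv ℝ f (x + s • z) z * gam z) = s * heat (lap f) s x := by
      have e1 : ∀ z, fderiv ℝ f (x + s • z) z * gam z
          = ∑ i, pds f i (x + s • z) * (z i * gam z) := by
        intro z
        rw [fderiv_eq_sum, Finset.sum_mul]
        refine Finset.sum_congr rfl fun i _ => by ring
      simp_rw [e1]
      have hbi : ∀ i, Integrable (fun z => pds f i (x + s • z) * (z i * gam z)) := by
        intro i
        obtain ⟨C, _, hC⟩ := (hf.pds i).bdd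
        have := (hf.pds i).cont
        refine (gam_norm_int.const_mul C).mono' (by fun_prop) (Eventually.of_forall fun z => ?_)
        rw [norm_mul, norm_mul, Real.norm_of_nonneg (gam_pos z).le]
        have h1 := coord_le z i
        have h2 := hC (x + s • z)
        have h3 := gam_pos z
        simp only [Real.norm_eq_abs]
        gcongr
      rw [integral_finsetSum _ fun i _ => hbi i]
      have e2 : ∀ i, (∫ z, pds f i (x + s • z) * (z i * gam z))
          = s * heat (pds (pds f i) i) s x := by
        intro i
        obtain ⟨C, _, hC⟩ := (hf.pds i).bdd
        obtain ⟨C2, _, hC2⟩ := ((hf.pds i).pds i).bdd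
        have hpd : ∀ z, pds (fun z => pds f i (x + s • z)) i z
            = s * pds (pds f i) i (x + s • z) := by
          intro z
          have hd := ((hf.pds i).diff (x + s • z)).hasFDerivAt
          have h1 : HasFDerivAt (fun z : E3 => x + s • z) (s • ContinuousLinearMap.id ℝ E3) z := by
            simpa using ((hasFDerivAt_id z).const_smul s).const_add x
          have h2 := hd.comp z h1
          have h3 : pds (fun z => pds f i (x + s • z)) i z
            = (fderiv ℝ (pds f i) (x + s • z)).comp (s • ContinuousLinearMap.id ℝ E3) (ee i) := by
            conv_lhs => unfold pds
            rw [← h2.fderiv]; rfl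
          rw [h3]
          simp [pds]
        rw [gam_ibp (h := fun z => pds f i (x + s • z)) (C := C) (D := |s| * C2) ?_
          (fun z => hC _) i ?_]
        · simp_rw [hpd]
          unfold heat
          rw [← integral_const_mul]
          congr 1; funext z; ring
        · exact (((hf.pds i).sm.of_le (by exact_mod_cast le_top)).comp (by fun_prop))
        · intro z
          rw [hpd, abs_mul]
          exact mul_le_mul_of_nonneg_left (hC2 _) (abs_nonneg _)
      simp_rw [e2]
      rw [← Finset.mul_sum]
      congr 1
      exact (heat_sum (f := fun i => pds (pds f i) i) (fun i => (hf.pds i).pds i) s x).symm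
    rw [← e]
    exact h2
  · refine Eventually.of_forall fun z y _ => ?_
    rw [norm_mul, Real.norm_of_nonneg (gam_pos z).le, ← mul_assoc]
    exact mul_le_mul_of_nonneg_right ((ContinuousLinearMap.le_opNorm _ _).trans
      (mul_le_mul_of_nonneg_right (hD _) (norm_nonneg _))) (gam_pos z).le
  · refine Eventually.of_forall fun z y _ => ?_
    have h1 : HasDerivAt (fun y : ℝ => x + y • z) z y := by
      simpa using ((hasDerivAt_id y).smul_const z).const_add x
    have := ((hf.diff (x + y • z)).hasFDerivAt.comp_hasDerivAt y h1).mul_const (gam z)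
    exact this

lemma heat_lint {f : E3 → ℝ} (hf : CC f) (s : ℝ) :
    ∫⁻ x, ‖heat f s x‖ₑ ≤ ∫⁻ x, ‖f x‖ₑ := by
  have hc := hf.cont
  have gc := gam_cont
  calc ∫⁻ x, ‖heat f s x‖ₑ ≤ ∫⁻ x, ∫⁻ z, ‖f (x + s • z)‖ₑ * ‖gam z‖ₑ := by
        refine lintegral_mono fun x => ?_
        refine (enorm_integral_le_lintegral_enorm _).trans (le_of_eq ?_)
        simp_rw [enorm_mul]
    _ = ∫⁻ z, ∫⁻ x, ‖f (x + s • z)‖ₑ * ‖gam z‖ₑ := by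
        rw [lintegral_lintegral_swap]
        have : Continuous (fun p : E3 × E3 => ‖f (p.1 + s • p.2)‖ₑ) := by fun_prop
        have h2 : Continuous (fun p : E3 × E3 => ‖gam p.2‖ₑ) := by fun_prop
        exact (this.measurable.mul h2.measurable).aemeasurable
    _ = ∫⁻ z, (∫⁻ x, ‖f x‖ₑ) * ‖gam z‖ₑ := by
        refine lintegral_congr fun z => ?_
        rw [lintegral_mul_const _ (Continuous.measurable (by fun_prop))]
        congr 1
        exact lintegral_add_right_eq_self (fun x => ‖f x‖ₑ) (s • z)
    _ = ∫⁻ x, ‖f x‖ₑ := by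
        rw [lintegral_const_mul _ (Continuous.measurable (by fun_prop))]
        have : ∫⁻ z, ‖gam z‖ₑ = 1 := by
          have := ofReal_integral_eq_lintegral_ofReal gam_int
            (Eventually.of_forall fun z => (gam_pos z).le)
          rw [gam_one] at this
          simp only [ENNReal.ofReal_one] at this
          rw [this]
          refine lintegral_congr fun z => ?_
          rw [Real.enorm_eq_ofReal (gam_pos z).le]
        rw [this, mul_one]

lemma heat_integrable {f : E3 → ℝ} (hf : CC f) (s : ℝ) : Integrable (heat f s) := by
  refine ⟨(heat_diff hf s).continuous.aestronglyMeasurable, ?_⟩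
  exact (heat_lint hf s).trans_lt hf.integrable.2

lemma heat_integrable_prod {f : E3 → ℝ} (hf : CC f) (S : ℝ) :
    Integrable (fun p : ℝ × E3 => heat f p.1 p.2)
      ((volume.restrict (Set.Ioc 0 S)).prod volume) := by
  refine ⟨(heat_cont hf).aestronglyMeasurable, ?_⟩
  unfold HasFiniteIntegral
  rw [lintegral_prod _ (heat_cont hf).enorm.measurable.aemeasurable]
  calc ∫⁻ s in Set.Ioc 0 S, ∫⁻ x, ‖heat f s x‖ₑ
      ≤ ∫⁻ s in Set.Ioc 0 S, ∫⁻ x, ‖f x‖ₑ := lintegral_mono fun s => heat_lint hf s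
    _ < ⊤ := by
      rw [lintegral_const]
      exact ENNReal.mul_lt_top hf.integrable.2 (by simp)

/-- decay as `s → ∞` -/
lemma heat_decay {f : E3 → ℝ} (hf : CC f) {s : ℝ} (hs : 0 < s) (x : E3) :
    |heat f s x| ≤ (1 / gm) * (s ^ 3)⁻¹ * ∫ y, |f y| := by
  have hc := hf.cont
  unfold heat
  have hi : Integrable (fun z : E3 => |f (x + s • z)|) := by
    have h1 : Integrable (fun z : E3 => |f (x + z)|) := hf.integrable.abs.comp_add_left x
    exact (integrable_comp_smul_iff volume (fun z : E3 => |f (x + z)|) hs.ne').2 h1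
  calc |∫ z, f (x + s • z) * gam z| ≤ ∫ z, |f (x + s • z) * gam z| := abs_integral_le_integral_abs
    _ ≤ ∫ z, (1 / gm) * |f (x + s • z)| := by
        apply integral_mono (hf.heat_int s x).abs (hi.const_mul _)
        intro z
        simp only [abs_mul, abs_of_pos (gam_pos z)]
        rw [mul_comm]
        exact mul_le_mul_of_nonneg_right (gam_le z) (abs_nonneg _)
    _ = _ := by
        rw [integral_const_mul, mul_assoc]
        congr 1
        have := Measure.integral_comp_smul (volume : Measure E3) (fun z => |f (x + z)|) s
        rw [this, integral_add_left_eq_self (fun z => |f z|) x]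
        simp [abs_of_pos (inv_pos.2 (pow_pos hs 3))]
end

section
/-! ### Bellman function -/

def bq (ε g : ℝ) : ℝ := √(g + ε)
def bs (ε f g : ℝ) : ℝ := √(f ^ 2 + g + ε)
def Bel (ε f g : ℝ) : ℝ :=
  (g + ε) * bq ε g - ε * √ε - 3 / 2 * √ε * g + 1 / 2 * f ^ 2 * bs ε f g
def BelF (ε f g : ℝ) : ℝ := f * bs ε f g + f ^ 3 / (2 * bs ε f g)
def BelG (ε f g : ℝ) : ℝ := 3 / 2 * (bq ε g - √ε) + f ^ 2 / (4 * bs ε f g)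
def BelFF (ε f g : ℝ) : ℝ :=
  bs ε f g + 5 * f ^ 2 / (2 * bs ε f g) - f ^ 4 / (2 * bs ε f g ^ 3)
def BelFG (ε f g : ℝ) : ℝ := f / (2 * bs ε f g) - f ^ 3 / (4 * bs ε f g ^ 3)
def BelGG (ε f g : ℝ) : ℝ := 3 / (4 * bq ε g) - f ^ 2 / (8 * bs ε f g ^ 3)

lemma bq_pos {ε g : ℝ} (hε : 0 < ε) (hg : 0 ≤ g) : 0 < bq ε g := Real.sqrt_pos.2 (by linarith)
lemma bs_pos {ε g : ℝ} (hε : 0 < ε) (hg : 0 ≤ g) (f : ℝ) : 0 < bs ε f g :=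
  Real.sqrt_pos.2 (by nlinarith [sq_nonneg f])
lemma bq_sq {ε g : ℝ} (hε : 0 < ε) (hg : 0 ≤ g) : bq ε g ^ 2 = g + ε :=
  Real.sq_sqrt (by linarith)
lemma bs_sq {ε g : ℝ} (hε : 0 < ε) (hg : 0 ≤ g) (f : ℝ) : bs ε f g ^ 2 = f ^ 2 + g + ε :=
  Real.sq_sqrt (by nlinarith [sq_nonneg f])
lemma bq_le_bs {ε g : ℝ} (f : ℝ) : bq ε g ≤ bs ε f g :=
  Real.sqrt_le_sqrt (by nlinarith [sq_nonneg f])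

lemma bel_quad {ε g : ℝ} (hε : 0 < ε) (hg : 0 ≤ g) (f a b : ℝ) :
    1 / 2 * bq ε g * a ^ 2 + b ^ 2 / (8 * bq ε g) ≤
      BelFF ε f g * a ^ 2 + 2 * BelFG ε f g * a * b + BelGG ε f g * b ^ 2 := by
  have hq := bq_pos hε hg
  have hs := bs_pos hε hg f
  have hqs : bq ε g ≤ bs ε f g := bq_le_bs f
  have hf2 : f ^ 2 ≤ bs ε f g ^ 2 := by rw [bs_sq hε hg]; linarith
  unfold BelFF BelFG BelGG
  generalize bs ε f g = s at *
  generalize bq ε g = q at *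
  -- normalise r = f / s
  obtain ⟨r, rfl⟩ : ∃ r, f = r * s := ⟨f / s, by field_simp⟩
  have hr : r ^ 2 ≤ 1 := by
    have : r ^ 2 * s ^ 2 ≤ 1 * s ^ 2 := by nlinarith
    exact le_of_mul_le_mul_right this (by positivity)
  have e1 : s + 5 * (r * s) ^ 2 / (2 * s) - (r * s) ^ 4 / (2 * s ^ 3)
      = s * (1 + 5 / 2 * r ^ 2 - r ^ 4 / 2) := by field_simp
  have e2 : r * s / (2 * s) - (r * s) ^ 3 / (4 * s ^ 3) = r / 2 - r ^ 3 / 4 := by field_simp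
  have e3 : 3 / (4 * q) - (r * s) ^ 2 / (8 * s ^ 3) = 3 / 4 * q⁻¹ - r ^ 2 / 8 * s⁻¹ := by
    field_simp
  have e4 : b ^ 2 / (8 * q) = 1 / 8 * q⁻¹ * b ^ 2 := by field_simp
  rw [e1, e2, e3, e4]
  have hinv : s⁻¹ ≤ q⁻¹ := inv_anti₀ hq hqs
  have hsi : 0 < s⁻¹ := inv_pos.2 hs
  have hss : s * s⁻¹ = 1 := mul_inv_cancel₀ hs.ne'
  -- complete the square: s a² /2 + k a b + k²/(2 s) b² ≥ 0
  set k := r - r ^ 3 / 2 with hk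
  have hk2 : k ^ 2 ≤ r ^ 2 := by
    have : k ^ 2 = r ^ 2 * (1 - r ^ 2 / 2) ^ 2 := by rw [hk]; ring
    rw [this]
    have h1 : (1 - r ^ 2 / 2) ^ 2 ≤ 1 := by nlinarith [sq_nonneg r]
    nlinarith [sq_nonneg r]
  have sq : 0 ≤ s * a ^ 2 / 2 + k * a * b + k ^ 2 * s⁻¹ / 2 * b ^ 2 := by
    have : s * a ^ 2 / 2 + k * a * b + k ^ 2 * s⁻¹ / 2 * b ^ 2
      = s⁻¹ / 2 * (s * a + k * b) ^ 2 := by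
      field_simp; ring
    rw [this]; positivity
  have t1 : 0 ≤ (5 / 2 * r ^ 2 - r ^ 4 / 2) := by nlinarith [sq_nonneg r]
  have t2 : 0 ≤ s * (5 / 2 * r ^ 2 - r ^ 4 / 2) * a ^ 2 := by positivity
  have t3 : q * a ^ 2 ≤ s * a ^ 2 := by gcongr
  have t4 : k ^ 2 * s⁻¹ / 2 * b ^ 2 + r ^ 2 / 8 * s⁻¹ * b ^ 2 ≤ 5 / 8 * q⁻¹ * b ^ 2 := by
    have : k ^ 2 * s⁻¹ / 2 + r ^ 2 / 8 * s⁻¹ ≤ 5 / 8 * q⁻¹ := by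
      have : k ^ 2 * s⁻¹ ≤ 1 * s⁻¹ := by gcongr; linarith
      have : r ^ 2 * s⁻¹ ≤ 1 * s⁻¹ := by gcongr
      linarith
    nlinarith [sq_nonneg b]
  have ek : 2 * (r / 2 - r ^ 3 / 4) = k := by rw [hk]; ring
  rw [ek]
  nlinarith

lemma bel_quad_sum {ε g : ℝ} (hε : 0 < ε) (hg : 0 ≤ g) (f : ℝ) (a b : Fin 3 → ℝ) (i k : Fin 3) :
    1 / 2 * a i * b k ≤
      ∑ j, (BelFF ε f g * a j ^ 2 + 2 * BelFG ε f g * a j * b j + BelGG ε f g * b j ^ 2) := by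
  have hq := bq_pos hε hg
  calc 1 / 2 * a i * b k ≤ 1 / 2 * bq ε g * a i ^ 2 + b k ^ 2 / (8 * bq ε g) := by
        have : 1 / 2 * bq ε g * a i ^ 2 + b k ^ 2 / (8 * bq ε g) - 1 / 2 * a i * b k
          = (2 * bq ε g * a i - b k) ^ 2 / (8 * bq ε g) := by field_simp; ring
        have h2 : 0 ≤ (2 * bq ε g * a i - b k) ^ 2 / (8 * bq ε g) := by positivity
        linarith
    _ ≤ (∑ j, 1 / 2 * bq ε g * a j ^ 2) + ∑ j, b j ^ 2 / (8 * bq ε g) := by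
        apply add_le_add
        · exact Finset.single_le_sum (f := fun j => 1 / 2 * bq ε g * a j ^ 2)
            (fun j _ => by positivity) (Finset.mem_univ i)
        · exact Finset.single_le_sum (f := fun j => b j ^ 2 / (8 * bq ε g))
            (fun j _ => by positivity) (Finset.mem_univ k)
    _ = ∑ j, (1 / 2 * bq ε g * a j ^ 2 + b j ^ 2 / (8 * bq ε g)) := Finset.sum_add_distrib.symm
    _ ≤ _ := Finset.sum_le_sum fun j _ => bel_quad hε hg f (a j) (b j)

lemma bel_aux {ε g : ℝ} (hε : 0 < ε) (hg : 0 ≤ g) :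
    0 ≤ (g + ε) * bq ε g - ε * √ε - 3 / 2 * √ε * g ∧
    (g + ε) * bq ε g - ε * √ε - 3 / 2 * √ε * g ≤ g * √g := by
  have hq := bq_pos hε hg
  have hq2 := bq_sq hε hg
  have ha := Real.sqrt_nonneg g
  have hb := Real.sqrt_pos.2 hε
  have ha2 := Real.sq_sqrt hg
  have hb2 := Real.sq_sqrt hε.le
  generalize bq ε g = q at *
  generalize √g = a at *
  generalize √ε = b at *
  subst ha2 hb2
  constructor
  · have : b ^ 3 + 3 / 2 * b * a ^ 2 ≤ (a ^ 2 + b ^ 2) * q := by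
      refine (sq_le_sq₀ (by positivity) (by positivity)).1 ?_
      rw [mul_pow, hq2]
      nlinarith [pow_nonneg ha 6, mul_nonneg (pow_nonneg ha 4) (sq_nonneg b)]
    nlinarith
  · have : (a ^ 2 + b ^ 2) * q ≤ b ^ 3 + 3 / 2 * b * a ^ 2 + a ^ 3 := by
      refine (sq_le_sq₀ (by positivity) (by positivity)).1 ?_
      rw [mul_pow, hq2]
      have h3 : 0 ≤ a ^ 3 * b * (3 * a ^ 2 - 3 / 4 * a * b + 2 * b ^ 2) := by
        have : 0 ≤ 3 * a ^ 2 - 3 / 4 * a * b + 2 * b ^ 2 := by nlinarith [sq_nonneg (a - b)]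
        positivity
      nlinarith
    nlinarith

lemma bel_nonneg {ε g : ℝ} (hε : 0 < ε) (hg : 0 ≤ g) (f : ℝ) : 0 ≤ Bel ε f g := by
  have := (bel_aux hε hg).1
  have h2 := bs_pos hε hg f
  unfold Bel
  have : 0 ≤ 1 / 2 * f ^ 2 * bs ε f g := by positivity
  linarith

lemma bel_le {ε g : ℝ} (hε : 0 < ε) (hg : 0 ≤ g) (f : ℝ) :
    Bel ε f g ≤ g * √g + 1 / 2 * f ^ 2 * (|f| + √g + √ε) := by
  have := (bel_aux hε hg).2
  have h2 : bs ε f g ≤ |f| + √g + √ε := by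
    unfold bs
    apply Real.sqrt_le_iff.2
    refine ⟨by positivity, ?_⟩
    have e1 := Real.sq_sqrt hg
    have e2 := Real.sq_sqrt hε.le
    have e3 := sq_abs f
    have a1 := Real.sqrt_nonneg g
    have a2 := Real.sqrt_nonneg ε
    have a3 := abs_nonneg f
    nlinarith [mul_nonneg a1 a2, mul_nonneg a1 a3, mul_nonneg a2 a3]
  unfold Bel
  have : 1 / 2 * f ^ 2 * bs ε f g ≤ 1 / 2 * f ^ 2 * (|f| + √g + √ε) := by gcongr
  linarith

section derivs
variable {ε : ℝ} {f g : ℝ → ℝ} {f' g' t : ℝ}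

lemma bq_der (hε : 0 < ε) (hg0 : 0 ≤ g t) (hg : HasDerivAt g g' t) :
    HasDerivAt (fun t => bq ε (g t)) (g' / (2 * bq ε (g t))) t := by
  unfold bq
  exact (hg.add_const ε).sqrt (by linarith)

lemma bs_der (hε : 0 < ε) (hg0 : 0 ≤ g t) (hf : HasDerivAt f f' t) (hg : HasDerivAt g g' t) :
    HasDerivAt (fun t => bs ε (f t) (g t)) ((2 * f t * f' + g') / (2 * bs ε (f t) (g t))) t := by
  unfold bs
  have := (((hf.pow 2).add hg).add_const ε).sqrt (by simp; nlinarith [sq_nonneg (f t)])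
  refine this.congr_deriv ?_
  simp

lemma bel_der (hε : 0 < ε) (hg0 : 0 ≤ g t) (hf : HasDerivAt f f' t) (hg : HasDerivAt g g' t) :
    HasDerivAt (fun t => Bel ε (f t) (g t))
      (BelF ε (f t) (g t) * f' + BelG ε (f t) (g t) * g') t := by
  have hq := bq_pos hε hg0
  have hs := bs_pos hε hg0 (f t)
  have hq2 := bq_sq hε hg0
  have h := (((hg.add_const ε).mul (bq_der hε hg0 hg)).sub_const (ε * √ε)).sub
    (hg.const_mul (3 / 2 * √ε)) |>.add (((hf.pow 2).const_mul (1/2)).mul (bs_der hε hg0 hf hg))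
  refine h.congr_deriv ?_
  unfold BelF BelG
  simp only [Nat.cast_ofNat, Pi.pow_apply]
  rw [← hq2]
  field_simp
  ring

lemma belF_der (hε : 0 < ε) (hg0 : 0 ≤ g t) (hf : HasDerivAt f f' t) (hg : HasDerivAt g g' t) :
    HasDerivAt (fun t => BelF ε (f t) (g t))
      (BelFF ε (f t) (g t) * f' + BelFG ε (f t) (g t) * g') t := by
  have hs := bs_pos hε hg0 (f t)
  have hsd := bs_der hε hg0 hf hg
  have h := (hf.mul hsd).add ((hf.pow 3).div (hsd.const_mul 2) (by positivity))
  refine h.congr_deriv ?_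
  unfold BelFF BelFG
  simp only [Nat.cast_ofNat, Pi.pow_apply]
  field_simp
  ring

lemma belG_der (hε : 0 < ε) (hg0 : 0 ≤ g t) (hf : HasDerivAt f f' t) (hg : HasDerivAt g g' t) :
    HasDerivAt (fun t => BelG ε (f t) (g t))
      (BelFG ε (f t) (g t) * f' + BelGG ε (f t) (g t) * g') t := by
  have hq := bq_pos hε hg0
  have hs := bs_pos hε hg0 (f t)
  have hsd := bs_der hε hg0 hf hg
  have h := (((bq_der hε hg0 hg).sub_const (√ε)).const_mul (3/2)).add
    ((hf.pow 2).div (hsd.const_mul 4) (by positivity))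
  refine h.congr_deriv ?_
  unfold BelFG BelGG
  simp only [Nat.cast_ofNat, Pi.pow_apply]
  field_simp
  ring
end derivs

lemma bel_cont {ε : ℝ} (hε : 0 < ε) {X : Type*} [TopologicalSpace X] {f g : X → ℝ}
    (hf : Continuous f) (hg : Continuous g) (h0 : ∀ x, 0 ≤ g x) :
    Continuous (fun x => Bel ε (f x) (g x)) ∧ Continuous (fun x => BelF ε (f x) (g x)) ∧
    Continuous (fun x => BelG ε (f x) (g x)) ∧ Continuous (fun x => BelFF ε (f x) (g x)) ∧
    Continuous (fun x => BelFG ε (f x) (g x)) ∧ Continuous (fun x => BelGG ε (f x) (g x)) := by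
  have hs : Continuous (fun x => bs ε (f x) (g x)) := by unfold bs; fun_prop
  have hq : Continuous (fun x => bq ε (g x)) := by unfold bq; fun_prop
  have hs0 : ∀ x, bs ε (f x) (g x) ≠ 0 := fun x => (bs_pos hε (h0 x) _).ne'
  have hq0 : ∀ x, bq ε (g x) ≠ 0 := fun x => (bq_pos hε (h0 x)).ne'
  refine ⟨?_, ?_, ?_, ?_, ?_, ?_⟩
  · unfold Bel; fun_prop
  · unfold BelF; fun_prop (disch := intro x; have := hs0 x; positivity)
  · unfold BelG; fun_prop (disch := intro x; have := hs0 x; positivity)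
  · unfold BelFF; fun_prop (disch := intro x; have := hs0 x; positivity)
  · unfold BelFG; fun_prop (disch := intro x; have := hs0 x; positivity)
  · unfold BelGG; fun_prop (disch := intro x; have := hs0 x; have := hq0 x; positivity)

/-- all Bellman quantities are bounded on bounded sets. -/
lemma bel_bdd {ε : ℝ} (hε : 0 < ε) (M : ℝ) : ∃ K, 0 ≤ K ∧ ∀ f g, |f| ≤ M → 0 ≤ g → g ≤ M →
    |BelF ε f g| ≤ K ∧ |BelG ε f g| ≤ K ∧ |BelFF ε f g| ≤ K ∧
    |BelFG ε f g| ≤ K ∧ |BelGG ε f g| ≤ K := by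
  have hc := bel_cont hε (X := ℝ × ℝ) (f := fun p => p.1) (g := fun p => |p.2|) (by fun_prop)
    (by fun_prop) (fun p => abs_nonneg _)
  have hK : IsCompact (Set.Icc (-M) M ×ˢ Set.Icc 0 M) := isCompact_Icc.prod isCompact_Icc
  obtain ⟨K1, h1⟩ := hK.exists_bound_of_continuousOn hc.2.1.continuousOn
  obtain ⟨K2, h2⟩ := hK.exists_bound_of_continuousOn hc.2.2.1.continuousOn
  obtain ⟨K3, h3⟩ := hK.exists_bound_of_continuousOn hc.2.2.2.1.continuousOn
  obtain ⟨K4, h4⟩ := hK.exists_bound_of_continuousOn hc.2.2.2.2.1.continuousOn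
  obtain ⟨K5, h5⟩ := hK.exists_bound_of_continuousOn hc.2.2.2.2.2.continuousOn
  refine ⟨|K1| + |K2| + |K3| + |K4| + |K5|, by positivity, fun f g hf hg hgM => ?_⟩
  have hm : (f, g) ∈ Set.Icc (-M) M ×ˢ Set.Icc 0 M :=
    ⟨⟨(abs_le.1 hf).1, (abs_le.1 hf).2⟩, ⟨hg, hgM⟩⟩
  have a1 := h1 _ hm
  have a2 := h2 _ hm
  have a3 := h3 _ hm
  have a4 := h4 _ hm
  have a5 := h5 _ hm
  simp only [abs_of_nonneg hg, Real.norm_eq_abs] at a1 a2 a3 a4 a5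
  have b1 := le_abs_self K1
  have b2 := le_abs_self K2
  have b3 := le_abs_self K3
  have b4 := le_abs_self K4
  have b5 := le_abs_self K5
  have c1 := abs_nonneg K1
  have c2 := abs_nonneg K2
  have c3 := abs_nonneg K3
  have c4 := abs_nonneg K4
  have c5 := abs_nonneg K5
  refine ⟨?_, ?_, ?_, ?_, ?_⟩ <;> linarith
end

section
/-! ### Monotonicity along the heat flow -/

lemma iadd {X : Type*} [MeasurableSpace X] {μ : Measure X} {f g : X → ℝ} (hf : Integrable f μ)
    (hg : Integrable g μ) : Integrable (fun x => f x + g x) μ := hf.add hg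

lemma bi {P f : E3 → ℝ} (hf : CC f) (s : ℝ) (hP : Continuous P) {K : ℝ} (hK : ∀ x, |P x| ≤ K) :
    Integrable (fun x => P x * heat f s x) :=
  (heat_integrable hf s).bdd_mul (c := K) hP.aestronglyMeasurable (Eventually.of_forall hK)

lemma heat_ibp {P DP f : E3 → ℝ} (hf : CC f) (s : ℝ) (j : Fin 3) (hP : Differentiable ℝ P)
    {K : ℝ} (hK : ∀ x, |P x| ≤ K) (hD : ∀ x, pds P j x = DP x) (hDc : Continuous DP) {K' : ℝ}
    (hK' : ∀ x, |DP x| ≤ K') :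
    ∫ x, P x * heat (pds f j) s x = - ∫ x, DP x * heat f s x := by
  have h := integral_mul_fderiv_eq_neg_fderiv_mul_of_integrable (μ := (volume : Measure E3))
    (f := P) (g := heat f s) (v := ee j) ?_ ?_ ?_ (fun x _ => hP x)
    (fun x _ => heat_diff hf s x)
  · have e1 : ∀ x, fderiv ℝ (heat f s) x (ee j) = heat (pds f j) s x := fun x => by
      rw [← heat_pds hf s j]; rfl
    have e2 : ∀ x, fderiv ℝ P x (ee j) = DP x := hD
    simp only [e1, e2] at h
    exact h
  · have e2 : ∀ x, fderiv ℝ P x (ee j) = DP x := hD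
    simp only [e2]
    exact bi hf s hDc hK'
  · have e1 : ∀ x, fderiv ℝ (heat f s) x (ee j) = heat (pds f j) s x := fun x => by
      rw [← heat_pds hf s j]; rfl
    simp only [e1]
    exact bi (hf.pds j) s hP.continuous hK
  · exact bi hf s hP.continuous hK

lemma pds_of_line {P : E3 → ℝ} {x : E3} {j : Fin 3} {c : ℝ} (hP : DifferentiableAt ℝ P x)
    (h : HasDerivAt (fun t : ℝ => P (x + t • ee j)) c 0) : pds P j x = c := by
  have h1 : HasDerivAt (fun t : ℝ => x + t • ee j) (ee j) 0 := by
    simpa using ((hasDerivAt_id (0:ℝ)).smul_const (ee j)).const_add x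
  have h2 : HasFDerivAt P (fderiv ℝ P x) (x + (0:ℝ) • ee j) := by simpa using hP.hasFDerivAt
  exact (h2.comp_hasDerivAt (0:ℝ) h1).unique h

lemma line_of_diff {P : E3 → ℝ} {x : E3} (j : Fin 3) (hP : DifferentiableAt ℝ P x) :
    HasDerivAt (fun t : ℝ => P (x + t • ee j)) (pds P j x) 0 := by
  have h1 : HasDerivAt (fun t : ℝ => x + t • ee j) (ee j) 0 := by
    simpa using ((hasDerivAt_id (0:ℝ)).smul_const (ee j)).const_add x
  have h2 : HasFDerivAt P (fderiv ℝ P x) (x + (0:ℝ) • ee j) := by simpa using hP.hasFDerivAt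
  exact h2.comp_hasDerivAt (0:ℝ) h1

lemma heat_line {f : E3 → ℝ} (hf : CC f) (s : ℝ) (j : Fin 3) (x : E3) :
    HasDerivAt (fun t : ℝ => heat f s (x + t • ee j)) (heat (pds f j) s x) 0 := by
  have := line_of_diff j (heat_diff hf s x)
  rwa [heat_pds hf s j] at this

section
variable {ε : ℝ} {h g : E3 → ℝ}

lemma heat_contx {f : E3 → ℝ} (hf : CC f) (s : ℝ) : Continuous (heat f s) :=
  (heat_diff hf s).continuous

lemma bel_ibp (hε : 0 < ε) (hh : CC h) (hg : CC g) (g0 : ∀ x, 0 ≤ g x) (s : ℝ) :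
    Integrable (fun x => BelF ε (heat h s x) (heat g s x) * heat (lap h) s x
      + BelG ε (heat h s x) (heat g s x) * heat (lap g) s x) ∧
    (Integrable fun x => ∑ j, (BelFF ε (heat h s x) (heat g s x) * heat (pds h j) s x ^ 2
      + 2 * BelFG ε (heat h s x) (heat g s x) * heat (pds h j) s x * heat (pds g j) s x
      + BelGG ε (heat h s x) (heat g s x) * heat (pds g j) s x ^ 2)) ∧
    ∫ x, (BelF ε (heat h s x) (heat g s x) * heat (lap h) s x
      + BelG ε (heat h s x) (heat g s x) * heat (lap g) s x) =
    - ∫ x, ∑ j, (BelFF ε (heat h s x) (heat g s x) * heat (pds h j) s x ^ 2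
      + 2 * BelFG ε (heat h s x) (heat g s x) * heat (pds h j) s x * heat (pds g j) s x
      + BelGG ε (heat h s x) (heat g s x) * heat (pds g j) s x ^ 2) := by
  have hp := heat_nonneg g0 s
  obtain ⟨c0, c1, c2, c3, c4, c5⟩ := bel_cont hε (heat_contx hh s) (heat_contx hg s) hp
  obtain ⟨M1, M10, hM1⟩ := hh.bdd
  obtain ⟨M2, M20, hM2⟩ := hg.bdd
  obtain ⟨K, K0, hK⟩ := bel_bdd hε (max M1 M2)
  have hKx : ∀ x, _ := fun x => hK (heat h s x) (heat g s x)
    ((heat_abs_le hh hM1 s x).trans (le_max_left _ _)) (hp x)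
    ((le_abs_self _).trans ((heat_abs_le hg hM2 s x).trans (le_max_right _ _)))
  have dF : Differentiable ℝ (fun x => BelF ε (heat h s x) (heat g s x)) := by
    intro x
    have d1 := heat_diff hh s x
    have d2 := heat_diff hg s x
    have d3 : DifferentiableAt ℝ (fun x => bs ε (heat h s x) (heat g s x)) x := by
      unfold bs
      have h0 : heat h s x ^ 2 + heat g s x + ε ≠ 0 := by
        nlinarith [sq_nonneg (heat h s x), hp x]
      exact (((d1.pow 2).add d2).add_const ε).sqrt h0
    have p0 := bs_pos hε (hp x) (heat h s x)
    have p2 : 2 * bs ε (heat h s x) (heat g s x) ≠ 0 := by positivity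
    have p4 : 4 * bs ε (heat h s x) (heat g s x) ≠ 0 := by positivity
    unfold BelF
    simp only [div_eq_mul_inv]
    exact (d1.mul d3).add ((d1.pow 3).mul ((d3.const_mul 2).inv p2))
  have dG : Differentiable ℝ (fun x => BelG ε (heat h s x) (heat g s x)) := by
    intro x
    have d1 := heat_diff hh s x
    have d2 := heat_diff hg s x
    have d3 : DifferentiableAt ℝ (fun x => bs ε (heat h s x) (heat g s x)) x := by
      unfold bs
      have h0 : heat h s x ^ 2 + heat g s x + ε ≠ 0 := by
        nlinarith [sq_nonneg (heat h s x), hp x]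
      exact (((d1.pow 2).add d2).add_const ε).sqrt h0
    have d4 : DifferentiableAt ℝ (fun x => bq ε (heat g s x)) x := by
      unfold bq
      exact (d2.add_const ε).sqrt (by have := hp x; linarith)
    have p0 := bs_pos hε (hp x) (heat h s x)
    have p2 : 2 * bs ε (heat h s x) (heat g s x) ≠ 0 := by positivity
    have p4 : 4 * bs ε (heat h s x) (heat g s x) ≠ 0 := by positivity
    unfold BelG
    simp only [div_eq_mul_inv (_ ^ 2)]
    exact ((d4.sub_const _).const_mul _).add ((d1.pow 2).mul ((d3.const_mul 4).inv p4))
  have pF : ∀ j x, pds (fun x => BelF ε (heat h s x) (heat g s x)) j x =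
      BelFF ε (heat h s x) (heat g s x) * heat (pds h j) s x +
      BelFG ε (heat h s x) (heat g s x) * heat (pds g j) s x := fun j x => by
    refine pds_of_line (dF x) ?_
    have := belF_der (t := 0) hε (by simpa using hp x) (heat_line hh s j x) (heat_line hg s j x)
    simpa using this
  have pG : ∀ j x, pds (fun x => BelG ε (heat h s x) (heat g s x)) j x =
      BelFG ε (heat h s x) (heat g s x) * heat (pds h j) s x +
      BelGG ε (heat h s x) (heat g s x) * heat (pds g j) s x := fun j x => by
    refine pds_of_line (dG x) ?_
    have := belG_der (t := 0) hε (by simpa using hp x) (heat_line hh s j x) (heat_line hg s j x)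
    simpa using this
  have bd : ∀ {A f : E3 → ℝ} (_ : Continuous A) (_ : ∀ x, |A x| ≤ K) (_ : CC f),
      Continuous (fun x => A x * heat f s x) ∧ ∃ K', ∀ x, |A x * heat f s x| ≤ K' := by
    intro A f cA hA hf
    obtain ⟨C, C0, hC⟩ := hf.bdd
    refine ⟨cA.mul (heat_contx hf s), K * C, fun x => ?_⟩
    rw [abs_mul]
    exact mul_le_mul (hA x) (heat_abs_le hf hC s x) (abs_nonneg _) K0
  have b2 : ∀ {A B f f' : E3 → ℝ} (_ : Continuous A) (_ : ∀ x, |A x| ≤ K) (_ : CC f)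
      (_ : Continuous B) (_ : ∀ x, |B x| ≤ K) (_ : CC f'),
      Continuous (fun x => A x * heat f s x + B x * heat f' s x) ∧
      ∃ K', ∀ x, |A x * heat f s x + B x * heat f' s x| ≤ K' := by
    intro A B f f' cA hA hf cB hB hf'
    obtain ⟨k1, K1, h1⟩ := bd cA hA hf
    obtain ⟨k2, K2, h2⟩ := bd cB hB hf'
    exact ⟨k1.add k2, K1 + K2, fun x => (abs_add_le _ _).trans (add_le_add (h1 x) (h2 x))⟩
  have F1 : ∀ j, _ := fun j => b2 c3 (fun x => (hKx x).2.2.1) (hh.pds j) c4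
    (fun x => (hKx x).2.2.2.1) (hg.pds j)
  have G1 : ∀ j, _ := fun j => b2 c4 (fun x => (hKx x).2.2.2.1) (hh.pds j) c5
    (fun x => (hKx x).2.2.2.2) (hg.pds j)
  have iF : ∀ j, ∫ x, BelF ε (heat h s x) (heat g s x) * heat (pds (pds h j) j) s x = _ :=
    fun j => heat_ibp (hh.pds j) s j dF (fun x => (hKx x).1) (pF j) (F1 j).1 (F1 j).2.choose_spec
  have iG : ∀ j, ∫ x, BelG ε (heat h s x) (heat g s x) * heat (pds (pds g j) j) s x = _ :=
    fun j => heat_ibp (hg.pds j) s j dG (fun x => (hKx x).2.1) (pG j) (G1 j).1 (G1 j).2.choose_spec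
  have IF : ∀ j : Fin 3, _ := fun j => bi (hh.pds j) s (F1 j).1 (F1 j).2.choose_spec
  have IG : ∀ j : Fin 3, _ := fun j => bi (hg.pds j) s (G1 j).1 (G1 j).2.choose_spec
  have JF : ∀ j : Fin 3, _ := fun j => bi ((hh.pds j).pds j) s c1 (fun x => (hKx x).1)
  have JG : ∀ j : Fin 3, _ := fun j => bi ((hg.pds j).pds j) s c2 (fun x => (hKx x).2.1)
  have el : ∀ {f : E3 → ℝ} (_ : CC f) x, heat (lap f) s x = ∑ j, heat (pds (pds f j) j) s x := by
    intro f hf x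
    exact heat_sum (f := fun i => pds (pds f i) i) (fun i => (hf.pds i).pds i) s x
  have e1 : ∀ x, BelF ε (heat h s x) (heat g s x) * heat (lap h) s x
      + BelG ε (heat h s x) (heat g s x) * heat (lap g) s x =
      ∑ j, (BelF ε (heat h s x) (heat g s x) * heat (pds (pds h j) j) s x +
        BelG ε (heat h s x) (heat g s x) * heat (pds (pds g j) j) s x) := fun x => by
    rw [el hh, el hg, Finset.mul_sum, Finset.mul_sum, Finset.sum_add_distrib]
  have e2 : ∀ x, ∑ j, (BelFF ε (heat h s x) (heat g s x) * heat (pds h j) s x ^ 2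
      + 2 * BelFG ε (heat h s x) (heat g s x) * heat (pds h j) s x * heat (pds g j) s x
      + BelGG ε (heat h s x) (heat g s x) * heat (pds g j) s x ^ 2) =
      ∑ j, ((BelFF ε (heat h s x) (heat g s x) * heat (pds h j) s x +
      BelFG ε (heat h s x) (heat g s x) * heat (pds g j) s x) * heat (pds h j) s x
      + (BelFG ε (heat h s x) (heat g s x) * heat (pds h j) s x +
      BelGG ε (heat h s x) (heat g s x) * heat (pds g j) s x) * heat (pds g j) s x) := fun x =>
    Finset.sum_congr rfl fun j _ => by ring
  simp only [e1, e2]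
  refine ⟨integrable_finsetSum _ fun j _ => iadd (JF j) (JG j),
    integrable_finsetSum _ fun j _ => iadd (IF j) (IG j), ?_⟩
  rw [integral_finsetSum _ fun j _ => iadd (JF j) (JG j),
    integral_finsetSum _ fun j _ => iadd (IF j) (IG j), ← Finset.sum_neg_distrib]
  refine Finset.sum_congr rfl fun j _ => ?_
  rw [integral_add (JF j) (JG j), integral_add (IF j) (IG j), iF j, iG j]
  ring

/-- the time derivative of the Bellman functional has nonpositive integral -/
lemma bel_M_le (hε : 0 < ε) {W : E3 → ℝ} {h : Fin 3 → E3 → ℝ} (hW : CC W) (hh : ∀ k, CC (h k))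
    (hg : CC g) (g0 : ∀ x, 0 ≤ g x) (i : Fin 3)
    (hl : ∀ x, lap W x = ∑ k, pds (pds (h k) i) k x) (s : ℝ) :
    ∫ x, ((∑ k, (BelF ε (heat (h k) s x) (heat g s x) * heat (lap (h k)) s x
      + BelG ε (heat (h k) s x) (heat g s x) * heat (lap g) s x))
      - 1 / 4 * (heat W s x * heat (lap g) s x + heat g s x * heat (lap W) s x)) ≤ 0 := by
  obtain ⟨MW, _, hMW⟩ := hW.bdd
  obtain ⟨Mg, _, hMg⟩ := hg.bdd
  have bb := fun k => bel_ibp hε (hh k) hg g0 s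
  have i1 := bi hg.lap s (heat_contx hW s) (heat_abs_le hW hMW s)
  have i2 := bi hW.lap s (heat_contx hg s) (heat_abs_le hg hMg s)
  have el : ∀ {f : E3 → ℝ} (_ : CC f) x, heat (lap f) s x = ∑ j, heat (pds (pds f j) j) s x := by
    intro f hf x
    exact heat_sum (f := fun i => pds (pds f i) i) (fun i => (hf.pds i).pds i) s x
  have ib : ∀ {p q : E3 → ℝ} (_ : CC p) (_ : CC q) (j : Fin 3),
      Integrable (fun x => heat p s x * heat q s x) ∧
      ∫ x, heat p s x * heat (pds q j) s x = - ∫ x, heat (pds p j) s x * heat q s x := by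
    intro p q hp hq j
    obtain ⟨C, _, hC⟩ := hp.bdd
    obtain ⟨D, _, hD⟩ := (hp.pds j).bdd
    refine ⟨bi hq s (heat_contx hp s) (heat_abs_le hp hC s), ?_⟩
    exact heat_ibp hq s j (heat_diff hp s) (heat_abs_le hp hC s)
      (fun x => by rw [heat_pds hp s j]) (heat_contx (hp.pds j) s) (heat_abs_le (hp.pds j) hD s)
  have e1 : ∫ x, heat W s x * heat (lap g) s x = ∫ x, heat g s x * heat (lap W) s x := by
    simp only [el hg, el hW, Finset.mul_sum]
    rw [integral_finsetSum _ fun j _ => (ib hW ((hg.pds j).pds j) j).1,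
      integral_finsetSum _ fun j _ => (ib hg ((hW.pds j).pds j) j).1]
    refine Finset.sum_congr rfl fun j _ => ?_
    rw [(ib hW (hg.pds j) j).2, (ib hg (hW.pds j) j).2]
    simp only [mul_comm]
  have elW : ∀ x, heat (lap W) s x = ∑ k, heat (pds (pds (h k) i) k) s x := by
    intro x
    have : lap W = fun x => ∑ k, pds (pds (h k) i) k x := funext hl
    rw [this]
    exact heat_sum (f := fun k => pds (pds (h k) i) k) (fun k => ((hh k).pds i).pds k) s x
  have e2 : ∫ x, heat g s x * heat (lap W) s x =
      - ∑ k, ∫ x, heat (pds g k) s x * heat (pds (h k) i) s x := by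
    simp only [elW, Finset.mul_sum]
    rw [integral_finsetSum _ fun j _ => (ib hg (((hh j).pds i).pds j) j).1, ← Finset.sum_neg_distrib]
    refine Finset.sum_congr rfl fun j _ => ?_
    rw [(ib hg ((hh j).pds i) j).2]
  rw [integral_sub (integrable_finsetSum _ fun k _ => (bb k).1) ((iadd i1 i2).const_mul _),
    integral_finsetSum _ fun k _ => (bb k).1, integral_const_mul, integral_add i1 i2, e1, e2]
  have key : ∀ k, ∫ x, (BelF ε (heat (h k) s x) (heat g s x) * heat (lap (h k)) s x
      + BelG ε (heat (h k) s x) (heat g s x) * heat (lap g) s x) ≤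
      - (1 / 2 * ∫ x, heat (pds g k) s x * heat (pds (h k) i) s x) := by
    intro k
    rw [(bb k).2.2, neg_le_neg_iff, ← integral_const_mul]
    refine integral_mono ((ib (hg.pds k) ((hh k).pds i) 0).1.const_mul _) (bb k).2.1 fun x => ?_
    have := bel_quad_sum hε (heat_nonneg g0 s x) (heat (h k) s x)
      (fun j => heat (pds (h k) j) s x) (fun j => heat (pds g j) s x) i k
    refine le_trans (le_of_eq ?_) this
    ring
  have := Finset.sum_le_sum fun k (_ : k ∈ Finset.univ) => key k
  rw [Finset.sum_neg_distrib, ← Finset.mul_sum] at this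
  linarith

lemma bel_int (hε : 0 < ε) {h : E3 → ℝ} (hh : CC h) (hg : CC g) (g0 : ∀ x, 0 ≤ g x) (s : ℝ) :
    Integrable (fun x => Bel ε (heat h s x) (heat g s x)) := by
  obtain ⟨M1, M10, hM1⟩ := hh.bdd
  obtain ⟨M2, M20, hM2⟩ := hg.bdd
  have hp := heat_nonneg g0 s
  have hc := (bel_cont hε (heat_contx hh s) (heat_contx hg s) hp).1
  have i1 := ((heat_integrable hg s).abs.const_mul (√M2)).add
    ((heat_integrable hh s).abs.const_mul (1/2 * M1 * (M1 + √M2 + √ε)))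
  refine i1.mono' hc.aestronglyMeasurable (Eventually.of_forall fun x => ?_)
  have hb := bel_le hε (hp x) (heat h s x)
  rw [Real.norm_of_nonneg (bel_nonneg hε (hp x) _)]
  refine hb.trans ?_
  have a1 := heat_abs_le hh hM1 s x
  have a2 : heat g s x ≤ M2 := (le_abs_self _).trans (heat_abs_le hg hM2 s x)
  have a3 : √(heat g s x) ≤ √M2 := Real.sqrt_le_sqrt a2
  simp only [Pi.add_apply]
  rw [abs_of_nonneg (hp x)]
  have t1 : heat g s x * √(heat g s x) ≤ √M2 * heat g s x := by
    rw [mul_comm]; exact mul_le_mul_of_nonneg_right a3 (hp x)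
  have t2 : 1 / 2 * heat h s x ^ 2 * (|heat h s x| + √(heat g s x) + √ε) ≤
      1/2 * M1 * (M1 + √M2 + √ε) * |heat h s x| := by
    rw [← sq_abs (heat h s x)]
    calc 1 / 2 * |heat h s x| ^ 2 * (|heat h s x| + √(heat g s x) + √ε)
        ≤ 1 / 2 * (M1 * |heat h s x|) * (M1 + √M2 + √ε) := by
          rw [sq]; gcongr
      _ = _ := by ring
  linarith

set_option maxHeartbeats 400000 in
lemma bel_mono (hε : 0 < ε) {W : E3 → ℝ} {h : Fin 3 → E3 → ℝ} (hW : CC W) (hh : ∀ k, CC (h k))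
    (hg : CC g) (g0 : ∀ x, 0 ≤ g x) (i : Fin 3)
    (hl : ∀ x, lap W x = ∑ k, pds (pds (h k) i) k x) {S : ℝ} (hS : 0 ≤ S) :
    ∫ x, ((∑ k, Bel ε (heat (h k) S x) (heat g S x)) - 1 / 4 * (heat W S x * heat g S x)) ≤
    ∫ x, ((∑ k, Bel ε (h k x) (g x)) - 1 / 4 * (W x * g x)) := by
  obtain ⟨M, hM⟩ : ∃ M : ℝ → E3 → ℝ, ∀ s x, M s x =
      (∑ k, (BelF ε (heat (h k) s x) (heat g s x) * heat (lap (h k)) s x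
      + BelG ε (heat (h k) s x) (heat g s x) * heat (lap g) s x))
      - 1 / 4 * (heat W s x * heat (lap g) s x + heat g s x * heat (lap W) s x) :=
    ⟨_, fun _ _ => rfl⟩
  have hp := fun s => heat_nonneg g0 s
  have bc := fun k => bel_cont hε (heat_cont (hh k)) (heat_cont hg) (fun p => hp p.1 p.2)
  have hWc := heat_cont hW
  have hgc := heat_cont hg
  have hWl := heat_cont hW.lap
  have hgl := heat_cont hg.lap
  have hMc : Continuous (fun p : ℝ × E3 => M p.1 p.2) := by
    simp only [hM]
    refine Continuous.sub (continuous_finsetSum _ fun k _ => ?_) ?_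
    · exact ((bc k).2.1.mul (heat_cont (hh k).lap)).add ((bc k).2.2.1.mul hgl)
    · exact continuous_const.mul ((hWc.mul hgl).add (hgc.mul hWl))
  have hder : ∀ s x, HasDerivAt (fun s => (∑ k, Bel ε (heat (h k) s x) (heat g s x))
      - 1 / 4 * (heat W s x * heat g s x)) (s * M s x) s := by
    intro s x
    have d1 := heat_deriv hW s x
    have d2 := heat_deriv hg s x
    have d3 := HasDerivAt.fun_sum (u := Finset.univ) fun k _ =>
      bel_der hε (hp s x) (heat_deriv (hh k) s x) d2
    refine (d3.sub ((d1.mul d2).const_mul (1/4))).congr_deriv ?_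
    simp only [hM, mul_sub, Finset.mul_sum]
    congr 1
    · exact Finset.sum_congr rfl fun k _ => by ring
    · ring
  have ftc : ∀ x, ∫ s in Set.Ioc 0 S, s * M s x =
      ((∑ k, Bel ε (heat (h k) S x) (heat g S x)) - 1 / 4 * (heat W S x * heat g S x)) -
      ((∑ k, Bel ε (h k x) (g x)) - 1 / 4 * (W x * g x)) := by
    intro x
    rw [← intervalIntegral.integral_of_le hS, intervalIntegral.integral_eq_sub_of_hasDerivAt
      (fun s _ => hder s x)]
    · simp only [heat_zero]
    · apply Continuous.intervalIntegrable
      have hc : Continuous (fun s : ℝ => (s, x)) := by fun_prop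
      exact continuous_id.mul (hMc.comp hc)
  have Lint : ∀ s, Integrable (fun x => (∑ k, Bel ε (heat (h k) s x) (heat g s x))
      - 1 / 4 * (heat W s x * heat g s x)) := by
    intro s
    obtain ⟨MW, _, hMW⟩ := hW.bdd
    have q1 := integrable_finsetSum (Finset.univ : Finset (Fin 3))
      fun k _ => bel_int hε (hh k) hg g0 s
    have q2 := (bi hg s (heat_contx hW s) (heat_abs_le hW hMW s)).const_mul (1 / 4)
    exact q1.sub q2
  have L0 : Integrable (fun x => (∑ k, Bel ε (h k x) (g x)) - 1 / 4 * (W x * g x)) := by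
    simpa only [heat_zero] using Lint 0
  have hinteg : Integrable (fun p : ℝ × E3 => p.1 * M p.1 p.2)
      ((volume.restrict (Set.Ioc 0 S)).prod volume) := by
    obtain ⟨MW, _, hMW⟩ := hW.bdd
    obtain ⟨Mg, _, hMg⟩ := hg.bdd
    have iM : Integrable (fun p : ℝ × E3 => M p.1 p.2)
      ((volume.restrict (Set.Ioc 0 S)).prod volume) := by
      simp only [hM]
      suffices hq : (∀ k, Integrable (fun p : ℝ × E3 =>
          BelF ε (heat (h k) p.1 p.2) (heat g p.1 p.2) * heat (lap (h k)) p.1 p.2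
          + BelG ε (heat (h k) p.1 p.2) (heat g p.1 p.2) * heat (lap g) p.1 p.2)
          ((volume.restrict (Set.Ioc 0 S)).prod volume)) ∧ Integrable (fun p : ℝ × E3 =>
          heat W p.1 p.2 * heat (lap g) p.1 p.2 + heat g p.1 p.2 * heat (lap W) p.1 p.2)
          ((volume.restrict (Set.Ioc 0 S)).prod volume) by
        have q1 := integrable_finsetSum (Finset.univ : Finset (Fin 3)) fun k _ => hq.1 k
        have q2 := hq.2.const_mul (1/4)
        exact q1.sub q2
      refine ⟨fun k => ?_, ?_⟩
      · obtain ⟨M1, M10, hM1⟩ := (hh k).bdd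
        obtain ⟨K, K0, hK⟩ := bel_bdd hε (max M1 Mg)
        have hKx : ∀ p : ℝ × E3, _ := fun p => hK (heat (h k) p.1 p.2) (heat g p.1 p.2)
          ((heat_abs_le (hh k) hM1 _ _).trans (le_max_left _ _)) (hp _ _)
          ((le_abs_self _).trans ((heat_abs_le hg hMg _ _).trans (le_max_right _ _)))
        exact ((heat_integrable_prod (hh k).lap S).bdd_mul (c := K)
          (bc k).2.1.aestronglyMeasurable (Eventually.of_forall fun p => (hKx p).1)).add
          ((heat_integrable_prod hg.lap S).bdd_mul (c := K)
          (bc k).2.2.1.aestronglyMeasurable (Eventually.of_forall fun p => (hKx p).2.1))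
      · exact ((heat_integrable_prod hg.lap S).bdd_mul (c := MW)
          hWc.aestronglyMeasurable (Eventually.of_forall fun p => heat_abs_le hW hMW _ _)).add
          ((heat_integrable_prod hW.lap S).bdd_mul (c := Mg)
          hgc.aestronglyMeasurable (Eventually.of_forall fun p => heat_abs_le hg hMg _ _))
    refine iM.bdd_mul (c := S) continuous_fst.aestronglyMeasurable ?_
    have hm : MeasurableSet {p : ℝ × E3 | p.1 ∈ Set.Ioc 0 S} := measurableSet_Ioc.preimage measurable_fst
    have : ∀ᵐ p ∂((volume.restrict (Set.Ioc 0 S)).prod (volume : Measure E3)),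
        p.1 ∈ Set.Ioc 0 S := by
      have := (Measure.quasiMeasurePreserving_fst (μ := volume.restrict (Set.Ioc 0 S))
        (ν := (volume : Measure E3))).ae (ae_restrict_mem measurableSet_Ioc)
      exact this
    filter_upwards [this] with p hp
    rw [Real.norm_eq_abs, abs_of_pos hp.1]; exact hp.2
  have sw := integral_integral_swap (f := fun s x => s * M s x) hinteg
  have h1 : ∫ x, ∫ s in Set.Ioc 0 S, s * M s x ≤ 0 := by
    rw [← sw]
    refine setIntegral_nonpos measurableSet_Ioc fun s hs => ?_
    rw [integral_const_mul]
    exact mul_nonpos_of_nonneg_of_nonpos hs.1.le (by simpa only [hM] using bel_M_le hε hW hh hg g0 i hl s)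
  simp only [ftc] at h1
  rw [integral_sub (Lint S) L0] at h1
  linarith
end
end

section
lemma a2b_le {a b : ℝ} (ha : 0 ≤ a) (hb : 0 ≤ b) : a ^ 2 * b ≤ a ^ 3 + b ^ 3 := by
  rcases le_total a b with h | h
  · have : a ^ 2 * b ≤ b ^ 2 * b := by gcongr
    nlinarith [pow_nonneg ha 3]
  · have : a ^ 2 * b ≤ a ^ 2 * a := by gcongr
    nlinarith [pow_nonneg hb 3]

section
variable {W g : E3 → ℝ} {h : Fin 3 → E3 → ℝ}

lemma CC.abs3 {f : E3 → ℝ} (hf : CC f) : Integrable (fun x => |f x| ^ 3) := by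
  have := hf.cont
  refine Continuous.integrable_of_hasCompactSupport (by fun_prop) ?_
  refine hf.cs.comp_left (g := fun t : ℝ => |t| ^ 3) (by simp)

lemma CC.gsqrt {f : E3 → ℝ} (hf : CC f) : Integrable (fun x => f x * √(f x)) := by
  have := hf.cont
  refine Continuous.integrable_of_hasCompactSupport (by fun_prop) ?_
  exact hf.cs.mul_right

lemma bel_final (hW : CC W) (hh : ∀ k, CC (h k)) (hg : CC g) (g0 : ∀ x, 0 ≤ g x) (i : Fin 3)
    (hl : ∀ x, lap W x = ∑ k, pds (pds (h k) i) k x) :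
    ∫ x, W x * g x ≤ 18 * (∫ x, g x * √(g x)) + 4 * ∑ k, ∫ x, |h k x| ^ 3 := by
  have step1 : ∀ ε > 0, 1 / 4 * ∫ x, W x * g x ≤ ∑ k, ∫ x, Bel ε (h k x) (g x) := by
    intro ε hε
    have bI : ∀ k, Integrable (fun x => Bel ε (h k x) (g x)) := fun k => by
      simpa only [heat_zero] using bel_int hε (hh k) hg g0 0
    have WI : Integrable (fun x => W x * g x) := (hW.mul hg).integrable
    have key : ∀ S > 0, 1 / 4 * ∫ x, W x * g x ≤ (∑ k, ∫ x, Bel ε (h k x) (g x)) +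
        (1 / 4 * ((1 / gm) * (∫ y, |W y|) * ∫ y, |g y|)) * (S ^ 3)⁻¹ := by
      intro S hS
      have m := bel_mono hε hW hh hg g0 i hl hS.le
      have e : ∫ x, ((∑ k, Bel ε (h k x) (g x)) - 1 / 4 * (W x * g x)) =
          (∑ k, ∫ x, Bel ε (h k x) (g x)) - 1 / 4 * ∫ x, W x * g x := by
        rw [integral_sub (integrable_finsetSum _ fun k _ => bI k) (WI.const_mul _),
          integral_finsetSum _ fun k _ => bI k, integral_const_mul]
      rw [e] at m
      have iS := heat_integrable hg S
      have lo : ∫ x, - (1 / 4 * ((1 / gm) * (S ^ 3)⁻¹ * ∫ y, |W y|)) * |heat g S x| ≤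
          ∫ x, ((∑ k, Bel ε (heat (h k) S x) (heat g S x)) - 1 / 4 * (heat W S x * heat g S x)) := by
        obtain ⟨MW, _, hMW⟩ := hW.bdd
        have q1 := integrable_finsetSum (Finset.univ : Finset (Fin 3))
          fun k _ => bel_int hε (hh k) hg g0 S
        have q2 := (bi hg S (heat_contx hW S) (heat_abs_le hW hMW S)).const_mul (1 / 4)
        refine integral_mono (iS.abs.const_mul _) (q1.sub q2) fun x => ?_
        have h1 := heat_decay hW hS x
        have h2 : 0 ≤ ∑ k, Bel ε (heat (h k) S x) (heat g S x) :=
          Finset.sum_nonneg fun k _ => bel_nonneg hε (heat_nonneg g0 S x) _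
        have h3 : heat W S x * heat g S x ≤ ((1 / gm) * (S ^ 3)⁻¹ * ∫ y, |W y|) * |heat g S x| :=
          (le_abs_self _).trans (by rw [abs_mul]; gcongr)
        simp only
        linarith
      rw [integral_const_mul] at lo
      have gg : ∫ x, |heat g S x| ≤ ∫ y, |g y| := by
        have := heat_lint hg S
        rw [← ofReal_integral_norm_eq_lintegral_enorm iS,
          ← ofReal_integral_norm_eq_lintegral_enorm hg.integrable] at this
        exact (ENNReal.ofReal_le_ofReal_iff (integral_nonneg fun _ => norm_nonneg _)).1 this
      have hgm := gm_pos
      have hWn : 0 ≤ ∫ y, |W y| := integral_nonneg fun _ => abs_nonneg _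
      have : (1 / 4 * ((1 / gm) * (S ^ 3)⁻¹ * ∫ y, |W y|)) * ∫ x, |heat g S x| ≤
          (1 / 4 * ((1 / gm) * (S ^ 3)⁻¹ * ∫ y, |W y|)) * ∫ y, |g y| := by gcongr
      have e3 : (1 / 4 * ((1 / gm) * (∫ y, |W y|) * ∫ y, |g y|)) * (S ^ 3)⁻¹ =
        (1 / 4 * ((1 / gm) * (S ^ 3)⁻¹ * ∫ y, |W y|)) * ∫ y, |g y| := by ring
      rw [e3]
      linarith
    have lim : Tendsto (fun S : ℝ => (∑ k, ∫ x, Bel ε (h k x) (g x)) +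
        (1 / 4 * ((1 / gm) * (∫ y, |W y|) * ∫ y, |g y|)) * (S ^ 3)⁻¹) atTop
        (𝓝 ((∑ k, ∫ x, Bel ε (h k x) (g x)) +
        (1 / 4 * ((1 / gm) * (∫ y, |W y|) * ∫ y, |g y|)) * 0)) := by
      refine tendsto_const_nhds.add (tendsto_const_nhds.mul ?_)
      exact (tendsto_pow_atTop (by norm_num)).inv_tendsto_atTop
    rw [mul_zero, add_zero] at lim
    exact ge_of_tendsto lim ((eventually_gt_atTop 0).mono key)
  have step2 : ∀ ε > 0, ∀ k, ∫ x, Bel ε (h k x) (g x) ≤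
      3 / 2 * (∫ x, g x * √(g x)) + (∫ x, |h k x| ^ 3) + (1 / 2 * ∫ x, h k x * h k x) * √ε := by
    intro ε hε k
    have bI : Integrable (fun x => Bel ε (h k x) (g x)) := by
      simpa only [heat_zero] using bel_int hε (hh k) hg g0 0
    have i1 := hg.gsqrt
    have i2 := (hh k).abs3
    have i3 := ((hh k).mul (hh k)).integrable
    rw [mul_right_comm, ← integral_const_mul, ← integral_const_mul, ← integral_add (i1.const_mul _) i2,
      ← integral_add (iadd (i1.const_mul _) i2) (i3.const_mul _)]
    refine integral_mono bI (iadd (iadd (i1.const_mul _) i2) (i3.const_mul _)) fun x => ?_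
    have := bel_le hε (g0 x) (h k x)
    have h2 := a2b_le (abs_nonneg (h k x)) (Real.sqrt_nonneg (g x))
    have h3 : √(g x) ^ 3 = g x * √(g x) := by
      rw [pow_succ, Real.sq_sqrt (g0 x)]
    rw [sq_abs, h3] at h2
    have h4 : h k x ^ 2 * |h k x| = |h k x| ^ 3 := by rw [← sq_abs]; ring
    simp only
    nlinarith
  have step3 : ∀ ε > 0, ∫ x, W x * g x ≤ (18 * (∫ x, g x * √(g x)) + 4 * ∑ k, ∫ x, |h k x| ^ 3) +
      (2 * ∑ k, ∫ x, h k x * h k x) * √ε := by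
    intro ε hε
    have s1 := step1 ε hε
    have s2 := Finset.sum_le_sum fun k (_ : k ∈ Finset.univ) => step2 ε hε k
    simp only [Fin.sum_univ_three] at s1 s2 ⊢
    linarith
  have lim : Tendsto (fun ε : ℝ => (18 * (∫ x, g x * √(g x)) + 4 * ∑ k, ∫ x, |h k x| ^ 3) +
      (2 * ∑ k, ∫ x, h k x * h k x) * √ε) (𝓝[>] 0) (𝓝 ((18 * (∫ x, g x * √(g x)) +
      4 * ∑ k, ∫ x, |h k x| ^ 3) + (2 * ∑ k, ∫ x, h k x * h k x) * √0)) := by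
    refine tendsto_const_nhds.add (tendsto_const_nhds.mul ?_)
    exact (Real.continuous_sqrt.tendsto 0).mono_left nhdsWithin_le_nhds
  rw [Real.sqrt_zero, mul_zero, add_zero] at lim
  exact ge_of_tendsto lim (eventually_mem_nhdsWithin.mono step3)

lemma lap_const_mul (hW : CC W) (c : ℝ) (x : E3) : lap (fun x => c * W x) x = c * lap W x := by
  unfold lap
  rw [Finset.mul_sum]
  refine Finset.sum_congr rfl fun i _ => ?_
  rw [pds_const_mul hW.diff, pds_const_mul (hW.pds i).diff]

/-- positive part estimate -/
lemma bel_pos_part (hW : CC W) (hh : ∀ k, CC (h k)) (i : Fin 3)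
    (hl : ∀ x, lap W x = ∑ k, pds (pds (h k) i) k x) :
    ∫ x, (max (W x) 0) ^ 3 ≤ 10368 * ∑ k, ∫ x, |h k x| ^ 3 := by
  have hp : Integrable (fun x => (max (W x) 0) ^ 3) := by
    have := hW.cont
    refine Continuous.integrable_of_hasCompactSupport (by fun_prop) ?_
    refine hW.cs.comp_left (g := fun t : ℝ => (max t 0) ^ 3) (by simp)
  set g : ℕ → E3 → ℝ := fun n x => W x * (W x * Real.smoothTransition ((n + 1 : ℝ) * W x)) with hgdef
  have hg : ∀ n, CC (g n) := fun n => by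
    refine ⟨?_, hW.cs.mul_right⟩
    have := hW.sm
    exact this.mul (this.mul (Real.smoothTransition.contDiff.comp (contDiff_const.mul this)))
  have g0 : ∀ n x, 0 ≤ g n x := fun n x => by
    simp only [hgdef]
    rw [← mul_assoc]
    exact mul_nonneg (mul_self_nonneg _) (Real.smoothTransition.nonneg _)
  have gz : ∀ n x, W x ≤ 0 → g n x = 0 := fun n x hx => by
    simp only [hgdef]
    rw [Real.smoothTransition.zero_of_nonpos (mul_nonpos_of_nonneg_of_nonpos (by positivity) hx)]
    simp
  have gle : ∀ n x, g n x ≤ W x ^ 2 := fun n x => by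
    simp only [hgdef]
    rw [← mul_assoc, sq]
    exact mul_le_of_le_one_right (mul_self_nonneg _) (Real.smoothTransition.le_one _)
  have gs : ∀ n x, g n x * √(g n x) ≤ W x * g n x := fun n x => by
    rcases le_or_gt (W x) 0 with hx | hx
    · rw [gz n x hx]; simp
    · rw [mul_comm]
      refine mul_le_mul_of_nonneg_right ?_ (g0 n x)
      exact Real.sqrt_le_iff.2 ⟨hx.le, gle n x⟩
  have est : ∀ n, ∫ x, W x * g n x ≤ 10368 * ∑ k, ∫ x, |h k x| ^ 3 := by
    intro n
    have b := bel_final (W := fun x => 36 * W x) (h := fun k x => 36 * h k x) (g := g n)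
      (hW.const_mul 36) (fun k => (hh k).const_mul 36) (hg n) (g0 n) i (fun x => by
        rw [lap_const_mul hW, hl x, Finset.mul_sum]
        refine Finset.sum_congr rfl fun k _ => ?_
        rw [pds_const_mul (hh k).diff, pds_const_mul ((hh k).pds i).diff])
    simp only [abs_mul, mul_pow, mul_assoc, integral_const_mul] at b
    rw [← Finset.mul_sum] at b
    have c : ∫ x, g n x * √(g n x) ≤ ∫ x, W x * g n x :=
      integral_mono (hg n).gsqrt (hW.mul (hg n)).integrable (gs n)
    have : |(36:ℝ)| ^ 3 = 46656 := by norm_num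
    rw [this] at b
    linarith
  have lim : Tendsto (fun n => ∫ x, W x * g n x) atTop (𝓝 (∫ x, (max (W x) 0) ^ 3)) := by
    refine tendsto_integral_of_dominated_convergence (fun x => |W x| ^ 3)
      (fun n => (hW.mul (hg n)).cont.aestronglyMeasurable) hW.abs3
      (fun n => Eventually.of_forall fun x => ?_) (Eventually.of_forall fun x => ?_)
    · rw [Real.norm_eq_abs, abs_mul, abs_of_nonneg (g0 n x), pow_succ', sq_abs]
      exact mul_le_mul_of_nonneg_left (gle n x) (abs_nonneg _)
    · rcases le_or_gt (W x) 0 with hx | hx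
      · simp only [gz _ x hx, max_eq_right hx]; simp
      · rw [max_eq_left hx.le]
        refine tendsto_const_nhds.congr' ?_
        obtain ⟨N, hN⟩ := exists_nat_gt (1 / W x)
        filter_upwards [eventually_ge_atTop N] with n hn
        have : 1 ≤ (n + 1 : ℝ) * W x := by
          rw [div_lt_iff₀ hx] at hN
          have : (N : ℝ) ≤ n := by exact_mod_cast hn
          nlinarith
        simp only [hgdef]
        rw [Real.smoothTransition.one_of_one_le this]
        ring
  exact le_of_tendsto lim (Eventually.of_forall est)

lemma bel_abs (hW : CC W) (hh : ∀ k, CC (h k)) (i : Fin 3)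
    (hl : ∀ x, lap W x = ∑ k, pds (pds (h k) i) k x) :
    ∫ x, |W x| ^ 3 ≤ 20736 * ∑ k, ∫ x, |h k x| ^ 3 := by
  have p1 := bel_pos_part hW hh i hl
  have p2 := bel_pos_part (W := fun x => (-1) * W x) (h := fun k x => (-1) * h k x)
    (hW.const_mul _) (fun k => (hh k).const_mul _) i (fun x => by
      rw [lap_const_mul hW, hl x, Finset.mul_sum]
      refine Finset.sum_congr rfl fun k _ => ?_
      rw [pds_const_mul (hh k).diff, pds_const_mul ((hh k).pds i).diff])
  have q : ∀ {V : E3 → ℝ} (_ : CC V), Integrable (fun x => (max (V x) 0) ^ 3) := by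
    intro V hV
    have := hV.cont
    refine Continuous.integrable_of_hasCompactSupport (by fun_prop) ?_
    refine hV.cs.comp_left (g := fun t : ℝ => (max t 0) ^ 3) (by simp)
  have e : ∀ x, |W x| ^ 3 = (max (W x) 0) ^ 3 + (max ((-1) * W x) 0) ^ 3 := fun x => by
    rcases le_total (W x) 0 with hx | hx
    · rw [abs_of_nonpos hx, max_eq_right hx, max_eq_left (by linarith)]; ring
    · rw [abs_of_nonneg hx, max_eq_left hx, max_eq_right (by linarith)]; ring
  simp only [e]
  rw [integral_add (q hW) (q (hW.const_mul (-1)))]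
  simp only [abs_mul, abs_neg, abs_one, one_mul] at p2
  linarith
end

/-- the curl-div components of a vector field -/
def hcd (U : Fin 3 → E3 → ℝ) (j k : Fin 3) (x : E3) : ℝ :=
  pds (U j) k x - pds (U k) j x + if j = k then ∑ m, pds (U m) m x else 0

lemma CC.hcd {U : Fin 3 → E3 → ℝ} (hU : ∀ j, CC (U j)) (j k : Fin 3) : CC (hcd U j k) := by
  unfold _root_.hcd
  refine (((hU j).pds k).sub ((hU k).pds j)).add ?_
  by_cases h : j = k
  · simp only [h, if_true]; exact CC.sum fun m => (hU m).pds m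
  · simp only [h, if_false]; exact cc_zero

lemma pds_sum {f : Fin 3 → E3 → ℝ} (hf : ∀ k, CC (f k)) (i : Fin 3) :
    pds (fun x => ∑ k, f k x) i = fun x => ∑ k, pds (f k) i x := by
  simp only [Fin.sum_univ_three]
  rw [pds_add ((hf 0).add (hf 1)).diff (hf 2).diff, pds_add (hf 0).diff (hf 1).diff]

/-- Result A: the L³ div-curl estimate. -/
theorem resA {U : Fin 3 → E3 → ℝ} (hU : ∀ j, CC (U j)) (i j : Fin 3) :
    ∫ x, |pds (U j) i x| ^ 3 ≤ 20736 * ∑ k, ∫ x, |hcd U j k x| ^ 3 := by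
  refine bel_abs ((hU j).pds i) (CC.hcd hU j) i fun x => ?_
  have e1 : lap (pds (U j) i) = pds (lap (U j)) i := by
    unfold lap
    rw [pds_sum (f := fun k => pds (pds (U j) k) k) (fun k => ((hU j).pds k).pds k)]
    funext x
    refine Finset.sum_congr rfl fun k _ => ?_
    rw [pds_comm (hU j) i k, pds_comm ((hU j).pds k) i k]
  have e2 : lap (U j) = fun x => ∑ k, pds (hcd U j k) k x := by
    funext x
    have e3 : ∀ k, pds (hcd U j k) k x = pds (pds (U j) k) k x - pds (pds (U k) k) j x +
        if j = k then ∑ m, pds (pds (U m) m) j x else 0 := fun k => by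
      unfold hcd
      by_cases h : j = k
      · simp only [h, if_true]
        rw [pds_add (((hU k).pds k).sub ((hU k).pds k)).diff
          (CC.sum fun m => (hU m).pds m).diff, pds_sub ((hU k).pds k).diff ((hU k).pds k).diff,
          pds_sum fun m => (hU m).pds m]
      · simp only [h, if_false, add_zero]
        rw [pds_sub ((hU j).pds k).diff ((hU k).pds j).diff, pds_comm (hU k) j k]
    simp only [e3, lap]
    rw [Finset.sum_add_distrib, Finset.sum_sub_distrib]
    simp
  rw [e1, e2, pds_sum fun k => (CC.hcd hU j k).pds k]
  refine Finset.sum_congr rfl fun k _ => ?_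
  rw [pds_comm (CC.hcd hU j k) k i]
end

section
/-! ### Geometry of the domain -/

def kap : ℝ := (volume (Metric.ball (0:E3) 1)).toReal

lemma kap_pos : 0 < kap :=
  ENNReal.toReal_pos (Metric.measure_ball_pos _ _ one_pos).ne' measure_ball_lt_top.ne

lemma vol_ball (x : E3) {r : ℝ} (hr : 0 ≤ r) :
    volume (Metric.ball x r) = ENNReal.ofReal (kap * r ^ 3) := by
  rw [Measure.addHaar_ball _ x hr, mul_comm, ENNReal.ofReal_mul kap_pos.le, kap,
    ENNReal.ofReal_toReal measure_ball_lt_top.ne]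
  simp

lemma rpow_neg_anti {a x y : ℝ} (ha : 0 ≤ a) (hx : 0 < x) (h : x ≤ y) : y ^ (-a) ≤ x ^ (-a) :=
  Real.rpow_le_rpow_of_nonpos hx h (by linarith)

lemma zero_rpow_le {a x : ℝ} (ha : 0 ≤ a) (hx : 0 < x) : (0:ℝ) ^ (-a) ≤ x ^ (-a) := by
  rcases ha.eq_or_lt with rfl | h
  · simp
  · rw [Real.zero_rpow (by linarith)]; positivity

lemma one_d {a : ℝ} (ha : 0 ≤ a) (ha1 : a < 1) (c : ℝ) {ρ : ℝ} (hρ : 0 < ρ) :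
    ∫⁻ t in Set.Ioo 0 ρ, ENNReal.ofReal (|c + t| ^ (-a)) ≤
      ENNReal.ofReal ((1 + 2 / (1 - a)) * ρ ^ (1 - a)) := by
  set G : ℝ → ℝ≥0∞ := (Set.Ioo 0 ρ).indicator fun t => ENNReal.ofReal (t ^ (-a)) with hG
  have hGm : Measurable G := Measurable.indicator (by fun_prop) measurableSet_Ioo
  have hGi : ∫⁻ t, G t = ENNReal.ofReal (ρ ^ (1 - a) / (1 - a)) := by
    rw [hG, lintegral_indicator measurableSet_Ioo]
    have hi : IntegrableOn (fun t : ℝ => t ^ (-a)) (Set.Ioo 0 ρ) := by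
      have := intervalIntegral.intervalIntegrable_rpow' (a := 0) (b := ρ) (r := -a) (by linarith)
      rw [intervalIntegrable_iff_integrableOn_Ioo_of_le hρ.le] at this
      exact this
    rw [← ofReal_integral_eq_lintegral_ofReal hi]
    · rw [← integral_Ioc_eq_integral_Ioo, ← intervalIntegral.integral_of_le hρ.le,
        integral_rpow (Or.inl (by linarith))]
      rw [Real.zero_rpow (by linarith), show -a + 1 = 1 - a by ring, sub_zero]
    · filter_upwards [ae_restrict_mem measurableSet_Ioo] with t ht
      exact Real.rpow_nonneg ht.1.le _
  have pw : ∀ t, ENNReal.ofReal (|c + t| ^ (-a)) ≤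
      ENNReal.ofReal (ρ ^ (-a)) + (G (c + t) + G (-c - t)) := by
    intro t
    rcases lt_trichotomy (c + t) 0 with h | h | h
    · rcases lt_or_ge (-c - t) ρ with h2 | h2
      · refine le_add_left (le_add_left (le_of_eq ?_))
        have hm : -c - t ∈ Set.Ioo 0 ρ := ⟨by linarith, h2⟩
        rw [hG, Set.indicator_of_mem hm, abs_of_neg h]
        congr 2; ring
      · refine le_add_right (ENNReal.ofReal_le_ofReal ?_)
        exact rpow_neg_anti ha hρ (by rw [abs_of_neg h]; linarith)
    · refine le_add_right (ENNReal.ofReal_le_ofReal ?_)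
      rw [h, abs_zero]; exact zero_rpow_le ha hρ
    · rcases lt_or_ge (c + t) ρ with h2 | h2
      · refine le_add_left (le_add_right (le_of_eq ?_))
        have hm : c + t ∈ Set.Ioo 0 ρ := ⟨h, h2⟩
        rw [hG, Set.indicator_of_mem hm, abs_of_pos h]
      · refine le_add_right (ENNReal.ofReal_le_ofReal ?_)
        exact rpow_neg_anti ha hρ (by rw [abs_of_pos h]; linarith)
  calc ∫⁻ t in Set.Ioo 0 ρ, ENNReal.ofReal (|c + t| ^ (-a))
      ≤ ∫⁻ t in Set.Ioo 0 ρ, (ENNReal.ofReal (ρ ^ (-a)) + (G (c + t) + G (-c - t))) :=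
        lintegral_mono fun t => pw t
    _ = ENNReal.ofReal (ρ ^ (-a)) * volume (Set.Ioo 0 ρ) +
        ∫⁻ t in Set.Ioo 0 ρ, (G (c + t) + G (-c - t)) := by
        rw [lintegral_add_left measurable_const, setLIntegral_const]
    _ ≤ ENNReal.ofReal (ρ ^ (-a)) * volume (Set.Ioo 0 ρ) +
        ∫⁻ t, (G (c + t) + G (-c - t)) := by
        gcongr; exact Measure.restrict_le_self
    _ = ENNReal.ofReal (ρ ^ (-a)) * ENNReal.ofReal ρ +
        (ENNReal.ofReal (ρ ^ (1 - a) / (1 - a)) + ENNReal.ofReal (ρ ^ (1 - a) / (1 - a))) := by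
        rw [lintegral_add_left (by fun_prop), lintegral_add_left_eq_self G c,
          lintegral_sub_left_eq_self G (-c), hGi]
        simp
    _ = _ := by
        have h1 : 0 < 1 - a := by linarith
        rw [← ENNReal.ofReal_mul (by positivity), ← ENNReal.ofReal_add (by positivity) (by positivity),
          ← ENNReal.ofReal_add (by positivity) (by positivity)]
        congr 1
        have : ρ ^ (1 - a) = ρ ^ (-a) * ρ := by
          rw [show 1 - a = -a + 1 by ring, Real.rpow_add_one hρ.ne']
        rw [this]; ring

section
variable {Ω : Set E3}

lemma fr_compact (hΩ : IsLipschitzDomain Ω) : IsCompact (frontier Ω) :=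
  Metric.isCompact_of_isClosed_isBounded isClosed_frontier
    ((hΩ.isBounded.closure).subset frontier_subset_closure)

lemma fr_nonempty (hΩ : IsLipschitzDomain Ω) : (frontier Ω).Nonempty := by
  rw [nonempty_frontier_iff]
  refine ⟨hΩ.nonempty, fun h => ?_⟩
  have := hΩ.isBounded
  rw [h] at this
  exact NormedSpace.unbounded_univ ℝ E3 this

lemma dB_cont (Ω : Set E3) : Continuous (dB Ω) := Metric.continuous_infDist_pt _

lemma dB_nonneg (Ω : Set E3) (x : E3) : 0 ≤ dB Ω x := Metric.infDist_nonneg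

lemma dB_pos (hΩ : IsLipschitzDomain Ω) {x : E3} (hx : x ∈ Ω) : 0 < dB Ω x := by
  refine lt_of_le_of_ne (dB_nonneg _ _) fun h => ?_
  have := (isClosed_frontier.mem_iff_infDist_zero (fr_nonempty hΩ)).2 h.symm
  rw [hΩ.isOpen.frontier_eq] at this
  exact this.2 hx

lemma dB_lip (Ω : Set E3) (x y : E3) : dB Ω x ≤ dB Ω y + dist x y :=
  Metric.infDist_le_infDist_add_dist

lemma dB_near (hΩ : IsLipschitzDomain Ω) (x : E3) : ∃ P ∈ frontier Ω, dB Ω x = dist x P :=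
  (fr_compact hΩ).exists_infDist_eq_dist (fr_nonempty hΩ) x

/-- points of the ball of radius `d(x)` around `x ∈ Ω` belong to `Ω`. -/
lemma dball_sub (hΩ : IsLipschitzDomain Ω) {x : E3} (hx : x ∈ Ω) :
    Metric.ball x (dB Ω x) ⊆ Ω := by
  intro y hy
  by_contra hn
  have hc : IsPreconnected (Metric.ball x (dB Ω x)) := (convex_ball x _).isPreconnected
  have key : ∀ z ∈ Metric.ball x (dB Ω x), z ∉ frontier Ω := fun z hz1 hz2 => by
    have := Metric.infDist_le_dist_of_mem hz2 (x := x)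
    rw [Metric.mem_ball, dist_comm] at hz1
    exact absurd hz1 (not_lt.2 this)
  have hdich : ∀ z ∈ Metric.ball x (dB Ω x), z ∈ Ω ∨ z ∈ (closure Ω)ᶜ := fun z hz => by
    by_contra h
    push Not at h
    refine key z hz ?_
    rw [hΩ.isOpen.frontier_eq]
    exact ⟨by simpa using h.2, h.1⟩
  obtain ⟨z, -, hz⟩ := hc Ω (closure Ω)ᶜ hΩ.isOpen isClosed_closure.isOpen_compl
    (fun z hz => hdich z hz) ⟨x, Metric.mem_ball_self (dB_pos hΩ hx), hx⟩
    ⟨y, hy, (hdich y hy).resolve_left hn⟩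
  exact hz.2 (subset_closure hz.1)

lemma proj12_sub (x y : E3) : ‖proj12 x - proj12 y‖ ≤ ‖x - y‖ := by
  rw [EuclideanSpace.norm_eq, EuclideanSpace.norm_eq]
  apply Real.sqrt_le_sqrt
  simp only [Fin.sum_univ_two, Fin.sum_univ_three]
  simp [proj12, mk2]
  positivity

lemma local_star (hΩ : IsLipschitzDomain Ω) {a : ℝ} (ha : 0 ≤ a) (ha1 : a < 1) {P : E3}
    (hP : P ∈ frontier Ω) : ∃ δ > 0, ∀ x ρ, 0 < ρ → Metric.ball x ρ ⊆ Metric.ball P δ →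
    ∫⁻ y in Metric.ball x ρ, ENNReal.ofReal (dB Ω y ^ (-a)) ≤
      ENNReal.ofReal (16 * kap * (1 + 2 / (1 - a)) * ρ ^ (3 - a)) := by
  obtain ⟨f, R, R', r, A, hf, hR, hR', hr, hr1, hA, hA2, hfr, -⟩ := hΩ.charts P hP
  have hAl : ∀ u v, |A u - A v| ≤ ‖u - v‖ := fun u v => by
    have := hA.dist_le_mul u v
    rw [Real.dist_eq, dist_eq_norm, Real.coe_toNNReal r hr.le] at this
    nlinarith [norm_nonneg (u - v)]
  set ψ : E3 → ℝ := fun y => (f y) 2 - A (proj12 (f y)) with hψ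
  have hpc : Continuous proj12 := by
    have : LipschitzWith 1 proj12 := LipschitzWith.of_dist_le_mul fun x y => by
      simpa [dist_eq_norm] using proj12_sub x y
    exact this.continuous
  have hψc : Continuous ψ := by
    have h1 := f.continuous
    have h2 : Continuous A := hA.continuous
    have h3 : Continuous fun y : E3 => y 2 := by fun_prop
    exact (h3.comp h1).sub (h2.comp (hpc.comp h1))
  -- the vertical direction
  set g := f.symm.toRealAffineIsometryEquiv with hg
  have hgc : ∀ y, g y = f.symm y := fun y => rfl
  set u : E3 := g.linearIsometryEquiv (ee 2) with hu
  have hun : ‖u‖ = 1 := by rw [hu, LinearIsometryEquiv.norm_map, ee_norm]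
  have hfu : ∀ x (t : ℝ), f (x + t • u) = f x + t • ee 2 := fun x t => by
    apply f.symm.injective
    rw [IsometryEquiv.symm_apply_apply]
    have : g (t • ee 2 +ᵥ f x) = g.linearIsometryEquiv (t • ee 2) +ᵥ g (f x) := g.map_vadd _ _
    rw [hgc, hgc, IsometryEquiv.symm_apply_apply, map_smul, vadd_eq_add, vadd_eq_add] at this
    rw [add_comm (f x), this, add_comm, hu]
  have hψu : ∀ x (t : ℝ), ψ (x + t • u) = ψ x + t := fun x t => by
    have e1 : proj12 (f x + t • ee 2) = proj12 (f x) := by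
      unfold proj12; simp [ee]
    simp only [hψ, hfu, e1]
    simp [ee]; ring
  set δ := min R R' / 2 with hδ
  have hδ0 : 0 < δ := by have := lt_min hR hR'; positivity
  have hδR : 2 * δ ≤ R := by rw [hδ]; linarith [min_le_left R R']
  have hδR' : 2 * δ ≤ R' := by rw [hδ]; linarith [min_le_right R R']
  have hp0 : ∀ y : E3, ‖proj12 y‖ ≤ ‖y‖ := fun y => by
    have := proj12_sub y 0
    have e0 : proj12 0 = 0 := by ext i; fin_cases i <;> simp [proj12, mk2]
    simpa [e0] using this
  have chart : ∀ y, dist y P < 2 * δ → (y ∈ frontier Ω ↔ ψ y = 0) := fun y hy => by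
    have h1 : ‖f y‖ < 2 * δ := by
      rw [← dist_zero_right, ← hf, f.dist_eq]; exact hy
    have h2 := hfr (f y) ((hp0 _).trans_lt (h1.trans_le hδR))
      ((coord_le _ 2).trans_lt (h1.trans_le hδR'))
    rw [f.symm_apply_apply] at h2
    rw [h2, hψ]; exact sub_eq_zero.symm
  have low : ∀ y ∈ Metric.ball P δ, ENNReal.ofReal (dB Ω y ^ (-a)) ≤
      ENNReal.ofReal (2 * |ψ y| ^ (-a)) := by
    intro y hy
    rw [Metric.mem_ball] at hy
    apply ENNReal.ofReal_le_ofReal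
    by_cases h0 : ψ y = 0
    · have : dB Ω y = 0 := Metric.infDist_zero_of_mem ((chart y (by linarith)).2 h0)
      rw [this, h0, abs_zero]
      have : 0 ≤ (0:ℝ) ^ (-a) := Real.rpow_nonneg le_rfl _
      linarith
    · obtain ⟨q, hq, hqd⟩ := dB_near hΩ y
      have hle : dB Ω y ≤ dist y P := Metric.infDist_le_dist_of_mem hP
      have hqP : dist q P < 2 * δ := by
        have := dist_triangle q y P
        rw [dist_comm q y, ← hqd] at this
        linarith
      have hψq := (chart q hqP).1 hq
      have h3 : |ψ y| ≤ 2 * dB Ω y := by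
        have e : ψ y = (f y - f q) 2 - (A (proj12 (f y)) - A (proj12 (f q))) := by
          have : ψ y = ψ y - ψ q := by rw [hψq]; ring
          rw [this]; simp only [hψ, PiLp.sub_apply]; ring
        have e2 : ‖f y - f q‖ = dB Ω y := by rw [← dist_eq_norm, f.dist_eq, hqd]
        rw [e]
        have i1 := coord_le (f y - f q) 2
        have i2 := (hAl (proj12 (f y)) (proj12 (f q))).trans (proj12_sub _ _)
        have := abs_sub ((f y - f q) 2) (A (proj12 (f y)) - A (proj12 (f q)))
        linarith
      have h4 : 0 < |ψ y| := abs_pos.2 h0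
      calc dB Ω y ^ (-a) ≤ (|ψ y| / 2) ^ (-a) := rpow_neg_anti ha (by positivity) (by linarith)
        _ = |ψ y| ^ (-a) * 2 ^ a := by
          rw [Real.div_rpow h4.le (by norm_num), Real.rpow_neg (by norm_num : (0:ℝ) ≤ 2)]
          simp [div_eq_mul_inv]
        _ ≤ |ψ y| ^ (-a) * 2 := by
          gcongr
          calc (2:ℝ) ^ a ≤ 2 ^ (1:ℝ) := Real.rpow_le_rpow_of_exponent_le (by norm_num) ha1.le
            _ = 2 := by simp
        _ = _ := mul_comm _ _
  refine ⟨δ, hδ0, fun x ρ hρ hsub => ?_⟩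
  set I := ∫⁻ y in Metric.ball x ρ, ENNReal.ofReal (dB Ω y ^ (-a)) with hI
  have bm : Measurable fun y => ENNReal.ofReal (2 * |ψ y| ^ (-a)) := by
    have := hψc.measurable; fun_prop
  have shift : ∀ t ∈ Set.Ioo 0 ρ, I ≤ ∫⁻ y in Metric.ball x (2 * ρ),
      ENNReal.ofReal (2 * |ψ y + t| ^ (-a)) := by
    intro t ht
    calc I ≤ ∫⁻ y in Metric.ball x ρ, ENNReal.ofReal (2 * |ψ y| ^ (-a)) :=
          setLIntegral_mono bm fun y hy => low y (hsub hy)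
      _ = ∫⁻ y, (Metric.ball x ρ).indicator (fun y => ENNReal.ofReal (2 * |ψ y| ^ (-a))) y := by
          rw [lintegral_indicator Metric.isOpen_ball.measurableSet]
      _ = ∫⁻ y, (Metric.ball x ρ).indicator (fun y => ENNReal.ofReal (2 * |ψ y| ^ (-a)))
            (y + t • u) := (lintegral_add_right_eq_self _ _).symm
      _ ≤ ∫⁻ y, (Metric.ball x (2 * ρ)).indicator
            (fun y => ENNReal.ofReal (2 * |ψ y + t| ^ (-a))) y := by
          refine lintegral_mono fun y => ?_
          by_cases hy : y + t • u ∈ Metric.ball x ρ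
          · have : y ∈ Metric.ball x (2 * ρ) := by
              rw [Metric.mem_ball] at hy ⊢
              have h1 := dist_triangle y (y + t • u) x
              have h2 : dist y (y + t • u) = t := by
                rw [dist_self_add_right, norm_smul, hun, mul_one, Real.norm_of_nonneg ht.1.le]
              linarith [ht.2]
            rw [Set.indicator_of_mem hy, Set.indicator_of_mem this, hψu]
          · rw [Set.indicator_of_notMem hy]; exact zero_le
      _ = _ := by rw [lintegral_indicator Metric.isOpen_ball.measurableSet]
  have avg : ENNReal.ofReal ρ * I ≤ ENNReal.ofReal (2 * ((1 + 2 / (1 - a)) * ρ ^ (1 - a))) *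
      ENNReal.ofReal (kap * (2 * ρ) ^ 3) := by
    calc ENNReal.ofReal ρ * I = ∫⁻ t in Set.Ioo 0 ρ, I := by
          rw [setLIntegral_const, Real.volume_Ioo, sub_zero, mul_comm]
      _ ≤ ∫⁻ t in Set.Ioo 0 ρ, ∫⁻ y in Metric.ball x (2 * ρ),
          ENNReal.ofReal (2 * |ψ y + t| ^ (-a)) := setLIntegral_mono' measurableSet_Ioo shift
      _ = ∫⁻ y in Metric.ball x (2 * ρ), ∫⁻ t in Set.Ioo 0 ρ,
          ENNReal.ofReal (2 * |ψ y + t| ^ (-a)) := by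
          apply lintegral_lintegral_swap
          have := hψc.measurable
          apply Measurable.aemeasurable
          unfold Function.uncurry
          fun_prop
      _ ≤ ∫⁻ y in Metric.ball x (2 * ρ), ENNReal.ofReal (2 * ((1 + 2 / (1 - a)) * ρ ^ (1 - a))) := by
          refine lintegral_mono fun y => ?_
          simp only [ENNReal.ofReal_mul (show (0:ℝ) ≤ 2 by norm_num)]
          rw [lintegral_const_mul _ (by fun_prop)]
          gcongr
          exact one_d ha ha1 _ hρ
      _ = _ := by rw [setLIntegral_const, vol_ball x (by positivity)]
  have h1a : 0 < 1 - a := by linarith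
  rw [← ENNReal.ofReal_mul (by positivity)] at avg
  have hk := kap_pos
  have e : 2 * ((1 + 2 / (1 - a)) * ρ ^ (1 - a)) * (kap * (2 * ρ) ^ 3) =
      ρ * (16 * kap * (1 + 2 / (1 - a)) * ρ ^ (3 - a)) := by
    have : ρ ^ (3 - a) = ρ ^ (1 - a) * ρ ^ 2 := by
      rw [← Real.rpow_natCast, ← Real.rpow_add hρ]; congr 1; push_cast; ring
    rw [this]; ring
  rw [e, ENNReal.ofReal_mul hρ.le] at avg
  exact (ENNReal.mul_le_mul_iff_right (by simpa using hρ) ENNReal.ofReal_ne_top).1 avg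

lemma dB_rpow_meas (Ω : Set E3) (s : ℝ) : Measurable fun y => ENNReal.ofReal (dB Ω y ^ s) := by
  have := (dB_cont Ω).measurable
  fun_prop

lemma star_small (hΩ : IsLipschitzDomain Ω) {a : ℝ} (ha : 0 ≤ a) (ha1 : a < 1) :
    ∃ δ > 0, ∀ x ρ, 0 < ρ → ρ ≤ δ →
    ∫⁻ y in Metric.ball x ρ, ENNReal.ofReal (dB Ω y ^ (-a)) ≤
      ENNReal.ofReal (16 * kap * (1 + 2 / (1 - a)) * ρ ^ (3 - a)) := by
  have H := fun P : frontier Ω => local_star hΩ ha ha1 P.2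
  choose δ hδ H using H
  obtain ⟨δ₀, hδ₀, hL⟩ := lebesgue_number_lemma_of_metric (fr_compact hΩ)
    (c := fun P : frontier Ω => Metric.ball (P:E3) (δ P)) (fun P => Metric.isOpen_ball)
    (fun P hP => Set.mem_iUnion.2 ⟨⟨P, hP⟩, Metric.mem_ball_self (hδ _)⟩)
  refine ⟨δ₀ / 4, by positivity, fun x ρ hρ hρ2 => ?_⟩
  rcases le_or_gt (2 * ρ) (dB Ω x) with h | h
  · have h1a : 0 < 1 - a := by linarith
    calc ∫⁻ y in Metric.ball x ρ, ENNReal.ofReal (dB Ω y ^ (-a))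
        ≤ ∫⁻ y in Metric.ball x ρ, ENNReal.ofReal (ρ ^ (-a)) := by
          refine setLIntegral_mono measurable_const fun y hy => ENNReal.ofReal_le_ofReal ?_
          apply rpow_neg_anti ha hρ
          rw [Metric.mem_ball, dist_comm] at hy
          linarith [dB_lip Ω x y]
      _ = ENNReal.ofReal (ρ ^ (-a) * (kap * ρ ^ 3)) := by
          rw [setLIntegral_const, vol_ball x hρ.le, ← ENNReal.ofReal_mul (by positivity)]
      _ ≤ _ := by
          apply ENNReal.ofReal_le_ofReal
          have e : ρ ^ (3 - a) = ρ ^ (-a) * ρ ^ 3 := by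
            rw [← Real.rpow_natCast, ← Real.rpow_add hρ]; congr 1; push_cast; ring
          rw [e]
          have hk := kap_pos
          have : 0 < 2 / (1 - a) := by positivity
          have h3 : 0 < ρ ^ (-a) * ρ ^ 3 * kap := by positivity
          nlinarith [mul_pos h3 this]
  · obtain ⟨P, hP, hPd⟩ := dB_near hΩ x
    obtain ⟨Q, hQ⟩ := hL P hP
    refine H Q x ρ hρ (fun y hy => hQ ?_)
    rw [Metric.mem_ball] at hy ⊢
    have := dist_triangle y x P
    linarith

lemma star (hΩ : IsLipschitzDomain Ω) {a : ℝ} (ha : 0 ≤ a) (ha1 : a < 1) :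
    ∃ C > 0, ∀ x ρ, 0 < ρ →
    ∫⁻ y in Metric.ball x ρ ∩ Ω, ENNReal.ofReal (dB Ω y ^ (-a)) ≤
      ENNReal.ofReal (C * ρ ^ (3 - a)) := by
  obtain ⟨δ, hδ, H⟩ := star_small hΩ ha ha1
  have tot : ∫⁻ y in Ω, ENNReal.ofReal (dB Ω y ^ (-a)) < ∞ := by
    obtain ⟨t, -, htf, hts⟩ := (hΩ.isBounded.isCompact_closure).finite_cover_balls hδ
    calc ∫⁻ y in Ω, ENNReal.ofReal (dB Ω y ^ (-a))
        ≤ ∫⁻ y in ⋃ x : htf.toFinset, Metric.ball (x:E3) δ, ENNReal.ofReal (dB Ω y ^ (-a)) := by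
          apply lintegral_mono_set
          intro y hy
          simpa using hts (subset_closure hy)
      _ ≤ ∑' x : htf.toFinset, ∫⁻ y in Metric.ball (x:E3) δ, ENNReal.ofReal (dB Ω y ^ (-a)) :=
          lintegral_iUnion_le _ _
      _ < ∞ := by
          rw [tsum_fintype]
          exact ENNReal.sum_lt_top.2 fun x _ => (H x δ hδ le_rfl).trans_lt ENNReal.ofReal_lt_top
  set T := (∫⁻ y in Ω, ENNReal.ofReal (dB Ω y ^ (-a))).toReal with hT
  set K := 16 * kap * (1 + 2 / (1 - a)) with hK
  have hk := kap_pos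
  have h1a : 0 < 1 - a := by linarith
  have hK0 : 0 < K := by positivity
  have hT0 : 0 ≤ T := ENNReal.toReal_nonneg
  refine ⟨K + T * δ ^ (-(3 - a)), by positivity, fun x ρ hρ => ?_⟩
  rcases le_or_gt ρ δ with h | h
  · refine ((lintegral_mono_set Set.inter_subset_left).trans (H x ρ hρ h)).trans
      (ENNReal.ofReal_le_ofReal ?_)
    gcongr
    have : 0 ≤ T * δ ^ (-(3 - a)) := by positivity
    linarith
  · refine (lintegral_mono_set Set.inter_subset_right).trans ?_
    rw [← ENNReal.ofReal_toReal tot.ne, ← hT]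
    apply ENNReal.ofReal_le_ofReal
    have h3 : 1 ≤ δ ^ (-(3 - a)) * ρ ^ (3 - a) := by
      rw [Real.rpow_neg hδ.le, ← div_eq_inv_mul, one_le_div (by positivity)]
      exact Real.rpow_le_rpow hδ.le h.le (by linarith)
    have h4 : 0 < K * ρ ^ (3 - a) := by positivity
    nlinarith
end
end

section
/-! ### Kernel estimates -/

lemma lint_Ioi {e c : ℝ} (he : e < -1) (hc : 0 < c) :
    ∫⁻ t in Set.Ioi c, ENNReal.ofReal (t ^ e) = ENNReal.ofReal (c ^ (e + 1) / (-(e + 1))) := by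
  rw [← ofReal_integral_eq_lintegral_ofReal (integrableOn_Ioi_rpow_of_lt he hc)]
  · rw [integral_Ioi_rpow_of_lt he hc]; congr 1; rw [div_neg, neg_div]
  · filter_upwards [ae_restrict_mem measurableSet_Ioi] with t ht
    exact Real.rpow_nonneg (hc.le.trans ht.le) _

lemma lint_Ioc {e c : ℝ} (he : -1 < e) (hc : 0 < c) :
    ∫⁻ t in Set.Ioc 0 c, ENNReal.ofReal (t ^ e) = ENNReal.ofReal (c ^ (e + 1) / (e + 1)) := by
  have hi : IntegrableOn (fun t : ℝ => t ^ e) (Set.Ioc 0 c) := by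
    have := intervalIntegral.intervalIntegrable_rpow' (a := 0) (b := c) (r := e) he
    rwa [intervalIntegrable_iff_integrableOn_Ioc_of_le hc.le] at this
  rw [← ofReal_integral_eq_lintegral_ofReal hi]
  · rw [← intervalIntegral.integral_of_le hc.le, integral_rpow (Or.inl he)]
    rw [Real.zero_rpow (by linarith), sub_zero]
  · filter_upwards [ae_restrict_mem measurableSet_Ioc] with t ht
    exact Real.rpow_nonneg ht.1.le _

lemma layer (μ : Measure E3) [SFinite μ] (x : E3) {s : ℝ} (hs : 0 < s) :
    ∫⁻ y, ENNReal.ofReal (dist x y ^ (-s)) ∂μ ≤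
      ∫⁻ t in Set.Ioi 0, ENNReal.ofReal (s * t ^ (-s - 1)) * μ (Metric.ball x t) := by
  have pw : ∀ y, ENNReal.ofReal (dist x y ^ (-s)) ≤ ∫⁻ t in Set.Ioi (0:ℝ),
      ENNReal.ofReal (s * t ^ (-s - 1)) * (Set.indicator {p : E3 × ℝ | dist p.1 x < p.2} 1 (y, t)) := by
    intro y
    rcases eq_or_ne x y with rfl | hxy
    · rw [dist_self, Real.zero_rpow (by linarith)]; simp
    have hd : 0 < dist x y := dist_pos.2 hxy
    calc ENNReal.ofReal (dist x y ^ (-s))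
        = ENNReal.ofReal s * ∫⁻ t in Set.Ioi (dist x y), ENNReal.ofReal (t ^ (-s - 1)) := by
          rw [lint_Ioi (by linarith) hd, ← ENNReal.ofReal_mul hs.le]
          congr 1; rw [show -s - 1 + 1 = -s by ring]; field_simp
      _ = ∫⁻ t in Set.Ioi (dist x y), ENNReal.ofReal (s * t ^ (-s - 1)) *
          (Set.indicator {p : E3 × ℝ | dist p.1 x < p.2} 1 (y, t)) := by
          rw [← lintegral_const_mul _ (by fun_prop)]
          refine setLIntegral_congr_fun measurableSet_Ioi fun t ht => ?_
          have : (y, t) ∈ {p : E3 × ℝ | dist p.1 x < p.2} := by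
            show dist y x < t
            rw [dist_comm]; exact ht
          simp only [Set.indicator_of_mem this, ENNReal.ofReal_mul hs.le, Pi.one_apply, mul_one]
      _ ≤ _ := lintegral_mono_set (Set.Ioi_subset_Ioi hd.le)
  have hms : MeasurableSet {p : E3 × ℝ | dist p.1 x < p.2} :=
    measurableSet_lt (by fun_prop) (by fun_prop)
  have hm : Measurable (Set.indicator {p : E3 × ℝ | dist p.1 x < p.2} (1 : E3 × ℝ → ℝ≥0∞)) :=
    measurable_one.indicator hms
  calc _ ≤ ∫⁻ y, (∫⁻ t in Set.Ioi (0:ℝ),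
      ENNReal.ofReal (s * t ^ (-s - 1)) *
        (Set.indicator {p : E3 × ℝ | dist p.1 x < p.2} 1 (y, t))) ∂μ := lintegral_mono pw
    _ = ∫⁻ t in Set.Ioi (0:ℝ), ∫⁻ y,
      ENNReal.ofReal (s * t ^ (-s - 1)) *
        (Set.indicator {p : E3 × ℝ | dist p.1 x < p.2} 1 (y, t)) ∂μ := by
        apply lintegral_lintegral_swap
        apply Measurable.aemeasurable
        have h2 : Measurable fun p : E3 × ℝ => ENNReal.ofReal (s * p.2 ^ (-s - 1)) := by fun_prop
        exact h2.mul hm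
    _ = _ := by
        refine lintegral_congr fun t => ?_
        have hm2 : Measurable fun y : E3 =>
            (Set.indicator {p : E3 × ℝ | dist p.1 x < p.2} (1 : E3 × ℝ → ℝ≥0∞)) (y, t) :=
          hm.comp (by fun_prop)
        rw [lintegral_const_mul _ hm2]
        congr 1
        rw [← lintegral_indicator_one Metric.isOpen_ball.measurableSet]
        rfl

lemma layer_inner (μ : Measure E3) [SFinite μ] (x : E3) {s m C ρ : ℝ} (hs : 0 < s) (hm : s < m)
    (hC : 0 ≤ C) (hρ : 0 < ρ) (h1 : ∀ t, 0 < t → μ (Metric.ball x t) ≤ ENNReal.ofReal (C * t ^ m))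
    (h2 : μ Set.univ ≤ ENNReal.ofReal (C * ρ ^ m)) :
    ∫⁻ y, ENNReal.ofReal (dist x y ^ (-s)) ∂μ ≤ ENNReal.ofReal (C * (m / (m - s)) * ρ ^ (m - s)) := by
  refine (layer μ x hs).trans ?_
  have hms : 0 < m - s := by linarith
  rw [← Set.Ioc_union_Ioi_eq_Ioi hρ.le, lintegral_union measurableSet_Ioi
    (Set.Ioc_disjoint_Ioi le_rfl)]
  have a1 : ∫⁻ t in Set.Ioc 0 ρ, ENNReal.ofReal (s * t ^ (-s - 1)) * μ (Metric.ball x t) ≤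
      ENNReal.ofReal (s * C * (ρ ^ (m - s) / (m - s))) := by
    calc _ ≤ ∫⁻ t in Set.Ioc 0 ρ, ENNReal.ofReal (s * C) * ENNReal.ofReal (t ^ (m - s - 1)) := by
          refine setLIntegral_mono' measurableSet_Ioc fun t ht => ?_
          refine (mul_le_mul_right (h1 t ht.1) _).trans_eq ?_
          have ht0 : 0 < t := ht.1
          rw [← ENNReal.ofReal_mul (by positivity), ← ENNReal.ofReal_mul (by positivity)]
          congr 1
          rw [show m - s - 1 = (-s - 1) + m by ring, Real.rpow_add ht0]; ring
      _ = _ := by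
          rw [lintegral_const_mul _ (by fun_prop), lint_Ioc (by linarith) hρ,
            ← ENNReal.ofReal_mul (by positivity)]
          congr 2; rw [show m - s - 1 + 1 = m - s by ring]
  have a2 : ∫⁻ t in Set.Ioi ρ, ENNReal.ofReal (s * t ^ (-s - 1)) * μ (Metric.ball x t) ≤
      ENNReal.ofReal (C * ρ ^ (m - s)) := by
    calc _ ≤ ∫⁻ t in Set.Ioi ρ, ENNReal.ofReal (s * (C * ρ ^ m)) * ENNReal.ofReal (t ^ (-s - 1)) := by
          refine setLIntegral_mono' measurableSet_Ioi fun t ht => ?_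
          refine (mul_le_mul_right ((measure_mono (Set.subset_univ _)).trans h2) _).trans_eq ?_
          have ht0 : 0 < t := hρ.trans ht
          rw [← ENNReal.ofReal_mul (by positivity), ← ENNReal.ofReal_mul (by positivity)]
          congr 1; ring
      _ = _ := by
          rw [lintegral_const_mul _ (by fun_prop), lint_Ioi (by linarith) hρ,
            ← ENNReal.ofReal_mul (by positivity)]
          congr 1
          rw [show -s - 1 + 1 = -s by ring, neg_neg, sub_eq_add_neg, Real.rpow_add hρ]
          field_simp
  refine (add_le_add a1 a2).trans_eq ?_
  rw [← ENNReal.ofReal_add (by positivity) (by positivity)]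
  congr 1; field_simp; ring

lemma layer_outer (μ : Measure E3) [SFinite μ] (x : E3) {s m C ρ : ℝ} (hs : 0 < s) (hm : m < s)
    (hC : 0 ≤ C) (hρ : 0 < ρ) (h1 : ∀ t, 0 < t → μ (Metric.ball x t) ≤ ENNReal.ofReal (C * t ^ m))
    (h2 : μ (Metric.ball x ρ) = 0) :
    ∫⁻ y, ENNReal.ofReal (dist x y ^ (-s)) ∂μ ≤ ENNReal.ofReal (C * (s / (s - m)) * ρ ^ (m - s)) := by
  refine (layer μ x hs).trans ?_
  have hms : 0 < s - m := by linarith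
  rw [← Set.Ioc_union_Ioi_eq_Ioi hρ.le, lintegral_union measurableSet_Ioi
    (Set.Ioc_disjoint_Ioi le_rfl)]
  have a1 : ∫⁻ t in Set.Ioc 0 ρ, ENNReal.ofReal (s * t ^ (-s - 1)) * μ (Metric.ball x t) = 0 := by
    rw [setLIntegral_congr_fun (g := fun _ => 0) measurableSet_Ioc, lintegral_zero]
    intro t ht
    have : μ (Metric.ball x t) = 0 := measure_mono_null (Metric.ball_subset_ball ht.2) h2
    simp [this]
  rw [a1, zero_add]
  calc _ ≤ ∫⁻ t in Set.Ioi ρ, ENNReal.ofReal (s * C) * ENNReal.ofReal (t ^ (m - s - 1)) := by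
        refine setLIntegral_mono' measurableSet_Ioi fun t ht => ?_
        have ht0 : 0 < t := hρ.trans ht
        refine (mul_le_mul_right (h1 t ht0) _).trans_eq ?_
        rw [← ENNReal.ofReal_mul (by positivity), ← ENNReal.ofReal_mul (by positivity)]
        congr 1
        rw [show m - s - 1 = (-s - 1) + m by ring, Real.rpow_add ht0]; ring
    _ = _ := by
        rw [lintegral_const_mul _ (by fun_prop), lint_Ioi (by linarith) hρ,
          ← ENNReal.ofReal_mul (by positivity)]
        congr 1
        rw [show m - s - 1 + 1 = m - s by ring, show -(m - s) = s - m by ring]; field_simp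

section
variable {Ω : Set E3}

lemma dist_rpow_meas (x : E3) (s : ℝ) : Measurable fun y => ENNReal.ofReal (dist x y ^ s) := by
  fun_prop

/-- inner kernel estimate -/
lemma ker_inner (hΩ : IsLipschitzDomain Ω) {a θ : ℝ} (ha : 0 ≤ a) (hθ : 0 ≤ θ) (h : θ + a < 1) :
    ∃ C > 0, ∀ x ρ, 0 < ρ →
    ∫⁻ y in Metric.ball x ρ ∩ Ω, ENNReal.ofReal (dist x y ^ (-(2 + θ))) *
      ENNReal.ofReal (dB Ω y ^ (-a)) ≤ ENNReal.ofReal (C * ρ ^ (1 - θ - a)) := by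
  obtain ⟨C, hC, H⟩ := star hΩ ha (by linarith)
  have h0 : 0 < 3 - a - (2 + θ) := by linarith
  have h1 : 0 < 3 - a := by linarith
  refine ⟨C * ((3 - a) / (3 - a - (2 + θ))), by positivity, fun x ρ hρ => ?_⟩
  have hms : MeasurableSet (Metric.ball x ρ ∩ Ω) :=
    Metric.isOpen_ball.measurableSet.inter hΩ.isOpen.measurableSet
  have := layer_inner ((volume.restrict (Metric.ball x ρ ∩ Ω)).withDensity
    fun y => ENNReal.ofReal (dB Ω y ^ (-a))) x (s := 2 + θ) (m := 3 - a) (C := C) (ρ := ρ)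
    (by linarith) (by linarith) hC.le hρ ?_ ?_
  · rw [lintegral_withDensity_eq_lintegral_mul _ (dB_rpow_meas _ _) (dist_rpow_meas _ _)] at this
    refine (le_of_eq (lintegral_congr fun y => ?_)).trans (this.trans_eq ?_)
    · simp only [Pi.mul_apply]; rw [mul_comm]
    · congr 3; ring
  · intro t ht
    rw [withDensity_apply _ Metric.isOpen_ball.measurableSet,
      Measure.restrict_restrict Metric.isOpen_ball.measurableSet]
    refine (lintegral_mono_set ?_).trans (H x t ht)
    exact fun y hy => ⟨hy.1, hy.2.2⟩
  · rw [withDensity_apply _ MeasurableSet.univ, Measure.restrict_univ]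
    exact H x ρ hρ

/-- outer kernel estimate -/
lemma ker_outer (hΩ : IsLipschitzDomain Ω) {a : ℝ} (ha : 0 < a) (ha1 : a < 1) :
    ∃ C > 0, ∀ x ρ, 0 < ρ →
    ∫⁻ y in (Metric.ball x ρ)ᶜ ∩ Ω, ENNReal.ofReal (dist x y ^ (-3:ℝ)) *
      ENNReal.ofReal (dB Ω y ^ (-a)) ≤ ENNReal.ofReal (C * ρ ^ (-a)) := by
  obtain ⟨C, hC, H⟩ := star hΩ ha.le ha1
  refine ⟨C * (3 / (3 - (3 - a))), mul_pos hC (div_pos (by norm_num) (by linarith)), fun x ρ hρ => ?_⟩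
  have hb := (Metric.isOpen_ball (x := x) (ε := ρ)).measurableSet
  have hms : MeasurableSet ((Metric.ball x ρ)ᶜ ∩ Ω) := hb.compl.inter hΩ.isOpen.measurableSet
  have := layer_outer ((volume.restrict ((Metric.ball x ρ)ᶜ ∩ Ω)).withDensity
    fun y => ENNReal.ofReal (dB Ω y ^ (-a))) x (s := 3) (m := 3 - a) (C := C) (ρ := ρ)
    (by linarith) (by linarith) hC.le hρ ?_ ?_
  · rw [lintegral_withDensity_eq_lintegral_mul _ (dB_rpow_meas _ _) (dist_rpow_meas _ _)] at this
    refine (le_of_eq (lintegral_congr fun y => ?_)).trans (this.trans_eq ?_)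
    · simp only [Pi.mul_apply]; rw [mul_comm]
    · congr 3; ring
  · intro t ht
    rw [withDensity_apply _ Metric.isOpen_ball.measurableSet,
      Measure.restrict_restrict Metric.isOpen_ball.measurableSet]
    refine (lintegral_mono_set ?_).trans (H x t ht)
    exact fun y hy => ⟨hy.1, hy.2.2⟩
  · rw [withDensity_apply _ hb, Measure.restrict_restrict hb, ← Set.inter_assoc,
      Set.inter_compl_self, Set.empty_inter, Measure.restrict_empty, lintegral_zero_measure]

end
end

section
/-! ### Regularised Biot-Savart kernel -/

def Ak (ε : ℝ) (z : E3) : ℝ := √(‖z‖ ^ 2 + ε ^ 2)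

def Kk (ε : ℝ) (i : Fin 3) (z : E3) : ℝ := z i / Ak ε z ^ 3

def DK (ε : ℝ) (i k : Fin 3) (z : E3) : ℝ :=
  (if i = k then 1 else 0) / Ak ε z ^ 3 - 3 * z i * z k / Ak ε z ^ 5

variable {ε : ℝ}

lemma Ak_sq (ε : ℝ) (z : E3) : Ak ε z ^ 2 = ‖z‖ ^ 2 + ε ^ 2 := Real.sq_sqrt (by positivity)

lemma Ak_pos (hε : 0 < ε) (z : E3) : 0 < Ak ε z := Real.sqrt_pos.2 (by positivity)

lemma Ak_ge (ε : ℝ) (z : E3) : ‖z‖ ≤ Ak ε z := Real.le_sqrt_of_sq_le (by nlinarith [sq_nonneg ε])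

lemma Ak_ge' (_hε : 0 < ε) (z : E3) : ε ≤ Ak ε z := Real.le_sqrt_of_sq_le (by nlinarith [sq_nonneg ‖z‖])

lemma Ak_cont (ε : ℝ) : Continuous (Ak ε) := by unfold Ak; fun_prop

lemma Kk_cont (hε : 0 < ε) (i : Fin 3) : Continuous (Kk ε i) := by
  unfold Kk
  exact Continuous.div (by fun_prop) ((Ak_cont ε).pow 3) fun z => (pow_pos (Ak_pos hε z) 3).ne'

lemma DK_cont (hε : 0 < ε) (i k : Fin 3) : Continuous (DK ε i k) := by
  unfold DK
  exact (Continuous.div (by fun_prop) ((Ak_cont ε).pow 3) fun z => (pow_pos (Ak_pos hε z) 3).ne').sub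
    (Continuous.div (by fun_prop) ((Ak_cont ε).pow 5) fun z => (pow_pos (Ak_pos hε z) 5).ne')

lemma Kk_diff (hε : 0 < ε) (i : Fin 3) : Differentiable ℝ (Kk ε i) := by
  have hA : Differentiable ℝ (Ak ε) := by
    intro z
    unfold Ak
    refine DifferentiableAt.sqrt ?_ (by positivity)
    exact ((contDiff_norm_sq ℝ (n := 1)).differentiable (by simp) z).add (differentiableAt_const _)
  have : Kk ε i = fun z => z i * (Ak ε z ^ 3)⁻¹ := by funext z; rw [Kk, div_eq_mul_inv]
  rw [this]
  have h1 : Differentiable ℝ fun z : E3 => z i := by fun_prop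
  exact h1.mul ((hA.pow 3).inv fun z => (pow_pos (Ak_pos hε z) 3).ne')

lemma Kk_pds (hε : 0 < ε) (i k : Fin 3) (z : E3) : pds (Kk ε i) k z = DK ε i k z := by
  apply pds_of_line (Kk_diff hε i z)
  have hA := Ak_pos hε z
  have e1 : ∀ t : ℝ, Ak ε (z + t • ee k) = √(‖z‖ ^ 2 + 2 * t * z k + t ^ 2 + ε ^ 2) := fun t => by
    unfold Ak
    rw [norm_add_sq_real, norm_smul, ee_norm, real_inner_smul_right]
    congr 1
    simp only [ee, EuclideanSpace.inner_single_right, Real.norm_eq_abs, mul_one, sq_abs]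
    simp; ring
  have e2 : ∀ t : ℝ, (z + t • ee k) i = z i + t * (if i = k then 1 else 0) := fun t => by
    simp [ee, Pi.single_apply]
  have hq : HasDerivAt (fun t : ℝ => ‖z‖ ^ 2 + 2 * t * z k + t ^ 2 + ε ^ 2) (2 * z k) 0 := by
    have := ((((hasDerivAt_id (0:ℝ)).const_mul 2).mul_const (z k)).const_add (‖z‖ ^ 2)).add
      ((hasDerivAt_id (0:ℝ)).pow 2)
    have := this.add_const (ε ^ 2)
    exact this.congr_deriv (by simp)
  have hpos : 0 < ‖z‖ ^ 2 + ε ^ 2 := by positivity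
  have hs := hq.sqrt (by simp; positivity)
  have hn : HasDerivAt (fun t : ℝ => z i + t * (if i = k then 1 else 0)) (if i = k then 1 else 0) 0 := by
    have := ((hasDerivAt_id (0:ℝ)).mul_const (if i = k then (1:ℝ) else 0)).const_add (z i)
    simpa using this
  have hA0 : √(‖z‖ ^ 2 + 2 * 0 * z k + 0 ^ 2 + ε ^ 2) = Ak ε z := by
    unfold Ak; congr 1; ring
  have hd := hn.fun_div (hs.fun_pow 3) (by rw [hA0]; positivity)
  simp only [hA0] at hd
  have : (fun t : ℝ => Kk ε i (z + t • ee k)) = fun t => (z i + t * (if i = k then 1 else 0)) /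
      (√(‖z‖ ^ 2 + 2 * t * z k + t ^ 2 + ε ^ 2)) ^ 3 := by
    funext t; rw [Kk, e1, e2]
  rw [this]
  refine hd.congr_deriv ?_
  unfold DK
  generalize (if i = k then (1:ℝ) else 0) = e
  field_simp
  norm_num
  ring

lemma DK_symm (i k : Fin 3) (z : E3) : DK ε i k z = DK ε k i z := by
  unfold DK
  simp only [eq_comm (a := i)]
  ring

lemma norm_sq3 (z : E3) : ‖z‖ ^ 2 = z 0 ^ 2 + z 1 ^ 2 + z 2 ^ 2 := by
  rw [EuclideanSpace.norm_sq_eq, Fin.sum_univ_three]; simp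

lemma DK_trace (hε : 0 < ε) (z : E3) : ∑ i, DK ε i i z = 3 * ε ^ 2 / Ak ε z ^ 5 := by
  have hA := Ak_pos hε z
  have h2 := Ak_sq ε z
  rw [norm_sq3] at h2
  simp only [DK, Fin.sum_univ_three, if_true]
  field_simp
  linear_combination 3 * h2

lemma DK_bound (hε : 0 < ε) (i k : Fin 3) (z : E3) : |DK ε i k z| ≤ 4 / ε ^ 3 := by
  have hA := Ak_pos hε z
  have hA1 := Ak_ge ε z
  have hA2 := Ak_ge' hε z
  have h1 : |(if i = k then (1:ℝ) else 0) / Ak ε z ^ 3| ≤ 1 / Ak ε z ^ 3 := by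
    rw [abs_div, abs_of_pos (pow_pos hA 3)]
    gcongr
    split_ifs <;> simp
  have h2 : |3 * z i * z k / Ak ε z ^ 5| ≤ 3 / Ak ε z ^ 3 := by
    rw [abs_div, abs_of_pos (pow_pos hA 5), div_le_div_iff₀ (by positivity) (by positivity),
      abs_mul, abs_mul, abs_of_pos (by norm_num : (0:ℝ) < 3)]
    have i1 := (coord_le z i).trans hA1
    have i2 := (coord_le z k).trans hA1
    calc 3 * |z i| * |z k| * Ak ε z ^ 3 ≤ 3 * Ak ε z * Ak ε z * Ak ε z ^ 3 := by gcongr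
      _ = _ := by ring
  calc |DK ε i k z| ≤ 1 / Ak ε z ^ 3 + 3 / Ak ε z ^ 3 := (abs_sub _ _).trans (add_le_add h1 h2)
    _ = 4 / Ak ε z ^ 3 := by ring
    _ ≤ _ := by gcongr

lemma Kk_bound (hε : 0 < ε) (i : Fin 3) (z : E3) : |Kk ε i z| ≤ 1 / ε ^ 2 := by
  have hA := Ak_pos hε z
  have hA1 := Ak_ge ε z
  have hA2 := Ak_ge' hε z
  rw [Kk, abs_div, abs_of_pos (pow_pos hA 3), div_le_div_iff₀ (by positivity) (by positivity)]
  calc |z i| * ε ^ 2 ≤ Ak ε z * Ak ε z ^ 2 := by gcongr; exact (coord_le z i).trans hA1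
    _ = _ := by ring

lemma Kk_bound2 (hε : 0 < ε) (i : Fin 3) {z : E3} (hz : z ≠ 0) : |Kk ε i z| ≤ 1 / ‖z‖ ^ 2 := by
  have hA := Ak_pos hε z
  have hA1 := Ak_ge ε z
  have hz' : 0 < ‖z‖ := norm_pos_iff.2 hz
  rw [Kk, abs_div, abs_of_pos (pow_pos hA 3), div_le_div_iff₀ (by positivity) (by positivity)]
  calc |z i| * ‖z‖ ^ 2 ≤ Ak ε z * Ak ε z ^ 2 := by gcongr; exact (coord_le z i).trans hA1
    _ = _ := by ring

lemma Ak_lip (hε : 0 < ε) (a b : E3) : |Ak ε a - Ak ε b| ≤ ‖a - b‖ := by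
  have ha := Ak_pos hε a
  have hb := Ak_pos hε b
  have h1 := Ak_sq ε a
  have h2 := Ak_sq ε b
  have h3 : (Ak ε a - Ak ε b) * (Ak ε a + Ak ε b) = (‖a‖ - ‖b‖) * (‖a‖ + ‖b‖) := by linarith
  have h4 : |Ak ε a - Ak ε b| * (Ak ε a + Ak ε b) = |‖a‖ - ‖b‖| * (‖a‖ + ‖b‖) := by
    rw [← abs_of_pos (add_pos ha hb), ← abs_mul, h3, abs_mul,
      abs_of_nonneg (show 0 ≤ ‖a‖ + ‖b‖ by positivity)]
  have h5 := abs_norm_sub_norm_le a b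
  have h6 : |Ak ε a - Ak ε b| * (Ak ε a + Ak ε b) ≤ ‖a - b‖ * (Ak ε a + Ak ε b) := by
    rw [h4]
    gcongr
    · exact Ak_ge _ _
    · exact Ak_ge _ _
  exact le_of_mul_le_mul_right h6 (by positivity)

lemma Kk_alg {x y A B D : ℝ} (hA : 0 < A) (hB : 0 < B) (hxy : |x - y| ≤ D) (hy : |y| ≤ B)
    (hAB : |A - B| ≤ D) :
    |x / A ^ 3 - y / B ^ 3| ≤ D * (2 / A ^ 3 + 1 / (A ^ 2 * B) + 1 / (A * B ^ 2)) := by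
  have hD : 0 ≤ D := (abs_nonneg _).trans hxy
  have e : x / A ^ 3 - y / B ^ 3 = (x - y) / A ^ 3 -
      y * ((A - B) * ((A ^ 2 + A * B + B ^ 2) / (A ^ 3 * B ^ 3))) := by
    field_simp; ring
  rw [e]
  have h0 : 0 < (A ^ 2 + A * B + B ^ 2) / (A ^ 3 * B ^ 3) := by positivity
  calc _ ≤ |x - y| / A ^ 3 + |y| * (|A - B| * ((A ^ 2 + A * B + B ^ 2) / (A ^ 3 * B ^ 3))) := by
        refine (abs_sub _ _).trans (le_of_eq ?_)
        rw [abs_div, abs_mul, abs_mul, abs_of_pos h0, abs_of_pos (pow_pos hA 3)]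
    _ ≤ D / A ^ 3 + B * (D * ((A ^ 2 + A * B + B ^ 2) / (A ^ 3 * B ^ 3))) := by gcongr
    _ = _ := by field_simp; ring

lemma Kk_lip (hε : 0 < ε) (i : Fin 3) (a b : E3) : |Kk ε i a - Kk ε i b| ≤ 4 / ε ^ 3 * ‖a - b‖ := by
  have hA := Ak_pos hε a
  have hB := Ak_pos hε b
  have hA2 := Ak_ge' hε a
  have hB2 := Ak_ge' hε b
  have := Kk_alg hA hB (coord_le (a - b) i) ((coord_le b i).trans (Ak_ge ε b)) (Ak_lip hε a b)
  refine this.trans ?_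
  calc _ ≤ ‖a - b‖ * (2 / ε ^ 3 + 1 / (ε ^ 2 * ε) + 1 / (ε * ε ^ 2)) := by gcongr
    _ = _ := by field_simp; ring

lemma Kk_far (hε : 0 < ε) (i : Fin 3) {a b : E3} (hb : b ≠ 0) (h : 2 * ‖a - b‖ ≤ ‖b‖) :
    |Kk ε i a - Kk ε i b| ≤ 22 * (‖a - b‖ / ‖b‖ ^ 3) := by
  have hA := Ak_pos hε a
  have hB := Ak_pos hε b
  have hb0 : 0 < ‖b‖ := norm_pos_iff.2 hb
  have hA2 : ‖b‖ / 2 ≤ Ak ε a := by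
    have h1 := Ak_ge ε a
    have := norm_sub_norm_le b a
    rw [norm_sub_rev] at this
    linarith
  have hB2 := Ak_ge ε b
  have := Kk_alg hA hB (coord_le (a - b) i) ((coord_le b i).trans (Ak_ge ε b)) (Ak_lip hε a b)
  refine this.trans ?_
  calc _ ≤ ‖a - b‖ * (2 / (‖b‖ / 2) ^ 3 + 1 / ((‖b‖ / 2) ^ 2 * ‖b‖) + 1 / ((‖b‖ / 2) * ‖b‖ ^ 2)) := by
        gcongr
    _ = _ := by field_simp; ring

lemma Kk_eps {ε' : ℝ} (hε' : 0 < ε') (h : ε' ≤ ε) (i : Fin 3) {z : E3} (hz : z ≠ 0) {θ : ℝ}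
    (hθ : 0 ≤ θ) (hθ1 : θ ≤ 1) :
    |Kk ε i z - Kk ε' i z| ≤ 4 * ε ^ θ * ‖z‖ ^ (-(2 + θ)) := by
  have hε : 0 < ε := hε'.trans_le h
  have hz0 : 0 < ‖z‖ := norm_pos_iff.2 hz
  have hA := Ak_pos hε z
  have hB := Ak_pos hε' z
  have hA1 := Ak_ge ε z
  have hB1 := Ak_ge ε' z
  have hAB : |Ak ε z - Ak ε' z| ≤ ε := by
    have h1 := Ak_sq ε z
    have h2 := Ak_sq ε' z
    rw [abs_le]; constructor <;> nlinarith
  have b1 : |Kk ε i z - Kk ε' i z| ≤ 4 * (ε / ‖z‖ ^ 3) := by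
    have := Kk_alg (x := z i) (y := z i) hA hB (D := ε) (by simpa using hε.le) ((coord_le z i).trans hB1) hAB
    refine this.trans ?_
    calc _ ≤ ε * (2 / ‖z‖ ^ 3 + 1 / (‖z‖ ^ 2 * ‖z‖) + 1 / (‖z‖ * ‖z‖ ^ 2)) := by gcongr
      _ = _ := by field_simp; ring
  have b2 : |Kk ε i z - Kk ε' i z| ≤ 2 * (1 / ‖z‖ ^ 2) := by
    have := abs_sub (Kk ε i z) (Kk ε' i z)
    linarith [Kk_bound2 hε i hz, Kk_bound2 hε' i hz]
  have e2 : 4 * ε ^ θ * ‖z‖ ^ (-(2 + θ)) = 4 * ((1 / ‖z‖ ^ 2) * (ε / ‖z‖) ^ θ) := by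
    rw [neg_add, Real.rpow_add hz0, Real.rpow_neg hz0.le, Real.rpow_neg hz0.le,
      Real.div_rpow hε.le hz0.le, Real.rpow_two]
    field_simp
  rw [e2]
  rcases le_total ε ‖z‖ with hc | hc
  · refine b1.trans ?_
    have : ε / ‖z‖ ≤ (ε / ‖z‖) ^ θ := by
      have := Real.rpow_le_rpow_of_exponent_ge (x := ε / ‖z‖) (by positivity)
        ((div_le_one hz0).2 hc) hθ1
      simpa using this
    calc 4 * (ε / ‖z‖ ^ 3) = 4 * ((1 / ‖z‖ ^ 2) * (ε / ‖z‖)) := by field_simp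
      _ ≤ _ := by gcongr
  · refine b2.trans ?_
    have : 1 ≤ (ε / ‖z‖) ^ θ := Real.one_le_rpow ((one_le_div hz0).2 hc) hθ
    have h3 : 0 < 1 / ‖z‖ ^ 2 := by positivity
    nlinarith
end

section
/-! ### Biot-Savart representation -/

/-- antisymmetric part of the gradient -/
def qq (V : Fin 3 → E3 → ℝ) (i j : Fin 3) (x : E3) : ℝ := pds (V j) i x - pds (V i) j x

def QQ (V : Fin 3 → E3 → ℝ) (x : E3) : ℝ := ∑ i, ∑ j, |qq V i j x|

/-- regularised Biot-Savart operator -/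
def BSe (V : Fin 3 → E3 → ℝ) (ε : ℝ) (j : Fin 3) (x : E3) : ℝ :=
  ∫ y, ∑ i, qq V i j y * Kk ε i (x - y)

def mK : ℝ := ∫ z : E3, 3 / Ak 1 z ^ 5

lemma mK_int : Integrable fun z : E3 => 3 / Ak 1 z ^ 5 := by
  have h := (integrable_rpow_neg_one_add_norm_sq (E := E3) (μ := volume) (r := 5)
    (by simp; norm_num)).const_mul 3
  refine h.congr (Eventually.of_forall fun z => ?_)
  have h0 : (0:ℝ) < 1 + ‖z‖ ^ 2 := by positivity
  simp only [Ak]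
  rw [neg_div, Real.rpow_neg h0.le, one_pow, add_comm (‖z‖ ^ 2), div_eq_mul_inv, Real.sqrt_eq_rpow,
    ← Real.rpow_mul_natCast h0.le]
  norm_num [div_eq_mul_inv]

lemma mK_pos : 0 < mK := by
  unfold mK
  rw [integral_pos_iff_support_of_nonneg]
  · have : Function.support (fun z : E3 => 3 / Ak 1 z ^ 5) = Set.univ := by
      ext z; simp [(Ak_pos one_pos z).ne']
    rw [this]; simp
  · intro z; have := Ak_pos one_pos z; positivity
  · exact mK_int

lemma CC.mul_bdd {f g : E3 → ℝ} (hf : CC f) (hg : Continuous g) : Integrable fun y => f y * g y :=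
  (hf.cont.mul hg).integrable_of_hasCompactSupport hf.cs.mul_right

lemma bs_ibp {f : E3 → ℝ} {ε : ℝ} (hf : CC f) (hε : 0 < ε) (i k : Fin 3) (x : E3) :
    ∫ y, f y * DK ε i k (x - y) = ∫ y, pds f k y * Kk ε i (x - y) := by
  have hg : ∀ y, HasFDerivAt (fun y => Kk ε i (x - y)) (-(fderiv ℝ (Kk ε i) (x - y))) y := by
    intro y
    have h1 : HasFDerivAt (fun y : E3 => x - y) (-(ContinuousLinearMap.id ℝ E3)) y := by
      simpa using (hasFDerivAt_id y).const_sub x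
    have := ((Kk_diff hε i (x - y)).hasFDerivAt).comp y h1
    refine this.congr_fderiv ?_
    ext z; simp
  have hgd : ∀ y, fderiv ℝ (fun y => Kk ε i (x - y)) y (ee k) = - DK ε i k (x - y) := fun y => by
    rw [(hg y).fderiv, ContinuousLinearMap.neg_apply, ← Kk_pds hε]; rfl
  have hc1 : Continuous fun y : E3 => Kk ε i (x - y) := (Kk_cont hε i).comp (by fun_prop)
  have hc2 : Continuous fun y : E3 => -DK ε i k (x - y) :=
    ((DK_cont hε i k).comp (by fun_prop)).neg
  have := integral_mul_fderiv_eq_neg_fderiv_mul_of_integrable (μ := (volume : Measure E3))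
    (f := f) (g := fun y => Kk ε i (x - y)) (v := ee k) ?_ ?_ ?_ (fun x _ => hf.diff x)
    (fun y _ => (hg y).differentiableAt)
  · simp only [hgd, mul_neg, integral_neg, neg_inj] at this
    exact this
  · exact (hf.pds k).mul_bdd hc1
  · simp only [hgd]; exact hf.mul_bdd hc2
  · exact hf.mul_bdd hc1

variable {V : Fin 3 → E3 → ℝ}

lemma qq_cc (hV : ∀ j, CC (V j)) (i j : Fin 3) : CC (qq V i j) :=
  ((hV j).pds i).sub ((hV i).pds j)

lemma isum3 {f : Fin 3 → E3 → ℝ} (hf : ∀ i, Integrable (f i)) :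
    ∫ y, ∑ i, f i y = ∑ i, ∫ y, f i y := integral_finset_sum _ fun i _ => hf i

lemma bs_id (hV : ∀ j, CC (V j)) (hdiv : ∀ x, ∑ i, pds (V i) i x = 0) {ε : ℝ} (hε : 0 < ε)
    (j : Fin 3) (x : E3) :
    ∫ y, V j y * (3 * ε ^ 2 / Ak ε (x - y) ^ 5) = BSe V ε j x := by
  have hc1 : ∀ i, Continuous fun y : E3 => Kk ε i (x - y) := fun i =>
    (Kk_cont hε i).comp (by fun_prop)
  have hc2 : ∀ i k, Continuous fun y : E3 => DK ε i k (x - y) := fun i k =>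
    (DK_cont hε i k).comp (by fun_prop)
  have e1 : ∫ y, V j y * (3 * ε ^ 2 / Ak ε (x - y) ^ 5) =
      ∑ i, ∫ y, pds (V j) i y * Kk ε i (x - y) := by
    simp only [← DK_trace hε, Finset.mul_sum]
    rw [isum3 fun i => (hV j).mul_bdd (hc2 i i)]
    exact Finset.sum_congr rfl fun i _ => bs_ibp (hV j) hε i i x
  have e2 : ∑ i, ∫ y, pds (V i) j y * Kk ε i (x - y) = 0 := by
    calc _ = ∑ i, ∫ y, pds (V i) i y * Kk ε j (x - y) := by
          refine Finset.sum_congr rfl fun i _ => ?_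
          rw [← bs_ibp (hV i) hε i j x, ← bs_ibp (hV i) hε j i x]
          simp only [DK_symm]
      _ = ∫ y, (∑ i, pds (V i) i y) * Kk ε j (x - y) := by
          rw [← isum3 fun i => ((hV i).pds i).mul_bdd (hc1 j)]
          simp only [Finset.sum_mul]
      _ = 0 := by simp [hdiv]
  rw [e1, ← sub_zero (∑ i, ∫ y, pds (V j) i y * Kk ε i (x - y)), ← e2, ← Finset.sum_sub_distrib,
    BSe, isum3 fun i => (qq_cc hV i j).mul_bdd (hc1 i)]
  refine Finset.sum_congr rfl fun i _ => ?_
  rw [← integral_sub (((hV j).pds i).mul_bdd (hc1 i)) (((hV i).pds j).mul_bdd (hc1 i))]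
  simp only [qq, sub_mul]

lemma bs_lim (hV : ∀ j, CC (V j)) (hdiv : ∀ x, ∑ i, pds (V i) i x = 0) (j : Fin 3) (x : E3) :
    Tendsto (fun c : ℝ => BSe V c⁻¹ j x) atTop (𝓝 (mK * V j x)) := by
  have hm := mK_pos
  have key := tendsto_integral_comp_smul_smul_of_integrable' (μ := (volume : Measure E3))
    (φ := fun z : E3 => 3 / Ak 1 z ^ 5 / mK) (fun z => by
      have := Ak_pos one_pos z; positivity) (by
      rw [integral_div, ← mK, div_self hm.ne']) ?_ (g := V j) (x₀ := x) (hV j).integrable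
      (hV j).cont.continuousAt
  · have := key.const_mul mK
    refine this.congr' ?_
    filter_upwards [eventually_gt_atTop 0] with c hc
    rw [← bs_id hV hdiv (inv_pos.2 hc), ← integral_const_mul]
    refine integral_congr_ae (Eventually.of_forall fun y => ?_)
    have hA : Ak 1 (c • (x - y)) = c * Ak c⁻¹ (x - y) := by
      unfold Ak
      rw [norm_smul, ← Real.sqrt_sq hc.le, ← Real.sqrt_mul (by positivity), Real.sqrt_sq hc.le]
      congr 1
      rw [Real.norm_of_nonneg hc.le]
      field_simp
    have hp := Ak_pos (inv_pos.2 hc) (x - y)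
    simp only [finrank_euclideanSpace, Fintype.card_fin, smul_eq_mul, hA]
    field_simp
  · simp only [finrank_euclideanSpace, Fintype.card_fin]
    have h1 : Tendsto (fun z : E3 => 3 / mK * (‖z‖ ^ 2)⁻¹) (cobounded E3) (𝓝 0) := by
      have : Tendsto (fun z : E3 => ‖z‖ ^ 2) (cobounded E3) atTop :=
        (tendsto_pow_atTop (by norm_num)).comp tendsto_norm_cobounded_atTop
      simpa using this.inv_tendsto_atTop.const_mul (3 / mK)
    refine squeeze_zero' (Eventually.of_forall fun z => ?_) ?_ h1
    · have := Ak_pos one_pos z; positivity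
    · have hne : ∀ᶠ z : E3 in cobounded E3, 0 < ‖z‖ :=
        tendsto_norm_cobounded_atTop.eventually_gt_atTop 0
      filter_upwards [hne] with z hz
      have hA := Ak_pos one_pos z
      have hA1 := Ak_ge 1 z
      calc ‖z‖ ^ 3 * (3 / Ak 1 z ^ 5 / mK) ≤ ‖z‖ ^ 3 * (3 / ‖z‖ ^ 5 / mK) := by gcongr
        _ = _ := by field_simp

/-- general bound principle -/
lemma bs_gen (hV : ∀ j, CC (V j)) (j : Fin 3) {κ : ℕ → Fin 3 → E3 → ℝ} {L : ℝ} {B : E3 → ℝ≥0∞}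
    (hlim : Tendsto (fun n => ∫ y, ∑ i, qq V i j y * κ n i y) atTop (𝓝 L))
    (hB : ∀ n i, ∀ᵐ y, ENNReal.ofReal |κ n i y| ≤ B y) :
    ENNReal.ofReal |L| ≤ ∫⁻ y, ENNReal.ofReal (QQ V y) * B y := by
  have h1 : Tendsto (fun n => ENNReal.ofReal |∫ y, ∑ i, qq V i j y * κ n i y|) atTop
      (𝓝 (ENNReal.ofReal |L|)) := ENNReal.tendsto_ofReal hlim.abs
  refine le_of_tendsto' h1 fun n => ?_
  rw [← Real.norm_eq_abs, ofReal_norm]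
  refine (enorm_integral_le_lintegral_enorm _).trans (lintegral_mono_ae ?_)
  filter_upwards [hB n 0, hB n 1, hB n 2] with y h0 h1 h2
  have h : ∀ i, ENNReal.ofReal |κ n i y| ≤ B y := fun i => by fin_cases i <;> assumption
  rw [← ofReal_norm]
  calc ENNReal.ofReal ‖∑ i, qq V i j y * κ n i y‖
      ≤ ENNReal.ofReal (∑ i, |qq V i j y| * |κ n i y|) := by
        apply ENNReal.ofReal_le_ofReal
        refine (norm_sum_le _ _).trans (le_of_eq ?_)
        simp only [Real.norm_eq_abs, abs_mul]
    _ = ∑ i, ENNReal.ofReal |qq V i j y| * ENNReal.ofReal |κ n i y| := by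
        rw [ENNReal.ofReal_sum_of_nonneg fun i _ => by positivity]
        exact Finset.sum_congr rfl fun i _ => ENNReal.ofReal_mul (abs_nonneg _)
    _ ≤ ∑ i, ENNReal.ofReal |qq V i j y| * B y :=
        Finset.sum_le_sum fun i _ => mul_le_mul_right (h i) _
    _ = ENNReal.ofReal (∑ i, |qq V i j y|) * B y := by
        rw [ENNReal.ofReal_sum_of_nonneg fun i _ => abs_nonneg _, Finset.sum_mul]
    _ ≤ _ := by
        gcongr
        unfold QQ
        refine Finset.sum_le_sum fun i _ => ?_
        exact Finset.single_le_sum (f := fun j => |qq V i j y|) (fun j _ => abs_nonneg _)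
          (Finset.mem_univ j)

lemma bs_int (hV : ∀ j, CC (V j)) {ε : ℝ} (hε : 0 < ε) (j : Fin 3) (x : E3) :
    Integrable fun y => ∑ i, qq V i j y * Kk ε i (x - y) :=
  integrable_finset_sum _ fun i _ => (qq_cc hV i j).mul_bdd ((Kk_cont hε i).comp (by fun_prop))

lemma bs_lim_nat (hV : ∀ j, CC (V j)) (hdiv : ∀ x, ∑ i, pds (V i) i x = 0) (j : Fin 3) (x : E3)
    {ε : ℝ} (hε : 0 < ε) : Tendsto (fun n : ℕ => BSe V ((n:ℝ) + ε⁻¹)⁻¹ j x) atTop (𝓝 (mK * V j x)) :=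
  (bs_lim hV hdiv j x).comp
    (tendsto_atTop_add_const_right _ _ tendsto_natCast_atTop_atTop)

lemma ae_ne (x : E3) : ∀ᵐ y : E3, y ≠ x := by
  have := (measure_singleton (μ := (volume : Measure E3)) x)
  exact compl_mem_ae_iff.2 this

lemma pos_nat {ε : ℝ} (hε : 0 < ε) (n : ℕ) : 0 < ((n:ℝ) + ε⁻¹)⁻¹ := by positivity

/-- pointwise bound by the Riesz potential -/
lemma bs0 (hV : ∀ j, CC (V j)) (hdiv : ∀ x, ∑ i, pds (V i) i x = 0) (j : Fin 3) (x : E3) :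
    ENNReal.ofReal |mK * V j x| ≤
      ∫⁻ y, ENNReal.ofReal (QQ V y) * ENNReal.ofReal (dist x y ^ (-2:ℝ)) := by
  refine bs_gen hV j (κ := fun n i y => Kk ((n:ℝ) + 1⁻¹)⁻¹ i (x - y))
    (bs_lim_nat hV hdiv j x one_pos) fun n i => ?_
  filter_upwards [ae_ne x] with y hy
  apply ENNReal.ofReal_le_ofReal
  refine (Kk_bound2 (pos_nat one_pos n) i (sub_ne_zero.2 hy.symm)).trans (le_of_eq ?_)
  rw [dist_eq_norm, Real.rpow_neg (norm_nonneg _), Real.rpow_two, one_div]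

/-- approximation by the regularised operator -/
lemma bs2 (hV : ∀ j, CC (V j)) (hdiv : ∀ x, ∑ i, pds (V i) i x = 0) (j : Fin 3) (x : E3)
    {ε θ : ℝ} (hε : 0 < ε) (hθ : 0 ≤ θ) (hθ1 : θ ≤ 1) :
    ENNReal.ofReal |BSe V ε j x - mK * V j x| ≤
      ENNReal.ofReal (4 * ε ^ θ) * ∫⁻ y, ENNReal.ofReal (QQ V y) *
        ENNReal.ofReal (dist x y ^ (-(2 + θ))) := by
  have hl : Tendsto (fun n : ℕ => ∫ y, ∑ i, qq V i j y *
      (Kk ε i (x - y) - Kk ((n:ℝ) + ε⁻¹)⁻¹ i (x - y))) atTop (𝓝 (BSe V ε j x - mK * V j x)) := by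
    refine (tendsto_const_nhds.sub (bs_lim_nat hV hdiv j x hε)).congr fun n => ?_
    rw [BSe, BSe, ← integral_sub (bs_int hV hε j x) (bs_int hV (pos_nat hε n) j x)]
    simp only [mul_sub, Finset.sum_sub_distrib]
  have := bs_gen hV j hl (B := fun y => ENNReal.ofReal (4 * ε ^ θ) *
    ENNReal.ofReal (dist x y ^ (-(2 + θ)))) fun n i => ?_
  · refine this.trans (le_of_eq ?_)
    rw [← lintegral_const_mul' _ _ ENNReal.ofReal_ne_top]
    refine lintegral_congr fun y => ?_
    ring
  · filter_upwards [ae_ne x] with y hy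
    rw [← ENNReal.ofReal_mul (by positivity), dist_eq_norm]
    apply ENNReal.ofReal_le_ofReal
    refine Kk_eps (pos_nat hε n) ?_ i (sub_ne_zero.2 hy.symm) hθ hθ1
    rw [inv_le_comm₀ (by positivity) hε]
    linarith [(Nat.cast_nonneg n : (0:ℝ) ≤ n)]

/-- difference bound -/
lemma bs1 (hV : ∀ j, CC (V j)) (hdiv : ∀ x, ∑ i, pds (V i) i x = 0) (j : Fin 3) {x z : E3} {r : ℝ}
    (hr : 0 < r) (hxz : dist x z ≤ r) :
    ENNReal.ofReal |mK * V j x - mK * V j z| ≤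
      (∫⁻ y in Metric.ball z (2 * r), ENNReal.ofReal (QQ V y) * ENNReal.ofReal (dist x y ^ (-2:ℝ))) +
      (∫⁻ y in Metric.ball z (2 * r), ENNReal.ofReal (QQ V y) * ENNReal.ofReal (dist z y ^ (-2:ℝ))) +
      ENNReal.ofReal (22 * r) * ∫⁻ y in (Metric.ball z (2 * r))ᶜ,
        ENNReal.ofReal (QQ V y) * ENNReal.ofReal (dist z y ^ (-3:ℝ)) := by
  have hl : Tendsto (fun n : ℕ => ∫ y, ∑ i, qq V i j y *
      (Kk ((n:ℝ) + 1⁻¹)⁻¹ i (x - y) - Kk ((n:ℝ) + 1⁻¹)⁻¹ i (z - y))) atTop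
      (𝓝 (mK * V j x - mK * V j z)) := by
    refine ((bs_lim_nat hV hdiv j x one_pos).sub (bs_lim_nat hV hdiv j z one_pos)).congr fun n => ?_
    rw [BSe, BSe, ← integral_sub (bs_int hV (pos_nat one_pos n) j x)
      (bs_int hV (pos_nat one_pos n) j z)]
    simp only [mul_sub, Finset.sum_sub_distrib]
  have hb : MeasurableSet (Metric.ball z (2 * r)) := Metric.isOpen_ball.measurableSet
  have := bs_gen hV j hl (B := fun y =>
    (Metric.ball z (2 * r)).indicator (fun y => ENNReal.ofReal (dist x y ^ (-2:ℝ)) +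
      ENNReal.ofReal (dist z y ^ (-2:ℝ))) y + (Metric.ball z (2 * r))ᶜ.indicator
      (fun y => ENNReal.ofReal (22 * r) * ENNReal.ofReal (dist z y ^ (-3:ℝ))) y) fun n i => ?_
  · refine this.trans (le_of_eq ?_)
    have hQ : Measurable fun y => ENNReal.ofReal (QQ V y) := by
      have : Continuous (QQ V) := by
        unfold QQ
        exact continuous_finset_sum _ fun i _ => continuous_finset_sum _ fun j _ =>
          (qq_cc hV i j).cont.abs
      exact this.measurable.ennreal_ofReal
    have m1 : ∀ w : E3, ∀ s : ℝ, Measurable fun y => ENNReal.ofReal (QQ V y) *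
      ENNReal.ofReal (dist w y ^ s) := fun w s => hQ.mul (dist_rpow_meas w s)
    rw [← lintegral_add_compl _ hb, ← lintegral_add_left (m1 x _),
      ← lintegral_const_mul _ (m1 z _)]
    congr 1
    · refine setLIntegral_congr_fun hb fun y hy => ?_
      have hy' : y ∉ (Metric.ball z (2 * r))ᶜ := fun h => h hy
      simp only [Set.indicator_of_mem hy, Set.indicator_of_notMem hy', add_zero, mul_add]
    · refine setLIntegral_congr_fun hb.compl fun y hy => ?_
      simp only [Set.indicator_of_mem hy, Set.indicator_of_notMem hy, zero_add]
      ring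
  · have hn := pos_nat one_pos n
    filter_upwards [ae_ne x, ae_ne z] with y hyx hyz
    by_cases hy : y ∈ Metric.ball z (2 * r)
    · have hy' : y ∉ (Metric.ball z (2 * r))ᶜ := fun h => h hy
      simp only [Set.indicator_of_mem hy, Set.indicator_of_notMem hy', add_zero]
      rw [← ENNReal.ofReal_add (by positivity) (by positivity)]
      apply ENNReal.ofReal_le_ofReal
      have e : ∀ w : E3, dist w y ^ (-2:ℝ) = 1 / ‖w - y‖ ^ 2 := fun w => by
        rw [dist_eq_norm, Real.rpow_neg (norm_nonneg _), Real.rpow_two, one_div]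
      rw [e, e]
      exact (abs_sub _ _).trans (add_le_add (Kk_bound2 hn i (sub_ne_zero.2 hyx.symm))
        (Kk_bound2 hn i (sub_ne_zero.2 hyz.symm)))
    · have hy' : y ∈ (Metric.ball z (2 * r))ᶜ := hy
      simp only [Set.indicator_of_notMem hy, Set.indicator_of_mem hy', zero_add]
      rw [← ENNReal.ofReal_mul (by positivity)]
      apply ENNReal.ofReal_le_ofReal
      have hd : 2 * r ≤ ‖z - y‖ := by
        rw [Metric.mem_ball, not_lt, dist_comm, dist_eq_norm] at hy; exact hy
      have e3 : x - y - (z - y) = x - z := by abel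
      rw [dist_eq_norm] at hxz
      have := Kk_far hn i (a := x - y) (b := z - y) (sub_ne_zero.2 hyz.symm)
        (by rw [e3]; linarith)
      refine this.trans ?_
      rw [e3, dist_eq_norm, Real.rpow_neg (norm_nonneg _), mul_assoc, div_eq_mul_inv]
      have : ‖z - y‖ ^ (3:ℝ) = ‖z - y‖ ^ 3 := by rw [← Real.rpow_natCast]; norm_num
      rw [this]
      gcongr
end

section
/-! ### Schur tests -/

lemma schur0 {μ : Measure E3} {k f w : E3 → ℝ≥0∞} (hk : Measurable k) (hf : Measurable f)
    (hw : Measurable w) (hw0 : ∀ᵐ x ∂μ, w x ≠ 0 ∧ w x ≠ ⊤) :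
    (∫⁻ y, f y * k y ∂μ) ^ 3 ≤ (∫⁻ y, f y ^ 3 * w y ^ 2 * k y ∂μ) * (∫⁻ y, k y * (w y)⁻¹ ∂μ) ^ 2 := by
  have hpq : (3:ℝ).HolderConjugate (3/2) := by
    rw [Real.holderConjugate_iff]; norm_num
  have h := ENNReal.lintegral_mul_le_Lp_mul_Lq μ hpq
    (f := fun y => f y * (w y ^ (2/3:ℝ)) * k y ^ (1/3:ℝ))
    (g := fun y => k y ^ (2/3:ℝ) * (w y)⁻¹ ^ (2/3:ℝ))
    (by fun_prop) (by fun_prop)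
  have e0 : ∫⁻ y, f y * k y ∂μ = ∫⁻ y, ((fun y => f y * (w y ^ (2/3:ℝ)) * k y ^ (1/3:ℝ)) *
      (fun y => k y ^ (2/3:ℝ) * (w y)⁻¹ ^ (2/3:ℝ))) y ∂μ := by
    refine lintegral_congr_ae (hw0.mono fun y hy => ?_)
    simp only [Pi.mul_apply]
    have e1 : k y ^ (1/3:ℝ) * k y ^ (2/3:ℝ) = k y := by
      rw [← ENNReal.rpow_add_of_nonneg _ _ (by norm_num) (by norm_num)]; norm_num
    have e2 : w y ^ (2/3:ℝ) * (w y)⁻¹ ^ (2/3:ℝ) = 1 := by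
      rw [ENNReal.inv_rpow, ENNReal.mul_inv_cancel]
      · simp [hy.1, hy.2]
      · exact ENNReal.rpow_ne_top_of_nonneg (by norm_num) hy.2
    calc f y * k y = f y * (w y ^ (2/3:ℝ) * (w y)⁻¹ ^ (2/3:ℝ)) * (k y ^ (1/3:ℝ) * k y ^ (2/3:ℝ)) := by
          rw [e1, e2, mul_one]
      _ = _ := by ring
  have e3 : ∀ y, (f y * (w y ^ (2/3:ℝ)) * k y ^ (1/3:ℝ)) ^ (3:ℝ) = f y ^ 3 * w y ^ 2 * k y := by
    intro y
    rw [ENNReal.mul_rpow_of_nonneg _ _ (by norm_num), ENNReal.mul_rpow_of_nonneg _ _ (by norm_num),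
      ← ENNReal.rpow_mul, ← ENNReal.rpow_mul]
    norm_num
  have e4 : ∀ y, (k y ^ (2/3:ℝ) * (w y)⁻¹ ^ (2/3:ℝ)) ^ (3/2:ℝ) = k y * (w y)⁻¹ := by
    intro y
    rw [ENNReal.mul_rpow_of_nonneg _ _ (by norm_num), ← ENNReal.rpow_mul, ← ENNReal.rpow_mul]
    norm_num
  rw [← e0] at h
  simp only [e3, e4] at h
  calc _ ≤ ((∫⁻ y, f y ^ 3 * w y ^ 2 * k y ∂μ) ^ (1/3:ℝ) *
        (∫⁻ y, k y * (w y)⁻¹ ∂μ) ^ (1/(3/2):ℝ)) ^ 3 := by gcongr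
    _ = _ := by
      rw [mul_pow, ← ENNReal.rpow_natCast, ← ENNReal.rpow_natCast, ← ENNReal.rpow_mul,
        ← ENNReal.rpow_mul, ← ENNReal.rpow_natCast]
      norm_num

lemma schurD {Ω T : Set E3} (hΩ : IsLipschitzDomain Ω) (hT : MeasurableSet T) (hTΩ : T ⊆ Ω)
    {k f : E3 → ℝ≥0∞} (hk : Measurable k) (hf : Measurable f) (a : ℝ) :
    (∫⁻ y in T, f y * k y) ^ 3 ≤ (∫⁻ y in T, f y ^ 3 * ENNReal.ofReal (dB Ω y ^ (2*a)) * k y) *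
      (∫⁻ y in T, k y * ENNReal.ofReal (dB Ω y ^ (-a))) ^ 2 := by
  have h := schur0 (μ := volume.restrict T) hk hf (dB_rpow_meas Ω a)
    ((ae_restrict_mem hT).mono fun y hy => by
      have := Real.rpow_pos_of_pos (dB_pos hΩ (hTΩ hy)) a
      simp [this])
  refine h.trans (le_of_eq ?_)
  congr 1
  · refine setLIntegral_congr_fun hT fun y hy => ?_
    have h0 := dB_pos hΩ (hTΩ hy)
    have h1 := Real.rpow_pos_of_pos h0 a
    rw [← ENNReal.ofReal_pow h1.le, ← Real.rpow_natCast, ← Real.rpow_mul h0.le, mul_comm a]; norm_num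
  · congr 1
    refine setLIntegral_congr_fun hT fun y hy => ?_
    have h0 := dB_pos hΩ (hTΩ hy)
    have h1 := Real.rpow_pos_of_pos h0 a
    rw [Real.rpow_neg h0.le, ENNReal.ofReal_inv_of_pos h1]

lemma dist2_meas (s : ℝ) : Measurable fun p : E3 × E3 => ENNReal.ofReal (dist p.1 p.2 ^ s) :=
  ((measurable_dist).pow_const s).ennreal_ofReal

lemma dB1_meas (Ω : Set E3) (s : ℝ) : Measurable fun p : E3 × E3 => ENNReal.ofReal (dB Ω p.1 ^ s) :=
  (dB_rpow_meas Ω s).comp measurable_fst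

lemma dB2_meas (Ω : Set E3) (s : ℝ) : Measurable fun p : E3 × E3 => ENNReal.ofReal (dB Ω p.2 ^ s) :=
  (dB_rpow_meas Ω s).comp measurable_snd

lemma diamB {Ω : Set E3} (hΩ : IsLipschitzDomain Ω) : ∃ D > 0, ∀ x ∈ Ω, Ω ⊆ Metric.ball x D := by
  obtain ⟨C, hC⟩ := Metric.isBounded_iff.1 hΩ.isBounded
  refine ⟨|C| + 1, by positivity, fun x hx y hy => ?_⟩
  have := hC hy hx
  rw [Metric.mem_ball]; linarith [le_abs_self C]

lemma ker_full {Ω : Set E3} (hΩ : IsLipschitzDomain Ω) {a θ : ℝ} (ha : 0 ≤ a) (hθ : 0 ≤ θ)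
    (h : θ + a < 1) : ∃ C > 0, ∀ x ∈ Ω,
    ∫⁻ y in Ω, ENNReal.ofReal (dist x y ^ (-(2+θ))) * ENNReal.ofReal (dB Ω y ^ (-a)) ≤ ENNReal.ofReal C := by
  obtain ⟨C, hC, hk⟩ := ker_inner hΩ ha hθ h
  obtain ⟨D, hD, hDs⟩ := diamB hΩ
  refine ⟨C * D ^ (1-θ-a), by positivity, fun x hx => ?_⟩
  have := hk x D hD
  rwa [Set.inter_eq_right.2 (hDs x hx)] at this

lemma wl3 {Ω : Set E3} (hΩ : IsLipschitzDomain Ω) {α θ : ℝ} (ha : 0 ≤ α) (hθ : 0 ≤ θ)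
    (h : θ + α/2 < 1) : ∃ C > 0, ∀ f : E3 → ℝ≥0∞, Measurable f →
    ∫⁻ x in Ω, ENNReal.ofReal (dB Ω x ^ (-(α/2))) * (∫⁻ y in Ω, f y * ENNReal.ofReal (dist x y ^ (-(2+θ)))) ^ 3
      ≤ ENNReal.ofReal C * ∫⁻ y in Ω, f y ^ 3 * ENNReal.ofReal (dB Ω y ^ α) := by
  obtain ⟨C, hC, hk⟩ := ker_full hΩ (a := α/2) (by positivity) hθ h
  have hm := hΩ.isOpen.measurableSet
  refine ⟨C ^ 3, by positivity, fun f hf => ?_⟩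
  have s1 : ∀ x ∈ Ω, ENNReal.ofReal (dB Ω x ^ (-(α/2))) * (∫⁻ y in Ω, f y * ENNReal.ofReal (dist x y ^ (-(2+θ)))) ^ 3
      ≤ ENNReal.ofReal C ^ 2 * ∫⁻ y in Ω, f y ^ 3 * ENNReal.ofReal (dB Ω y ^ α) *
        (ENNReal.ofReal (dist y x ^ (-(2+θ))) * ENNReal.ofReal (dB Ω x ^ (-(α/2)))) := by
    intro x hx
    have h1 := schurD hΩ hm subset_rfl (dist_rpow_meas x (-(2+θ))) hf (α/2)
    rw [show 2 * (α/2) = α by ring] at h1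
    have h2 := hk x hx
    have h3 : (∫⁻ y in Ω, f y * ENNReal.ofReal (dist x y ^ (-(2+θ)))) ^ 3 ≤
        (∫⁻ y in Ω, f y ^ 3 * ENNReal.ofReal (dB Ω y ^ α) * ENNReal.ofReal (dist x y ^ (-(2+θ)))) * ENNReal.ofReal C ^ 2 :=
      h1.trans (by gcongr)
    calc _ ≤ ENNReal.ofReal (dB Ω x ^ (-(α/2))) * ((∫⁻ y in Ω, f y ^ 3 * ENNReal.ofReal (dB Ω y ^ α) *
        ENNReal.ofReal (dist x y ^ (-(2+θ)))) * ENNReal.ofReal C ^ 2) := by gcongr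
      _ = ENNReal.ofReal C ^ 2 * ((∫⁻ y in Ω, f y ^ 3 * ENNReal.ofReal (dB Ω y ^ α) *
        ENNReal.ofReal (dist x y ^ (-(2+θ)))) * ENNReal.ofReal (dB Ω x ^ (-(α/2)))) := by ring
      _ = _ := by
        rw [← lintegral_mul_const' _ _ ENNReal.ofReal_ne_top]
        simp only [mul_assoc, dist_comm x]
  have hmm : Measurable fun p : E3 × E3 => f p.2 ^ 3 * ENNReal.ofReal (dB Ω p.2 ^ α) *
        (ENNReal.ofReal (dist p.2 p.1 ^ (-(2+θ))) * ENNReal.ofReal (dB Ω p.1 ^ (-(α/2)))) := by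
    have h1 := (dist2_meas (-(2+θ))).comp (measurable_swap (α := E3) (β := E3))
    have h2 := dB1_meas Ω (-(α/2))
    have h3 := dB2_meas Ω α
    have h4 : Measurable fun p : E3 × E3 => f p.2 ^ 3 := (hf.comp measurable_snd).pow_const 3
    exact (h4.mul h3).mul (h1.mul h2)
  calc _ ≤ ∫⁻ x in Ω, ENNReal.ofReal C ^ 2 * ∫⁻ y in Ω, f y ^ 3 * ENNReal.ofReal (dB Ω y ^ α) *
        (ENNReal.ofReal (dist y x ^ (-(2+θ))) * ENNReal.ofReal (dB Ω x ^ (-(α/2)))) := setLIntegral_mono' hm s1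
    _ = ENNReal.ofReal C ^ 2 * ∫⁻ y in Ω, ∫⁻ x in Ω, f y ^ 3 * ENNReal.ofReal (dB Ω y ^ α) *
        (ENNReal.ofReal (dist y x ^ (-(2+θ))) * ENNReal.ofReal (dB Ω x ^ (-(α/2)))) := by
      rw [lintegral_const_mul' _ _ (by simp), lintegral_lintegral_swap hmm.aemeasurable]
    _ ≤ ENNReal.ofReal C ^ 2 * ∫⁻ y in Ω, f y ^ 3 * ENNReal.ofReal (dB Ω y ^ α) * ENNReal.ofReal C := by
      gcongr ENNReal.ofReal C ^ 2 * ?_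
      refine setLIntegral_mono' hm fun y hy => ?_
      rw [lintegral_const_mul _ (by
        exact ((dist_rpow_meas y _).mul (dB_rpow_meas Ω _)))]
      gcongr
      exact hk y hy
    _ = _ := by
      rw [lintegral_mul_const' _ _ ENNReal.ofReal_ne_top, ENNReal.ofReal_pow hC.le]; ring
end

section
/-! ### Weighted Fubini estimates -/

lemma fubS {Ω : Set E3} (hm : MeasurableSet Ω) {S : Set (E3 × E3)} (hS : MeasurableSet S)
    {H : E3 × E3 → ℝ≥0∞} (hH : Measurable H) :
    ∫⁻ z in Ω, (∫⁻ y in {y | (z,y) ∈ S} ∩ Ω, H (z,y)) =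
      ∫⁻ y in Ω, (∫⁻ z in {z | (z,y) ∈ S} ∩ Ω, H (z,y)) := by
  have h1 : ∀ z, (∫⁻ y in {y | (z,y) ∈ S} ∩ Ω, H (z,y)) = ∫⁻ y in Ω, S.indicator H (z,y) := by
    intro z
    have hz : MeasurableSet {y | (z,y) ∈ S} := measurable_prodMk_left hS
    rw [← Measure.restrict_restrict hz, ← lintegral_indicator hz]
    rfl
  have h2 : ∀ y, (∫⁻ z in {z | (z,y) ∈ S} ∩ Ω, H (z,y)) = ∫⁻ z in Ω, S.indicator H (z,y) := by
    intro y
    have hz : MeasurableSet {z | (z,y) ∈ S} := measurable_prodMk_right hS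
    rw [← Measure.restrict_restrict hz, ← lintegral_indicator hz]
    rfl
  simp only [h1, h2]
  exact lintegral_lintegral_swap (f := fun z y => S.indicator H (z,y))
    (hH.indicator hS).aemeasurable

lemma rpow_cmp {x y s : ℝ} (hx : 0 < x) (hy : 0 < y) (h1 : x ≤ 2 * y) (h2 : y ≤ 2 * x) :
    x ^ s ≤ 2 ^ |s| * y ^ s := by
  rcases le_total 0 s with hs | hs
  · rw [abs_of_nonneg hs, ← Real.mul_rpow (by norm_num) hy.le]
    exact Real.rpow_le_rpow hx.le h1 hs
  · rw [abs_of_nonpos hs, Real.rpow_neg (by norm_num), ← Real.inv_rpow (by norm_num),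
      ← Real.mul_rpow (by norm_num) hy.le]
    exact Real.rpow_le_rpow_of_nonpos (by positivity) (by linarith) hs

lemma fub1 {Ω : Set E3} (hΩ : IsLipschitzDomain Ω) (α : ℝ) :
    ∃ C > 0, ∀ f : E3 → ℝ≥0∞, Measurable f →
    ∫⁻ z in Ω, ENNReal.ofReal (dB Ω z ^ (α-1)) * (∫⁻ y in Metric.ball z (dB Ω z / 2),
        f y * ENNReal.ofReal (dist z y ^ (-2:ℝ)))
      ≤ ENNReal.ofReal C * ∫⁻ y in Ω, f y * ENNReal.ofReal (dB Ω y ^ α) := by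
  obtain ⟨C, hC, hk⟩ := ker_inner hΩ (a := 0) (θ := 0) le_rfl le_rfl (by norm_num)
  have hm := hΩ.isOpen.measurableSet
  refine ⟨2 ^ |α-1| * C, by positivity, fun f hf => ?_⟩
  let S : Set (E3 × E3) := {p | dist p.2 p.1 < dB Ω p.1 / 2}
  have hS : MeasurableSet S := by
    refine measurableSet_lt (by fun_prop) ?_
    exact (((dB_cont Ω).measurable).comp measurable_fst).div_const 2
  have hH : Measurable fun p : E3 × E3 => ENNReal.ofReal (dB Ω p.1 ^ (α-1)) *
      (f p.2 * ENNReal.ofReal (dist p.1 p.2 ^ (-2:ℝ))) :=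
    (dB1_meas Ω _).mul ((hf.comp measurable_snd).mul (dist2_meas _))
  calc _ = ∫⁻ z in Ω, (∫⁻ y in {y | (z,y) ∈ S} ∩ Ω, ENNReal.ofReal (dB Ω z ^ (α-1)) *
        (f y * ENNReal.ofReal (dist z y ^ (-2:ℝ)))) := by
        refine setLIntegral_congr_fun hm fun z hz => ?_
        have : {y | (z,y) ∈ S} ∩ Ω = Metric.ball z (dB Ω z / 2) := by
          rw [Set.inter_eq_left.2]
          · rfl
          · intro y hy
            refine dball_sub hΩ hz (Metric.ball_subset_ball ?_ hy)
            linarith [dB_nonneg Ω z]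
        rw [this, lintegral_const_mul' _ _ ENNReal.ofReal_ne_top]
    _ = ∫⁻ y in Ω, (∫⁻ z in {z | (z,y) ∈ S} ∩ Ω, ENNReal.ofReal (dB Ω z ^ (α-1)) *
        (f y * ENNReal.ofReal (dist z y ^ (-2:ℝ)))) := fubS hm hS hH
    _ ≤ ∫⁻ y in Ω, ENNReal.ofReal (2 ^ |α-1| * C) * (f y * ENNReal.ofReal (dB Ω y ^ α)) := by
        refine setLIntegral_mono' hm fun y hy => ?_
        have hy0 := dB_pos hΩ hy
        have hmz : MeasurableSet ({z | (z,y) ∈ S} ∩ Ω) := (measurable_prodMk_right hS).inter hm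
        have hsub : {z | (z,y) ∈ S} ∩ Ω ⊆ Metric.ball y (dB Ω y) ∩ Ω := by
          rintro z ⟨hz, hzΩ⟩
          have hz' : dist y z < dB Ω z / 2 := hz
          refine ⟨?_, hzΩ⟩
          have := dB_lip Ω z y
          rw [Metric.mem_ball]; rw [dist_comm] at this hz'; rw [dist_comm y z] at *; linarith
        calc _ ≤ ∫⁻ z in {z | (z,y) ∈ S} ∩ Ω, (f y * ENNReal.ofReal (2 ^ |α-1| * dB Ω y ^ (α-1))) *
              (ENNReal.ofReal (dist y z ^ (-(2+0):ℝ)) * ENNReal.ofReal (dB Ω z ^ (-0:ℝ))) := by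
              refine setLIntegral_mono' hmz fun z hz => ?_
              have hz' : dist y z < dB Ω z / 2 := hz.1
              have h1 := dB_lip Ω z y
              have h2 := dB_lip Ω y z
              rw [dist_comm z y] at h1
              have h3 : dB Ω z ^ (α-1) ≤ 2 ^ |α-1| * dB Ω y ^ (α-1) :=
                rpow_cmp (dB_pos hΩ hz.2) hy0 (by linarith) (by linarith)
              rw [dist_comm z y]
              simp only [add_zero, neg_zero, Real.rpow_zero, ENNReal.ofReal_one, mul_one]
              calc _ ≤ ENNReal.ofReal (2 ^ |α-1| * dB Ω y ^ (α-1)) *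
                    (f y * ENNReal.ofReal (dist y z ^ (-2:ℝ))) := by gcongr
                _ = _ := by ring
          _ ≤ ∫⁻ z in Metric.ball y (dB Ω y) ∩ Ω,
              (f y * ENNReal.ofReal (2 ^ |α-1| * dB Ω y ^ (α-1))) *
              (ENNReal.ofReal (dist y z ^ (-(2+0):ℝ)) * ENNReal.ofReal (dB Ω z ^ (-0:ℝ))) :=
              lintegral_mono_set hsub
          _ ≤ (f y * ENNReal.ofReal (2 ^ |α-1| * dB Ω y ^ (α-1))) * 
              ENNReal.ofReal (C * dB Ω y ^ (1-0-0:ℝ)) := by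
              rw [lintegral_const_mul _ (by exact (dist_rpow_meas y _).mul (dB_rpow_meas Ω _))]
              gcongr
              exact hk y _ hy0
          _ = _ := by
              rw [mul_assoc, ← ENNReal.ofReal_mul (by positivity),
                mul_left_comm (ENNReal.ofReal (2 ^ |α-1| * C)), ← ENNReal.ofReal_mul (by positivity)]
              congr 2
              have : dB Ω y ^ α = dB Ω y ^ (α-1) * dB Ω y ^ (1-0-0:ℝ) := by
                rw [← Real.rpow_add hy0]; congr 1; ring
              rw [this]; ring
    _ = _ := lintegral_const_mul' _ _ ENNReal.ofReal_ne_top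

lemma fub2 {Ω : Set E3} (hΩ : IsLipschitzDomain Ω) {α : ℝ} (hα0 : 0 ≤ α) (hα : α < 2) :
    ∃ C > 0, ∀ f : E3 → ℝ≥0∞, Measurable f →
    ∫⁻ z in Ω, ENNReal.ofReal (dB Ω z ^ α) * (∫⁻ y in (Metric.ball z (dB Ω z / 2))ᶜ ∩ Ω,
        f y * ENNReal.ofReal (dist z y ^ (-3:ℝ))) ^ 3
      ≤ ENNReal.ofReal C * ∫⁻ y in Ω, f y ^ 3 * ENNReal.ofReal (dB Ω y ^ α) := by
  obtain ⟨a, ha⟩ : ∃ a : ℝ, a = (1+α)/3 := ⟨_, rfl⟩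
  obtain ⟨b, hb⟩ : ∃ b : ℝ, b = (2-α)/3 := ⟨_, rfl⟩
  obtain ⟨C, hC, hk⟩ := ker_outer hΩ (a := a) (by rw [ha]; positivity) (by linarith)
  obtain ⟨C', hC', hk'⟩ := ker_outer hΩ (a := b) (by linarith) (by linarith)
  have hm := hΩ.isOpen.measurableSet
  obtain ⟨K, hK⟩ : ∃ K : ℝ, K = (C * (1/2) ^ (-a)) ^ 2 := ⟨_, rfl⟩
  have hK0 : 0 < K := by rw [hK]; positivity
  refine ⟨K * (C' * (1/3) ^ (-b)), by positivity, fun f hf => ?_⟩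
  let S : Set (E3 × E3) := {p | dB Ω p.1 / 2 ≤ dist p.2 p.1}
  have hS : MeasurableSet S := by
    refine measurableSet_le ?_ (by fun_prop)
    exact (((dB_cont Ω).measurable).comp measurable_fst).div_const 2
  have hH : Measurable fun p : E3 × E3 => ENNReal.ofReal (K * dB Ω p.1 ^ (-b)) *
      (f p.2 ^ 3 * ENNReal.ofReal (dB Ω p.2 ^ (2*a)) * ENNReal.ofReal (dist p.1 p.2 ^ (-3:ℝ))) := by
    have h1 : Measurable fun p : E3 × E3 => ENNReal.ofReal (K * dB Ω p.1 ^ (-b)) := by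
      refine Measurable.ennreal_ofReal (Measurable.const_mul ?_ K)
      exact (((dB_cont Ω).measurable).comp measurable_fst).pow_const _
    exact h1.mul ((((hf.comp measurable_snd).pow_const 3).mul (dB2_meas Ω _)).mul (dist2_meas _))
  have hset : ∀ z, (Metric.ball z (dB Ω z / 2))ᶜ = {y | (z,y) ∈ S} := by
    intro z; ext y; simp [S]
  calc _ ≤ ∫⁻ z in Ω, (∫⁻ y in {y | (z,y) ∈ S} ∩ Ω, ENNReal.ofReal (K * dB Ω z ^ (-b)) *
        (f y ^ 3 * ENNReal.ofReal (dB Ω y ^ (2*a)) * ENNReal.ofReal (dist z y ^ (-3:ℝ)))) := by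
        refine setLIntegral_mono' hm fun z hz => ?_
        have hz0 := dB_pos hΩ hz
        have h1 := schurD hΩ (Metric.isOpen_ball.measurableSet.compl.inter hm)
          (Set.inter_subset_right (s := (Metric.ball z (dB Ω z / 2))ᶜ)) (dist_rpow_meas z (-3)) hf a
        have h2 := hk z (dB Ω z / 2) (by positivity)
        rw [lintegral_const_mul' _ _ ENNReal.ofReal_ne_top, ← hset]
        calc _ ≤ ENNReal.ofReal (dB Ω z ^ α) * ((∫⁻ y in (Metric.ball z (dB Ω z / 2))ᶜ ∩ Ω,
              f y ^ 3 * ENNReal.ofReal (dB Ω y ^ (2*a)) * ENNReal.ofReal (dist z y ^ (-3:ℝ))) *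
              ENNReal.ofReal (C * (dB Ω z / 2) ^ (-a)) ^ 2) := by
              gcongr
              exact h1.trans (by gcongr)
          _ = (ENNReal.ofReal (dB Ω z ^ α) * ENNReal.ofReal (C * (dB Ω z / 2) ^ (-a)) ^ 2) * 
              (∫⁻ y in (Metric.ball z (dB Ω z / 2))ᶜ ∩ Ω,
              f y ^ 3 * ENNReal.ofReal (dB Ω y ^ (2*a)) * ENNReal.ofReal (dist z y ^ (-3:ℝ))) := by
              ring
          _ = _ := by
              congr 1
              rw [← ENNReal.ofReal_pow (by positivity), ← ENNReal.ofReal_mul (by positivity)]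
              congr 1
              have e1 : (dB Ω z / 2) ^ (-a) = (1/2) ^ (-a) * dB Ω z ^ (-a) := by
                rw [← Real.mul_rpow (by norm_num) hz0.le]; congr 1; ring
              have e2 : dB Ω z ^ (-b) = dB Ω z ^ α * (dB Ω z ^ (-a)) ^ 2 := by
                rw [← Real.rpow_natCast (dB Ω z ^ (-a)), ← Real.rpow_mul hz0.le,
                  ← Real.rpow_add hz0]
                congr 1; rw [ha, hb]; push_cast; ring
              rw [e1, e2, hK]; ring
    _ = ∫⁻ y in Ω, (∫⁻ z in {z | (z,y) ∈ S} ∩ Ω, ENNReal.ofReal (K * dB Ω z ^ (-b)) *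
        (f y ^ 3 * ENNReal.ofReal (dB Ω y ^ (2*a)) * ENNReal.ofReal (dist z y ^ (-3:ℝ)))) := fubS hm hS hH
    _ ≤ ∫⁻ y in Ω, ENNReal.ofReal (K * (C' * (1/3) ^ (-b))) * (f y ^ 3 * ENNReal.ofReal (dB Ω y ^ α)) := by
        refine setLIntegral_mono' hm fun y hy => ?_
        have hy0 := dB_pos hΩ hy
        have hsub : {z | (z,y) ∈ S} ∩ Ω ⊆ (Metric.ball y (dB Ω y / 3))ᶜ ∩ Ω := by
          rintro z ⟨hz, hzΩ⟩
          have hz' : dB Ω z / 2 ≤ dist y z := hz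
          refine ⟨?_, hzΩ⟩
          have := dB_lip Ω y z
          rw [Set.mem_compl_iff, Metric.mem_ball, dist_comm z y]; linarith
        calc _ ≤ ∫⁻ z in (Metric.ball y (dB Ω y / 3))ᶜ ∩ Ω, ENNReal.ofReal (K * dB Ω z ^ (-b)) *
              (f y ^ 3 * ENNReal.ofReal (dB Ω y ^ (2*a)) * ENNReal.ofReal (dist z y ^ (-3:ℝ))) :=
              lintegral_mono_set hsub
          _ = ∫⁻ z in (Metric.ball y (dB Ω y / 3))ᶜ ∩ Ω,
              (ENNReal.ofReal K * (f y ^ 3 * ENNReal.ofReal (dB Ω y ^ (2*a)))) *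
              (ENNReal.ofReal (dist y z ^ (-3:ℝ)) * ENNReal.ofReal (dB Ω z ^ (-b))) := by
              refine lintegral_congr fun z => ?_
              rw [ENNReal.ofReal_mul hK0.le, dist_comm z y]; ring
          _ ≤ (ENNReal.ofReal K * (f y ^ 3 * ENNReal.ofReal (dB Ω y ^ (2*a)))) *
              ENNReal.ofReal (C' * (dB Ω y / 3) ^ (-b)) := by
              rw [lintegral_const_mul _ (by exact (dist_rpow_meas y _).mul (dB_rpow_meas Ω _))]
              gcongr
              exact hk' y _ (by positivity)
          _ = f y ^ 3 * (ENNReal.ofReal K * (ENNReal.ofReal (dB Ω y ^ (2*a)) *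
              ENNReal.ofReal (C' * (dB Ω y / 3) ^ (-b)))) := by ring
          _ = f y ^ 3 * (ENNReal.ofReal (K * (C' * (1/3) ^ (-b))) * ENNReal.ofReal (dB Ω y ^ α)) := by
              rw [← ENNReal.ofReal_mul (by positivity), ← ENNReal.ofReal_mul hK0.le,
                ← ENNReal.ofReal_mul (by positivity)]
              congr 2
              have e1 : (dB Ω y / 3) ^ (-b) = (1/3) ^ (-b) * dB Ω y ^ (-b) := by
                rw [← Real.mul_rpow (by norm_num) hy0.le]; congr 1; ring
              have e2 : dB Ω y ^ α = dB Ω y ^ (2*a) * dB Ω y ^ (-b) := by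
                rw [← Real.rpow_add hy0]
                congr 1; rw [ha, hb]; ring
              rw [e1, e2]; ring
          _ = _ := by ring
    _ = _ := lintegral_const_mul' _ _ ENNReal.ofReal_ne_top

lemma whit {Ω : Set E3} (hΩ : IsLipschitzDomain Ω) (α : ℝ) :
    ∃ C > 0, ∀ g : E3 → ℝ≥0∞, Measurable g →
    ∫⁻ x in Ω, g x * ENNReal.ofReal (dB Ω x ^ α) ≤ ENNReal.ofReal C *
      ∫⁻ z in Ω, ENNReal.ofReal (dB Ω z ^ (α-3)) * (∫⁻ x in Metric.ball z (dB Ω z / 8), g x) := by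
  have hm := hΩ.isOpen.measurableSet
  have hkap := kap_pos
  obtain ⟨c, hc⟩ : ∃ c : ℝ, c = (2 ^ |-(α-3)|)⁻¹ * kap * (1/16)^3 := ⟨_, rfl⟩
  have hc0 : 0 < c := by rw [hc]; positivity
  refine ⟨c⁻¹, by positivity, fun g hg => ?_⟩
  let S : Set (E3 × E3) := {p | dist p.2 p.1 < dB Ω p.1 / 8}
  have hS : MeasurableSet S := by
    refine measurableSet_lt (by fun_prop) ?_
    exact (((dB_cont Ω).measurable).comp measurable_fst).div_const 8
  have hH : Measurable fun p : E3 × E3 => ENNReal.ofReal (dB Ω p.1 ^ (α-3)) * g p.2 :=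
    (dB1_meas Ω _).mul (hg.comp measurable_snd)
  have e1 : ∫⁻ z in Ω, ENNReal.ofReal (dB Ω z ^ (α-3)) * (∫⁻ x in Metric.ball z (dB Ω z / 8), g x)
     = ∫⁻ z in Ω, (∫⁻ y in {y | (z,y) ∈ S} ∩ Ω, ENNReal.ofReal (dB Ω z ^ (α-3)) * g y) := by
        refine setLIntegral_congr_fun hm fun z hz => ?_
        have : {y | (z,y) ∈ S} ∩ Ω = Metric.ball z (dB Ω z / 8) := by
          rw [Set.inter_eq_left.2]
          · rfl
          · intro y hy
            refine dball_sub hΩ hz (Metric.ball_subset_ball ?_ hy)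
            linarith [dB_nonneg Ω z]
        rw [this, lintegral_const_mul' _ _ ENNReal.ofReal_ne_top]
  rw [e1, fubS hm hS hH, ← lintegral_const_mul' _ _ ENNReal.ofReal_ne_top]
  refine setLIntegral_mono' hm fun x hx => ?_
  have hx0 := dB_pos hΩ hx
  have hsub : Metric.ball x (dB Ω x / 16) ⊆ {z | (z,x) ∈ S} ∩ Ω := by
    intro z hz
    rw [Metric.mem_ball] at hz
    refine ⟨?_, dball_sub hΩ hx (by rw [Metric.mem_ball]; linarith)⟩
    show dist x z < dB Ω z / 8
    have := dB_lip Ω x z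
    rw [dist_comm] at hz; linarith
  calc g x * ENNReal.ofReal (dB Ω x ^ α) = ENNReal.ofReal c⁻¹ *
        (ENNReal.ofReal ((2 ^ |-(α-3)|)⁻¹ * dB Ω x ^ (α-3)) * g x * volume (Metric.ball x (dB Ω x / 16))) := by
        rw [vol_ball x (by positivity), mul_comm (ENNReal.ofReal _) (g x), mul_assoc,
          ← ENNReal.ofReal_mul (by positivity), mul_left_comm, ← ENNReal.ofReal_mul (by positivity)]
        congr 2
        have e2 : dB Ω x ^ α = dB Ω x ^ (α-3) * dB Ω x ^ 3 := by
          rw [← Real.rpow_natCast, ← Real.rpow_add hx0]; congr 1; push_cast; ring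
        rw [e2, hc]
        have : (2:ℝ) ^ |-(α-3)| ≠ 0 := by positivity
        field_simp
    _ = ENNReal.ofReal c⁻¹ * ∫⁻ z in Metric.ball x (dB Ω x / 16),
        ENNReal.ofReal ((2 ^ |-(α-3)|)⁻¹ * dB Ω x ^ (α-3)) * g x := by
        rw [setLIntegral_const]
    _ ≤ ENNReal.ofReal c⁻¹ * ∫⁻ z in Metric.ball x (dB Ω x / 16),
        ENNReal.ofReal (dB Ω z ^ (α-3)) * g x := by
        gcongr ENNReal.ofReal c⁻¹ * ?_
        refine setLIntegral_mono' Metric.isOpen_ball.measurableSet fun z hz => ?_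
        have hz' : dist z x < dB Ω x / 16 := hz
        have h1 := dB_lip Ω x z
        have h2 := dB_lip Ω z x
        rw [dist_comm x z] at h1
        gcongr
        rw [inv_mul_le_iff₀ (by positivity), abs_neg]
        exact rpow_cmp hx0 (dB_pos hΩ (hsub hz).2) (by linarith) (by linarith)
    _ ≤ _ := by
        gcongr
end

section
/-! ### Local gradient estimate -/

lemma cutoff : ∃ C > 0, ∀ (z : E3) (r : ℝ), 0 < r → ∃ η : E3 → ℝ, CC η ∧ (∀ x, |η x| ≤ 1) ∧
    (∀ x ∈ Metric.ball z r, η x = 1) ∧ (∀ x ∉ Metric.ball z (2*r), η x = 0 ∧ fderiv ℝ η x = 0) ∧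
    (∀ x, ‖fderiv ℝ η x‖ ≤ C / r) := by
  let χ : ContDiffBump (0:E3) := ⟨1, 3/2, one_pos, by norm_num⟩
  have hχ : CC (fun x => χ x) := ⟨χ.contDiff, χ.hasCompactSupport⟩
  obtain ⟨C, hC, hb⟩ := hχ.fbdd
  refine ⟨C + 1, by positivity, fun z r hr => ?_⟩
  have hfd : ∀ x : E3, HasFDerivAt (fun x => χ (r⁻¹ • (x - z)))
      ((fderiv ℝ χ (r⁻¹ • (x - z))).comp (r⁻¹ • ContinuousLinearMap.id ℝ E3)) x := by
    intro x
    have h1 : HasFDerivAt (fun x : E3 => r⁻¹ • (x - z)) (r⁻¹ • ContinuousLinearMap.id ℝ E3) x :=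
      ((hasFDerivAt_id x).sub_const z).const_smul r⁻¹
    exact (hχ.diff _).hasFDerivAt.comp x h1
  have hsm : ContDiff ℝ (⊤:ℕ∞) (fun x => χ (r⁻¹ • (x - z))) := by
    have : ContDiff ℝ (⊤:ℕ∞) (fun x : E3 => r⁻¹ • (x - z)) := by fun_prop
    exact hχ.sm.comp this
  have hz : ∀ x, 3/2 * r ≤ dist x z → χ (r⁻¹ • (x - z)) = 0 := by
    intro x hx
    apply χ.zero_of_le_dist
    rw [dist_zero_right, norm_smul, ← dist_eq_norm, Real.norm_of_nonneg (by positivity),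
      le_inv_mul_iff₀ hr]
    show r * (3/2) ≤ _
    linarith
  have hts : tsupport (fun x => χ (r⁻¹ • (x - z))) ⊆ Metric.closedBall z (3/2 * r) := by
    refine closure_minimal ?_ Metric.isClosed_closedBall
    intro x hx
    by_contra h
    rw [Metric.mem_closedBall, not_le] at h
    exact hx (hz x h.le)
  refine ⟨fun x => χ (r⁻¹ • (x - z)), ⟨hsm, ?_⟩, ?_, ?_, ?_, ?_⟩
  · exact (isCompact_closedBall z _).of_isClosed_subset (isClosed_tsupport _) hts
  · intro x
    rw [abs_of_nonneg χ.nonneg]; exact χ.le_one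
  · intro x hx
    apply χ.one_of_mem_closedBall
    rw [Metric.mem_closedBall, dist_zero_right, norm_smul, ← dist_eq_norm,
      Real.norm_of_nonneg (by positivity), inv_mul_le_iff₀ hr]
    rw [Metric.mem_ball] at hx
    show _ ≤ r * 1
    linarith
  · intro x hx
    have : x ∉ tsupport (fun x => χ (r⁻¹ • (x - z))) := fun h => hx (by
      have := hts h
      rw [Metric.mem_closedBall] at this
      rw [Metric.mem_ball]; linarith)
    exact ⟨image_eq_zero_of_notMem_tsupport (f := fun x => χ (r⁻¹ • (x - z))) this,
      fderiv_of_notMem_tsupport ℝ this⟩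
  · intro x
    rw [(hfd x).fderiv]
    refine (ContinuousLinearMap.opNorm_comp_le _ _).trans ?_
    have h1 : ‖r⁻¹ • ContinuousLinearMap.id ℝ E3‖ ≤ r⁻¹ := by
      rw [norm_smul, Real.norm_of_nonneg (by positivity)]
      have := ContinuousLinearMap.norm_id_le (𝕜 := ℝ) (E := E3)
      have h2 : 0 < r⁻¹ := by positivity
      nlinarith
    calc _ ≤ C * r⁻¹ := by gcongr; exact hb _
      _ ≤ _ := by rw [div_eq_mul_inv]; gcongr; linarith

lemma abs_qq_le (V : Fin 3 → E3 → ℝ) (i j : Fin 3) (x : E3) : |qq V i j x| ≤ QQ V x := by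
  unfold QQ
  refine le_trans ?_ (Finset.single_le_sum (f := fun i => ∑ j, |qq V i j x|)
    (fun i _ => Finset.sum_nonneg fun j _ => abs_nonneg _) (Finset.mem_univ i))
  exact Finset.single_le_sum (f := fun j => |qq V i j x|) (fun j _ => abs_nonneg _) (Finset.mem_univ j)

lemma QQ_nonneg (V : Fin 3 → E3 → ℝ) (x : E3) : 0 ≤ QQ V x :=
  (abs_nonneg _).trans (abs_qq_le V 0 0 x)

lemma QQ_cont {V : Fin 3 → E3 → ℝ} (hV : ∀ j, CC (V j)) : Continuous (QQ V) := by
  unfold QQ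
  have := fun i j => (qq_cc hV i j).cont
  fun_prop

lemma QQ_meas {V : Fin 3 → E3 → ℝ} (hV : ∀ j, CC (V j)) : Measurable fun x => ENNReal.ofReal (QQ V x) :=
  (QQ_cont hV).measurable.ennreal_ofReal

lemma loc1 : ∃ C > 0, ∀ V : Fin 3 → E3 → ℝ, (∀ j, CC (V j)) → (∀ x, ∑ i, pds (V i) i x = 0) →
    ∀ (z : E3) (r : ℝ), 0 < r → ∀ i j,
    ∫⁻ x in Metric.ball z r, ENNReal.ofReal (|pds (V j) i x| ^ 3) ≤ ENNReal.ofReal C *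
      ∫⁻ x in Metric.ball z (2*r), ENNReal.ofReal ((QQ V x + (∑ m, |V m x - V m z|) / r) ^ 3) := by
  obtain ⟨C, hC, hcut⟩ := cutoff
  refine ⟨20736 * 3 * (1 + 3 * C) ^ 3, by positivity, fun V hV hdiv z r hr i j => ?_⟩
  obtain ⟨η, hη, hη1, hη2, hη3, hη4⟩ := hcut z r hr
  let U : Fin 3 → E3 → ℝ := fun j x => η x * V j x - V j z * η x
  have hU : ∀ j, CC (U j) := fun j => (hη.mul (hV j)).sub (hη.const_mul _)
  have hpd : ∀ j k x, pds (U j) k x = pds η k x * (V j x - V j z) + η x * pds (V j) k x := by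
    intro j k x
    have h1 := (hη.diff x).hasFDerivAt
    have h2 := (hV j).diff x |>.hasFDerivAt
    have h3 := (h1.mul h2).sub (h1.const_mul (V j z))
    have h4 : fderiv ℝ (U j) x = _ := h3.fderiv
    simp only [pds]
    rw [h4]; simp; ring
  have hpη : ∀ k x, |pds η k x| ≤ C / r := by
    intro k x
    have := (fderiv ℝ η x).le_opNorm (ee k)
    rw [ee_norm, mul_one] at this
    exact this.trans (hη4 x)
  obtain ⟨W, hW⟩ : ∃ W : E3 → ℝ, ∀ x, W x = ∑ m, |V m x - V m z| := ⟨_, fun _ => rfl⟩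
  have hWm : ∀ m x, |V m x - V m z| ≤ W x := fun m x => by
    rw [hW]; exact Finset.single_le_sum (f := fun m => |V m x - V m z|)
      (fun j _ => abs_nonneg _) (Finset.mem_univ m)
  have hW0 : ∀ x, 0 ≤ W x := fun x => (abs_nonneg _).trans (hWm 0 x)
  have hcdb : ∀ j k x, |hcd U j k x| ≤ (1 + 3 * C) * (QQ V x + W x / r) := by
    intro j k x
    have e : hcd U j k x = η x * qq V k j x + (pds η k x * (V j x - V j z)
        - pds η j x * (V k x - V k z) + if j = k then ∑ m, pds η m x * (V m x - V m z) else 0) := by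
      simp only [hcd, qq, hpd]
      by_cases h : j = k
      · subst h
        simp only [if_true, Finset.sum_add_distrib, ← Finset.mul_sum, hdiv]; ring
      · simp only [h, if_false]; ring
    have hb : ∀ k m, |pds η k x * (V m x - V m z)| ≤ C / r * |V m x - V m z| := by
      intro k m; rw [abs_mul]; gcongr; exact hpη k x
    have hb1 : ∀ k m, |pds η k x * (V m x - V m z)| ≤ C / r * W x :=
      fun k m => (hb k m).trans (by gcongr; exact hWm m x)
    have h3 : |if j = k then ∑ m, pds η m x * (V m x - V m z) else 0| ≤ C / r * W x := by
      split_ifs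
      · refine (Finset.abs_sum_le_sum_abs _ _).trans ?_
        rw [hW, Finset.mul_sum]
        exact Finset.sum_le_sum fun m _ => hb m m
      · have := hW0 x; simp; positivity
    have h4 : |η x * qq V k j x| ≤ QQ V x := by
      rw [abs_mul]
      have := abs_qq_le V k j x
      have h5 := hη1 x
      nlinarith [abs_nonneg (η x), abs_nonneg (qq V k j x)]
    have h6 : |hcd U j k x| ≤ QQ V x + (C / r * W x + C / r * W x + C / r * W x) := by
      rw [e]
      refine (abs_add_le _ _).trans (add_le_add h4 ((abs_add_le _ _).trans (add_le_add ?_ h3)))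
      exact (abs_sub _ _).trans (add_le_add (hb1 _ _) (hb1 _ _))
    have h7 : C / r * W x = C * (W x / r) := by ring
    have h8 : 0 ≤ W x / r := by have := hW0 x; positivity
    have := QQ_nonneg V x
    rw [h7] at h6
    nlinarith
  have hcd0 : ∀ j k, ∀ x ∉ Metric.ball z (2*r), hcd U j k x = 0 := by
    intro j k x hx
    obtain ⟨h1, h2⟩ := hη3 x hx
    have h3 : ∀ j k, pds (U j) k x = 0 := by
      intro j k; rw [hpd, h1]; simp [pds, h2]
    simp [hcd, h3]
  have hres := resA hU i j
  have s1 : ∫⁻ x in Metric.ball z r, ENNReal.ofReal (|pds (V j) i x| ^ 3) ≤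
      ENNReal.ofReal (∫ x, |pds (U j) i x| ^ 3) := by
    rw [ofReal_integral_eq_lintegral_ofReal ((hU j).pds i).abs3
      (Eventually.of_forall fun x => by positivity)]
    calc _ = ∫⁻ x in Metric.ball z r, ENNReal.ofReal (|pds (U j) i x| ^ 3) := by
          refine setLIntegral_congr_fun Metric.isOpen_ball.measurableSet fun x hx => ?_
          have h1 : η =ᶠ[𝓝 x] fun _ => 1 :=
            Filter.eventually_of_mem (Metric.isOpen_ball.mem_nhds hx) fun y hy => hη2 y hy
          have h2 : fderiv ℝ η x = 0 := by rw [h1.fderiv_eq]; simp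
          rw [hpd, hη2 x hx]; simp [pds, h2]
      _ ≤ _ := setLIntegral_le_lintegral _ _
  have s2 : ∀ k, ENNReal.ofReal (∫ x, |hcd U j k x| ^ 3) ≤ ENNReal.ofReal ((1+3*C)^3) *
      ∫⁻ x in Metric.ball z (2*r), ENNReal.ofReal ((QQ V x + W x / r) ^ 3) := by
    intro k
    rw [ofReal_integral_eq_lintegral_ofReal (CC.hcd hU j k).abs3
      (Eventually.of_forall fun x => by positivity), ← lintegral_const_mul' _ _ ENNReal.ofReal_ne_top,
      ← lintegral_indicator Metric.isOpen_ball.measurableSet]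
    refine lintegral_mono fun x => ?_
    by_cases hx : x ∈ Metric.ball z (2*r)
    · rw [Set.indicator_of_mem hx, ← ENNReal.ofReal_mul (by positivity), ← mul_pow]
      gcongr
      exact hcdb j k x
    · simp [hcd0 j k x hx]
  calc _ ≤ ENNReal.ofReal (∫ x, |pds (U j) i x| ^ 3) := s1
    _ ≤ ENNReal.ofReal (20736 * ∑ k, ∫ x, |hcd U j k x|^3) := ENNReal.ofReal_le_ofReal hres
    _ = ENNReal.ofReal 20736 * ∑ k, ENNReal.ofReal (∫ x, |hcd U j k x|^3) := by
      rw [ENNReal.ofReal_mul (by norm_num), ENNReal.ofReal_sum_of_nonneg]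
      intro k _; exact integral_nonneg fun x => by positivity
    _ ≤ ENNReal.ofReal 20736 * ∑ k : Fin 3, ENNReal.ofReal ((1+3*C)^3) *
      ∫⁻ x in Metric.ball z (2*r), ENNReal.ofReal ((QQ V x + W x / r) ^ 3) := by
      gcongr with k; exact s2 k
    _ = _ := by
      simp only [hW]
      rw [Finset.sum_const, Finset.card_univ, Fintype.card_fin, nsmul_eq_mul,
        ENNReal.ofReal_mul (by norm_num), ENNReal.ofReal_mul (by norm_num)]
      rw [show ENNReal.ofReal (3:ℝ) = ((3:ℕ):ℝ≥0∞) by simp]; ring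
end

section
/-! ### Weighted Gaffney inequality -/

/-- solenoidal test fields in components -/
structure SV (Ω : Set E3) (V : Fin 3 → E3 → ℝ) : Prop where
  cc : ∀ j, CC (V j)
  supp : ∀ j, tsupport (V j) ⊆ Ω
  div : ∀ x, ∑ i, pds (V i) i x = 0

lemma SV.pds0 {Ω : Set E3} {V : Fin 3 → E3 → ℝ} (h : SV Ω V) {x : E3} (hx : x ∉ Ω) (i j : Fin 3) :
    pds (V j) i x = 0 := by
  simp only [pds]
  rw [fderiv_of_notMem_tsupport ℝ (fun h1 => hx (h.supp j h1))]; simp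

lemma SV.QQ0 {Ω : Set E3} {V : Fin 3 → E3 → ℝ} (h : SV Ω V) {x : E3} (hx : x ∉ Ω) : QQ V x = 0 := by
  simp [QQ, qq, h.pds0 hx]

lemma SV.lint {Ω : Set E3} (hΩ : IsLipschitzDomain Ω) {V : Fin 3 → E3 → ℝ} (h : SV Ω V) {S : Set E3}
    (k : E3 → ℝ≥0∞) :
    ∫⁻ y in S, ENNReal.ofReal (QQ V y) * k y = ∫⁻ y in S ∩ Ω, ENNReal.ofReal (QQ V y) * k y := by
  have hm := hΩ.isOpen.measurableSet
  rw [Set.inter_comm, ← Measure.restrict_restrict hm, ← lintegral_indicator hm]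
  refine lintegral_congr fun y => ?_
  by_cases hy : y ∈ Ω
  · rw [Set.indicator_of_mem hy]
  · rw [Set.indicator_of_notMem hy, h.QQ0 hy]; simp

lemma pow3_add (a b : ℝ≥0∞) : (a + b) ^ 3 ≤ 8 * (a ^ 3 + b ^ 3) := by
  have key : ∀ a b : ℝ≥0∞, a ≤ b → (a + b) ^ 3 ≤ 8 * (a ^ 3 + b ^ 3) := by
    intro a b h
    calc (a + b) ^ 3 ≤ (b + b) ^ 3 := by gcongr
      _ = 8 * b ^ 3 := by ring
      _ ≤ _ := by gcongr; exact le_add_self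
  rcases le_total a b with h | h
  · exact key a b h
  · rw [add_comm a b, add_comm (a^3)]; exact key b a h

lemma loc2 {Ω : Set E3} (hΩ : IsLipschitzDomain Ω) : ∃ C > 0, ∀ V : Fin 3 → E3 → ℝ, SV Ω V →
    ∀ z ∈ Ω, ∀ i j,
    ∫⁻ x in Metric.ball z (dB Ω z / 8), ENNReal.ofReal (|pds (V j) i x| ^ 3) ≤ ENNReal.ofReal C *
      (ENNReal.ofReal (dB Ω z ^ 2) * (∫⁻ y in Metric.ball z (dB Ω z / 2),
        ENNReal.ofReal (QQ V y) ^ 3 * ENNReal.ofReal (dist z y ^ (-2:ℝ))) +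
      ENNReal.ofReal (dB Ω z ^ 3) * (∫⁻ y in (Metric.ball z (dB Ω z / 2))ᶜ ∩ Ω,
        ENNReal.ofReal (QQ V y) * ENNReal.ofReal (dist z y ^ (-3:ℝ))) ^ 3) := by
  obtain ⟨C₁, hC₁, hl⟩ := loc1
  obtain ⟨C, hC, hk⟩ := ker_inner hΩ (a := 0) (θ := 0) le_rfl le_rfl (by norm_num)
  have hk' : ∀ x ρ, 0 < ρ → ∫⁻ y in Metric.ball x ρ ∩ Ω, ENNReal.ofReal (dist x y ^ (-2:ℝ)) ≤
      ENNReal.ofReal (C * ρ) := by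
    intro x ρ hρ
    have := hk x ρ hρ
    simpa using this
  have hmK := mK_pos
  have hkap := kap_pos
  obtain ⟨K1, hK1⟩ : ∃ K1 : ℝ, K1 = 8 + 512 * (24/mK)^3 * (C^3 + kap * C^2/64) := ⟨_, rfl⟩
  obtain ⟨K2, hK2⟩ : ∃ K2 : ℝ, K2 = 512 * (24/mK)^3 * (kap / 64 * (22/4)^3) := ⟨_, rfl⟩
  have hK10 : 0 < K1 := by rw [hK1]; positivity
  have hK20 : 0 < K2 := by rw [hK2]; positivity
  refine ⟨C₁ * (K1 + K2), by positivity, fun V hV z hz i j => ?_⟩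
  obtain ⟨δ, hδ⟩ : ∃ δ, δ = dB Ω z := ⟨_, rfl⟩
  have hδ0 : 0 < δ := hδ ▸ dB_pos hΩ hz
  have h1 := hl V hV.cc hV.div z (δ/8) (by positivity) i j
  rw [← hδ]
  rw [show 2 * (δ/8) = δ/4 by ring] at h1
  obtain ⟨f, hf⟩ : ∃ f : E3 → ℝ≥0∞, ∀ y, f y = ENNReal.ofReal (QQ V y) := ⟨_, fun _ => rfl⟩
  have hfm : Measurable f := by
    have : f = fun y => ENNReal.ofReal (QQ V y) := funext hf
    rw [this]; exact QQ_meas hV.cc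
  have hlf := fun S => hV.lint hΩ (S := S)
  simp only [← hf] at hlf ⊢
  obtain ⟨I2, hI2⟩ : ∃ I2, I2 = ∫⁻ y in Metric.ball z (δ / 2), f y ^ 3 * ENNReal.ofReal (dist z y ^ (-2:ℝ)) :=
    ⟨_, rfl⟩
  obtain ⟨O, hO⟩ : ∃ O, O = ∫⁻ y in (Metric.ball z (δ / 2))ᶜ ∩ Ω, f y * ENNReal.ofReal (dist z y ^ (-3:ℝ)) :=
    ⟨_, rfl⟩
  rw [← hI2, ← hO]
  have hB2m : MeasurableSet (Metric.ball z (δ/2)) := Metric.isOpen_ball.measurableSet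
  have hB1m : MeasurableSet (Metric.ball z (δ/4)) := Metric.isOpen_ball.measurableSet
  have hB2Ω : Metric.ball z (δ/2) ⊆ Ω :=
    (Metric.ball_subset_ball (by rw [← hδ]; linarith)).trans (dball_sub hΩ hz)
  have hB1Ω : Metric.ball z (δ/4) ⊆ Ω :=
    (Metric.ball_subset_ball (by linarith)).trans hB2Ω
  have hkb : ∀ x ∈ Metric.ball z (δ/2), ∫⁻ y in Metric.ball z (δ/2), ENNReal.ofReal (dist x y ^ (-2:ℝ)) ≤
      ENNReal.ofReal (C * δ) := by
    intro x hx
    refine (lintegral_mono_set ?_).trans (hk' x δ hδ0)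
    intro y hy
    refine ⟨?_, hB2Ω hy⟩
    have := dist_triangle_right y x z
    rw [Metric.mem_ball] at hx hy ⊢; linarith
  have hI0 : ∫⁻ y in Metric.ball z (δ/2), f y ^ 3 ≤ ENNReal.ofReal (δ^2) * I2 := by
    rw [hI2, ← lintegral_const_mul' _ _ ENNReal.ofReal_ne_top]
    refine setLIntegral_mono_ae' hB2m ?_
    filter_upwards [ae_ne z] with y hy hyB
    have hd : 0 < dist z y := dist_pos.2 hy.symm
    rw [mul_left_comm, ← ENNReal.ofReal_mul (by positivity)]
    refine le_mul_of_one_le_right (by simp) ?_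
    rw [← ENNReal.ofReal_one]
    apply ENNReal.ofReal_le_ofReal
    rw [Real.rpow_neg hd.le, ← div_eq_mul_inv, le_div_iff₀ (by positivity), one_mul]
    rw [Metric.mem_ball, dist_comm] at hyB
    norm_num
    gcongr; linarith
  have hN : ∀ x ∈ Metric.ball z (δ/2), (∫⁻ y in Metric.ball z (δ/2), f y * ENNReal.ofReal (dist x y ^ (-2:ℝ))) ^ 3
      ≤ (∫⁻ y in Metric.ball z (δ/2), f y ^ 3 * ENNReal.ofReal (dist x y ^ (-2:ℝ))) * ENNReal.ofReal (C*δ) ^ 2 := by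
    intro x hx
    have h := schurD hΩ hB2m hB2Ω (dist_rpow_meas x (-2)) hfm 0
    simp only [mul_zero, neg_zero, Real.rpow_zero, ENNReal.ofReal_one, mul_one] at h
    refine h.trans ?_
    gcongr
    exact hkb x hx
  obtain ⟨N1, hN1⟩ : ∃ N1 : E3 → ℝ≥0∞, ∀ x, N1 x =
    ∫⁻ y in Metric.ball z (δ/2), f y * ENNReal.ofReal (dist x y ^ (-2:ℝ)) := ⟨_, fun _ => rfl⟩
  have hzB : z ∈ Metric.ball z (δ/2) := Metric.mem_ball_self (by positivity)
  have hN2 : N1 z ^ 3 ≤ I2 * ENNReal.ofReal (C*δ) ^ 2 := by rw [hN1, hI2]; exact hN z hzB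
  have hN1i : ∫⁻ x in Metric.ball z (δ/4), N1 x ^ 3 ≤ ENNReal.ofReal (δ^2) * I2 * ENNReal.ofReal (C*δ) ^ 3 := by
    calc _ ≤ ∫⁻ x in Metric.ball z (δ/4), (∫⁻ y in Metric.ball z (δ/2),
          f y ^ 3 * ENNReal.ofReal (dist x y ^ (-2:ℝ))) * ENNReal.ofReal (C*δ) ^ 2 := by
          refine setLIntegral_mono' hB1m fun x hx => ?_
          rw [hN1]; exact hN x (Metric.ball_subset_ball (by linarith) hx)
      _ = (∫⁻ y in Metric.ball z (δ/2), (∫⁻ x in Metric.ball z (δ/4),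
          f y ^ 3 * ENNReal.ofReal (dist x y ^ (-2:ℝ)))) * ENNReal.ofReal (C*δ) ^ 2 := by
          rw [lintegral_mul_const' _ _ (by simp)]
          congr 1
          refine lintegral_lintegral_swap (Measurable.aemeasurable ?_)
          exact (((hfm.comp measurable_snd).pow_const 3).mul (dist2_meas _))
      _ ≤ (∫⁻ y in Metric.ball z (δ/2), f y ^ 3 * ENNReal.ofReal (C*δ)) * ENNReal.ofReal (C*δ) ^ 2 := by
          gcongr ?_ * _
          refine setLIntegral_mono' hB2m fun y hy => ?_
          simp only [dist_comm _ y]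
          rw [lintegral_const_mul _ (dist_rpow_meas y _)]
          gcongr
          refine (lintegral_mono_set ?_).trans (hkb y hy)
          exact Metric.ball_subset_ball (by linarith)
      _ = (∫⁻ y in Metric.ball z (δ/2), f y ^ 3) * ENNReal.ofReal (C*δ) ^ 3 := by
          rw [lintegral_mul_const' _ _ (by simp)]; ring
      _ ≤ _ := by gcongr
  obtain ⟨A, hA⟩ : ∃ A, A = ENNReal.ofReal (24 / (δ * mK)) := ⟨_, rfl⟩
  obtain ⟨B, hB⟩ : ∃ B, B = ENNReal.ofReal (22 * (δ/4)) := ⟨_, rfl⟩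
  have hpt : ∀ x ∈ Metric.ball z (δ/4), ENNReal.ofReal ((QQ V x + (∑ m, |V m x - V m z|) / (δ/8)) ^ 3) ≤
      8 * f x ^ 3 + 512 * A ^ 3 * (N1 x ^ 3 + (N1 z ^ 3 + (B * O) ^ 3)) := by
    intro x hx
    have hq := QQ_nonneg V x
    have hm : ∀ m, ENNReal.ofReal |mK * V m x - mK * V m z| ≤ N1 x + N1 z + B * O := by
      intro m
      have := bs1 hV.cc hV.div m (r := δ/4) (by positivity) (le_of_lt hx)
      rw [show 2 * (δ/4) = δ/2 by ring] at this
      simp only [← hf] at this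
      rw [hlf (Metric.ball z (δ/2))ᶜ (fun y => ENNReal.ofReal (dist z y ^ (-3:ℝ))), ← hN1, ← hN1, ← hO,
        ← hB] at this
      exact this
    have e1 : QQ V x + (∑ m, |V m x - V m z|) / (δ/8) = QQ V x + 8 / (δ * mK) *
        ∑ m, |mK * V m x - mK * V m z| := by
      have : ∀ m, |mK * V m x - mK * V m z| = mK * |V m x - V m z| := by
        intro m; rw [← mul_sub, abs_mul, abs_of_pos hmK]
      simp only [this, ← Finset.mul_sum]; field_simp
    have hs : ENNReal.ofReal (QQ V x + (∑ m, |V m x - V m z|) / (δ/8)) ≤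
        f x + A * (N1 x + N1 z + B * O) := by
      rw [e1, ENNReal.ofReal_add hq (by positivity), ENNReal.ofReal_mul (by positivity),
        ENNReal.ofReal_sum_of_nonneg (fun _ _ => abs_nonneg _), hf]
      refine add_le_add le_rfl ?_
      calc _ ≤ ENNReal.ofReal (8 / (δ*mK)) * ∑ m : Fin 3, (N1 x + N1 z + B * O) := by
            gcongr with m; exact hm m
        _ = _ := by
            rw [Finset.sum_const, Finset.card_univ, Fintype.card_fin, nsmul_eq_mul, ← mul_assoc, hA]
            congr 1
            rw [show (((3:ℕ):ℝ≥0∞)) = ENNReal.ofReal 3 by simp, ← ENNReal.ofReal_mul (by positivity)]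
            congr 1; ring
    rw [ENNReal.ofReal_pow (by positivity)]
    calc _ ≤ (f x + A * (N1 x + N1 z + B * O)) ^ 3 := by gcongr
      _ ≤ 8 * (f x ^ 3 + (A * (N1 x + N1 z + B * O)) ^ 3) := pow3_add _ _
      _ = 8 * f x ^ 3 + 8 * A ^ 3 * (N1 x + (N1 z + B * O)) ^ 3 := by ring
      _ ≤ 8 * f x ^ 3 + 8 * A ^ 3 * (8 * (N1 x ^ 3 + (8 * (N1 z ^ 3 + (B * O) ^ 3)))) := by
        gcongr
        refine (pow3_add _ _).trans ?_
        gcongr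
        exact pow3_add _ _
      _ ≤ 8 * f x ^ 3 + 8 * A ^ 3 * (8 * (8 * N1 x ^ 3 + (8 * (N1 z ^ 3 + (B * O) ^ 3)))) := by
        gcongr
        exact le_mul_of_one_le_left (by simp) (by norm_num)
      _ = _ := by ring
  have hN1m : Measurable fun x => N1 x ^ 3 := by
    simp only [hN1]
    refine Measurable.pow_const ?_ 3
    exact Measurable.lintegral_prod_right' (f := fun p : E3 × E3 => f p.2 * ENNReal.ofReal (dist p.1 p.2 ^ (-2:ℝ)))
      ((hfm.comp measurable_snd).mul (dist2_meas _))
  have hinteg : ∫⁻ x in Metric.ball z (δ/4), ENNReal.ofReal ((QQ V x + (∑ m, |V m x - V m z|) / (δ/8)) ^ 3) ≤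
      8 * (ENNReal.ofReal (δ^2) * I2) + 512 * A ^ 3 * (ENNReal.ofReal (δ^2) * I2 * ENNReal.ofReal (C*δ) ^ 3 +
        (I2 * ENNReal.ofReal (C*δ) ^ 2 + (B * O) ^ 3) * ENNReal.ofReal (kap * (δ/4)^3)) := by
    have h8 : (8:ℝ≥0∞) ≠ ⊤ := by norm_num
    calc _ ≤ ∫⁻ x in Metric.ball z (δ/4), (8 * f x ^ 3 + 512 * A ^ 3 * (N1 x ^ 3 + (N1 z ^ 3 + (B * O) ^ 3))) :=
          setLIntegral_mono' hB1m hpt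
      _ = 8 * (∫⁻ x in Metric.ball z (δ/4), f x ^ 3) + 512 * A ^ 3 * ((∫⁻ x in Metric.ball z (δ/4), N1 x ^ 3) +
          (N1 z ^ 3 + (B * O) ^ 3) * ENNReal.ofReal (kap * (δ/4)^3)) := by
          rw [lintegral_add_left (by fun_prop), lintegral_const_mul' _ _ h8, lintegral_const_mul' _ _ (by
            rw [hA]; exact ENNReal.mul_ne_top (by norm_num) (by simp)), lintegral_add_left hN1m,
            setLIntegral_const, vol_ball z (by positivity)]
      _ ≤ _ := by
          gcongr
          refine le_trans (lintegral_mono_set ?_) hI0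
          exact Metric.ball_subset_ball (by linarith)
  have e8 : (8:ℝ≥0∞) = ENNReal.ofReal 8 := by simp
  have e512 : (512:ℝ≥0∞) = ENNReal.ofReal 512 := by simp
  have hfin : 8 * (ENNReal.ofReal (δ^2) * I2) + 512 * A ^ 3 * (ENNReal.ofReal (δ^2) * I2 * ENNReal.ofReal (C*δ) ^ 3 +
        (I2 * ENNReal.ofReal (C*δ) ^ 2 + (B * O) ^ 3) * ENNReal.ofReal (kap * (δ/4)^3))
      = ENNReal.ofReal K1 * (ENNReal.ofReal (δ^2) * I2) + ENNReal.ofReal K2 * (ENNReal.ofReal (δ^3) * O ^ 3) := by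
    calc _ = (8 * ENNReal.ofReal (δ^2) + 512 * A ^ 3 * (ENNReal.ofReal (δ^2) * ENNReal.ofReal (C*δ) ^ 3 +
          ENNReal.ofReal (C*δ) ^ 2 * ENNReal.ofReal (kap * (δ/4)^3))) * I2 +
          (512 * A ^ 3 * (B ^ 3 * ENNReal.ofReal (kap * (δ/4)^3))) * O ^ 3 := by ring
      _ = ENNReal.ofReal (K1 * δ^2) * I2 + ENNReal.ofReal (K2 * δ^3) * O ^ 3 := by
          rw [hA, hB, e8, e512]
          simp (disch := positivity) only [← ENNReal.ofReal_pow, ← ENNReal.ofReal_mul, ← ENNReal.ofReal_add]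
          congr 3
          · rw [hK1]; field_simp; ring
          · rw [hK2]; field_simp; ring
      _ = _ := by
          rw [ENNReal.ofReal_mul hK10.le, ENNReal.ofReal_mul hK20.le]; ring
  calc _ ≤ _ := h1
    _ ≤ ENNReal.ofReal C₁ * (ENNReal.ofReal K1 * (ENNReal.ofReal (δ^2) * I2) +
        ENNReal.ofReal K2 * (ENNReal.ofReal (δ^3) * O ^ 3)) := by
        gcongr; exact hinteg.trans (le_of_eq hfin)
    _ ≤ ENNReal.ofReal C₁ * (ENNReal.ofReal (K1 + K2) * (ENNReal.ofReal (δ^2) * I2) +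
        ENNReal.ofReal (K1 + K2) * (ENNReal.ofReal (δ^3) * O ^ 3)) := by
        gcongr <;> linarith
    _ = _ := by rw [ENNReal.ofReal_mul hC₁.le]; ring

/-- weighted energy of the curl -/
def EQ (Ω : Set E3) (α : ℝ) (V : Fin 3 → E3 → ℝ) : ℝ≥0∞ :=
  ∫⁻ y in Ω, ENNReal.ofReal (QQ V y) ^ 3 * ENNReal.ofReal (dB Ω y ^ α)

lemma gaffney {Ω : Set E3} (hΩ : IsLipschitzDomain Ω) {α : ℝ} (hα0 : 0 ≤ α) (hα : α < 2) :
    ∃ C > 0, ∀ V : Fin 3 → E3 → ℝ, SV Ω V → ∀ i j,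
    ∫⁻ x in Ω, ENNReal.ofReal (|pds (V j) i x| ^ 3) * ENNReal.ofReal (dB Ω x ^ α) ≤
      ENNReal.ofReal C * EQ Ω α V := by
  obtain ⟨Cw, hCw, hw⟩ := whit hΩ α
  obtain ⟨C1, hC1, h1⟩ := fub1 hΩ α
  obtain ⟨C2, hC2, h2⟩ := fub2 hΩ hα0 hα
  obtain ⟨C3, hC3, h3⟩ := loc2 hΩ
  have hm := hΩ.isOpen.measurableSet
  refine ⟨Cw * (C3 * (C1 + C2)), by positivity, fun V hV i j => ?_⟩
  have hgm : Measurable fun x => ENNReal.ofReal (|pds (V j) i x| ^ 3) := by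
    have := ((hV.cc j).pds i).cont.measurable
    exact (this.abs.pow_const 3).ennreal_ofReal
  have h1' := h1 _ ((QQ_meas hV.cc).pow_const 3)
  have h2' := h2 _ (QQ_meas hV.cc)
  refine (hw _ hgm).trans ?_
  rw [ENNReal.ofReal_mul hCw.le, mul_assoc]
  refine mul_le_mul_right ?_ _
  obtain ⟨f, hf⟩ : ∃ f : E3 → ℝ≥0∞, ∀ y, f y = ENNReal.ofReal (QQ V y) := ⟨_, fun _ => rfl⟩
  simp only [EQ, ← hf] at h1' h2' ⊢
  have hfm : Measurable f := by
    have : f = fun y => ENNReal.ofReal (QQ V y) := funext hf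
    rw [this]; exact QQ_meas hV.cc
  have hdm := dB_rpow_meas Ω (α-1)
  calc _ ≤ ∫⁻ z in Ω, ENNReal.ofReal C3 * (ENNReal.ofReal (dB Ω z ^ (α-1)) * (∫⁻ y in Metric.ball z (dB Ω z / 2),
        f y ^ 3 * ENNReal.ofReal (dist z y ^ (-2:ℝ))) +
        ENNReal.ofReal (dB Ω z ^ α) * (∫⁻ y in (Metric.ball z (dB Ω z / 2))ᶜ ∩ Ω,
        f y * ENNReal.ofReal (dist z y ^ (-3:ℝ))) ^ 3) := by
        refine setLIntegral_mono' hm fun z hz => ?_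
        have hz0 := dB_pos hΩ hz
        have h4 := h3 V hV z hz i j
        simp only [← hf] at h4
        refine (mul_le_mul_right h4 _).trans (le_of_eq ?_)
        have e1 : dB Ω z ^ (α-1) = dB Ω z ^ (α-3) * dB Ω z ^ 2 := by
          rw [← Real.rpow_natCast, ← Real.rpow_add hz0]; congr 1; push_cast; ring
        have e2 : dB Ω z ^ α = dB Ω z ^ (α-3) * dB Ω z ^ 3 := by
          rw [← Real.rpow_natCast, ← Real.rpow_add hz0]; congr 1; push_cast; ring
        rw [e1, e2, ENNReal.ofReal_mul (by positivity), ENNReal.ofReal_mul (by positivity)]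
        ring
    _ = ENNReal.ofReal C3 * ((∫⁻ z in Ω, ENNReal.ofReal (dB Ω z ^ (α-1)) * (∫⁻ y in Metric.ball z (dB Ω z / 2),
        f y ^ 3 * ENNReal.ofReal (dist z y ^ (-2:ℝ)))) +
        ∫⁻ z in Ω, ENNReal.ofReal (dB Ω z ^ α) * (∫⁻ y in (Metric.ball z (dB Ω z / 2))ᶜ ∩ Ω,
        f y * ENNReal.ofReal (dist z y ^ (-3:ℝ))) ^ 3) := by
        rw [lintegral_const_mul' _ _ ENNReal.ofReal_ne_top, lintegral_add_left]
        refine hdm.mul ?_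
        have hS : MeasurableSet {p : E3 × E3 | dist p.2 p.1 < dB Ω p.1 / 2} := by
          refine measurableSet_lt (by fun_prop) ?_
          exact (((dB_cont Ω).measurable).comp measurable_fst).div_const 2
        have hH : Measurable fun p : E3 × E3 => f p.2 ^ 3 * ENNReal.ofReal (dist p.1 p.2 ^ (-2:ℝ)) :=
          ((hfm.comp measurable_snd).pow_const 3).mul (dist2_meas _)
        have := Measurable.lintegral_prod_right' (ν := (volume : Measure E3)) (hH.indicator hS)
        refine (Eq.subst (motive := fun g => Measurable g) ?_ this)
        funext z
        rw [← lintegral_indicator Metric.isOpen_ball.measurableSet]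
        rfl
    _ ≤ ENNReal.ofReal C3 * (ENNReal.ofReal C1 * (∫⁻ y in Ω, f y ^ 3 * ENNReal.ofReal (dB Ω y ^ α)) +
        ENNReal.ofReal C2 * ∫⁻ y in Ω, f y ^ 3 * ENNReal.ofReal (dB Ω y ^ α)) := by
        gcongr
    _ = _ := by
        rw [ENNReal.ofReal_mul hC3.le, ENNReal.ofReal_add hC1.le hC2.le]; ring

/-- weighted embedding -/
lemma embI {Ω : Set E3} (hΩ : IsLipschitzDomain Ω) {α : ℝ} (hα0 : 0 ≤ α) (hα : α < 2) :
    ∃ C > 0, ∀ V : Fin 3 → E3 → ℝ, SV Ω V → ∀ j,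
    ∫⁻ x in Ω, ENNReal.ofReal (dB Ω x ^ (-(α/2))) * ENNReal.ofReal (|V j x|) ^ 3 ≤
      ENNReal.ofReal C * EQ Ω α V := by
  obtain ⟨C, hC, h⟩ := wl3 hΩ (α := α) (θ := 0) hα0 le_rfl (by linarith)
  have hm := hΩ.isOpen.measurableSet
  have hmK := mK_pos
  refine ⟨(mK⁻¹)^3 * C, by positivity, fun V hV j => ?_⟩
  have h1 := h _ (QQ_meas hV.cc)
  rw [ENNReal.ofReal_mul (by positivity), mul_assoc]
  refine le_trans ?_ (mul_le_mul_right h1 _)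
  rw [← lintegral_const_mul' _ _ ENNReal.ofReal_ne_top]
  refine lintegral_mono fun x => ?_
  have h2 := bs0 hV.cc hV.div j x
  have h3 := hV.lint hΩ (S := Set.univ) (fun y => ENNReal.ofReal (dist x y ^ (-2:ℝ)))
  rw [Measure.restrict_univ, Set.univ_inter] at h3
  rw [h3] at h2
  have e : |V j x| = mK⁻¹ * |mK * V j x| := by
    rw [abs_mul, abs_of_pos hmK]; field_simp
  rw [e, ENNReal.ofReal_mul (by positivity), mul_pow, ENNReal.ofReal_pow (by positivity), mul_left_comm]
  simp only [add_zero]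
  gcongr

/-- approximation by the regularised operator -/
lemma embE {Ω : Set E3} (hΩ : IsLipschitzDomain Ω) {α : ℝ} (hα0 : 0 ≤ α) (hα : α < 2) :
    ∃ C > 0, ∃ θ > (0:ℝ), ∀ V : Fin 3 → E3 → ℝ, SV Ω V → ∀ j, ∀ ε > 0,
    ∫⁻ x in Ω, ENNReal.ofReal (dB Ω x ^ (-(α/2))) * ENNReal.ofReal (|BSe V ε j x - mK * V j x|) ^ 3 ≤
      ENNReal.ofReal (C * ε ^ θ) * EQ Ω α V := by
  obtain ⟨θ, hθ⟩ : ∃ θ : ℝ, θ = (1 - α/2)/2 := ⟨_, rfl⟩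
  have hθ0 : 0 < θ := by linarith
  obtain ⟨C, hC, h⟩ := wl3 hΩ (α := α) (θ := θ) hα0 hθ0.le (by linarith)
  refine ⟨4^3 * C, by positivity, 3 * θ, by positivity, fun V hV j ε hε => ?_⟩
  have h1 := h _ (QQ_meas hV.cc)
  have e : 4 ^ 3 * C * ε ^ (3 * θ) = (4 * ε ^ θ) ^ 3 * C := by
    rw [mul_comm 3 θ, Real.rpow_mul hε.le]; norm_cast; ring
  rw [e, ENNReal.ofReal_mul (by positivity), mul_assoc]
  refine le_trans ?_ (mul_le_mul_right h1 _)
  rw [← lintegral_const_mul' _ _ ENNReal.ofReal_ne_top]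
  refine lintegral_mono fun x => ?_
  have h2 := bs2 hV.cc hV.div j x hε hθ0.le (by linarith)
  have h3 := hV.lint hΩ (S := Set.univ) (fun y => ENNReal.ofReal (dist x y ^ (-(2+θ))))
  rw [Measure.restrict_univ, Set.univ_inter] at h3
  rw [h3] at h2
  rw [ENNReal.ofReal_pow (by positivity), mul_left_comm, ← mul_pow]
  gcongr
end

section
section Brou
variable {E : Type*} [NormedAddCommGroup E] [InnerProductSpace ℝ E] [FiniteDimensional ℝ E]

theorem det_interp (T : ℝ) (hT : 0 < T) : ∃ (n : ℕ) (t c : Fin n → ℝ),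
    (∀ k, 0 < t k ∧ t k < T) ∧ ∑ k, c k = 1 ∧
    ∀ L : E →L[ℝ] E, (1 + L).det = ∑ k, c k * (1 + t k • L).det := by
  classical
  obtain ⟨N, hN⟩ : ∃ N, N = Module.finrank ℝ E := ⟨_, rfl⟩
  obtain ⟨t, ht⟩ : ∃ t : Fin (N+1) → ℝ, t = fun k : Fin (N+1) => T / (((k:ℕ):ℝ) + 2) := ⟨_, rfl⟩
  have hinj : Function.Injective t := by
    intro a b h
    rw [ht] at h
    simp only at h
    have ha : (0:ℝ) < (a:ℕ) + 2 := by positivity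
    have hb : (0:ℝ) < (b:ℕ) + 2 := by positivity
    rw [div_eq_div_iff ha.ne' hb.ne'] at h
    have := mul_left_cancel₀ hT.ne' h
    apply Fin.ext
    have h2 : ((b:ℕ):ℝ) = ((a:ℕ):ℝ) := by linarith
    exact_mod_cast h2.symm
  refine ⟨N+1, t, fun k => (Lagrange.basis Finset.univ t k).eval 1, ?_, ?_, ?_⟩
  · intro k
    rw [ht]
    simp only
    constructor
    · positivity
    · rw [div_lt_iff₀ (by positivity)]
      have : (0:ℝ) ≤ (k:ℕ) := by positivity
      nlinarith
  · rw [← Polynomial.eval_finsetSum, Lagrange.sum_basis hinj.injOn ⟨0, Finset.mem_univ _⟩]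
    simp
  · intro L
    let b := Module.finBasis ℝ E
    let M := LinearMap.toMatrix b b (L : E →ₗ[ℝ] E)
    obtain ⟨f, hf⟩ : ∃ f : Polynomial ℝ, f = Matrix.det ((Polynomial.X : Polynomial ℝ) • M.map Polynomial.C + (1 : Matrix _ _ ℝ).map Polynomial.C) := ⟨_, rfl⟩
    have hev : ∀ s : ℝ, f.eval s = (1 + s • L).det := by
      intro s
      have h1 : (1 + s • L).det = Matrix.det (1 + s • M) := by
        rw [ContinuousLinearMap.det, ← LinearMap.det_toMatrix b]
        congr 1
        simp only [ContinuousLinearMap.toLinearMap_add, ContinuousLinearMap.toLinearMap_smul, map_add, map_smul]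
        congr 1
        exact LinearMap.toMatrix_one b
      rw [h1, hf, ← Polynomial.coe_evalRingHom, RingHom.map_det]
      congr 1
      ext i j
      simp [Matrix.map_apply, Matrix.add_apply, Matrix.smul_apply, Matrix.one_apply]
      split_ifs <;> simp <;> ring
    have hdeg : f.degree < (Finset.univ : Finset (Fin (N+1))).card := by
      have h := Polynomial.natDegree_det_X_add_C_le M 1
      rw [← hf] at h
      refine lt_of_le_of_lt Polynomial.degree_le_natDegree ?_
      simp only [Finset.card_univ, Fintype.card_fin] at h ⊢
      exact_mod_cast (by omega)
    have hi := Lagrange.eq_interpolate_of_eval_eq (s := Finset.univ) (v := t) (r := fun k => f.eval (t k)) hinj.injOn hdeg (fun _ _ => rfl)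
    have h1 := hev 1
    rw [one_smul] at h1
    rw [← h1]
    conv_lhs => rw [hi]
    rw [Lagrange.interpolate_apply, Polynomial.eval_finsetSum]
    refine Finset.sum_congr rfl fun k _ => ?_
    rw [Polynomial.eval_mul, Polynomial.eval_C, hev]
    ring

theorem det_one_add_pos (L : E →L[ℝ] E) (hL : ‖L‖ < 1) : 0 < (1 + L).det := by
  have hne : ∀ s ∈ Set.Icc (0:ℝ) 1, (1 + s • L).det ≠ 0 := by
    intro s hs
    have h1 : ‖-(s • L)‖ < 1 := by
      rw [norm_neg, norm_smul, Real.norm_of_nonneg hs.1]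
      nlinarith [norm_nonneg L, hs.2]
    have := isUnit_one_sub_of_norm_lt_one h1
    rw [sub_neg_eq_add] at this
    have h2 := this.map (ContinuousLinearMap.toLinearMapRingHom : (E →L[ℝ] E) →+* _)
    have h3 := h2.map (LinearMap.det : (E →ₗ[ℝ] E) →* ℝ)
    exact h3.ne_zero
  have hc : ContinuousOn (fun s : ℝ => (1 + s • L).det) (Set.Icc 0 1) := by
    apply Continuous.continuousOn
    exact ContinuousLinearMap.continuous_det.comp (by fun_prop)
  by_contra hneg
  push Not at hneg
  have h0 : (1 + (0:ℝ) • L).det = 1 := by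
    rw [zero_smul, add_zero]
    exact LinearMap.det_id
  have : (0:ℝ) ∈ Set.Icc ((1 + (1:ℝ) • L).det) ((1 + (0:ℝ) • L).det) := by
    rw [h0, one_smul]; exact ⟨hneg, zero_le_one⟩
  obtain ⟨s, hs, h⟩ := intermediate_value_Icc' zero_le_one hc this
  exact hne s hs h

variable [MeasurableSpace E] [BorelSpace E]

theorem lip_vol_small {K : ℝ≥0} {g : E → E} (hg : LipschitzWith K g) {ρ : ℝ}
    (h0 : ∀ x, ρ ≤ ‖x‖ → g x = 0) {t : ℝ} (ht : 0 < t) (htK : t * K < 1) (μ : Measure E)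
    (hμ : μ = Measure.hausdorffMeasure (Module.finrank ℝ E)) :
    ∫⁻ x in Metric.ball 0 ρ, ENNReal.ofReal ((1 + t • fderiv ℝ g x).det) ∂μ = μ (Metric.ball 0 ρ) := by
  have : μ.IsAddHaarMeasure := by rw [hμ]; infer_instance
  obtain ⟨f, hf⟩ : ∃ f : E → E, f = fun x => x + t • g x := ⟨_, rfl⟩
  have hinj : Function.Injective f := by
    intro x y h
    have h1 : x - y = t • (g y - g x) := by
      rw [hf] at h
      simp only at h
      rw [smul_sub, sub_eq_sub_iff_add_eq_add, h, add_comm]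
    have h2 : ‖x - y‖ ≤ t * (K * ‖x - y‖) := by
      conv_lhs => rw [h1]
      rw [norm_smul, Real.norm_of_nonneg ht.le]
      gcongr
      have := hg.norm_sub_le y x
      rwa [norm_sub_rev y x] at this
    have h3 : ‖x - y‖ = 0 := by
      have := norm_nonneg (x - y)
      nlinarith
    exact sub_eq_zero.1 (norm_eq_zero.1 h3)
  have hsurj : Function.Surjective f := by
    intro y
    have hc : ContractingWith (t.toNNReal * K) (fun x => y - t • g x) := by
      constructor
      · rw [← NNReal.coe_lt_coe]; push_cast; rw [Real.coe_toNNReal _ ht.le]; exact htK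
      · refine LipschitzWith.of_dist_le_mul fun a b => ?_
        rw [dist_eq_norm, dist_eq_norm, show y - t • g a - (y - t • g b) = t • (g b - g a) by rw [smul_sub]; abel, norm_smul, Real.norm_of_nonneg ht.le]
        push_cast; rw [Real.coe_toNNReal _ ht.le, mul_assoc]
        gcongr
        have := hg.norm_sub_le b a
        rwa [norm_sub_rev b a] at this
    have : Nonempty E := ⟨0⟩
    refine ⟨ContractingWith.fixedPoint _ hc, ?_⟩
    have := hc.fixedPoint_isFixedPt
    rw [Function.IsFixedPt] at this
    rw [hf]
    simp only
    exact (sub_eq_iff_eq_add.1 this).symm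
  have himg : f '' Metric.ball 0 ρ = Metric.ball 0 ρ := by
    have hout : ∀ x, ρ ≤ ‖x‖ → f x = x := by
      intro x hx; rw [hf]; simp [h0 x hx]
    ext y
    constructor
    · rintro ⟨x, hx, rfl⟩
      by_contra hy
      simp only [Metric.mem_ball, dist_zero_right, not_lt] at hy hx
      have := hinj (hout _ hy)
      rw [this] at hy
      linarith
    · intro hy
      obtain ⟨x, rfl⟩ := hsurj y
      refine ⟨x, ?_, rfl⟩
      by_contra hx
      simp only [Metric.mem_ball, dist_zero_right, not_lt] at hy hx
      rw [hout x hx] at hy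
      linarith
  have hlf : LipschitzWith (1 + t.toNNReal * K) f := by
    rw [hf]
    refine LipschitzWith.id.add ?_
    refine LipschitzWith.of_dist_le_mul fun a b => ?_
    rw [dist_eq_norm, dist_eq_norm, ← smul_sub, norm_smul, Real.norm_of_nonneg ht.le]
    push_cast; rw [Real.coe_toNNReal _ ht.le, mul_assoc]
    gcongr
    exact hg.norm_sub_le a b
  obtain ⟨D, hD⟩ : ∃ D : Set E, D = {x | DifferentiableAt ℝ g x} := ⟨_, rfl⟩
  have hDm : MeasurableSet D := by rw [hD]; exact measurableSet_of_differentiableAt ℝ g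
  have hDn : μ Dᶜ = 0 := by
    have : ∀ᵐ x ∂μ, DifferentiableAt ℝ g x := hg.ae_differentiableAt
    rw [hD]; exact this
  have hfn : μ (f '' Dᶜ) = 0 := by
    have := hlf.hausdorffMeasure_image_le (d := (Module.finrank ℝ E : ℝ)) (by positivity) Dᶜ
    rw [← hμ, hDn, mul_zero] at this
    exact le_antisymm this bot_le
  have hcv := lintegral_abs_det_fderiv_eq_addHaar_image μ (s := Metric.ball 0 ρ ∩ D) (f := f)
    (f' := fun x => 1 + t • fderiv ℝ g x) (Metric.isOpen_ball.measurableSet.inter hDm) (by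
      intro x hx
      have hx2 : DifferentiableAt ℝ g x := by have := hx.2; rwa [hD] at this
      have h2 := (hasFDerivAt_id x).add (hx2.hasFDerivAt.const_smul t)
      rw [hf]
      exact HasFDerivAt.hasFDerivWithinAt h2) hinj.injOn
  have hI : μ (f '' (Metric.ball 0 ρ ∩ D)) = μ (Metric.ball 0 ρ) := by
    apply le_antisymm
    · calc _ ≤ μ (f '' Metric.ball 0 ρ) := measure_mono (Set.image_mono Set.inter_subset_left)
        _ = _ := by rw [himg]
    · calc μ (Metric.ball 0 ρ) = μ (f '' Metric.ball 0 ρ) := by rw [himg]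
        _ ≤ μ (f '' (Metric.ball 0 ρ ∩ D) ∪ f '' Dᶜ) := by
            apply measure_mono
            rw [← Set.image_union]
            apply Set.image_mono
            intro x hx
            by_cases h : x ∈ D
            · exact Or.inl ⟨hx, h⟩
            · exact Or.inr h
        _ ≤ μ (f '' (Metric.ball 0 ρ ∩ D)) + μ (f '' Dᶜ) := measure_union_le _ _
        _ = _ := by rw [hfn, add_zero]
  rw [← hI, ← hcv]
  have hae : (Metric.ball 0 ρ ∩ D : Set E) =ᵐ[μ] (Metric.ball 0 ρ : Set E) := by
    have : ∀ᵐ x ∂μ, x ∈ D := hDn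
    filter_upwards [this] with x hx
    exact propext ⟨fun h => h.1, fun h => ⟨h, hx⟩⟩
  rw [setLIntegral_congr hae]
  refine lintegral_congr fun x => ?_
  rw [abs_of_pos]
  apply det_one_add_pos
  rw [norm_smul, Real.norm_of_nonneg ht.le]
  have := norm_fderiv_le_of_lipschitz ℝ hg (x₀ := x)
  nlinarith

theorem lip_det_int {K : ℝ≥0} {g : E → E} (hg : LipschitzWith K g) (ρ t : ℝ) (μ : Measure E)
    [IsLocallyFiniteMeasure μ] :
    IntegrableOn (fun x => (1 + t • fderiv ℝ g x).det) (Metric.ball 0 ρ) μ := by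
  have hm : Measurable fun x => (1 + t • fderiv ℝ g x).det := by
    refine ContinuousLinearMap.continuous_det.measurable.comp ?_
    exact measurable_const.add ((measurable_fderiv ℝ g).const_smul t)
  have hcpt : IsCompact (Metric.closedBall (0:E →L[ℝ] E) K) := isCompact_closedBall _ _
  have hc : Continuous fun L : E →L[ℝ] E => (1 + t • L).det :=
    ContinuousLinearMap.continuous_det.comp (by fun_prop)
  obtain ⟨C, hC⟩ := hcpt.exists_bound_of_continuousOn hc.continuousOn
  refine Measure.integrableOn_of_bounded (M := C) ?_ hm.aestronglyMeasurable ?_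
  · exact (measure_ball_lt_top).ne
  · refine Eventually.of_forall fun x => hC _ ?_
    rw [mem_closedBall_zero_iff]
    exact norm_fderiv_le_of_lipschitz ℝ hg

theorem lip_vol {K : ℝ≥0} {g : E → E} (hg : LipschitzWith K g) {ρ : ℝ}
    (h0 : ∀ x, ρ ≤ ‖x‖ → g x = 0) (μ : Measure E)
    (hμ : μ = Measure.hausdorffMeasure (Module.finrank ℝ E)) :
    ∫ x in Metric.ball 0 ρ, (1 + fderiv ℝ g x).det ∂μ = (μ (Metric.ball 0 ρ)).toReal := by
  have : μ.IsAddHaarMeasure := by rw [hμ]; infer_instance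
  obtain ⟨n, t, c, htk, hc, hdet⟩ := det_interp (E := E) (1 / ((K:ℝ) + 1)) (by positivity)
  have hfe : (fun x => (1 + fderiv ℝ g x).det) = fun x => ∑ k, c k * (1 + t k • fderiv ℝ g x).det :=
    funext fun x => hdet _
  rw [hfe, integral_finset_sum _ fun k _ => (lip_det_int hg ρ (t k) μ).const_mul (c k)]
  have : ∀ k, ∫ x in Metric.ball 0 ρ, c k * (1 + t k • fderiv ℝ g x).det ∂μ = c k * (μ (Metric.ball 0 ρ)).toReal := by
    intro k
    have hlt : t k * K < 1 := by
      have h2 := (htk k).2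
      rw [lt_div_iff₀ (by positivity)] at h2
      nlinarith [(htk k).1]
    rw [integral_const_mul]
    congr 1
    rw [integral_eq_lintegral_of_nonneg_ae, lip_vol_small hg h0 (htk k).1 hlt μ hμ]
    · refine Eventually.of_forall fun x => ?_
      apply le_of_lt
      apply det_one_add_pos
      rw [norm_smul, Real.norm_of_nonneg (htk k).1.le]
      have := norm_fderiv_le_of_lipschitz ℝ hg (x₀ := x)
      nlinarith [(htk k).1]
    · exact (lip_det_int hg ρ (t k) μ).1
  simp_rw [this]
  rw [← Finset.sum_mul, hc, one_mul]
end Brou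
end

section
/-- bounded and Lipschitz on a set -/
def BL {X Y : Type*} [NormedAddCommGroup X] [NormedAddCommGroup Y] (s : Set X) (f : X → Y) : Prop :=
  ∃ C : ℝ, 0 ≤ C ∧ (∀ x ∈ s, ‖f x‖ ≤ C) ∧ ∀ x ∈ s, ∀ y ∈ s, ‖f x - f y‖ ≤ C * ‖x - y‖

section BLs
variable {X Y : Type*} [NormedAddCommGroup X] [NormedAddCommGroup Y] [NormedSpace ℝ Y] {s : Set X}

theorem BL.add {f g : X → Y} (hf : BL s f) (hg : BL s g) : BL s (fun x => f x + g x) := by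
  obtain ⟨A, hA, h1, h2⟩ := hf
  obtain ⟨B, hB, h3, h4⟩ := hg
  refine ⟨A + B, by positivity, fun x hx => (norm_add_le _ _).trans (add_le_add (h1 x hx) (h3 x hx)),
    fun x hx y hy => ?_⟩
  rw [add_sub_add_comm, add_mul]
  exact (norm_add_le _ _).trans (add_le_add (h2 x hx y hy) (h4 x hx y hy))

theorem BL.smul {f : X → ℝ} {g : X → Y} (hf : BL s f) (hg : BL s g) : BL s (fun x => f x • g x) := by
  obtain ⟨A, hA, h1, h2⟩ := hf
  obtain ⟨B, hB, h3, h4⟩ := hg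
  refine ⟨2 * (A * B), by positivity, fun x hx => ?_, fun x hx y hy => ?_⟩
  · rw [norm_smul]
    have := mul_le_mul (h1 x hx) (h3 x hx) (norm_nonneg _) hA
    nlinarith [mul_nonneg hA hB]
  · have e : f x • g x - f y • g y = (f x - f y) • g x + f y • (g x - g y) := by
      rw [sub_smul, smul_sub]; abel
    rw [e]
    refine (norm_add_le _ _).trans ?_
    rw [norm_smul, norm_smul]
    have e1 := mul_le_mul (h2 x hx y hy) (h3 x hx) (norm_nonneg _) (by positivity)
    have e2 := mul_le_mul (h1 y hy) (h4 x hx y hy) (norm_nonneg _) hA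
    linarith

theorem BL.const (c : Y) : BL s (fun _ => c) :=
  ⟨‖c‖, norm_nonneg _, fun _ _ => le_rfl, fun x _ y _ => by rw [sub_self, norm_zero]; positivity⟩

theorem BL.invnorm {q : X → Y} (hq : BL s q) {m : ℝ} (hm : 0 < m) (h : ∀ x ∈ s, m ≤ ‖q x‖) :
    BL s (fun x => ‖q x‖⁻¹) := by
  obtain ⟨A, hA, h1, h2⟩ := hq
  refine ⟨m⁻¹ + A * (m⁻¹ * m⁻¹), by positivity, fun x hx => ?_, fun x hx y hy => ?_⟩
  · rw [Real.norm_of_nonneg (by positivity)]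
    have := inv_anti₀ hm (h x hx)
    have h3 : 0 ≤ A * (m⁻¹ * m⁻¹) := by positivity
    linarith
  · have hx0 := hm.trans_le (h x hx)
    have hy0 := hm.trans_le (h y hy)
    have e : ‖q x‖⁻¹ - ‖q y‖⁻¹ = (‖q y‖ - ‖q x‖) * (‖q x‖⁻¹ * ‖q y‖⁻¹) := by
      field_simp
    rw [e, norm_mul, Real.norm_eq_abs, Real.norm_of_nonneg (by positivity : 0 ≤ ‖q x‖⁻¹ * ‖q y‖⁻¹)]
    have e1 : |‖q y‖ - ‖q x‖| ≤ A * ‖x - y‖ := by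
      rw [abs_sub_comm]
      exact (abs_norm_sub_norm_le _ _).trans (h2 x hx y hy)
    have e2 : ‖q x‖⁻¹ * ‖q y‖⁻¹ ≤ m⁻¹ * m⁻¹ :=
      mul_le_mul (inv_anti₀ hm (h x hx)) (inv_anti₀ hm (h y hy)) (by positivity) (by positivity)
    calc _ ≤ A * ‖x - y‖ * (m⁻¹ * m⁻¹) := mul_le_mul e1 e2 (by positivity) (by positivity)
      _ = (A * (m⁻¹ * m⁻¹)) * ‖x - y‖ := by ring
      _ ≤ _ := by gcongr; linarith [inv_pos.2 hm]

theorem BL.cont {f : X → Y} (hf : BL s f) : ContinuousOn f s := by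
  obtain ⟨A, hA, h1, h2⟩ := hf
  have : LipschitzOnWith A.toNNReal f s := by
    refine LipschitzOnWith.of_dist_le_mul fun x hx y hy => ?_
    rw [dist_eq_norm, dist_eq_norm, Real.coe_toNNReal _ hA]
    exact h2 x hx y hy
  exact this.continuousOn
end BLs

section Zero
variable {E : Type*} [NormedAddCommGroup E] [InnerProductSpace ℝ E] [FiniteDimensional ℝ E]

theorem zero_thm (P : E → E) (hP : ∀ r : ℝ, BL (Metric.closedBall 0 r) P) {R : ℝ} (hR : 0 < R)
    (hpos : ∀ c, R ≤ ‖c‖ → 0 < inner ℝ (P c) c) : ∃ c, P c = 0 := by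
  borelize E
  by_contra hno
  push Not at hno
  obtain ⟨B, hB⟩ : ∃ B : Set E, B = Metric.closedBall 0 (2 * R) := ⟨_, rfl⟩
  have memB : ∀ x, x ∈ B ↔ ‖x‖ ≤ 2 * R := by intro x; rw [hB, mem_closedBall_zero_iff]
  obtain ⟨s, hs⟩ : ∃ s : E → ℝ, s = fun x => max 0 (min 1 ((2 * R - ‖x‖) / R)) := ⟨_, rfl⟩
  have s0 : ∀ x, 0 ≤ s x := by intro x; rw [hs]; exact le_max_left _ _
  have s1 : ∀ x, s x ≤ 1 := by intro x; rw [hs]; exact max_le zero_le_one (min_le_left _ _)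
  have sin : ∀ x, ‖x‖ ≤ R → s x = 1 := by
    intro x hx
    have : 1 ≤ (2 * R - ‖x‖) / R := by rw [le_div_iff₀ hR]; linarith
    rw [hs]; simp only; rw [min_eq_left this, max_eq_right zero_le_one]
  have sout : ∀ x, ‖x‖ = 2 * R → s x = 0 := by
    intro x hx
    rw [hs]; simp only; rw [hx]; simp
  have slip : ∀ x y, |s x - s y| ≤ R⁻¹ * ‖x - y‖ := by
    intro x y
    rw [hs]
    simp only
    refine (abs_max_sub_max_le_max _ _ _ _).trans ?_
    rw [sub_self, abs_zero]
    refine max_le (by positivity) ?_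
    refine (abs_min_sub_min_le_max _ _ _ _).trans ?_
    rw [sub_self, abs_zero]
    refine max_le (by positivity) ?_
    rw [← _root_.sub_div, abs_div, abs_of_pos hR, div_eq_inv_mul]
    gcongr
    rw [show 2 * R - ‖x‖ - (2 * R - ‖y‖) = ‖y‖ - ‖x‖ by ring, abs_sub_comm]
    exact abs_norm_sub_norm_le _ _
  have sBL : BL B s := by
    refine ⟨1 + R⁻¹, by positivity, fun x _ => ?_, fun x _ y _ => ?_⟩
    · rw [Real.norm_of_nonneg (s0 x)]; linarith [s1 x, inv_pos.2 hR]
    · rw [Real.norm_eq_abs]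
      refine (slip x y).trans ?_
      gcongr; linarith
  have s'BL : BL B (fun x => 1 + (-1:ℝ) • s x) := (BL.const 1).add ((BL.const (-1)).smul sBL)
  have idBL : BL B (fun x : E => x) := by
    refine ⟨2 * R + 1, by positivity, fun x hx => ?_, fun x _ y _ => ?_⟩
    · have := (memB x).1 hx; linarith
    · nlinarith [norm_nonneg (x - y)]
  obtain ⟨q, hq⟩ : ∃ q : E → E, q = fun x => s x • P x + (1 + (-1:ℝ) • s x) • x := ⟨_, rfl⟩
  have qBL : BL B q := by
    rw [hq]
    exact (sBL.smul (by rw [hB]; exact hP _)).add (s'BL.smul idBL)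
  have qne : ∀ x, q x ≠ 0 := by
    intro x h
    rcases le_total ‖x‖ R with hx | hx
    · rw [hq] at h
      simp only [sin x hx, smul_eq_mul] at h
      norm_num at h
      exact hno x h
    · have h2 : inner ℝ (q x) x = 0 := by rw [h, inner_zero_left]
      rw [hq] at h2
      simp only at h2
      rw [inner_add_left, real_inner_smul_left, real_inner_smul_left, real_inner_self_eq_norm_sq, smul_eq_mul] at h2
      have h3 := hpos x hx
      have h4 : 0 < ‖x‖ ^ 2 := by have := hR.trans_le hx; positivity
      rcases (s0 x).eq_or_lt with h5 | h5
      · rw [← h5] at h2; simp at h2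
        rw [h2] at h4; simp at h4
      · have := mul_pos h5 h3
        have h6 : 0 ≤ (1 + -1 * s x) * ‖x‖ ^ 2 := mul_nonneg (by linarith [s1 x]) h4.le
        linarith
  obtain ⟨m, hm, hmq⟩ : ∃ m > 0, ∀ x ∈ B, m ≤ ‖q x‖ := by
    have hc : IsCompact B := by rw [hB]; exact isCompact_closedBall _ _
    have hne : B.Nonempty := ⟨0, (memB 0).2 (by rw [norm_zero]; positivity)⟩
    obtain ⟨z, hz, hmin⟩ := hc.exists_isMinOn hne qBL.cont.norm
    exact ⟨‖q z‖, norm_pos_iff.2 (qne z), fun x hx => hmin hx⟩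
  obtain ⟨r, hr⟩ : ∃ r : E → E, r = fun x => (2 * R) • (‖q x‖⁻¹ • q x) := ⟨_, rfl⟩
  have rnorm : ∀ x, ‖r x‖ = 2 * R := by
    intro x
    rw [hr]
    simp only
    rw [norm_smul, norm_smul, norm_inv, norm_norm, inv_mul_cancel₀ (norm_ne_zero_iff.2 (qne x)), mul_one,
      Real.norm_of_nonneg (by positivity)]
  have rout : ∀ x, ‖x‖ = 2 * R → r x = x := by
    intro x hx
    have hqx : q x = x := by rw [hq]; simp [sout x hx]
    rw [hr]; simp only; rw [hqx, hx, smul_smul, mul_inv_cancel₀ (by positivity), one_smul]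
  have hBL : BL B (fun x => r x + (-1:ℝ) • x) := by
    rw [hr]
    exact ((BL.const (2*R)).smul ((qBL.invnorm hm hmq).smul qBL)).add ((BL.const (-1)).smul idBL)
  obtain ⟨C, hC, -, hlip⟩ := hBL
  classical
  obtain ⟨g, hg⟩ : ∃ g : E → E, g = fun x => if ‖x‖ ≤ 2 * R then r x + (-1:ℝ) • x else 0 := ⟨_, rfl⟩
  have gin : ∀ x, ‖x‖ ≤ 2 * R → g x = r x + (-1:ℝ) • x := by intro x hx; rw [hg]; simp only [hx, if_true]
  have gout : ∀ x, 2 * R ≤ ‖x‖ → g x = 0 := by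
    intro x hx
    rcases hx.eq_or_lt with h | h
    · rw [gin x h.symm.le, rout x h.symm]; simp
    · rw [hg]; simp only [not_le.2 h, if_false]
  have gmix : ∀ x y, ‖x‖ ≤ 2 * R → 2 * R ≤ ‖y‖ → ‖g x - g y‖ ≤ 2 * C * ‖x - y‖ := by
    intro x y hx hy
    have hy0 : 0 < ‖y‖ := by linarith
    obtain ⟨z, hz⟩ : ∃ z, z = ((2 * R) / ‖y‖) • y := ⟨_, rfl⟩
    have hzn : ‖z‖ = 2 * R := by
      rw [hz, norm_smul, Real.norm_of_nonneg (by positivity)]; field_simp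
    have hyz : ‖y - z‖ = ‖y‖ - 2 * R := by
      have : y - z = (1 - (2 * R) / ‖y‖) • y := by rw [hz, sub_smul, one_smul]
      rw [this, norm_smul, Real.norm_of_nonneg]
      · field_simp
      · rw [sub_nonneg, div_le_one hy0]; exact hy
    have h1 : ‖x - z‖ ≤ 2 * ‖x - y‖ := by
      have h2 : ‖x - z‖ ≤ ‖x - y‖ + ‖y - z‖ := by
        rw [show x - z = (x - y) + (y - z) by abel]; exact norm_add_le _ _
      have h3 : ‖y‖ - ‖x‖ ≤ ‖x - y‖ := by rw [norm_sub_rev]; exact norm_sub_norm_le _ _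
      linarith
    have h4 := hlip x ((memB x).2 hx) z ((memB z).2 hzn.le)
    simp only at h4
    rw [← gin x hx, ← gin z hzn.le, gout z hzn.ge] at h4
    rw [gout y hy]
    refine h4.trans ?_
    nlinarith
  have glip : LipschitzWith (2 * C).toNNReal g := by
    refine LipschitzWith.of_dist_le_mul fun x y => ?_
    rw [dist_eq_norm, dist_eq_norm, Real.coe_toNNReal _ (by positivity)]
    rcases le_total ‖x‖ (2 * R) with hx | hx <;> rcases le_total ‖y‖ (2 * R) with hy | hy
    · rw [gin x hx, gin y hy]
      refine (hlip x ((memB x).2 hx) y ((memB y).2 hy)).trans ?_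
      nlinarith [mul_nonneg hC (norm_nonneg (x - y))]
    · exact gmix x y hx hy
    · rw [norm_sub_rev, norm_sub_rev x]; exact gmix y x hy hx
    · rw [gout x hx, gout y hy, sub_self, norm_zero]; positivity
  obtain ⟨μ, hμ⟩ : ∃ μ : Measure E, μ = Measure.hausdorffMeasure (Module.finrank ℝ E) := ⟨_, rfl⟩
  have : μ.IsAddHaarMeasure := by rw [hμ]; infer_instance
  have hvol := lip_vol glip gout μ hμ
  have hz : ∫ x in Metric.ball 0 (2 * R), (1 + fderiv ℝ g x).det ∂μ = 0 := by
    have hae : ∀ᵐ x ∂μ, DifferentiableAt ℝ g x := glip.ae_differentiableAt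
    have hmem : ∀ᵐ x ∂(μ.restrict (Metric.ball 0 (2*R))), x ∈ Metric.ball (0:E) (2 * R) :=
      ae_restrict_mem Metric.isOpen_ball.measurableSet
    rw [integral_congr_ae (g := fun _ => (0:ℝ)), integral_zero]
    filter_upwards [ae_restrict_of_ae hae, hmem] with x hx hxb
    have hf : HasFDerivAt (fun y => y + g y) (1 + fderiv ℝ g x) x := (hasFDerivAt_id x).add hx.hasFDerivAt
    have hn := hf.norm_sq
    have hconst : (fun y => ‖y + g y‖ ^ 2) =ᶠ[𝓝 x] fun _ => (2 * R) ^ 2 := by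
      filter_upwards [Metric.isOpen_ball.mem_nhds hxb] with y hy
      rw [mem_ball_zero_iff] at hy
      rw [gin y hy.le]
      simp [rnorm y]
    have hD0 := (hn.congr_of_eventuallyEq hconst.symm).unique (hasFDerivAt_const ((2*R)^2) x)
    by_contra hdet
    have hu : IsUnit (LinearMap.det ((1 + fderiv ℝ g x : E →L[ℝ] E) : E →ₗ[ℝ] E)) := isUnit_iff_ne_zero.2 hdet
    have hb : Function.Surjective ((1 + fderiv ℝ g x : E →L[ℝ] E) : E →ₗ[ℝ] E) := by
      rw [← LinearMap.isUnit_iff_isUnit_det] at hu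
      exact ((Module.End.isUnit_iff _).1 hu).2
    obtain ⟨h, hh⟩ := hb (x + g x)
    have h1 := congrArg (fun L => L h) hD0
    simp only [ContinuousLinearMap.coe_coe] at hh
    simp only [_root_.smul_apply, ContinuousLinearMap.comp_apply, innerSL_apply_apply, hh,
      _root_.zero_apply, real_inner_self_eq_norm_sq] at h1
    rw [mem_ball_zero_iff] at hxb
    rw [gin x hxb.le] at h1
    simp [rnorm x] at h1
    exact hR.ne' h1
  rw [hz] at hvol
  have hpos2 : 0 < (μ (Metric.ball (0:E) (2 * R))).toReal :=
    ENNReal.toReal_pos (Metric.measure_ball_pos μ 0 (by positivity)).ne' measure_ball_lt_top.ne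
  linarith
end Zero
end

section
/-- abstract data for the existence theorem -/
structure AbsD (X : Type*) [AddCommGroup X] [Module ℝ X] (N S : Seminorm ℝ X)
    (A B : X → X →ₗ[ℝ] ℝ) (l : X →ₗ[ℝ] ℝ) (κ M K L : ℝ) : Prop where
  κ0 : 0 < κ
  M0 : 0 ≤ M
  K0 : 0 ≤ K
  L0 : 0 ≤ L
  A1 : ∀ v, A v v = N v ^ 3
  A0 : ∀ v φ, |A v φ| ≤ N v ^ 2 * N φ
  A2 : ∀ v w φ, |A v φ - A w φ| ≤ (N v + N w) * N (v - w) * N φ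
  A3 : ∀ v w, κ * N (v - w) ^ 3 ≤ A v (v - w) - A w (v - w)
  B1 : ∀ v, B v v = 0
  B0 : ∀ v φ, |B v φ| ≤ M * S v ^ 2 * N φ
  B2 : ∀ v w φ, |B v φ - B w φ| ≤ M * (S v + S w) * S (v - w) * N φ
  SN : ∀ v, S v ≤ K * N v
  l1 : ∀ φ, |l φ| ≤ L * N φ
  cpt : ∀ R δ : ℝ, 0 < δ → ∃ t : Finset X, ∀ v, N v ≤ R → ∃ w ∈ t, S (v - w) ≤ δ

section AbsS
variable {X : Type*} [AddCommGroup X] [Module ℝ X] {N S : Seminorm ℝ X}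
    {A B : X → X →ₗ[ℝ] ℝ} {l : X →ₗ[ℝ] ℝ} {κ M K L : ℝ}

theorem young3 (a b : ℝ) (ha : 0 ≤ a) (hb : 0 ≤ b) : a ^ 2 * b ≤ (2 * a ^ 3 + b ^ 3) / 3 := by
  nlinarith [mul_nonneg (add_nonneg (mul_nonneg zero_le_two ha) hb) (sq_nonneg (a - b))]

/-- approximate solution of the monotone problem with a given right-hand side -/
theorem solve_mono (H : AbsD X N S A B l κ M K L) (f : X →ₗ[ℝ] ℝ) (C : ℝ) (hC : 0 ≤ C)
    (hf : ∀ φ, |f φ| ≤ C * N φ) (δ : ℝ) (hδ : 0 < δ) : ∃ w, ∀ φ, |A w φ - f φ| ≤ δ * N φ := by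
  obtain ⟨J, hJ⟩ : ∃ J : X → ℝ, J = fun w => N w ^ 3 / 3 - f w := ⟨_, rfl⟩
  have key : ∀ n : ℝ, 0 ≤ n → n ^ 3 / 3 - C * n ≤ 1 → n ≤ 3 * (C + 1) := by
    intro n hn h
    by_contra hlt
    push Not at hlt
    have h1 : 3 * (C + 1) * n ≤ n ^ 2 := by nlinarith
    have h2 : 3 * (C + 1) * n * n ≤ n ^ 3 := by nlinarith
    have h3 : 3 * (C+1) * n ≤ n * n := by nlinarith
    nlinarith [mul_nonneg hC hn]
  have lower : ∀ w, -(C * (3 * (C + 1))) - 1 ≤ J w := by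
    intro w
    rw [hJ]; simp only
    have h1 := (abs_le.1 (hf w)).2
    have hn := apply_nonneg N w
    have h3 : 0 ≤ N w ^ 3 := by positivity
    by_cases h : N w ^ 3 / 3 - C * N w ≤ 1
    · have := key _ hn h
      have h2 := mul_le_mul_of_nonneg_left this hC
      linarith
    · have : 0 ≤ C * (3 * (C+1)) := by positivity
      linarith
  obtain ⟨D, hD⟩ : ∃ D, D = 3 * (C + 1) := ⟨_, rfl⟩
  have hD0 : 0 < D := by rw [hD]; positivity
  obtain ⟨t, ht⟩ : ∃ t, t = min 1 (δ / (2 * (2 * D + 1))) := ⟨_, rfl⟩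
  have ht0 : 0 < t := by rw [ht]; positivity
  have ht1 : t ≤ 1 := by rw [ht]; exact min_le_left _ _
  have ht2 : t * (2 * D + 1) ≤ δ / 2 := by
    have : t ≤ δ / (2 * (2 * D + 1)) := by rw [ht]; exact min_le_right _ _
    rw [le_div_iff₀ (by positivity)] at this
    linarith
  obtain ⟨τ, hτ⟩ : ∃ τ, τ = min 1 (t * δ / 2) := ⟨_, rfl⟩
  have hτ0 : 0 < τ := by rw [hτ]; positivity
  have hτ1 : τ ≤ 1 := by rw [hτ]; exact min_le_left _ _
  have hτ2 : τ ≤ t * δ / 2 := by rw [hτ]; exact min_le_right _ _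
  have hbdd : BddBelow (Set.range J) := ⟨-(C * (3 * (C + 1))) - 1, by rintro _ ⟨w, rfl⟩; exact lower w⟩
  obtain ⟨_, ⟨w, rfl⟩, hw⟩ := exists_lt_of_csInf_lt (Set.range_nonempty J)
    (show sInf (Set.range J) < sInf (Set.range J) + τ by linarith)
  have hmin : ∀ y, J w - τ ≤ J y := by
    intro y
    have := csInf_le hbdd ⟨y, rfl⟩
    linarith
  have hNw : N w ≤ D := by
    rw [hD]
    apply key _ (apply_nonneg N w)
    have h0 := hmin 0
    rw [hJ] at h0
    simp only [map_zero] at h0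
    have h1 := (abs_le.1 (hf w)).2
    linarith
  have one : ∀ φ, N φ ≤ 1 → -δ ≤ A w φ - f φ := by
    intro φ hφ
    have hφ0 := apply_nonneg N φ
    obtain ⟨y, hy⟩ : ∃ y, y = w + t • φ := ⟨_, rfl⟩
    have h1 := hmin y
    rw [hJ] at h1
    simp only at h1
    have h2 : A y w ≤ (2 * N y ^ 3 + N w ^ 3) / 3 :=
      ((abs_le.1 (H.A0 y w)).2).trans (young3 _ _ (apply_nonneg N y) (apply_nonneg N w))
    have h3 : A y y = N y ^ 3 := H.A1 y
    have h4 : A y y = A y w + t * A y φ := by rw [hy]; simp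
    have h5 : f y = f w + t * f φ := by rw [hy]; simp
    have h6 : -(τ) ≤ t * (A y φ - f φ) := by nlinarith
    have h7 : -(δ/2) ≤ A y φ - f φ := by
      by_contra hlt
      push Not at hlt
      have := mul_lt_mul_of_pos_left hlt ht0
      linarith
    have h8 := H.A2 y w φ
    have h9 : N (y - w) ≤ t := by
      rw [hy, add_sub_cancel_left, map_smul_eq_mul, Real.norm_of_nonneg ht0.le]
      nlinarith
    have h10 : N y ≤ D + 1 := by
      have : N y ≤ N w + N (t • φ) := by rw [hy]; exact map_add_le_add N _ _
      rw [map_smul_eq_mul, Real.norm_of_nonneg ht0.le] at this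
      nlinarith
    have h11 : (N y + N w) * N (y - w) * N φ ≤ (2 * D + 1) * t * 1 := by
      have := apply_nonneg N y
      have := apply_nonneg N w
      have := apply_nonneg N (y - w)
      refine mul_le_mul (mul_le_mul (by linarith) h9 (by positivity) (by positivity)) hφ hφ0 (by positivity)
    have := (abs_le.1 h8).2
    linarith
  have two : ∀ φ, N φ ≤ 1 → |A w φ - f φ| ≤ δ := by
    intro φ hφ
    have h1 := one φ hφ
    have h2 := one (-φ) (by rwa [map_neg_eq_map])
    rw [map_neg, map_neg] at h2
    rw [abs_le]; constructor <;> linarith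
  refine ⟨w, fun φ => ?_⟩
  rcases (apply_nonneg N φ).eq_or_lt with h | h
  · have h1 := H.A0 w φ
    have h2 := hf φ
    rw [← h, mul_zero] at h1 h2 ⊢
    have h3 := abs_nonpos_iff.1 h1
    have h4 := abs_nonpos_iff.1 h2
    rw [h3, h4]; simp
  · have h1 := two ((N φ)⁻¹ • φ) (by
      rw [map_smul_eq_mul, Real.norm_of_nonneg (by positivity), inv_mul_cancel₀ h.ne'])
    rw [map_smul, map_smul, smul_eq_mul, smul_eq_mul, ← mul_sub, abs_mul, abs_of_pos (by positivity),
      inv_mul_le_iff₀ h] at h1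
    linarith

theorem eu_norm_le {ι : Type*} [Fintype ι] (x : EuclideanSpace ℝ ι) : ‖x‖ ≤ ∑ i, |x i| := by
  rw [EuclideanSpace.norm_eq]
  apply Real.sqrt_le_iff.2
  refine ⟨Finset.sum_nonneg fun i _ => abs_nonneg _, ?_⟩
  have := Finset.sum_sq_le_sq_sum_of_nonneg (s := Finset.univ) (f := fun i => |x i|) (fun i _ => abs_nonneg _)
  simpa using this

theorem BL_pi {ι Y : Type*} [Fintype ι] [NormedAddCommGroup Y] {s : Set Y} {P : Y → EuclideanSpace ℝ ι}
    (h : ∀ i, BL s (fun c => P c i)) : BL s P := by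
  choose C hC h1 h2 using h
  refine ⟨∑ i, C i, Finset.sum_nonneg fun i _ => hC i, fun x hx => ?_, fun x hx y hy => ?_⟩
  · exact (eu_norm_le _).trans (Finset.sum_le_sum fun i _ => h1 i x hx)
  · refine (eu_norm_le _).trans ?_
    rw [Finset.sum_mul]
    exact Finset.sum_le_sum fun i _ => h2 i x hx y hy

theorem eu_coord_le {ι : Type*} [Fintype ι] (x : EuclideanSpace ℝ ι) (i : ι) : |x i| ≤ ‖x‖ := by
  have := PiLp.norm_apply_le x i
  rwa [Real.norm_eq_abs] at this

theorem cub_small {e σ n κ : ℝ} (hκ : 0 < κ) (he2 : e ≤ κ * σ ^ 3 / 3) (hσ0 : 0 < σ)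
    (hσ1 : σ ≤ 1) (hκn : κ * n ^ 3 ≤ e + 2 * e * n) : n ≤ σ := by
  by_contra hlt
  push Not at hlt
  have hn : 0 < n := hσ0.trans hlt
  have h0 : σ ^ 3 = σ ^ 2 * σ := by ring
  have h1 : σ ^ 2 * σ ≤ σ ^ 2 * n := mul_le_mul_of_nonneg_left hlt.le (sq_nonneg σ)
  have h3 : σ ^ 2 * σ ≤ σ ^ 2 * 1 := mul_le_mul_of_nonneg_left hσ1 (sq_nonneg σ)
  have h2 : e * n ≤ κ * σ ^ 3 / 3 * n := mul_le_mul_of_nonneg_right he2 hn.le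
  have h4 : κ * σ ^ 3 / 3 * n ≤ κ * (σ ^ 2 * n) / 3 := by
    rw [h0]
    have := mul_le_mul_of_nonneg_left h3 (mul_pos hκ hn).le
    linarith
  have h5 : κ * σ ^ 3 ≤ κ * (σ ^ 2 * n) := by rw [h0]; exact mul_le_mul_of_nonneg_left h1 hκ.le
  have h6 : σ ^ 2 * n < n ^ 3 := by
    have : σ ^ 2 < n ^ 2 := by nlinarith
    have := mul_lt_mul_of_pos_right this hn
    linarith [show n ^ 2 * n = n ^ 3 by ring]
  have h7 : κ * (σ ^ 2 * n) < κ * n ^ 3 := mul_lt_mul_of_pos_left h6 hκ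
  linarith

set_option maxHeartbeats 1000000 in
theorem approx_sol (H : AbsD X N S A B l κ M K L) (δ : ℝ) (hδ : 0 < δ) :
    ∃ v, N v ≤ L + 1 ∧ ∀ φ, |A v φ - B v φ - l φ| ≤ δ * N φ := by
  classical
  have hκ := H.κ0
  have hM := H.M0
  have hK := H.K0
  have hL := H.L0
  obtain ⟨σ, hσ⟩ : ∃ σ, σ = min 1 (δ / (2 * (2 * (L+1) + 1))) := ⟨_, rfl⟩
  have hσ0 : 0 < σ := by rw [hσ]; positivity
  have hσ1 : σ ≤ 1 := by rw [hσ]; exact min_le_left _ _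
  have hσ2 : (2 * (L+1) + 1) * σ ≤ δ / 2 := by
    have : σ ≤ δ / (2 * (2 * (L+1) + 1)) := by rw [hσ]; exact min_le_right _ _
    rw [le_div_iff₀ (by positivity)] at this
    linarith
  obtain ⟨e, he⟩ : ∃ e, e = min (δ / 4) (κ * σ ^ 3 / 3) := ⟨_, rfl⟩
  have he0 : 0 < e := by rw [he]; positivity
  have he1 : e ≤ δ / 4 := by rw [he]; exact min_le_left _ _
  have he2 : e ≤ κ * σ ^ 3 / 3 := by rw [he]; exact min_le_right _ _
  obtain ⟨δ₁, hδ₁⟩ : ∃ δ₁, δ₁ = min 1 (e / (M * (2 * (K * (L+1)) + 1) + 1)) := ⟨_, rfl⟩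
  have hδ₁0 : 0 < δ₁ := by rw [hδ₁]; positivity
  have hδ₁1 : δ₁ ≤ 1 := by rw [hδ₁]; exact min_le_left _ _
  have hδ₁2 : M * (2 * (K * (L+1)) + 1) * δ₁ ≤ e := by
    have : δ₁ ≤ e / (M * (2 * (K * (L+1)) + 1) + 1) := by rw [hδ₁]; exact min_le_right _ _
    rw [le_div_iff₀ (by positivity)] at this
    nlinarith
  obtain ⟨t, ht⟩ := H.cpt (L + 1) δ₁ hδ₁0
  have hsolve : ∀ i : t, ∃ w, ∀ φ, |A w φ - (B i.1 φ + l φ)| ≤ e * N φ := by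
    intro i
    refine solve_mono H (B i.1 + l) (M * S i.1 ^ 2 + L) (by positivity) (fun φ => ?_) e he0
    rw [add_mul]
    exact (abs_add_le _ _).trans (add_le_add (H.B0 _ _) (H.l1 _))
  choose w hw using hsolve
  obtain ⟨u, hu⟩ : ∃ u : EuclideanSpace ℝ t → X, u = fun c => ∑ i, c i • w i := ⟨_, rfl⟩
  obtain ⟨W, hW⟩ : ∃ W, W = ∑ i, N (w i) := ⟨_, rfl⟩
  have hW0 : 0 ≤ W := by rw [hW]; exact Finset.sum_nonneg fun i _ => apply_nonneg N _
  have husub : ∀ c c', u c - u c' = u (c - c') := by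
    intro c c'
    rw [hu]; simp only; rw [← Finset.sum_sub_distrib]
    refine Finset.sum_congr rfl fun i _ => ?_
    rw [← sub_smul]; rfl
  have huN : ∀ c, N (u c) ≤ W * ‖c‖ := by
    intro c
    rw [hu, hW, Finset.sum_mul]
    refine (Finset.le_sum_of_subadditive N (map_zero N).le (map_add_le_add N) _ _).trans (Finset.sum_le_sum fun i _ => ?_)
    rw [map_smul_eq_mul, mul_comm]
    exact mul_le_mul_of_nonneg_left (eu_coord_le c i) (apply_nonneg N _)
  obtain ⟨P, hP⟩ : ∃ P : EuclideanSpace ℝ t → EuclideanSpace ℝ t, P = fun c => WithLp.toLp 2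
    fun i => A (u c) (w i) - B (u c) (w i) - l (w i) + e * c i := ⟨_, rfl⟩
  have hPi : ∀ c i, P c i = A (u c) (w i) - B (u c) (w i) - l (w i) + e * c i := by
    intro c i; rw [hP]
  have hPBL : ∀ r, BL (Metric.closedBall 0 r) P := by
    intro r
    apply BL_pi
    intro i
    have hr : ∀ c ∈ Metric.closedBall (0 : EuclideanSpace ℝ t) r, N (u c) ≤ W * |r| := by
      intro c hc
      rw [mem_closedBall_zero_iff] at hc
      exact (huN c).trans (mul_le_mul_of_nonneg_left (hc.trans (le_abs_self r)) hW0)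
    have hS : ∀ c ∈ Metric.closedBall (0 : EuclideanSpace ℝ t) r, S (u c) ≤ K * (W * |r|) := by
      intro c hc
      exact (H.SN _).trans (mul_le_mul_of_nonneg_left (hr c hc) hK)
    have hA : BL (Metric.closedBall 0 r) (fun c => A (u c) (w i)) := by
      have hwi := apply_nonneg N (w i)
      refine ⟨(W * |r|) ^ 2 * N (w i) + 2 * (W * |r|) * W * N (w i), by positivity, fun c hc => ?_,
        fun c hc d hd => ?_⟩
      · rw [Real.norm_eq_abs]
        refine (H.A0 _ _).trans ?_
        have h1 : N (u c) ^ 2 ≤ (W * |r|) ^ 2 := pow_le_pow_left₀ (apply_nonneg N _) (hr c hc) 2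
        have h2 : 0 ≤ 2 * (W * |r|) * W * N (w i) := by positivity
        nlinarith
      · rw [Real.norm_eq_abs]
        refine (H.A2 _ _ _).trans ?_
        rw [husub]
        have h1 := huN (c - d)
        have h2 := hr c hc
        have h3 := hr d hd
        have := apply_nonneg N (u (c - d))
        calc (N (u c) + N (u d)) * N (u (c - d)) * N (w i)
            ≤ (W * |r| + W * |r|) * (W * ‖c - d‖) * N (w i) := by gcongr
          _ = (2 * (W * |r|) * W * N (w i)) * ‖c - d‖ := by ring
          _ ≤ _ := by gcongr; nlinarith [sq_nonneg (W * |r|)]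
    have hB : BL (Metric.closedBall 0 r) (fun c => B (u c) (w i)) := by
      have hwi := apply_nonneg N (w i)
      refine ⟨M * (K * (W * |r|)) ^ 2 * N (w i) + M * (2 * (K * (W * |r|))) * (K * W) * N (w i), by positivity,
        fun c hc => ?_, fun c hc d hd => ?_⟩
      · rw [Real.norm_eq_abs]
        refine (H.B0 _ _).trans ?_
        have h1 : S (u c) ^ 2 ≤ (K * (W * |r|)) ^ 2 := pow_le_pow_left₀ (apply_nonneg S _) (hS c hc) 2
        have h2 : 0 ≤ M * (2 * (K * (W * |r|))) * (K * W) * N (w i) := by positivity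
        have h3 := mul_le_mul_of_nonneg_right (mul_le_mul_of_nonneg_left h1 hM) hwi
        linarith
      · rw [Real.norm_eq_abs]
        refine (H.B2 _ _ _).trans ?_
        rw [husub]
        have h1 : S (u (c - d)) ≤ K * (W * ‖c - d‖) := (H.SN _).trans (mul_le_mul_of_nonneg_left (huN _) hK)
        have h2 := hS c hc
        have h3 := hS d hd
        have := apply_nonneg S (u (c - d))
        calc M * (S (u c) + S (u d)) * S (u (c - d)) * N (w i)
            ≤ M * (K * (W * |r|) + K * (W * |r|)) * (K * (W * ‖c - d‖)) * N (w i) := by gcongr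
          _ = (M * (2 * (K * (W * |r|))) * (K * W) * N (w i)) * ‖c - d‖ := by ring
          _ ≤ _ := by
            gcongr
            have : 0 ≤ M * (K * (W * |r|)) ^ 2 * N (w i) := by positivity
            linarith
    have hc : BL (Metric.closedBall 0 r) (fun c : EuclideanSpace ℝ t => c i) := by
      refine ⟨|r| + 1, by positivity, fun c hc => ?_, fun c hc d hd => ?_⟩
      · rw [Real.norm_eq_abs]
        rw [mem_closedBall_zero_iff] at hc
        linarith [eu_coord_le c i, le_abs_self r]
      · rw [Real.norm_eq_abs]
        have h1 := eu_coord_le (c - d) i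
        have h2 : (c - d) i = c i - d i := rfl
        rw [h2] at h1
        nlinarith [norm_nonneg (c - d), abs_nonneg r]
    have hall := ((hA.add ((BL.const (-1:ℝ)).smul hB)).add (BL.const (-(l (w i))))).add ((BL.const e).smul hc)
    have hfe : (fun c => P c i) = fun c => A (u c) (w i) + (-1:ℝ) • B (u c) (w i) + -(l (w i)) + e • c i := by
      funext c
      rw [hPi, smul_eq_mul, smul_eq_mul]; ring
    rw [hfe]
    exact hall
  have hdot : ∀ c, inner ℝ (P c) c = N (u c) ^ 3 - l (u c) + e * ‖c‖ ^ 2 := by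
    intro c
    have h1 : ∀ f : X →ₗ[ℝ] ℝ, f (u c) = ∑ i, c i * f (w i) := by
      intro f; rw [hu]; simp
    have h2 : N (u c) ^ 3 - l (u c) = ∑ i, c i * (A (u c) (w i) - B (u c) (w i) - l (w i)) := by
      have h3 := H.A1 (u c)
      have h4 := H.B1 (u c)
      rw [h1 (A (u c))] at h3
      rw [h1 (B (u c))] at h4
      simp_rw [mul_sub]
      rw [Finset.sum_sub_distrib, Finset.sum_sub_distrib, ← h3, h4, h1 l]
      ring
    rw [h2, EuclideanSpace.norm_sq_eq, PiLp.inner_apply, Finset.mul_sum, ← Finset.sum_add_distrib]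
    refine Finset.sum_congr rfl fun i _ => ?_
    rw [hPi]
    simp only [RCLike.inner_apply, conj_trivial, Real.norm_eq_abs, sq_abs]
    ring
  have hlow : ∀ n : ℝ, 0 ≤ n → -(L * (L + 1)) ≤ n ^ 3 - L * n := by
    intro n hn
    by_cases h : n ≤ L + 1
    · have : 0 ≤ n ^ 3 := by positivity
      nlinarith
    · push Not at h
      have h1 : n * n ≥ L * n := by nlinarith
      have h2 : n ^ 2 ≥ L := by nlinarith
      have h3 : n ^ 3 ≥ L * n := by nlinarith
      nlinarith [mul_nonneg hL (by linarith : 0 ≤ L + 1)]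
  obtain ⟨c, hc⟩ := zero_thm P hPBL (R := (L * (L+1) + 1) / e + 1) (by positivity) (by
    intro c hc
    rw [hdot]
    have h1 := (abs_le.1 (H.l1 (u c))).2
    have h2 := hlow (N (u c)) (apply_nonneg N _)
    have h3 : (L * (L+1) + 1) / e ≤ ‖c‖ ^ 2 := by
      have h0 : 0 ≤ (L * (L+1) + 1) / e := by positivity
      nlinarith
    rw [div_le_iff₀ he0] at h3
    linarith)
  have hz := hdot c
  rw [hc, inner_zero_left] at hz
  obtain ⟨v, hv⟩ : ∃ v, v = u c := ⟨_, rfl⟩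
  rw [← hv] at hz
  have hNv : N v ≤ L + 1 := by
    by_contra hlt
    push Not at hlt
    have h1 := (abs_le.1 (H.l1 v)).2
    have h2 : 0 ≤ e * ‖c‖ ^ 2 := by positivity
    have h3 : N v ^ 2 > L := by nlinarith
    have h4 : N v ^ 3 > L * N v := by nlinarith
    linarith
  have hN0 := apply_nonneg N v
  obtain ⟨z, hzt, hSz⟩ := ht v hNv
  obtain ⟨wi, hwi⟩ : ∃ wi, wi = w ⟨z, hzt⟩ := ⟨_, rfl⟩
  have hres : ∀ φ, |A wi φ - (B z φ + l φ)| ≤ e * N φ := by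
    intro φ; rw [hwi]; exact hw ⟨z, hzt⟩ φ
  have hSv : S v ≤ K * (L + 1) := (H.SN v).trans (mul_le_mul_of_nonneg_left hNv hK)
  have hSz2 : S z ≤ K * (L + 1) + 1 := by
    have : S z ≤ S v + S (v - z) := by
      have := map_sub_le_add S v (v - z)
      rwa [_root_.sub_sub_cancel] at this
    linarith
  have hBB : ∀ φ, |B v φ - B z φ| ≤ e * N φ := by
    intro φ
    refine (H.B2 v z φ).trans ?_
    have hφ := apply_nonneg N φ
    refine mul_le_mul_of_nonneg_right ?_ hφ
    refine le_trans ?_ hδ₁2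
    have := apply_nonneg S (v - z)
    exact mul_le_mul (mul_le_mul_of_nonneg_left (by linarith) hM) hSz this (by positivity)
  have hcoef : A v (v - wi) - B v (v - wi) - l (v - wi) ≤ e / 4 := by
    have h1 : A v wi - B v wi - l wi + e * c ⟨z, hzt⟩ = 0 := by
      have := hPi c ⟨z, hzt⟩
      rw [hc] at this
      rw [hv, hwi]
      exact this.symm
    rw [map_sub, map_sub, map_sub, H.A1, H.B1]
    have h3 : (c ⟨z, hzt⟩) ^ 2 ≤ ‖c‖ ^ 2 := by
      rw [← sq_abs (c _)]
      exact pow_le_pow_left₀ (abs_nonneg _) (eu_coord_le c _) 2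
    have h4 : e * (c ⟨z, hzt⟩) ^ 2 ≤ e * ‖c‖ ^ 2 := mul_le_mul_of_nonneg_left h3 he0.le
    have h5 : 0 ≤ e * (c ⟨z, hzt⟩ - 1/2) ^ 2 := by positivity
    nlinarith
  obtain ⟨n, hn⟩ : ∃ n, n = N (v - wi) := ⟨_, rfl⟩
  have hn0 : 0 ≤ n := by rw [hn]; exact apply_nonneg N _
  have hκn : κ * n ^ 3 ≤ e + 2 * e * n := by
    have h1 := H.A3 v wi
    have h2 := (abs_le.1 (hres (v - wi))).1
    have h3 := (abs_le.1 (hBB (v - wi))).2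
    rw [← hn] at h1 h2 h3
    linarith
  have hnσ : n ≤ σ := cub_small hκ he2 hσ0 hσ1 hκn
  have hNwi : N wi ≤ L + 1 + 1 := by
    have := map_sub_le_add N v (v - wi)
    rw [_root_.sub_sub_cancel, ← hn] at this
    linarith
  refine ⟨v, hNv, fun φ => ?_⟩
  have hφ := apply_nonneg N φ
  have h1 := H.A2 v wi φ
  rw [← hn] at h1
  have h2 := hres φ
  have h3 := hBB φ
  have h4 : (N v + N wi) * n * N φ ≤ (2 * (L+1) + 1) * σ * N φ := by
    exact mul_le_mul_of_nonneg_right (mul_le_mul (by linarith) hnσ hn0 (by positivity)) hφ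
  have h5 : (2 * (L+1) + 1) * σ * N φ ≤ δ / 2 * N φ := mul_le_mul_of_nonneg_right hσ2 hφ
  have h6 : e * N φ ≤ δ / 4 * N φ := mul_le_mul_of_nonneg_right he1 hφ
  rw [abs_le] at *
  constructor <;> linarith [h1.1, h1.2, h2.1, h2.2, h3.1, h3.2]

theorem abs_exist (H : AbsD X N S A B l κ M K L) : ∃ v : ℕ → X,
    (∀ k m, k ≤ m → N (v k - v m) ≤ 1 / ((k:ℝ) + 1)) ∧
    ∀ k φ, |A (v k) φ - B (v k) φ - l φ| ≤ 1 / ((k:ℝ) + 1) * N φ := by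
  classical
  have hκ := H.κ0
  have hM := H.M0
  have hK := H.K0
  have hL := H.L0
  have hex : ∀ n : ℕ, ∃ v, N v ≤ L + 1 ∧ ∀ φ, |A v φ - B v φ - l φ| ≤ 1 / ((n:ℝ) + 1) * N φ :=
    fun n => approx_sol H _ (by positivity)
  choose y hyN hy using hex
  let f : Ultrafilter ℕ := hyperfilter ℕ
  have hge : ∀ k : ℕ, {n | k ≤ n} ∈ f := by
    intro k
    have : (f : Filter ℕ) ≤ atTop := by rw [← Nat.cofinite_eq_atTop]; exact hyperfilter_le_cofinite
    exact this (Ici_mem_atTop k)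
  have hS : ∀ δ > 0, ∃ U ∈ f, ∀ m ∈ U, ∀ n ∈ U, S (y n - y m) ≤ 2 * δ := by
    intro δ hδ
    obtain ⟨t, ht⟩ := H.cpt (L + 1) δ hδ
    have hu : (⋃ w ∈ (t : Set X), {n | S (y n - w) ≤ δ}) ∈ f := by
      have : (⋃ w ∈ (t : Set X), {n | S (y n - w) ≤ δ}) = Set.univ := by
        ext n
        simp only [Set.mem_iUnion, Set.mem_univ, iff_true]
        obtain ⟨w, hw, h⟩ := ht (y n) (hyN n)
        exact ⟨w, hw, h⟩
      rw [this]; exact Filter.univ_mem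
    rw [Ultrafilter.finite_biUnion_mem_iff t.finite_toSet] at hu
    obtain ⟨w, -, hw⟩ := hu
    refine ⟨_, hw, fun m hm n hn => ?_⟩
    have h1 : S (y n - y m) ≤ S (y n - w) + S (y m - w) := by
      have := map_sub_le_add S (y n - w) (y m - w)
      rwa [sub_sub_sub_cancel_right] at this
    have h2 : S (y n - w) ≤ δ := hn
    have h3 : S (y m - w) ≤ δ := hm
    linarith
  have hN : ∀ ε > 0, ∃ U ∈ f, ∀ m ∈ U, ∀ n ∈ U, N (y n - y m) ≤ ε := by
    intro ε hε
    obtain ⟨d, hd⟩ : ∃ d, d = κ * ε ^ 2 / 3 := ⟨_, rfl⟩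
    have hd0 : 0 < d := by rw [hd]; positivity
    obtain ⟨δ, hδ⟩ : ∃ δ, δ = d / (M * (2 * (K * (L+1))) * 2 + 1) := ⟨_, rfl⟩
    have hδ0 : 0 < δ := by rw [hδ]; positivity
    have hδ1 : M * (2 * (K * (L+1))) * (2 * δ) ≤ d := by
      have : δ ≤ d / (M * (2 * (K * (L+1))) * 2 + 1) := hδ.le
      rw [le_div_iff₀ (by positivity)] at this
      nlinarith
    obtain ⟨U, hU, hUS⟩ := hS δ hδ0
    obtain ⟨k, hk⟩ := exists_nat_one_div_lt hd0
    refine ⟨U ∩ {n | k ≤ n}, inter_mem hU (hge k), fun m hm n hn => ?_⟩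
    have hsm := hUS m hm.1 n hn.1
    have hr : ∀ j, k ≤ j → 1 / ((j:ℝ) + 1) ≤ d := by
      intro j hj
      refine le_trans ?_ hk.le
      apply one_div_le_one_div_of_le (by positivity)
      have : (k:ℝ) ≤ j := by exact_mod_cast hj
      linarith
    obtain ⟨q, hq⟩ : ∃ q, q = N (y n - y m) := ⟨_, rfl⟩
    have hq0 : 0 ≤ q := by rw [hq]; exact apply_nonneg N _
    have h1 := H.A3 (y n) (y m)
    have h2 := (abs_le.1 (hy n (y n - y m))).2
    have h3 := (abs_le.1 (hy m (y n - y m))).1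
    have h4 := (abs_le.1 (H.B2 (y n) (y m) (y n - y m))).2
    rw [← hq] at h1 h2 h3 h4 ⊢
    have h5 : M * (S (y n) + S (y m)) * S (y n - y m) * q ≤ d * q := by
      refine mul_le_mul_of_nonneg_right (le_trans ?_ hδ1) hq0
      have e1 : S (y n) ≤ K * (L+1) := (H.SN _).trans (mul_le_mul_of_nonneg_left (hyN n) hK)
      have e2 : S (y m) ≤ K * (L+1) := (H.SN _).trans (mul_le_mul_of_nonneg_left (hyN m) hK)
      have := apply_nonneg S (y n - y m)
      exact mul_le_mul (mul_le_mul_of_nonneg_left (by linarith) hM) hsm this (by positivity)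
    have h6 := mul_le_mul_of_nonneg_right (hr n hn.2) hq0
    have h7 := mul_le_mul_of_nonneg_right (hr m hm.2) hq0
    have h8 : κ * q ^ 3 ≤ 3 * d * q := by linarith
    by_contra hlt
    push Not at hlt
    rw [hd] at h8
    have h9 : ε ^ 2 < q ^ 2 := by nlinarith
    have h10 : ε ^ 2 * q < q ^ 3 := by nlinarith
    have h11 := mul_lt_mul_of_pos_left h10 hκ
    linarith
  have hN2 : ∀ k : ℕ, ∃ U ∈ f, ∀ m ∈ U, ∀ n ∈ U, N (y n - y m) ≤ 1 / ((k:ℝ) + 1) :=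
    fun k => hN _ (by positivity)
  choose U hU hUN using hN2
  have hne : ∀ k : ℕ, ∃ n, k ≤ n ∧ ∀ j ≤ k, n ∈ U j := by
    intro k
    have h1 : (⋂ j ∈ Finset.range (k+1), U j) ∈ f := by
      rw [← Ultrafilter.mem_coe, Filter.biInter_finset_mem]
      exact fun j _ => hU j
    obtain ⟨n, hn1, hn2⟩ := (f.nonempty_of_mem (inter_mem h1 (hge k)))
    refine ⟨n, hn2, fun j hj => ?_⟩
    simp only [Set.mem_iInter, Finset.mem_range] at hn1
    exact hn1 j (by omega)
  choose i hik hiU using hne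
  refine ⟨fun k => y (i k), fun k m hkm => ?_, fun k φ => ?_⟩
  · exact hUN k _ (hiU m k hkm) _ (hiU k k le_rfl)
  · refine (hy (i k) φ).trans ?_
    refine mul_le_mul_of_nonneg_right ?_ (apply_nonneg N _)
    apply one_div_le_one_div_of_le (by positivity)
    have : (k:ℝ) ≤ i k := by exact_mod_cast hik k
    linarith
end AbsS
end

section
instance fact13 : Fact ((1:ℝ≥0∞) ≤ 3) := ⟨by norm_num⟩

section L3
variable {Z : Type*} [MeasurableSpace Z] {m : Measure Z}
variable {F₁ F₂ F₃ : Type*} [NormedAddCommGroup F₁] [NormedAddCommGroup F₂] [NormedAddCommGroup F₃]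

theorem hold3 (m : Measure Z) (a b c : Z → ℝ≥0∞) (ha : AEMeasurable a m) (hb : AEMeasurable b m) (hc : AEMeasurable c m) :
    ∫⁻ x, a x * b x * c x ∂m ≤ (∫⁻ x, a x ^ 3 ∂m) ^ (1/3:ℝ) * (∫⁻ x, b x ^ 3 ∂m) ^ (1/3:ℝ) *
      (∫⁻ x, c x ^ 3 ∂m) ^ (1/3:ℝ) := by
  have h := ENNReal.lintegral_prod_norm_pow_le (μ := m) (Finset.univ : Finset (Fin 3))
    (f := ![fun x => a x ^ 3, fun x => b x ^ 3, fun x => c x ^ 3]) (p := fun _ => 1/3) (by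
      intro i _
      fin_cases i
      · exact ha.pow_const 3
      · exact hb.pow_const 3
      · exact hc.pow_const 3) (by simp) (by intro i _; norm_num)
  have e : ∀ y : ℝ≥0∞, (y ^ 3) ^ (1/3:ℝ) = y := by
    intro y
    rw [← ENNReal.rpow_natCast, ← ENNReal.rpow_mul]; norm_num
  simp only [Fin.prod_univ_three, Matrix.cons_val_zero, Matrix.cons_val_one, Matrix.cons_val] at h
  simp only [e] at h
  exact h

theorem l3_eq (f : Z → F₁) : eLpNorm f 3 m = (∫⁻ x, ‖f x‖ₑ ^ 3 ∂m) ^ (1/3:ℝ) := by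
  rw [eLpNorm_eq_lintegral_rpow_enorm_toReal (by norm_num) (by norm_num)]
  norm_num

theorem l3_lt {f : Z → F₁} (h : ∫⁻ x, ‖f x‖ₑ ^ 3 ∂m < ⊤) : eLpNorm f 3 m < ⊤ := by
  rw [l3_eq]
  exact ENNReal.rpow_lt_top_of_nonneg (by norm_num) h.ne

theorem l3_pow (f : Z → F₁) : eLpNorm f 3 m ^ 3 = ∫⁻ x, ‖f x‖ₑ ^ 3 ∂m := by
  rw [l3_eq, ← ENNReal.rpow_natCast, ← ENNReal.rpow_mul]; norm_num

theorem hold3_L {f : Z → F₁} {g : Z → F₂} {h : Z → F₃} (hf : MemLp f 3 m) (hg : MemLp g 3 m) (hh : MemLp h 3 m) :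
    ∫⁻ x, ‖f x‖ₑ * ‖g x‖ₑ * ‖h x‖ₑ ∂m ≤ eLpNorm f 3 m * eLpNorm g 3 m * eLpNorm h 3 m := by
  rw [l3_eq, l3_eq, l3_eq]
  exact hold3 m _ _ _ hf.1.enorm hg.1.enorm hh.1.enorm

/-- integrability and bound for functions dominated by a product of three `L³` functions -/
theorem hold3_dom {f : Z → F₁} {g : Z → F₂} {h : Z → F₃} (hf : MemLp f 3 m) (hg : MemLp g 3 m) (hh : MemLp h 3 m)
    {k : Z → ℝ} (hk : AEStronglyMeasurable k m) (hb : ∀ᵐ x ∂m, |k x| ≤ ‖f x‖ * ‖g x‖ * ‖h x‖) :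
    Integrable k m ∧ |∫ x, k x ∂m| ≤ (eLpNorm f 3 m).toReal * (eLpNorm g 3 m).toReal * (eLpNorm h 3 m).toReal := by
  have h1 : ∫⁻ x, ‖k x‖ₑ ∂m ≤ eLpNorm f 3 m * eLpNorm g 3 m * eLpNorm h 3 m := by
    refine le_trans (lintegral_mono_ae ?_) (hold3_L hf hg hh)
    filter_upwards [hb] with x hx
    rw [← ofReal_norm, ← ofReal_norm, ← ofReal_norm, ← ofReal_norm, ← ENNReal.ofReal_mul (norm_nonneg _),
      ← ENNReal.ofReal_mul (by positivity)]
    exact ENNReal.ofReal_le_ofReal hx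
  have hfin : eLpNorm f 3 m * eLpNorm g 3 m * eLpNorm h 3 m < ⊤ :=
    ENNReal.mul_lt_top (ENNReal.mul_lt_top hf.2 hg.2) hh.2
  refine ⟨⟨hk, h1.trans_lt hfin⟩, ?_⟩
  have h2 : |∫ x, k x ∂m| ≤ (∫⁻ x, ‖k x‖ₑ ∂m).toReal := by
    have := norm_integral_le_lintegral_norm k (μ := m)
    rw [Real.norm_eq_abs] at this
    simpa only [ofReal_norm] using this
  refine h2.trans ?_
  rw [← ENNReal.toReal_mul, ← ENNReal.toReal_mul]
  exact ENNReal.toReal_mono hfin.ne h1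

/-- trilinear form on `L³` -/
def tri (f g h : Lp ℝ 3 m) : ℝ := ∫ x, f x * g x * h x ∂m

theorem tri_int (f g h : Lp ℝ 3 m) : Integrable (fun x => f x * g x * h x) m := by
  refine (hold3_dom (Lp.memLp f) (Lp.memLp g) (Lp.memLp h) (k := fun x => f x * g x * h x) ?_ ?_).1
  · exact ((Lp.aestronglyMeasurable f).mul (Lp.aestronglyMeasurable g)).mul (Lp.aestronglyMeasurable h)
  · refine Eventually.of_forall fun x => ?_
    rw [abs_mul, abs_mul]; rfl

theorem tri_bd (f g h : Lp ℝ 3 m) : |tri f g h| ≤ ‖f‖ * ‖g‖ * ‖h‖ := by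
  refine (hold3_dom (Lp.memLp f) (Lp.memLp g) (Lp.memLp h) (k := fun x => f x * g x * h x) ?_ ?_).2
  · exact ((Lp.aestronglyMeasurable f).mul (Lp.aestronglyMeasurable g)).mul (Lp.aestronglyMeasurable h)
  · refine Eventually.of_forall fun x => ?_
    rw [abs_mul, abs_mul]; rfl

theorem tri_sub1 (f f' g h : Lp ℝ 3 m) : tri (f - f') g h = tri f g h - tri f' g h := by
  rw [tri, tri, tri, ← integral_sub (tri_int f g h) (tri_int f' g h)]
  refine integral_congr_ae ?_
  filter_upwards [Lp.coeFn_sub f f'] with x hx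
  rw [hx, Pi.sub_apply]; ring

theorem tri_comm (f g h : Lp ℝ 3 m) : tri f g h = tri g f h := by
  rw [tri, tri]
  exact integral_congr_ae (Eventually.of_forall fun x => by simp only; ring)

theorem tri_add3 (f g h h' : Lp ℝ 3 m) : tri f g (h + h') = tri f g h + tri f g h' := by
  rw [tri, tri, tri, ← integral_add (tri_int f g h) (tri_int f g h')]
  refine integral_congr_ae ?_
  filter_upwards [Lp.coeFn_add h h'] with x hx
  rw [hx, Pi.add_apply]; ring

theorem tri_smul3 (c : ℝ) (f g h : Lp ℝ 3 m) : tri f g (c • h) = c * tri f g h := by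
  rw [tri, tri, ← integral_const_mul]
  refine integral_congr_ae ?_
  filter_upwards [Lp.coeFn_smul c h] with x hx
  rw [hx, Pi.smul_apply, smul_eq_mul]; ring

theorem tri_diff (f g f' g' h : Lp ℝ 3 m) : |tri f g h - tri f' g' h| ≤ (‖f - f'‖ * ‖g‖ + ‖f'‖ * ‖g - g'‖) * ‖h‖ := by
  have e : tri f g h - tri f' g' h = tri (f - f') g h + tri f' (g - g') h := by
    rw [tri_sub1, tri_comm f' (g - g'), tri_sub1, tri_comm g, tri_comm g']
    ring
  rw [e, add_mul]
  exact (abs_add_le _ _).trans (add_le_add (tri_bd _ _ _) (tri_bd _ _ _))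
end L3

section Mono
variable {Z : Type*} [MeasurableSpace Z] {m : Measure Z}
variable {E : Type*} [NormedAddCommGroup E] [InnerProductSpace ℝ E]

theorem pp_lip (p q : E) : ‖‖p‖ • p - ‖q‖ • q‖ ≤ (‖p‖ + ‖q‖) * ‖p - q‖ := by
  have e : ‖p‖ • p - ‖q‖ • q = ‖p‖ • (p - q) + (‖p‖ - ‖q‖) • q := by rw [smul_sub, sub_smul]; abel
  rw [e]
  refine (norm_add_le _ _).trans ?_
  rw [norm_smul, norm_smul, norm_norm, Real.norm_eq_abs]
  have := abs_norm_sub_norm_le p q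
  nlinarith [norm_nonneg q]

theorem pp_mono (p q : E) : 1/2 * ‖p - q‖ ^ 3 ≤ inner ℝ (‖p‖ • p - ‖q‖ • q) (p - q) := by
  have h1 : inner ℝ (‖p‖ • p - ‖q‖ • q) (p - q) = ‖p‖ ^ 3 + ‖q‖ ^ 3 - (‖p‖ + ‖q‖) * inner ℝ p q := by
    rw [inner_sub_left, inner_sub_right, inner_sub_right, real_inner_smul_left, real_inner_smul_left,
      real_inner_smul_left, real_inner_smul_left, real_inner_self_eq_norm_sq, real_inner_self_eq_norm_sq,
      real_inner_comm p q]
    ring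
  have h2 : ‖p - q‖ ^ 2 = ‖p‖ ^ 2 - 2 * inner ℝ p q + ‖q‖ ^ 2 := norm_sub_sq_real p q
  have h3 : ‖p - q‖ ≤ ‖p‖ + ‖q‖ := norm_sub_le p q
  have h4 : ‖p - q‖ ^ 3 ≤ (‖p‖ + ‖q‖) * ‖p - q‖ ^ 2 := by nlinarith [sq_nonneg ‖p - q‖]
  rw [h1]
  rw [h2] at h4
  nlinarith [mul_nonneg (add_nonneg (norm_nonneg p) (norm_nonneg q)) (sq_nonneg (‖p‖ - ‖q‖))]

/-- the monotone form -/
def mon (f g : Lp E 3 m) : ℝ := ∫ x, inner ℝ (‖f x‖ • f x) (g x) ∂m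

theorem mon_aes (f g : Lp E 3 m) : AEStronglyMeasurable (fun x => inner ℝ (‖f x‖ • f x) (g x)) m :=
  ((Lp.aestronglyMeasurable f).norm.smul (Lp.aestronglyMeasurable f)).inner (Lp.aestronglyMeasurable g)

theorem mon_int (f g : Lp E 3 m) : Integrable (fun x => inner ℝ (‖f x‖ • f x) (g x)) m := by
  refine (hold3_dom (Lp.memLp f) (Lp.memLp f) (Lp.memLp g) (mon_aes f g) ?_).1
  refine Eventually.of_forall fun x => ?_
  refine (abs_real_inner_le_norm _ _).trans ?_
  rw [norm_smul, norm_norm]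

theorem mon_bd (f g : Lp E 3 m) : |mon f g| ≤ ‖f‖ ^ 2 * ‖g‖ := by
  rw [pow_two]
  refine (hold3_dom (Lp.memLp f) (Lp.memLp f) (Lp.memLp g) (mon_aes f g) ?_).2
  refine Eventually.of_forall fun x => ?_
  refine (abs_real_inner_le_norm _ _).trans ?_
  rw [norm_smul, norm_norm]

theorem mon_add (f g h : Lp E 3 m) : mon f (g + h) = mon f g + mon f h := by
  rw [mon, mon, mon, ← integral_add (mon_int f g) (mon_int f h)]
  refine integral_congr_ae ?_
  filter_upwards [Lp.coeFn_add g h] with x hx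
  rw [hx, Pi.add_apply, inner_add_right]

theorem mon_smul (c : ℝ) (f g : Lp E 3 m) : mon f (c • g) = c * mon f g := by
  rw [mon, mon, ← integral_const_mul]
  refine integral_congr_ae ?_
  filter_upwards [Lp.coeFn_smul c g] with x hx
  rw [hx, Pi.smul_apply, real_inner_smul_right]

theorem l3n_pow {F : Type*} [NormedAddCommGroup F] (f : Lp F 3 m) : ‖f‖ ^ 3 = ∫ x, ‖f x‖ ^ 3 ∂m := by
  rw [Lp.norm_def, ← ENNReal.toReal_pow, l3_pow, integral_eq_lintegral_of_nonneg_ae]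
  · congr 1
    refine lintegral_congr fun x => ?_
    rw [← ofReal_norm, ENNReal.ofReal_pow (norm_nonneg _)]
  · exact Eventually.of_forall fun x => by positivity
  · exact ((Lp.aestronglyMeasurable f).norm.pow 3)

theorem l3n_int {F : Type*} [NormedAddCommGroup F] (f : Lp F 3 m) : Integrable (fun x => ‖f x‖ ^ 3) m := by
  have := (Lp.memLp f).integrable_norm_pow (p := 3) (by norm_num)
  exact this

theorem mon_self (f : Lp E 3 m) : mon f f = ‖f‖ ^ 3 := by
  rw [mon, l3n_pow]
  refine integral_congr_ae (Eventually.of_forall fun x => ?_)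
  simp only
  rw [real_inner_smul_left, real_inner_self_eq_norm_sq]; ring

theorem mon_diff (f f' g : Lp E 3 m) : |mon f g - mon f' g| ≤ (‖f‖ + ‖f'‖) * ‖f - f'‖ * ‖g‖ := by
  have hd := (Lp.memLp f).sub (Lp.memLp f')
  have e1 : mon f g - mon f' g = ∫ x, inner ℝ (‖f x‖ • f x - ‖f' x‖ • f' x) (g x) ∂m := by
    rw [mon, mon, ← integral_sub (mon_int f g) (mon_int f' g)]
    refine integral_congr_ae (Eventually.of_forall fun x => ?_)
    simp only
    rw [inner_sub_left]
  have a1 := hold3_dom (Lp.memLp f) hd (Lp.memLp g) (k := fun x => ‖f x‖ * ‖(⇑f - ⇑f') x‖ * ‖g x‖)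
    (((Lp.memLp f).1.norm.mul hd.1.norm).mul (Lp.memLp g).1.norm)
    (Eventually.of_forall fun x => by rw [abs_of_nonneg (by positivity)])
  have a2 := hold3_dom (Lp.memLp f') hd (Lp.memLp g) (k := fun x => ‖f' x‖ * ‖(⇑f - ⇑f') x‖ * ‖g x‖)
    (((Lp.memLp f').1.norm.mul hd.1.norm).mul (Lp.memLp g).1.norm)
    (Eventually.of_forall fun x => by rw [abs_of_nonneg (by positivity)])
  have hn : (eLpNorm (⇑f - ⇑f') 3 m).toReal = ‖f - f'‖ := by
    rw [Lp.norm_def]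
    congr 1
    exact eLpNorm_congr_ae (Lp.coeFn_sub f f').symm
  rw [hn, ← Lp.norm_def, ← Lp.norm_def] at a1 a2
  rw [e1]
  have h1 : |∫ x, inner ℝ (‖f x‖ • f x - ‖f' x‖ • f' x) (g x) ∂m| ≤
      ∫ x, (‖f x‖ * ‖(⇑f - ⇑f') x‖ * ‖g x‖ + ‖f' x‖ * ‖(⇑f - ⇑f') x‖ * ‖g x‖) ∂m := by
    rw [← Real.norm_eq_abs]
    refine norm_integral_le_of_norm_le (a1.1.add a2.1) (Eventually.of_forall fun x => ?_)
    rw [Real.norm_eq_abs]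
    refine (abs_real_inner_le_norm _ _).trans ?_
    rw [← add_mul, ← add_mul]
    exact mul_le_mul_of_nonneg_right (pp_lip _ _) (norm_nonneg _)
  rw [integral_add a1.1 a2.1] at h1
  have b1 := (abs_le.1 a1.2).2
  have b2 := (abs_le.1 a2.2).2
  refine h1.trans ((add_le_add b1 b2).trans (le_of_eq ?_))
  ring

theorem mon_mono (f f' : Lp E 3 m) : 1/2 * ‖f - f'‖ ^ 3 ≤ mon f (f - f') - mon f' (f - f') := by
  rw [l3n_pow, mon, mon, ← integral_sub (mon_int _ _) (mon_int _ _), ← integral_const_mul]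
  refine integral_mono_ae ((l3n_int _).const_mul _) ((mon_int _ _).sub (mon_int _ _)) ?_
  filter_upwards [Lp.coeFn_sub f f'] with x hx
  rw [hx, Pi.sub_apply]
  have := pp_mono (f x) (f' x)
  rw [inner_sub_left] at this
  exact this
end Mono
end

section
/-! ### The concrete function spaces -/

/-- The space of solenoidal test fields, in components. -/
def svX (Ω : Set E3) : Submodule ℝ (Fin 3 → E3 → ℝ) where
  carrier := {V | SV Ω V}
  add_mem' := by
    intro V W hV hW
    refine ⟨fun j => (hV.cc j).add (hW.cc j), fun j => ?_, fun x => ?_⟩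
    · exact (tsupport_add (V j) (W j)).trans (Set.union_subset (hV.supp j) (hW.supp j))
    · have h : ∀ i, pds ((V + W) i) i x = pds (V i) i x + pds (W i) i x := by
        intro i
        exact congrFun (pds_add (hV.cc i).diff (hW.cc i).diff i) x
      simp only [h, Finset.sum_add_distrib, hV.div, hW.div, add_zero]
  zero_mem' := by
    refine ⟨fun j => cc_zero, fun j => ?_, fun x => ?_⟩
    · have : tsupport ((0 : Fin 3 → E3 → ℝ) j) = ∅ := by
        rw [tsupport_eq_empty_iff]; rfl
      rw [this]; exact Set.empty_subset _
    · refine Finset.sum_eq_zero fun i _ => ?_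
      have : (0 : Fin 3 → E3 → ℝ) i = fun _ => 0 := rfl
      simp [pds, this]
  smul_mem' := by
    intro c V hV
    refine ⟨fun j => (hV.cc j).const_mul c, fun j => ?_, fun x => ?_⟩
    · exact (tsupport_smul_subset_right (fun _ => c) (V j)).trans (hV.supp j)
    · have h : ∀ i, pds ((c • V) i) i x = c * pds (V i) i x := by
        intro i
        exact congrFun (pds_const_mul (hV.cc i).diff c i) x
      simp only [h, ← Finset.mul_sum, hV.div, mul_zero]

section PQ
variable {Ω : Set E3} {α : ℝ}

lemma svX_pds_add (V W : svX Ω) (i j : Fin 3) (x : E3) :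
    pds ((V + W : svX Ω).1 j) i x = pds (V.1 j) i x + pds (W.1 j) i x :=
  congrFun (pds_add (V.2.cc j).diff (W.2.cc j).diff i) x

lemma svX_pds_smul (c : ℝ) (V : svX Ω) (i j : Fin 3) (x : E3) :
    pds ((c • V : svX Ω).1 j) i x = c * pds (V.1 j) i x :=
  congrFun (pds_const_mul (V.2.cc j).diff c i) x

/-- curl of a field given by components -/
def cu (V : Fin 3 → E3 → ℝ) (x : E3) : E3 := mk3 (qq V 1 2 x) (qq V 2 0 x) (qq V 0 1 x)

@[simp] lemma mk3_0 (a b c : ℝ) : mk3 a b c 0 = a := rfl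
@[simp] lemma mk3_1 (a b c : ℝ) : mk3 a b c 1 = b := rfl
@[simp] lemma mk3_2 (a b c : ℝ) : mk3 a b c 2 = c := rfl

lemma E3_ext {a b : E3} (h0 : a 0 = b 0) (h1 : a 1 = b 1) (h2 : a 2 = b 2) : a = b := by
  ext i; fin_cases i
  · exact h0
  · exact h1
  · exact h2

lemma QQ_le_cu (V : Fin 3 → E3 → ℝ) (x : E3) : QQ V x ≤ 6 * ‖cu V x‖ := by
  have h0 := coord_le (cu V x) 0
  have h1 := coord_le (cu V x) 1
  have h2 := coord_le (cu V x) 2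
  simp only [cu, mk3_0, mk3_1, mk3_2] at h0 h1 h2
  have hs : ∀ i j, |qq V i j x| = |qq V j i x| := fun i j => by
    rw [qq, qq, abs_sub_comm]
  have hd : ∀ i, |qq V i i x| = 0 := fun i => by simp [qq]
  simp only [QQ, Fin.sum_univ_three, hd]
  rw [hs 1 0, hs 0 2, hs 2 1]
  simp only [cu]
  linarith

lemma dB_bdd (hΩ : IsLipschitzDomain Ω) : ∃ D > 0, ∀ x ∈ Ω, dB Ω x ≤ D := by
  obtain ⟨D, hD, h⟩ := diamB hΩ
  obtain ⟨x0, hx0⟩ := hΩ.nonempty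
  refine ⟨dB Ω x0 + D, by have := dB_nonneg Ω x0; linarith, fun x hx => ?_⟩
  have := dB_lip Ω x x0
  have h2 := h x0 hx0 hx
  rw [Metric.mem_ball] at h2
  linarith

lemma dBp_meas (Ω : Set E3) (s : ℝ) : Measurable fun x => dB Ω x ^ s :=
  (dB_cont Ω).measurable.pow_const s

/-- raw weighted functions -/
def rU (Ω : Set E3) (α : ℝ) (j : Fin 3) : svX Ω →ₗ[ℝ] (E3 → ℝ) where
  toFun V x := dB Ω x ^ (-(α/6)) * V.1 j x
  map_add' V W := by
    funext x
    show _ * (V.1 j x + W.1 j x) = _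
    simp only [Pi.add_apply]; ring
  map_smul' c V := by
    funext x
    show _ * (c * V.1 j x) = _
    simp only [Pi.smul_apply, smul_eq_mul, RingHom.id_apply]; ring

def rD (Ω : Set E3) (α : ℝ) (i j : Fin 3) : svX Ω →ₗ[ℝ] (E3 → ℝ) where
  toFun V x := dB Ω x ^ (α/3) * pds (V.1 j) i x
  map_add' V W := by
    funext x
    rw [svX_pds_add]
    simp only [Pi.add_apply]; ring
  map_smul' c V := by
    funext x
    rw [svX_pds_smul]
    simp only [Pi.smul_apply, smul_eq_mul, RingHom.id_apply]; ring

lemma cu_co (V : Fin 3 → E3 → ℝ) (x : E3) : cu V x 0 = qq V 1 2 x ∧ cu V x 1 = qq V 2 0 x ∧ cu V x 2 = qq V 0 1 x :=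
  ⟨rfl, rfl, rfl⟩

lemma cu_add (V W : svX Ω) (x : E3) : cu (V + W : svX Ω).1 x = cu V.1 x + cu W.1 x := by
  apply E3_ext <;>
  · simp only [cu_co, PiLp.add_apply, qq, svX_pds_add]; ring

lemma cu_smul (c : ℝ) (V : svX Ω) (x : E3) : cu (c • V : svX Ω).1 x = c • cu V.1 x := by
  apply E3_ext <;>
  · simp only [cu_co, PiLp.smul_apply, smul_eq_mul, qq, svX_pds_smul]; ring

def rW (Ω : Set E3) (α : ℝ) : svX Ω →ₗ[ℝ] (E3 → E3) where
  toFun V x := dB Ω x ^ (α/3) • cu V.1 x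
  map_add' V W := by
    funext x
    rw [cu_add, smul_add]; rfl
  map_smul' c V := by
    funext x
    rw [cu_smul, smul_comm]; rfl

lemma enorm_real (a : ℝ) : ‖a‖ₑ = ENNReal.ofReal |a| := by rw [← ofReal_norm]; rfl

lemma enU (hΩ : IsLipschitzDomain Ω) (s : ℝ) {x : E3} (hx : x ∈ Ω) (t : ℝ) :
    ‖dB Ω x ^ (-(s/6)) * t‖ₑ ^ 3 = ENNReal.ofReal (dB Ω x ^ (-(s/2))) * ENNReal.ofReal |t| ^ 3 := by
  have h := dB_pos hΩ hx
  rw [enorm_mul, mul_pow, enorm_real, enorm_real, ← ENNReal.ofReal_pow (abs_nonneg _), abs_of_nonneg (by positivity),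
    ← Real.rpow_mul_natCast h.le]
  congr 3
  push_cast; ring

lemma enD (hΩ : IsLipschitzDomain Ω) (s : ℝ) {x : E3} (hx : x ∈ Ω) (t : ℝ) :
    ‖dB Ω x ^ (s/3) * t‖ₑ ^ 3 = ENNReal.ofReal (|t| ^ 3) * ENNReal.ofReal (dB Ω x ^ s) := by
  have h := dB_pos hΩ hx
  rw [enorm_mul, mul_pow, enorm_real, enorm_real, ← ENNReal.ofReal_pow (abs_nonneg _), abs_of_nonneg (by positivity),
    ← Real.rpow_mul_natCast h.le, ← ENNReal.ofReal_pow (abs_nonneg _), mul_comm]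
  congr 3
  push_cast; ring

lemma enW (hΩ : IsLipschitzDomain Ω) (s : ℝ) {x : E3} (hx : x ∈ Ω) (t : E3) :
    ‖dB Ω x ^ (s/3) • t‖ₑ ^ 3 = ENNReal.ofReal (‖t‖ ^ 3) * ENNReal.ofReal (dB Ω x ^ s) := by
  have := enD hΩ s hx ‖t‖
  rw [abs_norm] at this
  rw [← this, enorm_smul, enorm_mul]; simp

lemma bd_memLp (hΩ : IsLipschitzDomain Ω) {F : Type*} [NormedAddCommGroup F] {f : E3 → F}
    (hf : AEStronglyMeasurable f (volume.restrict Ω)) {C : ℝ} (hC : ∀ x ∈ Ω, ‖f x‖ ≤ C) :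
    MemLp f 3 (volume.restrict Ω) := by
  haveI : IsFiniteMeasure (volume.restrict Ω) := ⟨by
    rw [Measure.restrict_apply_univ]; exact hΩ.isBounded.measure_lt_top⟩
  refine MemLp.of_bound hf C ?_
  filter_upwards [ae_restrict_mem hΩ.isOpen.measurableSet] with x hx using hC x hx

lemma dBp_bdd (hΩ : IsLipschitzDomain Ω) {s : ℝ} (hs : 0 ≤ s) : ∃ C > 0, ∀ x ∈ Ω, dB Ω x ^ s ≤ C := by
  obtain ⟨D, hD, h⟩ := dB_bdd hΩ
  exact ⟨D ^ s, by positivity, fun x hx => Real.rpow_le_rpow (dB_nonneg Ω x) (h x hx) hs⟩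

lemma memD (hΩ : IsLipschitzDomain Ω) (hα0 : 0 ≤ α) (i j : Fin 3) (V : svX Ω) :
    MemLp (rD Ω α i j V) 3 (volume.restrict Ω) := by
  obtain ⟨C, hC, h⟩ := dBp_bdd hΩ (s := α/3) (by linarith)
  obtain ⟨M, hM, h2⟩ := ((V.2.cc j).pds i).bdd
  refine bd_memLp hΩ (C := C * M) ?_ fun x hx => ?_
  · exact ((dBp_meas Ω _).mul ((V.2.cc j).pds i).cont.measurable).aestronglyMeasurable
  · show ‖dB Ω x ^ (α/3) * pds (V.1 j) i x‖ ≤ _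
    have h0 : 0 ≤ dB Ω x ^ (α/3) := Real.rpow_nonneg (dB_nonneg Ω x) _
    rw [norm_mul, Real.norm_eq_abs, abs_of_nonneg h0]
    exact mul_le_mul (h x hx) (h2 x) (norm_nonneg _) hC.le

lemma E3_norm_le (z : E3) : ‖z‖ ≤ |z 0| + |z 1| + |z 2| := by
  rw [EuclideanSpace.norm_eq, Fin.sum_univ_three]
  refine Real.sqrt_le_iff.2 ⟨by positivity, ?_⟩
  simp only [Real.norm_eq_abs]
  nlinarith [abs_nonneg (z 0), abs_nonneg (z 1), abs_nonneg (z 2), mul_nonneg (abs_nonneg (z 0)) (abs_nonneg (z 1)),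
    mul_nonneg (abs_nonneg (z 0)) (abs_nonneg (z 2)), mul_nonneg (abs_nonneg (z 1)) (abs_nonneg (z 2))]

lemma E3_meas {f : E3 → E3} {μ : Measure E3} (h : ∀ i, AEStronglyMeasurable (fun x => f x i) μ) :
    AEStronglyMeasurable f μ := by
  have : f = fun x => ∑ i, f x i • ee i := by funext x; exact E3_sum (f x)
  rw [this]
  refine Finset.aestronglyMeasurable_fun_sum _ fun i _ => (h i).smul_const (ee i)

lemma rW_co (V : svX Ω) (x : E3) : rW Ω α V x 0 = rD Ω α 1 2 V x - rD Ω α 2 1 V x ∧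
    rW Ω α V x 1 = rD Ω α 2 0 V x - rD Ω α 0 2 V x ∧ rW Ω α V x 2 = rD Ω α 0 1 V x - rD Ω α 1 0 V x := by
  have e : rW Ω α V x = dB Ω x ^ (α/3) • cu V.1 x := rfl
  have e2 : ∀ i j, rD Ω α i j V x = dB Ω x ^ (α/3) * pds (V.1 j) i x := fun i j => rfl
  simp only [e, e2, PiLp.smul_apply, smul_eq_mul, cu_co, qq]
  refine ⟨?_, ?_, ?_⟩ <;> ring

lemma memW (hΩ : IsLipschitzDomain Ω) (hα0 : 0 ≤ α) (V : svX Ω) :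
    MemLp (rW Ω α V) 3 (volume.restrict Ω) := by
  have hm : ∀ i j k l, MemLp (fun x => rD Ω α i j V x - rD Ω α k l V x) 3 (volume.restrict Ω) :=
    fun i j k l => (memD hΩ hα0 i j V).sub (memD hΩ hα0 k l V)
  have hm2 : ∀ k, MemLp (fun x => rW Ω α V x k) 3 (volume.restrict Ω) := by
    intro k
    fin_cases k
    · exact (hm 1 2 2 1).ae_eq (Eventually.of_forall fun x => (rW_co V x).1.symm)
    · exact (hm 2 0 0 2).ae_eq (Eventually.of_forall fun x => (rW_co V x).2.1.symm)
    · exact (hm 0 1 1 0).ae_eq (Eventually.of_forall fun x => (rW_co V x).2.2.symm)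
  refine (((hm2 0).norm.add (hm2 1).norm).add (hm2 2).norm).mono (E3_meas fun i => (hm2 i).1) ?_
  refine Eventually.of_forall fun x => ?_
  refine (E3_norm_le _).trans (le_abs_self _)

lemma EQ_le (hΩ : IsLipschitzDomain Ω) (V : svX Ω) :
    EQ Ω α V.1 ≤ ENNReal.ofReal 216 * eLpNorm (rW Ω α V) 3 (volume.restrict Ω) ^ 3 := by
  rw [l3_pow, ← lintegral_const_mul' _ _ ENNReal.ofReal_ne_top]
  unfold EQ
  refine setLIntegral_mono' hΩ.isOpen.measurableSet fun x hx => ?_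
  show _ ≤ _ * ‖dB Ω x ^ (α/3) • cu V.1 x‖ₑ ^ 3
  rw [enW hΩ α hx, ← mul_assoc, ← ENNReal.ofReal_mul (by norm_num), ← ENNReal.ofReal_pow (QQ_nonneg _ _)]
  gcongr
  have := QQ_le_cu V.1 x
  have h0 := QQ_nonneg V.1 x
  calc QQ V.1 x ^ 3 ≤ (6 * ‖cu V.1 x‖) ^ 3 := by gcongr
    _ = _ := by ring

lemma cube_le {a b : ℝ≥0∞} {C : ℝ} (hC : 0 ≤ C) (hb : b ≠ ⊤) (h : a ^ 3 ≤ ENNReal.ofReal C * b ^ 3) :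
    a.toReal ≤ (C + 1) * b.toReal := by
  have h2 : a ^ 3 ≤ (ENNReal.ofReal (C + 1) * b) ^ 3 := by
    rw [mul_pow, ← ENNReal.ofReal_pow (by positivity)]
    refine h.trans ?_
    gcongr
    nlinarith [sq_nonneg C, mul_nonneg hC (sq_nonneg C)]
  have h3 : a ≤ ENNReal.ofReal (C + 1) * b := (ENNReal.pow_le_pow_left_iff (by norm_num)).1 h2
  have := ENNReal.toReal_mono (ENNReal.mul_ne_top ENNReal.ofReal_ne_top hb) h3
  rwa [ENNReal.toReal_mul, ENNReal.toReal_ofReal (by positivity)] at this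

lemma U_bd (hΩ : IsLipschitzDomain Ω) (hα0 : 0 ≤ α) (hα : α < 2) : ∃ C > 0, ∀ (V : svX Ω) j,
    eLpNorm (rU Ω α j V) 3 (volume.restrict Ω) ^ 3 ≤
      ENNReal.ofReal C * eLpNorm (rW Ω α V) 3 (volume.restrict Ω) ^ 3 := by
  obtain ⟨C, hC, h⟩ := embI hΩ hα0 hα
  refine ⟨C * 216, by positivity, fun V j => ?_⟩
  rw [l3_pow, ENNReal.ofReal_mul hC.le, mul_assoc]
  refine le_trans (le_of_eq ?_) ((h V.1 V.2 j).trans (mul_le_mul_right (EQ_le hΩ V) _))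
  refine setLIntegral_congr_fun hΩ.isOpen.measurableSet fun x hx => ?_
  exact enU hΩ α hx _

lemma memU (hΩ : IsLipschitzDomain Ω) (hα0 : 0 ≤ α) (hα : α < 2) (j : Fin 3) (V : svX Ω) :
    MemLp (rU Ω α j V) 3 (volume.restrict Ω) := by
  obtain ⟨C, hC, h⟩ := U_bd hΩ hα0 hα
  refine ⟨((dBp_meas Ω _).mul (V.2.cc j).cont.measurable).aestronglyMeasurable, ?_⟩
  have h2 : eLpNorm (rU Ω α j V) 3 (volume.restrict Ω) ^ 3 < ⊤ := (h V j).trans_lt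
    (ENNReal.mul_lt_top ENNReal.ofReal_lt_top (ENNReal.pow_lt_top (memW hΩ hα0 V).2))
  by_contra hc
  rw [not_lt_top_iff] at hc
  simp [hc] at h2

lemma D_bd (hΩ : IsLipschitzDomain Ω) (hα0 : 0 ≤ α) (hα : α < 2) : ∃ C > 0, ∀ (V : svX Ω) i j,
    eLpNorm (rD Ω α i j V) 3 (volume.restrict Ω) ^ 3 ≤
      ENNReal.ofReal C * eLpNorm (rW Ω α V) 3 (volume.restrict Ω) ^ 3 := by
  obtain ⟨C, hC, h⟩ := gaffney hΩ hα0 hα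
  refine ⟨C * 216, by positivity, fun V i j => ?_⟩
  rw [l3_pow, ENNReal.ofReal_mul hC.le, mul_assoc]
  refine le_trans (le_of_eq ?_) ((h V.1 V.2 i j).trans (mul_le_mul_right (EQ_le hΩ V) _))
  refine setLIntegral_congr_fun hΩ.isOpen.measurableSet fun x hx => ?_
  exact enD hΩ α hx _

/-- linear map into `L³` from a raw linear map -/
def toL {F : Type*} [NormedAddCommGroup F] [NormedSpace ℝ F] {m : Measure E3} (r : svX Ω →ₗ[ℝ] (E3 → F))
    (h : ∀ V, MemLp (r V) 3 m) : svX Ω →ₗ[ℝ] Lp F 3 m where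
  toFun V := (h V).toLp (r V)
  map_add' V W := by
    rw [← MemLp.toLp_add]
    exact MemLp.toLp_congr _ _ (by rw [map_add])
  map_smul' c V := by
    rw [RingHom.id_apply, ← MemLp.toLp_const_smul]
    exact MemLp.toLp_congr _ _ (by rw [map_smul])

lemma toL_coe {F : Type*} [NormedAddCommGroup F] [NormedSpace ℝ F] {m : Measure E3} (r : svX Ω →ₗ[ℝ] (E3 → F))
    (h : ∀ V, MemLp (r V) 3 m) (V : svX Ω) : ⇑(toL r h V) =ᵐ[m] r V := (h V).coeFn_toLp

lemma toL_norm {F : Type*} [NormedAddCommGroup F] [NormedSpace ℝ F] {m : Measure E3} (r : svX Ω →ₗ[ℝ] (E3 → F))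
    (h : ∀ V, MemLp (r V) 3 m) (V : svX Ω) : ‖toL r h V‖ = (eLpNorm (r V) 3 m).toReal :=
  Lp.norm_toLp (r V) (h V)

end PQ
end

section
/-! ### The operators of the weak formulation -/

/-- standing assumptions -/
structure Hy (Ω : Set E3) (α : ℝ) : Prop where
  dom : IsLipschitzDomain Ω
  a0 : 0 ≤ α
  a2 : α < 2

lemma pds_mul {f g : E3 → ℝ} (hf : Differentiable ℝ f) (hg : Differentiable ℝ g) (i : Fin 3) (x : E3) :
    pds (fun x => f x * g x) i x = pds f i x * g x + f x * pds g i x := by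
  simp only [pds]
  rw [fderiv_fun_mul (hf x) (hg x)]
  simp only [ContinuousLinearMap.add_apply, ContinuousLinearMap.smul_apply, smul_eq_mul]
  ring

lemma cc_ibp {f g : E3 → ℝ} (hf : CC f) (hg : CC g) (i : Fin 3) :
    ∫ x, f x * pds g i x = - ∫ x, pds f i x * g x :=
  integral_mul_fderiv_eq_neg_fderiv_mul_of_integrable (μ := (volume : Measure E3))
    (f := f) (g := g) (v := ee i) ((hf.pds i).mul hg).integrable (hf.mul (hg.pds i)).integrable (hf.mul hg).integrable
    (fun x _ => hf.diff x) (fun x _ => hg.diff x)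

/-- skew-symmetry of the convective term -/
lemma conv_zero {Ω : Set E3} {V : Fin 3 → E3 → ℝ} (h : SV Ω V) :
    ∑ i, ∑ j, ∫ x, V i x * V j x * pds (V j) i x = 0 := by
  have h1 : ∀ i j, ∫ x, V i x * V j x * pds (V j) i x = -(1/2) * ∫ x, pds (V i) i x * (V j x * V j x) := by
    intro i j
    have e := cc_ibp ((h.cc i).mul (h.cc j)) (h.cc j) i
    have e2 : ∫ x, pds (fun x => V i x * V j x) i x * V j x =
        (∫ x, pds (V i) i x * (V j x * V j x)) + ∫ x, V i x * V j x * pds (V j) i x := by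
      rw [← integral_add (((h.cc i).pds i).mul ((h.cc j).mul (h.cc j))).integrable
        (((h.cc i).mul (h.cc j)).mul ((h.cc j).pds i)).integrable]
      refine integral_congr_ae (Eventually.of_forall fun x => ?_)
      simp only
      rw [pds_mul (h.cc i).diff (h.cc j).diff]; ring
    rw [e2] at e
    linarith
  rw [Finset.sum_comm]
  refine Finset.sum_eq_zero fun j _ => ?_
  simp only [h1]
  rw [← Finset.mul_sum, ← integral_finset_sum _ (fun i _ => (((h.cc i).pds i).mul ((h.cc j).mul (h.cc j))).integrable)]
  simp only [← Finset.sum_mul, h.div, zero_mul, integral_zero, mul_zero]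

section PR
variable {Ω : Set E3} {α : ℝ}

def opU (H : Hy Ω α) (j : Fin 3) : svX Ω →ₗ[ℝ] Lp ℝ 3 (volume.restrict Ω) :=
  toL (rU Ω α j) (memU H.dom H.a0 H.a2 j)
def opD (H : Hy Ω α) (i j : Fin 3) : svX Ω →ₗ[ℝ] Lp ℝ 3 (volume.restrict Ω) :=
  toL (rD Ω α i j) (memD H.dom H.a0 i j)
def opW (H : Hy Ω α) : svX Ω →ₗ[ℝ] Lp E3 3 (volume.restrict Ω) :=
  toL (rW Ω α) (memW H.dom H.a0)

def sN (H : Hy Ω α) : Seminorm ℝ (svX Ω) := (normSeminorm ℝ (Lp E3 3 (volume.restrict Ω))).comp (opW H)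
def sU (H : Hy Ω α) (j : Fin 3) : Seminorm ℝ (svX Ω) := (normSeminorm ℝ (Lp ℝ 3 (volume.restrict Ω))).comp (opU H j)
def sS (H : Hy Ω α) : Seminorm ℝ (svX Ω) := sU H 0 + sU H 1 + sU H 2

lemma sN_eq (H : Hy Ω α) (V : svX Ω) : sN H V = ‖opW H V‖ := rfl
lemma sS_eq (H : Hy Ω α) (V : svX Ω) : sS H V = ∑ j, ‖opU H j V‖ := by
  rw [Fin.sum_univ_three]; rfl

lemma opU_bd (H : Hy Ω α) : ∃ C > 0, ∀ (V : svX Ω) j, ‖opU H j V‖ ≤ C * sN H V := by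
  obtain ⟨C, hC, h⟩ := U_bd H.dom H.a0 H.a2
  refine ⟨C + 1, by positivity, fun V j => ?_⟩
  rw [sN_eq, opU, opW, toL_norm, toL_norm]
  exact cube_le hC.le (memW H.dom H.a0 V).2.ne (h V j)

lemma opD_bd (H : Hy Ω α) : ∃ C > 0, ∀ (V : svX Ω) i j, ‖opD H i j V‖ ≤ C * sN H V := by
  obtain ⟨C, hC, h⟩ := D_bd H.dom H.a0 H.a2
  refine ⟨C + 1, by positivity, fun V i j => ?_⟩
  rw [sN_eq, opD, opW, toL_norm, toL_norm]
  exact cube_le hC.le (memW H.dom H.a0 V).2.ne (h V i j)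

def fA (H : Hy Ω α) (v : svX Ω) : svX Ω →ₗ[ℝ] ℝ where
  toFun φ := mon (opW H v) (opW H φ)
  map_add' a b := by rw [map_add, mon_add]
  map_smul' c a := by rw [map_smul, mon_smul]; rfl

def fB (H : Hy Ω α) (v : svX Ω) : svX Ω →ₗ[ℝ] ℝ where
  toFun φ := ∑ i, ∑ j, tri (opU H i v) (opU H j v) (opD H i j φ)
  map_add' a b := by simp only [map_add, tri_add3, Finset.sum_add_distrib]
  map_smul' c a := by simp only [map_smul, tri_smul3, Finset.mul_sum, RingHom.id_apply, smul_eq_mul]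

def fl (H : Hy Ω α) (h k : Fin 3 → Fin 3 → Lp ℝ 3 (volume.restrict Ω)) : svX Ω →ₗ[ℝ] ℝ where
  toFun φ := -∑ i, ∑ j, tri (h i j) (k i j) (opD H i j φ)
  map_add' a b := by simp only [map_add, tri_add3, Finset.sum_add_distrib]; ring
  map_smul' c a := by
    simp only [map_smul, tri_smul3, RingHom.id_apply, smul_eq_mul, ← Finset.mul_sum]; ring

lemma fl_bd (H : Hy Ω α) (h k : Fin 3 → Fin 3 → Lp ℝ 3 (volume.restrict Ω)) :
    ∃ L, 0 ≤ L ∧ ∀ φ, |fl H h k φ| ≤ L * sN H φ := by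
  obtain ⟨C, hC, hD⟩ := opD_bd H
  refine ⟨∑ i, ∑ j, ‖h i j‖ * ‖k i j‖ * C, by positivity, fun φ => ?_⟩
  show |-∑ i, ∑ j, tri (h i j) (k i j) (opD H i j φ)| ≤ _
  rw [abs_neg]
  refine (Finset.abs_sum_le_sum_abs _ _).trans ?_
  rw [Finset.sum_mul]
  refine Finset.sum_le_sum fun i _ => (Finset.abs_sum_le_sum_abs _ _).trans ?_
  rw [Finset.sum_mul]
  refine Finset.sum_le_sum fun j _ => (tri_bd _ _ _).trans ?_
  rw [mul_assoc (‖h i j‖ * ‖k i j‖)]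
  exact mul_le_mul_of_nonneg_left (hD φ i j) (by positivity)

lemma tri_conv (H : Hy Ω α) (v φ : svX Ω) (i j : Fin 3) :
    tri (opU H i v) (opU H j v) (opD H i j φ) = ∫ x in Ω, v.1 i x * v.1 j x * pds (φ.1 j) i x := by
  rw [tri]
  refine integral_congr_ae ?_
  filter_upwards [toL_coe (rU Ω α i) (memU H.dom H.a0 H.a2 i) v, toL_coe (rU Ω α j) (memU H.dom H.a0 H.a2 j) v,
    toL_coe (rD Ω α i j) (memD H.dom H.a0 i j) φ, ae_restrict_mem H.dom.isOpen.measurableSet] with x h1 h2 h3 hx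
  rw [opU, opU, opD, h1, h2, h3]
  show dB Ω x ^ (-(α/6)) * v.1 i x * (dB Ω x ^ (-(α/6)) * v.1 j x) * (dB Ω x ^ (α/3) * pds (φ.1 j) i x) = _
  have hp := dB_pos H.dom hx
  have e : dB Ω x ^ (-(α/6)) * dB Ω x ^ (-(α/6)) * dB Ω x ^ (α/3) = 1 := by
    rw [← Real.rpow_add hp, ← Real.rpow_add hp]
    have : -(α/6) + -(α/6) + α/3 = 0 := by ring
    rw [this, Real.rpow_zero]
  calc _ = (dB Ω x ^ (-(α/6)) * dB Ω x ^ (-(α/6)) * dB Ω x ^ (α/3)) * (v.1 i x * v.1 j x * pds (φ.1 j) i x) := by ring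
    _ = _ := by rw [e, one_mul]

lemma fB_self (H : Hy Ω α) (v : svX Ω) : fB H v v = 0 := by
  show ∑ i, ∑ j, tri (opU H i v) (opU H j v) (opD H i j v) = 0
  rw [← conv_zero v.2]
  refine Finset.sum_congr rfl fun i _ => Finset.sum_congr rfl fun j _ => ?_
  rw [tri_conv]
  refine setIntegral_eq_integral_of_forall_compl_eq_zero fun x hx => ?_
  rw [v.2.pds0 hx, mul_zero]

/-- everything but compactness -/
lemma absd (H : Hy Ω α) (h k : Fin 3 → Fin 3 → Lp ℝ 3 (volume.restrict Ω))
    (hc : ∀ R δ : ℝ, 0 < δ → ∃ t : Finset (svX Ω), ∀ v, sN H v ≤ R → ∃ w ∈ t, sS H (v - w) ≤ δ) :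
    ∃ κ M K L, AbsD (svX Ω) (sN H) (sS H) (fA H) (fB H) (fl H h k) κ M K L := by
  obtain ⟨C, hC, hD⟩ := opD_bd H
  obtain ⟨K, hK, hU⟩ := opU_bd H
  obtain ⟨L, hL, hl⟩ := fl_bd H h k
  refine ⟨1/2, C, 3 * K, L, ?_⟩
  refine ⟨by norm_num, hC.le, by positivity, hL, ?_, ?_, ?_, ?_, fB_self H, ?_, ?_, ?_, hl, hc⟩
  · intro v; exact mon_self _
  · intro v φ; exact mon_bd _ _
  · intro v w φ
    have := mon_diff (opW H v) (opW H w) (opW H φ)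
    rw [← map_sub] at this
    exact this
  · intro v w
    have := mon_mono (opW H v) (opW H w)
    rw [← map_sub] at this
    exact this
  · intro v φ
    show |∑ i, ∑ j, tri (opU H i v) (opU H j v) (opD H i j φ)| ≤ _
    have e : C * sS H v ^ 2 * sN H φ = ∑ i, ∑ j, ‖opU H i v‖ * ‖opU H j v‖ * (C * sN H φ) := by
      simp only [← Finset.sum_mul, ← Finset.mul_sum, sS_eq]; ring
    rw [e]
    refine (Finset.abs_sum_le_sum_abs _ _).trans (Finset.sum_le_sum fun i _ =>
      (Finset.abs_sum_le_sum_abs _ _).trans (Finset.sum_le_sum fun j _ => (tri_bd _ _ _).trans ?_))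
    exact mul_le_mul_of_nonneg_left (hD φ i j) (by positivity)
  · intro v w φ
    show |(∑ i, ∑ j, tri (opU H i v) (opU H j v) (opD H i j φ)) -
      ∑ i, ∑ j, tri (opU H i w) (opU H j w) (opD H i j φ)| ≤ _
    have e : C * (sS H v + sS H w) * sS H (v - w) * sN H φ = ∑ i, ∑ j, (‖opU H i (v - w)‖ * ‖opU H j v‖ +
        ‖opU H i w‖ * ‖opU H j (v - w)‖) * (C * sN H φ) := by
      simp only [← Finset.sum_mul, Finset.sum_add_distrib, ← Finset.mul_sum, sS_eq]; ring
    rw [e, ← Finset.sum_sub_distrib]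
    refine (Finset.abs_sum_le_sum_abs _ _).trans (Finset.sum_le_sum fun i _ => ?_)
    rw [← Finset.sum_sub_distrib]
    refine (Finset.abs_sum_le_sum_abs _ _).trans (Finset.sum_le_sum fun j _ => (tri_diff _ _ _ _ _).trans ?_)
    rw [← map_sub, ← map_sub]
    exact mul_le_mul_of_nonneg_left (hD φ i j) (by positivity)
  · intro v
    rw [sS_eq, Fin.sum_univ_three]
    have h0 := hU v 0
    have h1 := hU v 1
    have h2 := hU v 2
    linarith

/-! ### the right-hand side -/
def hF (Ω : Set E3) (α : ℝ) (F : E3 → Fin 3 → Fin 3 → ℝ) (i j : Fin 3) (x : E3) : ℝ :=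
  √(dB Ω x ^ (-(α/3)) * |F x i j|)
def hS (Ω : Set E3) (α : ℝ) (F : E3 → Fin 3 → Fin 3 → ℝ) (i j : Fin 3) (x : E3) : ℝ :=
  SignType.sign (F x i j) * hF Ω α F i j x

lemma frob_le (M : Fin 3 → Fin 3 → ℝ) (i j : Fin 3) : |M i j| ≤ frob M := by
  unfold frob
  refine Real.abs_le_sqrt ?_
  refine le_trans ?_ (Finset.single_le_sum (f := fun i => ∑ j, M i j ^ 2) (fun i _ => by positivity) (Finset.mem_univ i))
  exact Finset.single_le_sum (f := fun j => M i j ^ 2) (fun i _ => by positivity) (Finset.mem_univ j)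

lemma hF_cube {d f : ℝ} (hd : 0 < d) (hf : 0 ≤ f) (α : ℝ) :
    √(d ^ (-(α/3)) * f) ^ 3 = d ^ (-α/2) * f ^ ((3:ℝ)/2) := by
  rw [Real.sqrt_eq_rpow, ← Real.rpow_mul_natCast (by positivity), Real.mul_rpow (by positivity) hf,
    ← Real.rpow_mul hd.le]
  norm_num
  left; congr 1; ring

lemma memF (H : Hy Ω α) {F : E3 → Fin 3 → Fin 3 → ℝ} (hFm : ∀ i j, Measurable fun x => F x i j)
    (hFint : IntegrableOn (fun x => dB Ω x ^ (-α/2) * frob (F x) ^ ((3:ℝ)/2)) Ω) (i j : Fin 3) :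
    MemLp (hF Ω α F i j) 3 (volume.restrict Ω) := by
  have hm : Measurable (hF Ω α F i j) := by
    unfold hF
    exact ((dBp_meas Ω _).mul (hFm i j).abs).sqrt
  refine ⟨hm.aestronglyMeasurable, l3_lt ?_⟩
  refine lt_of_le_of_lt ?_ hFint.2
  refine setLIntegral_mono' H.dom.isOpen.measurableSet fun x hx => ?_
  have hp := dB_pos H.dom hx
  rw [enorm_real, enorm_real, ← ENNReal.ofReal_pow (abs_nonneg _)]
  refine ENNReal.ofReal_le_ofReal ?_
  have h0 : 0 ≤ frob (F x) := Real.sqrt_nonneg _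
  simp only [hF]
  rw [abs_of_nonneg (a := √(dB Ω x ^ (-(α/3)) * |F x i j|)) (Real.sqrt_nonneg _),
    abs_of_nonneg (a := dB Ω x ^ (-α/2) * frob (F x) ^ ((3:ℝ)/2)) (by positivity), hF_cube hp (abs_nonneg _)]
  have := frob_le (F x) i j
  gcongr

lemma memS (H : Hy Ω α) {F : E3 → Fin 3 → Fin 3 → ℝ} (hFm : ∀ i j, Measurable fun x => F x i j)
    (hFint : IntegrableOn (fun x => dB Ω x ^ (-α/2) * frob (F x) ^ ((3:ℝ)/2)) Ω) (i j : Fin 3) :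
    MemLp (hS Ω α F i j) 3 (volume.restrict Ω) := by
  have h := memF H hFm hFint i j
  refine h.mono ?_ (Eventually.of_forall fun x => ?_)
  · have hs : Measurable fun y : ℝ => ((SignType.sign y : SignType) : ℝ) := by
      have e : (fun y : ℝ => ((SignType.sign y : SignType) : ℝ)) = fun y => if 0 < y then 1 else if y < 0 then -1 else 0 := by
        funext y; rw [sign_apply]; split_ifs <;> simp
      rw [e]
      exact Measurable.ite measurableSet_Ioi measurable_const
        (Measurable.ite measurableSet_Iio measurable_const measurable_const)
    exact (hs.comp (hFm i j)).aestronglyMeasurable.mul h.1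
  · rw [hS, norm_mul]
    refine mul_le_of_le_one_left (norm_nonneg _) ?_
    rcases SignType.trichotomy (SignType.sign (F x i j)) with h | h | h <;> simp [h]

lemma hFS (H : Hy Ω α) (F : E3 → Fin 3 → Fin 3 → ℝ) (i j : Fin 3) {x : E3} (hx : x ∈ Ω) :
    hF Ω α F i j x * hS Ω α F i j x = dB Ω x ^ (-(α/3)) * F x i j := by
  have hp := dB_pos H.dom hx
  have e : hF Ω α F i j x * hF Ω α F i j x = dB Ω x ^ (-(α/3)) * |F x i j| :=
    Real.mul_self_sqrt (by positivity)
  rw [hS]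
  calc _ = SignType.sign (F x i j) * (hF Ω α F i j x * hF Ω α F i j x) := by ring
    _ = dB Ω x ^ (-(α/3)) * (SignType.sign (F x i j) * |F x i j|) := by rw [e]; ring
    _ = _ := by rw [sign_mul_abs]

end PR
end

section
/-! ### Compactness -/
section PS
variable {Ω : Set E3} {α : ℝ}

lemma w_tot (H : Hy Ω α) : ∫⁻ x in Ω, ENNReal.ofReal (dB Ω x ^ (-(α/2))) < ⊤ := by
  obtain ⟨C, hC, h⟩ := star H.dom (a := α/2) (by linarith [H.a0]) (by linarith [H.a2])
  obtain ⟨D, hD, hb⟩ := diamB H.dom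
  obtain ⟨x0, hx0⟩ := H.dom.nonempty
  have := h x0 D hD
  rw [Set.inter_eq_right.2 (hb x0 hx0)] at this
  exact this.trans_lt ENNReal.ofReal_lt_top

lemma mem6 (H : Hy Ω α) : MemLp (fun x => dB Ω x ^ (-(α/6))) 3 (volume.restrict Ω) := by
  refine ⟨(dBp_meas Ω _).aestronglyMeasurable, l3_lt ?_⟩
  refine lt_of_eq_of_lt ?_ (w_tot H)
  refine setLIntegral_congr_fun H.dom.isOpen.measurableSet fun x hx => ?_
  have := enU H.dom α hx 1
  simpa using this

lemma QQ_int_bd (H : Hy Ω α) : ∃ C > 0, ∀ V : svX Ω, ∫ x, QQ V.1 x ≤ C * sN H V := by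
  obtain ⟨c, hc⟩ : ∃ c, c = (eLpNorm (fun x => dB Ω x ^ (-(α/6))) 3 (volume.restrict Ω)).toReal := ⟨_, rfl⟩
  refine ⟨6 * (c * c) + 1, by rw [hc]; positivity, fun V => ?_⟩
  have hb := (hold3_dom (mem6 H) (mem6 H) (memW H.dom H.a0 V) (k := fun x => QQ V.1 x / 6)
    ((QQ_cont V.2.cc).div_const 6).aestronglyMeasurable ?_).2
  · rw [← hc, integral_div] at hb
    have e : ∫ x in Ω, QQ V.1 x = ∫ x, QQ V.1 x :=
      setIntegral_eq_integral_of_forall_compl_eq_zero fun x hx => V.2.QQ0 hx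
    rw [e] at hb
    have h2 := (le_abs_self _).trans hb
    have e2 : sN H V = (eLpNorm (rW Ω α V) 3 (volume.restrict Ω)).toReal := toL_norm _ _ _
    rw [← e2] at h2
    have h0 : 0 ≤ sN H V := apply_nonneg _ _
    linarith
  · filter_upwards [ae_restrict_mem H.dom.isOpen.measurableSet] with x hx
    have hp := dB_pos H.dom hx
    have hq := QQ_nonneg V.1 x
    rw [abs_of_nonneg (by positivity), Real.norm_eq_abs, abs_of_nonneg (by positivity)]
    show _ ≤ _ * ‖dB Ω x ^ (α/3) • cu V.1 x‖
    rw [norm_smul, Real.norm_eq_abs, abs_of_nonneg (a := dB Ω x ^ (α/3)) (by positivity)]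
    have e : dB Ω x ^ (-(α/6)) * dB Ω x ^ (-(α/6)) * dB Ω x ^ (α/3) = 1 := by
      rw [← Real.rpow_add hp, ← Real.rpow_add hp]
      have : -(α/6) + -(α/6) + α/3 = 0 := by ring
      rw [this, Real.rpow_zero]
    rw [← mul_assoc, e, one_mul]
    have := QQ_le_cu V.1 x
    linarith

lemma QQ_integrable (V : svX Ω) : Integrable (QQ V.1) := by
  unfold QQ
  exact integrable_finset_sum _ fun i _ => integrable_finset_sum _ fun j _ => (qq_cc V.2.cc i j).integrable.abs

lemma sum_qq_le (V : Fin 3 → E3 → ℝ) (j : Fin 3) (y : E3) : ∑ i, |qq V i j y| ≤ QQ V y := by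
  unfold QQ
  refine Finset.sum_le_sum fun i _ => ?_
  exact Finset.single_le_sum (f := fun j => |qq V i j y|) (fun i _ => abs_nonneg _) (Finset.mem_univ j)

lemma BSe_gen (V : svX Ω) (j : Fin 3) (k : Fin 3 → E3 → ℝ) {c : ℝ} (hk : ∀ i y, |k i y| ≤ c) :
    |∫ y, ∑ i, qq V.1 i j y * k i y| ≤ c * ∫ y, QQ V.1 y := by
  rw [← integral_const_mul, ← Real.norm_eq_abs]
  refine norm_integral_le_of_norm_le ((QQ_integrable V).const_mul c) (Eventually.of_forall fun y => ?_)
  rw [Real.norm_eq_abs]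
  have hc : 0 ≤ c := (abs_nonneg _).trans (hk 0 y)
  calc |∑ i, qq V.1 i j y * k i y| ≤ ∑ i, |qq V.1 i j y * k i y| := Finset.abs_sum_le_sum_abs _ _
    _ ≤ ∑ i, |qq V.1 i j y| * c := by
      refine Finset.sum_le_sum fun i _ => ?_
      rw [abs_mul]
      exact mul_le_mul_of_nonneg_left (hk i y) (abs_nonneg _)
    _ = c * ∑ i, |qq V.1 i j y| := by rw [← Finset.sum_mul, mul_comm]
    _ ≤ _ := mul_le_mul_of_nonneg_left (sum_qq_le _ _ _) hc

lemma BSe_bd (V : svX Ω) {ε : ℝ} (hε : 0 < ε) (j : Fin 3) (x : E3) :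
    |BSe V.1 ε j x| ≤ 1 / ε ^ 2 * ∫ y, QQ V.1 y :=
  BSe_gen V j (fun i y => Kk ε i (x - y)) (fun i y => Kk_bound hε i _)

lemma BSe_int (V : svX Ω) {ε : ℝ} (hε : 0 < ε) (j : Fin 3) (x : E3) :
    Integrable fun y => ∑ i, qq V.1 i j y * Kk ε i (x - y) :=
  integrable_finset_sum _ fun i _ => (qq_cc V.2.cc i j).mul_bdd ((Kk_cont hε i).comp (by fun_prop))

lemma BSe_lip (V : svX Ω) {ε : ℝ} (hε : 0 < ε) (j : Fin 3) (x x' : E3) :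
    |BSe V.1 ε j x - BSe V.1 ε j x'| ≤ 4 / ε ^ 3 * ‖x - x'‖ * ∫ y, QQ V.1 y := by
  have e : BSe V.1 ε j x - BSe V.1 ε j x' =
      ∫ y, ∑ i, qq V.1 i j y * (Kk ε i (x - y) - Kk ε i (x' - y)) := by
    rw [BSe, BSe, ← integral_sub (BSe_int V hε j x) (BSe_int V hε j x')]
    refine integral_congr_ae (Eventually.of_forall fun y => ?_)
    simp only [mul_sub, Finset.sum_sub_distrib]
  rw [e]
  refine BSe_gen V j (fun i y => Kk ε i (x - y) - Kk ε i (x' - y)) (fun i y => ?_)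
  have := Kk_lip hε i (x - y) (x' - y)
  rwa [show x - y - (x' - y) = x - x' by abel] at this

lemma BSe_cont (V : svX Ω) {ε : ℝ} (hε : 0 < ε) (j : Fin 3) : Continuous (BSe V.1 ε j) := by
  have h0 : 0 ≤ ∫ y, QQ V.1 y := integral_nonneg fun y => QQ_nonneg _ _
  have : LipschitzWith (Real.toNNReal (4 / ε ^ 3 * ∫ y, QQ V.1 y)) (BSe V.1 ε j) := by
    refine LipschitzWith.of_dist_le_mul fun x x' => ?_
    rw [Real.coe_toNNReal _ (by positivity), Real.dist_eq, dist_eq_norm]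
    have := BSe_lip V hε j x x'
    linarith
  exact this.continuous

lemma tb_of_bdd {Y : Type*} [PseudoMetricSpace Y] [ProperSpace Y] {A : Set Y} (h : IsBounded A) : TotallyBounded A :=
  (h.isCompact_closure.totallyBounded).subset subset_closure

/-- equi-Lipschitz net -/
lemma net1 (H : Hy Ω α) {ε : ℝ} (hε : 0 < ε) (R s : ℝ) (hs : 0 < s) : ∃ t : Finset (svX Ω),
    (∀ w ∈ t, sN H w ≤ R) ∧ ∀ v, sN H v ≤ R → ∃ w ∈ t, ∀ j, ∀ x ∈ Ω, |BSe v.1 ε j x - BSe w.1 ε j x| ≤ s := by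
  obtain ⟨C, hC, hQ⟩ := QQ_int_bd H
  have hQ2 : ∀ v, sN H v ≤ R → ∫ x, QQ v.1 x ≤ C * |R| := fun v hv => (hQ v).trans
    (mul_le_mul_of_nonneg_left (hv.trans (le_abs_self R)) hC.le)
  obtain ⟨Λ, hΛ⟩ : ∃ Λ, Λ = 4 / ε ^ 3 * (C * |R|) + 1 := ⟨_, rfl⟩
  have hΛ0 : 0 < Λ := by rw [hΛ]; positivity
  have hl : ∀ v, sN H v ≤ R → ∀ j x x', |BSe v.1 ε j x - BSe v.1 ε j x'| ≤ Λ * ‖x - x'‖ := by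
    intro v hv j x x'
    refine (BSe_lip v hε j x x').trans ?_
    calc _ ≤ 4 / ε ^ 3 * ‖x - x'‖ * (C * |R|) := mul_le_mul_of_nonneg_left (hQ2 v hv) (by positivity)
      _ ≤ _ := by rw [hΛ]; nlinarith [norm_nonneg (x - x')]
  have hr : 0 < s / (3 * Λ) := by positivity
  obtain ⟨T, hT, hcov⟩ := Metric.totallyBounded_iff.1 (tb_of_bdd H.dom.isBounded) _ hr
  haveI : Fintype T := hT.fintype
  obtain ⟨P, hP⟩ : ∃ P : svX Ω → (Fin 3 × T → ℝ), P = fun v p => BSe v.1 ε p.1 p.2 := ⟨_, rfl⟩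
  have hbd : IsBounded (P '' {v | sN H v ≤ R}) := by
    rw [isBounded_iff_forall_norm_le]
    refine ⟨1 / ε ^ 2 * (C * |R|), ?_⟩
    rintro _ ⟨v, hv, rfl⟩
    rw [pi_norm_le_iff_of_nonneg (by positivity)]
    intro p
    rw [hP, Real.norm_eq_abs]
    exact (BSe_bd v hε _ _).trans (mul_le_mul_of_nonneg_left (hQ2 v hv) (by positivity))
  obtain ⟨t, ht, htf, htc⟩ := (tb_of_bdd hbd).exists_subset (Metric.dist_mem_uniformity (show 0 < s/3 by positivity))
  obtain ⟨t', rfl⟩ := htf.exists_finset_coe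
  classical
  obtain ⟨u, hu, hut⟩ := Finset.subset_set_image_iff.1 ht
  refine ⟨u, fun w hw => hu hw, fun v hv => ?_⟩
  obtain ⟨y, hy, hvy⟩ := Set.mem_iUnion₂.1 (htc ⟨v, hv, rfl⟩)
  rw [← hut] at hy
  obtain ⟨w, hw, rfl⟩ := Finset.mem_image.1 (Finset.mem_coe.1 hy)
  refine ⟨w, hw, fun j x hx => ?_⟩
  obtain ⟨p, hp, hxp⟩ := Set.mem_iUnion₂.1 (hcov hx)
  rw [Metric.mem_ball, dist_eq_norm] at hxp
  have h1 := hl v hv j x p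
  have h2 := hl w (hu hw) j p x
  have h3 : |BSe v.1 ε j p - BSe w.1 ε j p| ≤ s / 3 := by
    have h4 : dist (P v) (P w) < s / 3 := hvy
    have := dist_le_pi_dist (P v) (P w) (j, ⟨p, hp⟩)
    rw [hP] at this
    simp only [Real.dist_eq] at this
    rw [hP] at h4
    exact this.trans h4.le
  have h5 : Λ * ‖x - p‖ ≤ s / 3 := by
    calc Λ * ‖x - p‖ ≤ Λ * (s / (3 * Λ)) := mul_le_mul_of_nonneg_left hxp.le hΛ0.le
      _ = _ := by field_simp
  rw [norm_sub_rev p x] at h2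
  have e : BSe v.1 ε j x - BSe w.1 ε j x = (BSe v.1 ε j x - BSe v.1 ε j p) +
    (BSe v.1 ε j p - BSe w.1 ε j p) + (BSe w.1 ε j p - BSe w.1 ε j x) := by ring
  rw [e]
  refine (abs_add_three _ _ _).trans ?_
  linarith

/-- uniform approximation by the regularised operator -/
lemma appr1 (H : Hy Ω α) (R δ : ℝ) (hδ : 0 < δ) : ∃ ε > 0, ∀ v : svX Ω, sN H v ≤ R → ∀ j,
    eLpNorm (fun x => dB Ω x ^ (-(α/6)) * (BSe v.1 ε j x - mK * v.1 j x)) 3 (volume.restrict Ω) ≤ ENNReal.ofReal δ := by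
  obtain ⟨C, hC, θ, hθ, h⟩ := embE H.dom H.a0 H.a2
  obtain ⟨q, hq⟩ : ∃ q, q = δ ^ 3 / (C * 216 * (|R| ^ 3 + 1)) := ⟨_, rfl⟩
  have hq0 : 0 < q := by rw [hq]; positivity
  refine ⟨q ^ (1/θ), by positivity, fun v hv j => ?_⟩
  have h1 := h v.1 v.2 j (q ^ (1/θ)) (by positivity)
  rw [← Real.rpow_mul hq0.le, one_div_mul_cancel hθ.ne', Real.rpow_one] at h1
  refine (ENNReal.pow_le_pow_left_iff (n := 3) (by norm_num)).1 ?_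
  rw [l3_pow]
  have e2 : eLpNorm (rW Ω α v) 3 (volume.restrict Ω) = ENNReal.ofReal (sN H v) := by
    have : sN H v = (eLpNorm (rW Ω α v) 3 (volume.restrict Ω)).toReal := toL_norm _ _ _
    rw [this, ENNReal.ofReal_toReal (memW H.dom H.a0 v).2.ne]
  have h0 : 0 ≤ sN H v := apply_nonneg _ _
  calc _ = ∫⁻ x in Ω, ENNReal.ofReal (dB Ω x ^ (-(α/2))) * ENNReal.ofReal (|BSe v.1 (q ^ (1/θ)) j x - mK * v.1 j x|) ^ 3 :=
        setLIntegral_congr_fun H.dom.isOpen.measurableSet fun x hx => enU H.dom α hx _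
    _ ≤ _ := h1
    _ ≤ ENNReal.ofReal (C * q) * (ENNReal.ofReal 216 * ENNReal.ofReal (sN H v) ^ 3) := by
        rw [← e2]; exact mul_le_mul_right (EQ_le H.dom v) _
    _ = ENNReal.ofReal (C * q * (216 * sN H v ^ 3)) := by
        rw [← ENNReal.ofReal_pow h0, ← ENNReal.ofReal_mul (by norm_num), ← ENNReal.ofReal_mul (by positivity)]
    _ ≤ ENNReal.ofReal (δ ^ 3) := by
        refine ENNReal.ofReal_le_ofReal ?_
        have h3 : sN H v ^ 3 ≤ |R| ^ 3 + 1 := by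
          have : sN H v ^ 3 ≤ |R| ^ 3 := by
            have := hv.trans (le_abs_self R)
            gcongr
          linarith
        calc C * q * (216 * sN H v ^ 3) ≤ C * q * (216 * (|R| ^ 3 + 1)) := by gcongr
          _ = δ ^ 3 := by rw [hq]; field_simp
    _ = _ := ENNReal.ofReal_pow hδ.le 3

lemma cptS (H : Hy Ω α) (R δ : ℝ) (hδ : 0 < δ) :
    ∃ t : Finset (svX Ω), ∀ v, sN H v ≤ R → ∃ w ∈ t, sS H (v - w) ≤ δ := by
  have hmK := mK_pos
  obtain ⟨δ1, hδ1⟩ : ∃ δ1, δ1 = mK * δ / 9 := ⟨_, rfl⟩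
  have hδ1p : 0 < δ1 := by rw [hδ1]; positivity
  obtain ⟨ε, hε, hap⟩ := appr1 H R δ1 hδ1p
  obtain ⟨c, hc⟩ : ∃ c, c = (eLpNorm (fun x => dB Ω x ^ (-(α/6))) 3 (volume.restrict Ω)).toReal := ⟨_, rfl⟩
  have hc0 : 0 ≤ c := by rw [hc]; positivity
  have hce : eLpNorm (fun x => dB Ω x ^ (-(α/6))) 3 (volume.restrict Ω) = ENNReal.ofReal c := by
    rw [hc, ENNReal.ofReal_toReal (mem6 H).2.ne]
  obtain ⟨t, ht, htc⟩ := net1 H hε R (δ1 / (c + 1)) (by positivity)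
  refine ⟨t, fun v hv => ?_⟩
  obtain ⟨w, hw, hvw⟩ := htc v hv
  refine ⟨w, hw, ?_⟩
  have key : ∀ j, ‖opU H j (v - w)‖ ≤ δ / 3 := by
    intro j
    obtain ⟨f, hf⟩ : ∃ f : svX Ω → E3 → ℝ, f = fun v x => dB Ω x ^ (-(α/6)) * (BSe v.1 ε j x - mK * v.1 j x) := ⟨_, rfl⟩
    obtain ⟨g, hg⟩ : ∃ g : E3 → ℝ, g = fun x => dB Ω x ^ (-(α/6)) * (BSe v.1 ε j x - BSe w.1 ε j x) := ⟨_, rfl⟩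
    have mf : ∀ v, AEStronglyMeasurable (f v) (volume.restrict Ω) := by
      intro v
      rw [hf]
      exact ((dBp_meas Ω _).mul ((BSe_cont v hε j).sub
        (continuous_const.mul (v.2.cc j).cont)).measurable).aestronglyMeasurable
    have mg : AEStronglyMeasurable g (volume.restrict Ω) := by
      rw [hg]
      exact ((dBp_meas Ω _).mul ((BSe_cont v hε j).sub (BSe_cont w hε j)).measurable).aestronglyMeasurable
    have e : mK • rU Ω α j (v - w) = (f w + g) - f v := by
      funext x
      rw [hf, hg]
      show mK * (dB Ω x ^ (-(α/6)) * (v.1 j x - w.1 j x)) = _ * _ + _ * _ - _ * _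
      ring
    have h1 : eLpNorm (mK • rU Ω α j (v - w)) 3 (volume.restrict Ω) ≤ ENNReal.ofReal (3 * δ1) := by
      rw [e]
      refine (eLpNorm_sub_le ((mf w).add mg) (mf v) (by norm_num)).trans ?_
      have b1 : eLpNorm (f w) 3 (volume.restrict Ω) ≤ ENNReal.ofReal δ1 := by
        rw [hf]; exact hap w (ht w hw) j
      have b2 : eLpNorm (f v) 3 (volume.restrict Ω) ≤ ENNReal.ofReal δ1 := by
        rw [hf]; exact hap v hv j
      have b3 : eLpNorm g 3 (volume.restrict Ω) ≤ ENNReal.ofReal δ1 := by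
        refine (eLpNorm_le_mul_eLpNorm_of_ae_le_mul (c := δ1 / (c + 1)) (g := fun x => dB Ω x ^ (-(α/6))) ?_ 3).trans ?_
        · filter_upwards [ae_restrict_mem H.dom.isOpen.measurableSet] with x hx
          rw [hg, norm_mul, mul_comm]
          exact mul_le_mul_of_nonneg_right (hvw j x hx) (norm_nonneg _)
        · rw [hce, ← ENNReal.ofReal_mul (by positivity)]
          refine ENNReal.ofReal_le_ofReal ?_
          rw [div_mul_eq_mul_div, div_le_iff₀ (by positivity)]
          nlinarith
      have b4 := eLpNorm_add_le (mf w) mg (p := 3) (by norm_num)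
      calc _ ≤ ENNReal.ofReal δ1 + ENNReal.ofReal δ1 + ENNReal.ofReal δ1 :=
            add_le_add (b4.trans (add_le_add b1 b3)) b2
        _ = _ := by rw [← ENNReal.ofReal_add hδ1p.le hδ1p.le, ← ENNReal.ofReal_add (by positivity) hδ1p.le]; congr 1; ring
    rw [eLpNorm_const_smul] at h1
    have h2 := ENNReal.toReal_mono ENNReal.ofReal_ne_top h1
    rw [ENNReal.toReal_mul, ENNReal.toReal_ofReal (by positivity), enorm_real,
      ENNReal.toReal_ofReal (abs_nonneg _), abs_of_pos hmK] at h2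
    rw [opU, toL_norm]
    rw [hδ1] at h2
    have h3 : 3 * (mK * δ / 9) = mK * (δ / 3) := by ring
    rw [h3] at h2
    exact le_of_mul_le_mul_left h2 hmK
  rw [sS_eq, Fin.sum_univ_three]
  have k0 := key 0
  have k1 := key 1
  have k2 := key 2
  linarith
end PS
end

section
/-! ### Passage to the limit -/
section PT
variable {Ω : Set E3} {α : ℝ}

/-- components of a vector field -/
def comps (φ : E3 → E3) : Fin 3 → E3 → ℝ := fun j x => φ x j

/-- vector field from components -/
def vecOf (V : Fin 3 → E3 → ℝ) (x : E3) : E3 := WithLp.toLp 2 (fun j => V j x)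

@[simp] lemma vecOf_co (V : Fin 3 → E3 → ℝ) (x : E3) (j : Fin 3) : vecOf V x j = V j x := rfl

lemma pd_eq {φ : E3 → E3} (h : Differentiable ℝ φ) (i j : Fin 3) (x : E3) : pd φ i j x = pds (comps φ j) i x := by
  have h1 : HasFDerivAt (comps φ j) ((EuclideanSpace.proj j : E3 →L[ℝ] ℝ).comp (fderiv ℝ φ x)) x :=
    (EuclideanSpace.proj j : E3 →L[ℝ] ℝ).hasFDerivAt.comp x (h x).hasFDerivAt
  rw [pds, h1.fderiv]; rfl

lemma comps_sv {φ : E3 → E3} (h : IsTestSol Ω φ) : SV Ω (comps φ) := by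
  have hd : Differentiable ℝ φ := h.smooth.differentiable (by simp)
  have hs : ∀ j, Function.support (comps φ j) ⊆ Function.support φ := by
    intro j x hx hx0
    exact hx (by rw [comps, hx0]; rfl)
  refine ⟨fun j => ⟨contDiff_euclidean.1 h.smooth j, h.compsupp.mono (hs j)⟩, fun j => ?_, fun x => ?_⟩
  · exact (closure_mono (hs j)).trans h.suppin
  · have := h.sol x
    simp only [vdiv, pd_eq hd] at this
    exact this

lemma vecOf_test {V : Fin 3 → E3 → ℝ} (h : SV Ω V) : IsTestSol Ω (vecOf V) := by
  have hsm : ContDiff ℝ (⊤ : ℕ∞) (vecOf V) := contDiff_euclidean.2 fun j => (h.cc j).sm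
  have hd : Differentiable ℝ (vecOf V) := hsm.differentiable (by simp)
  have hs : tsupport (vecOf V) ⊆ ⋃ j, tsupport (V j) := by
    refine closure_minimal ?_ (isClosed_iUnion_of_finite fun j => isClosed_tsupport _)
    intro x hx
    by_contra hc
    apply hx
    ext j
    by_contra hj
    exact hc (Set.mem_iUnion.2 ⟨j, subset_tsupport _ hj⟩)
  refine ⟨⟨hsm, ?_, ?_⟩, fun x => ?_⟩
  · exact (isCompact_iUnion fun j => (h.cc j).cs).of_isClosed_subset (isClosed_tsupport _) hs
  · exact hs.trans (Set.iUnion_subset h.supp)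
  · simp only [vdiv, pd_eq hd]
    exact h.div x

/-- Cauchy sequences have limits -/
lemma lim_ex {F : Type*} [NormedAddCommGroup F] [NormedSpace ℝ F] [CompleteSpace F] (H : Hy Ω α)
    (T : svX Ω →ₗ[ℝ] F) {C : ℝ} (hT : ∀ V, ‖T V‖ ≤ C * sN H V) {v : ℕ → svX Ω}
    (hv : ∀ k m, k ≤ m → sN H (v k - v m) ≤ 1/((k:ℝ)+1)) : ∃ g, Tendsto (fun k => T (v k)) atTop (𝓝 g) := by
  refine cauchySeq_tendsto_of_complete ?_
  refine cauchySeq_of_le_tendsto_0 (fun n : ℕ => |C| * (1/((n:ℝ)+1))) ?_ ?_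
  · have hw : ∀ n m N : ℕ, N ≤ n → n ≤ m → dist (T (v n)) (T (v m)) ≤ |C| * (1/((N:ℝ)+1)) := by
      intro n m N hn hm
      rw [dist_eq_norm, ← map_sub]
      refine (hT _).trans ?_
      have h0 : 0 ≤ sN H (v n - v m) := apply_nonneg _ _
      refine mul_le_mul (le_abs_self C) ((hv n m hm).trans ?_) h0 (abs_nonneg _)
      have : (N:ℝ) ≤ n := by exact_mod_cast hn
      gcongr
    intro n m N hn hm
    rcases le_total n m with h | h
    · exact hw n m N hn h
    · rw [dist_comm]; exact hw m n N hm h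
  · have := (tendsto_one_div_add_atTop_nhds_zero_nat (𝕜 := ℝ)).const_mul |C|
    simpa using this

lemma tri_lim {m : Measure E3} {f g : ℕ → Lp ℝ 3 m} {f' g' : Lp ℝ 3 m} (h : Lp ℝ 3 m)
    (hf : Tendsto f atTop (𝓝 f')) (hg : Tendsto g atTop (𝓝 g')) :
    Tendsto (fun k => tri (f k) (g k) h) atTop (𝓝 (tri f' g' h)) := by
  rw [tendsto_iff_dist_tendsto_zero]
  have h1 : Tendsto (fun k => (‖f k - f'‖ * ‖g k‖ + ‖f'‖ * ‖g k - g'‖) * ‖h‖) atTop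
      (𝓝 ((0 * ‖g'‖ + ‖f'‖ * 0) * ‖h‖)) :=
    (((tendsto_iff_norm_sub_tendsto_zero.1 hf).mul hg.norm).add
      ((tendsto_iff_norm_sub_tendsto_zero.1 hg).const_mul _)).mul_const _
  simp only [zero_mul, mul_zero, add_zero] at h1
  refine squeeze_zero (fun k => dist_nonneg) (fun k => ?_) h1
  rw [Real.dist_eq]
  exact tri_diff _ _ _ _ _

lemma mon_lim {m : Measure E3} {f : ℕ → Lp E3 3 m} {f' : Lp E3 3 m} (h : Lp E3 3 m)
    (hf : Tendsto f atTop (𝓝 f')) : Tendsto (fun k => mon (f k) h) atTop (𝓝 (mon f' h)) := by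
  rw [tendsto_iff_dist_tendsto_zero]
  have h1 : Tendsto (fun k => (‖f k‖ + ‖f'‖) * ‖f k - f'‖ * ‖h‖) atTop
      (𝓝 ((‖f'‖ + ‖f'‖) * 0 * ‖h‖)) :=
    ((hf.norm.add_const _).mul (tendsto_iff_norm_sub_tendsto_zero.1 hf)).mul_const _
  simp only [zero_mul, mul_zero] at h1
  refine squeeze_zero (fun k => dist_nonneg) (fun k => ?_) h1
  rw [Real.dist_eq]
  exact mon_diff _ _ _

/-- limit data -/
structure LimD (H : Hy Ω α) (v : ℕ → svX Ω) (w : Lp E3 3 (volume.restrict Ω))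
    (u : Fin 3 → Lp ℝ 3 (volume.restrict Ω)) (g : Fin 3 → Fin 3 → Lp ℝ 3 (volume.restrict Ω)) : Prop where
  hw : Tendsto (fun k => opW H (v k)) atTop (𝓝 w)
  hu : ∀ j, Tendsto (fun k => opU H j (v k)) atTop (𝓝 (u j))
  hg : ∀ i j, Tendsto (fun k => opD H i j (v k)) atTop (𝓝 (g i j))

lemma proj_lim {m : Measure E3} (k : Fin 3) {W : ℕ → Lp E3 3 m} {w : Lp E3 3 m} {a b : ℕ → Lp ℝ 3 m} {a' b' : Lp ℝ 3 m}
    (hW : Tendsto W atTop (𝓝 w)) (ha : Tendsto a atTop (𝓝 a')) (hb : Tendsto b atTop (𝓝 b'))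
    (h : ∀ n, ∀ᵐ x ∂m, W n x k = a n x - b n x) : ∀ᵐ x ∂m, w x k = a' x - b' x := by
  have h1 := ((EuclideanSpace.proj k : E3 →L[ℝ] ℝ).compLpL 3 m).continuous.tendsto w |>.comp hW
  have h2 : ∀ n, (EuclideanSpace.proj k : E3 →L[ℝ] ℝ).compLpL 3 m (W n) = a n - b n := by
    intro n
    refine Lp.ext ?_
    filter_upwards [(EuclideanSpace.proj k : E3 →L[ℝ] ℝ).coeFn_compLpL (W n), Lp.coeFn_sub (a n) (b n), h n] with x e1 e2 e3
    rw [e1, e2, Pi.sub_apply, ← e3]; rfl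
  have h3 := tendsto_nhds_unique h1 ((ha.sub hb).congr fun n => (h2 n).symm)
  filter_upwards [(EuclideanSpace.proj k : E3 →L[ℝ] ℝ).coeFn_compLpL w, Lp.coeFn_sub a' b'] with x e1 e2
  rw [h3, e2] at e1
  exact e1.symm

lemma opW_co (H : Hy Ω α) (V : svX Ω) : ∀ᵐ x ∂(volume.restrict Ω),
    opW H V x 0 = opD H 1 2 V x - opD H 2 1 V x ∧
    opW H V x 1 = opD H 2 0 V x - opD H 0 2 V x ∧ opW H V x 2 = opD H 0 1 V x - opD H 1 0 V x := by
  filter_upwards [toL_coe (rW Ω α) (memW H.dom H.a0) V, toL_coe (rD Ω α 1 2) (memD H.dom H.a0 1 2) V,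
    toL_coe (rD Ω α 2 1) (memD H.dom H.a0 2 1) V, toL_coe (rD Ω α 2 0) (memD H.dom H.a0 2 0) V,
    toL_coe (rD Ω α 0 2) (memD H.dom H.a0 0 2) V, toL_coe (rD Ω α 0 1) (memD H.dom H.a0 0 1) V,
    toL_coe (rD Ω α 1 0) (memD H.dom H.a0 1 0) V] with x e1 e2 e3 e4 e5 e6 e7
  simp only [opW, opD]
  rw [e1, e2, e3, e4, e5, e6, e7]
  exact rW_co V x

/-- velocity and gradient of the limit -/
def Lv (Ω : Set E3) (α : ℝ) (u : Fin 3 → Lp ℝ 3 (volume.restrict Ω)) : E3 → E3 :=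
  vecOf fun j x => dB Ω x ^ (α/6) * u j x
def LG (Ω : Set E3) (α : ℝ) (g : Fin 3 → Fin 3 → Lp ℝ 3 (volume.restrict Ω)) (x : E3) (i j : Fin 3) : ℝ :=
  dB Ω x ^ (-(α/3)) * g i j x

lemma LimD.curl {H : Hy Ω α} {v w u g} (L : LimD H v w u g) : ∀ᵐ x ∂(volume.restrict Ω),
    w x = dB Ω x ^ (α/3) • curlOf (LG Ω α g) x := by
  have h0 := proj_lim 0 L.hw (L.hg 1 2) (L.hg 2 1) fun n => (opW_co H (v n)).mono fun x h => h.1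
  have h1 := proj_lim 1 L.hw (L.hg 2 0) (L.hg 0 2) fun n => (opW_co H (v n)).mono fun x h => h.2.1
  have h2 := proj_lim 2 L.hw (L.hg 0 1) (L.hg 1 0) fun n => (opW_co H (v n)).mono fun x h => h.2.2
  filter_upwards [h0, h1, h2, ae_restrict_mem H.dom.isOpen.measurableSet] with x e0 e1 e2 hx
  have hp := dB_pos H.dom hx
  have e : dB Ω x ^ (α/3) * dB Ω x ^ (-(α/3)) = 1 := by
    rw [← Real.rpow_add hp]; simp
  have c : ∀ s t : ℝ, s - t = dB Ω x ^ (α/3) * (dB Ω x ^ (-(α/3)) * s - dB Ω x ^ (-(α/3)) * t) := by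
    intro s t
    rw [← mul_sub, ← mul_assoc, e, one_mul]
  apply E3_ext
  · rw [e0, PiLp.smul_apply]; exact c _ _
  · rw [e1, PiLp.smul_apply]; exact c _ _
  · rw [e2, PiLp.smul_apply]; exact c _ _

lemma w6 (H : Hy Ω α) {x : E3} (hx : x ∈ Ω) : dB Ω x ^ (-(α/6)) * dB Ω x ^ (α/6) = 1 := by
  have hp := dB_pos H.dom hx
  rw [← Real.rpow_add hp]; simp

lemma w3 (H : Hy Ω α) {x : E3} (hx : x ∈ Ω) : dB Ω x ^ (α/3) * dB Ω x ^ (-(α/3)) = 1 := by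
  have hp := dB_pos H.dom hx
  rw [← Real.rpow_add hp]; simp

lemma w66 (H : Hy Ω α) {x : E3} (hx : x ∈ Ω) : dB Ω x ^ (α/3) = dB Ω x ^ (α/6) * dB Ω x ^ (α/6) := by
  have hp := dB_pos H.dom hx
  rw [← Real.rpow_add hp]; congr 1; ring

lemma w66' (H : Hy Ω α) {x : E3} (hx : x ∈ Ω) : dB Ω x ^ (-(α/3)) = dB Ω x ^ (-(α/6)) * dB Ω x ^ (-(α/6)) := by
  have hp := dB_pos H.dom hx
  rw [← Real.rpow_add hp]; congr 1; ring

/-- weak gradient of the limit -/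
lemma LimD.weak {H : Hy Ω α} {v w u g} (L : LimD H v w u g) : HasWeakGrad Ω (Lv Ω α u) (LG Ω α g) := by
  intro ψ hψ i j
  have cψ : CC ψ := ⟨hψ.smooth, hψ.compsupp⟩
  have m2 : MemLp (fun x => dB Ω x ^ (α/3) * pds ψ i x) 3 (volume.restrict Ω) := by
    obtain ⟨C, hC, h⟩ := dBp_bdd H.dom (s := α/3) (by linarith [H.a0])
    obtain ⟨M, hM, h2⟩ := (cψ.pds i).bdd
    refine bd_memLp H.dom (C := C * M) ((dBp_meas Ω _).mul (cψ.pds i).cont.measurable).aestronglyMeasurable fun x hx => ?_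
    have h0 : 0 ≤ dB Ω x ^ (α/3) := Real.rpow_nonneg (dB_nonneg Ω x) _
    rw [norm_mul, Real.norm_eq_abs, abs_of_nonneg h0]
    exact mul_le_mul (h x hx) (h2 x) (norm_nonneg _) hC.le
  have m3 : MemLp (fun x => dB Ω x ^ (-(α/6)) * ψ x) 3 (volume.restrict Ω) := by
    obtain ⟨M, hM, h2⟩ := cψ.bdd
    refine ((mem6 H).const_mul M).mono ((dBp_meas Ω _).mul cψ.cont.measurable).aestronglyMeasurable
      (Eventually.of_forall fun x => ?_)
    rw [norm_mul, norm_mul, mul_comm]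
    refine mul_le_mul_of_nonneg_right ?_ (norm_nonneg _)
    exact (h2 x).trans (le_abs_self M)
  have key : ∀ k, tri (opU H j (v k)) ((mem6 H).toLp _) (m2.toLp _) = - tri (opD H i j (v k)) ((mem6 H).toLp _) (m3.toLp _) := by
    intro k
    have e1 : tri (opU H j (v k)) ((mem6 H).toLp _) (m2.toLp _) = ∫ x in Ω, (v k).1 j x * pds ψ i x := by
      rw [tri]
      refine integral_congr_ae ?_
      filter_upwards [toL_coe (rU Ω α j) (memU H.dom H.a0 H.a2 j) (v k), (mem6 H).coeFn_toLp, m2.coeFn_toLp,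
        ae_restrict_mem H.dom.isOpen.measurableSet] with x h1 h2 h3 hx
      rw [opU, h1, h2, h3, w66 H hx]
      show dB Ω x ^ (-(α/6)) * (v k).1 j x * _ * _ = _
      linear_combination ((v k).1 j x * pds ψ i x * (dB Ω x ^ (-(α/6)) * dB Ω x ^ (α/6) + 1)) * w6 H hx
    have e2 : tri (opD H i j (v k)) ((mem6 H).toLp _) (m3.toLp _) = ∫ x in Ω, pds ((v k).1 j) i x * ψ x := by
      rw [tri]
      refine integral_congr_ae ?_
      filter_upwards [toL_coe (rD Ω α i j) (memD H.dom H.a0 i j) (v k), (mem6 H).coeFn_toLp, m3.coeFn_toLp,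
        ae_restrict_mem H.dom.isOpen.measurableSet] with x h1 h2 h3 hx
      rw [opD, h1, h2, h3]
      show dB Ω x ^ (α/3) * pds ((v k).1 j) i x * _ * _ = _
      have := w3 H hx
      rw [w66' H hx] at this
      linear_combination (pds ((v k).1 j) i x * ψ x) * this
    rw [e1, e2, setIntegral_eq_integral_of_forall_compl_eq_zero, setIntegral_eq_integral_of_forall_compl_eq_zero]
    · exact cc_ibp ((v k).2.cc j) cψ i
    · intro x hx
      rw [(v k).2.pds0 hx, zero_mul]
    · intro x hx
      rw [image_eq_zero_of_notMem_tsupport (fun h => hx ((v k).2.supp j h)), zero_mul]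
  have l1 := tri_lim (m2.toLp _) (L.hu j) (tendsto_const_nhds (x := (mem6 H).toLp _))
  have l2 := (tri_lim (m3.toLp _) (L.hg i j) (tendsto_const_nhds (x := (mem6 H).toLp _))).neg
  have l3 := tendsto_nhds_unique l1 (l2.congr fun k => (key k).symm)
  have e1 : tri (u j) ((mem6 H).toLp _) (m2.toLp _) = ∫ x in Ω, Lv Ω α u x j * pds ψ i x := by
    rw [tri]
    refine integral_congr_ae ?_
    filter_upwards [(mem6 H).coeFn_toLp, m2.coeFn_toLp, ae_restrict_mem H.dom.isOpen.measurableSet] with x h2 h3 hx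
    rw [h2, h3, w66 H hx]
    show _ = dB Ω x ^ (α/6) * u j x * pds ψ i x
    linear_combination (u j x * pds ψ i x * dB Ω x ^ (α/6)) * w6 H hx
  have e2 : tri (g i j) ((mem6 H).toLp _) (m3.toLp _) = ∫ x in Ω, LG Ω α g x i j * ψ x := by
    rw [tri]
    refine integral_congr_ae ?_
    filter_upwards [(mem6 H).coeFn_toLp, m3.coeFn_toLp, ae_restrict_mem H.dom.isOpen.measurableSet] with x h2 h3 hx
    rw [h2, h3, LG, w66' H hx]
    ring
  rw [← e1, ← e2]
  exact l3

lemma sum3_cube (f : Fin 3 → ℝ) (hf : ∀ i, 0 ≤ f i) : (∑ i, f i) ^ 3 ≤ 9 * ∑ i, f i ^ 3 := by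
  have h := pow_sum_div_card_le_sum_pow (s := Finset.univ) (f := f) (fun i _ => hf i) 2
  rw [div_le_iff₀ (by norm_num)] at h
  norm_num at h
  linarith

end PT
end

section
section PU
variable {Ω : Set E3} {α : ℝ}

lemma frob_sum_le (M : Fin 3 → Fin 3 → ℝ) : frob M ≤ ∑ i, ∑ j, |M i j| := by
  unfold frob
  refine Real.sqrt_le_iff.2 ⟨Finset.sum_nonneg fun i _ => Finset.sum_nonneg fun j _ => abs_nonneg _, ?_⟩
  refine le_trans ?_ (Finset.sum_sq_le_sq_sum_of_nonneg (f := fun i => ∑ j, |M i j|)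
    fun i _ => Finset.sum_nonneg fun j _ => abs_nonneg _)
  refine Finset.sum_le_sum fun i _ => ?_
  refine le_trans (le_of_eq ?_) (Finset.sum_sq_le_sq_sum_of_nonneg (f := fun j => |M i j|) fun j _ => abs_nonneg _)
  exact Finset.sum_congr rfl fun j _ => (sq_abs _).symm

/-- pointwise comparison of the weighted norms -/
lemma pt_bd (H : Hy Ω α) : ∃ K, 0 < K ∧ ∀ x ∈ Ω, ∀ (y : E3) (M : Fin 3 → Fin 3 → ℝ) (a : Fin 3 → ℝ)
    (b : Fin 3 → Fin 3 → ℝ), (∀ j, y j = dB Ω x ^ (α/6) * a j) → (∀ i j, M i j = dB Ω x ^ (-(α/3)) * b i j) →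
    dB Ω x ^ α * (‖y‖ ^ (3:ℝ) + frob M ^ (3:ℝ)) ≤ K * (∑ j, ‖a j‖ ^ 3 + ∑ i, ∑ j, ‖b i j‖ ^ 3) := by
  obtain ⟨C, hC, h1⟩ := dBp_bdd H.dom (s := α) H.a0
  obtain ⟨D, hD, h2⟩ := dBp_bdd H.dom (s := α/6) (by linarith [H.a0])
  refine ⟨9 * (C * D ^ 3) + 81, by positivity, fun x hx y M a b hy hM => ?_⟩
  have hp := dB_pos H.dom hx
  have c1 := h1 x hx
  have c2 := h2 x hx
  obtain ⟨p, hpe⟩ : ∃ p, p = dB Ω x ^ α := ⟨_, rfl⟩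
  obtain ⟨q, hqe⟩ : ∃ q, q = dB Ω x ^ (α/6) := ⟨_, rfl⟩
  obtain ⟨r, hre⟩ : ∃ r, r = dB Ω x ^ (-(α/3)) := ⟨_, rfl⟩
  have hpr : p * r ^ 3 = 1 := by
    rw [hpe, hre, ← Real.rpow_mul_natCast hp.le, ← Real.rpow_add hp]
    norm_num
  have p0 : 0 < p := by rw [hpe]; positivity
  have q0 : 0 < q := by rw [hqe]; positivity
  have r0 : 0 < r := by rw [hre]; positivity
  rw [← hpe] at c1 ⊢
  rw [← hqe] at c2
  simp only [← hqe] at hy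
  simp only [← hre] at hM
  have e3 : ∀ t : ℝ, t ^ (3:ℝ) = t ^ 3 := fun t => by
    have := Real.rpow_natCast t 3
    simpa using this
  rw [e3, e3]
  have A0 : 0 ≤ ∑ j, ‖a j‖ ^ 3 := Finset.sum_nonneg fun i _ => by positivity
  have B0 : 0 ≤ ∑ i, ∑ j, ‖b i j‖ ^ 3 := Finset.sum_nonneg fun i _ => Finset.sum_nonneg fun j _ => by positivity
  have s1 : ‖y‖ ≤ q * ∑ j, ‖a j‖ := by
    refine (E3_norm_le y).trans (le_of_eq ?_)
    simp only [hy, abs_mul, abs_of_pos q0, Fin.sum_univ_three, Real.norm_eq_abs]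
    ring
  have s2 : frob M ≤ r * ∑ i, ∑ j, ‖b i j‖ := by
    refine (frob_sum_le M).trans (le_of_eq ?_)
    simp only [hM, abs_mul, abs_of_pos r0, ← Finset.mul_sum, Real.norm_eq_abs]
  have t1 : p * ‖y‖ ^ 3 ≤ 9 * (C * D ^ 3) * ∑ j, ‖a j‖ ^ 3 := by
    calc p * ‖y‖ ^ 3 ≤ C * (D * ∑ j, ‖a j‖) ^ 3 := by gcongr; exact s1.trans (by gcongr)
      _ = C * D ^ 3 * (∑ j, ‖a j‖) ^ 3 := by ring
      _ ≤ C * D ^ 3 * (9 * ∑ j, ‖a j‖ ^ 3) := by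
        gcongr; exact sum3_cube _ fun j => norm_nonneg _
      _ = _ := by ring
  have t2 : p * frob M ^ 3 ≤ 81 * ∑ i, ∑ j, ‖b i j‖ ^ 3 := by
    have f0 : 0 ≤ frob M := Real.sqrt_nonneg _
    calc p * frob M ^ 3 ≤ p * (r * ∑ i, ∑ j, ‖b i j‖) ^ 3 := by gcongr
      _ = (p * r ^ 3) * (∑ i, ∑ j, ‖b i j‖) ^ 3 := by ring
      _ = (∑ i, ∑ j, ‖b i j‖) ^ 3 := by rw [hpr, one_mul]
      _ ≤ 9 * ∑ i, (∑ j, ‖b i j‖) ^ 3 := sum3_cube _ fun i => Finset.sum_nonneg fun j _ => norm_nonneg _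
      _ ≤ 9 * ∑ i, 9 * ∑ j, ‖b i j‖ ^ 3 := by
        gcongr with i; exact sum3_cube _ fun j => norm_nonneg _
      _ = _ := by rw [← Finset.mul_sum]; ring
  have u1 : 0 ≤ 81 * ∑ j, ‖a j‖ ^ 3 := by positivity
  have u2 : 0 ≤ 9 * (C * D ^ 3) * ∑ i, ∑ j, ‖b i j‖ ^ 3 := by positivity
  nlinarith

lemma int_bd (H : Hy Ω α) : ∃ K, 0 < K ∧ ∀ (Y : E3 → E3) (M : E3 → Fin 3 → Fin 3 → ℝ)
    (a : Fin 3 → Lp ℝ 3 (volume.restrict Ω)) (b : Fin 3 → Fin 3 → Lp ℝ 3 (volume.restrict Ω)),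
    (∀ j, ∀ᵐ x ∂(volume.restrict Ω), Y x j = dB Ω x ^ (α/6) * a j x) →
    (∀ i j, ∀ᵐ x ∂(volume.restrict Ω), M x i j = dB Ω x ^ (-(α/3)) * b i j x) →
    IntegrableOn (fun x => dB Ω x ^ α * (‖Y x‖ ^ (3:ℝ) + frob (M x) ^ (3:ℝ))) Ω ∧
    0 ≤ ∫ x in Ω, dB Ω x ^ α * (‖Y x‖ ^ (3:ℝ) + frob (M x) ^ (3:ℝ)) ∧
    ∫ x in Ω, dB Ω x ^ α * (‖Y x‖ ^ (3:ℝ) + frob (M x) ^ (3:ℝ)) ≤ K * (∑ j, ‖a j‖ ^ 3 + ∑ i, ∑ j, ‖b i j‖ ^ 3) := by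
  obtain ⟨K, hK, h⟩ := pt_bd H
  refine ⟨K, hK, fun Y M a b hY hM => ?_⟩
  have hM' : ∀ᵐ x ∂(volume.restrict Ω), ∀ i j, M x i j = dB Ω x ^ (-(α/3)) * b i j x :=
    ae_all_iff.2 fun i => ae_all_iff.2 fun j => hM i j
  have hle : ∀ᵐ x ∂(volume.restrict Ω), dB Ω x ^ α * (‖Y x‖ ^ (3:ℝ) + frob (M x) ^ (3:ℝ)) ≤
      K * (∑ j, ‖a j x‖ ^ 3 + ∑ i, ∑ j, ‖b i j x‖ ^ 3) := by
    filter_upwards [ae_all_iff.2 hY, hM', ae_restrict_mem H.dom.isOpen.measurableSet] with x h1 h2 hx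
    exact h x hx _ _ (fun j => a j x) (fun i j => b i j x) h1 h2
  have hn : ∀ x, 0 ≤ dB Ω x ^ α * (‖Y x‖ ^ (3:ℝ) + frob (M x) ^ (3:ℝ)) := by
    intro x
    have f0 : 0 ≤ frob (M x) := Real.sqrt_nonneg _
    have f1 := Real.rpow_nonneg (dB_nonneg Ω x) α
    positivity
  have ia : Integrable (fun x => ∑ j, ‖a j x‖ ^ 3) (volume.restrict Ω) := integrable_finsetSum _ fun j _ => l3n_int (a j)
  have ib : Integrable (fun x => ∑ i, ∑ j, ‖b i j x‖ ^ 3) (volume.restrict Ω) :=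
    integrable_finsetSum _ fun i _ => integrable_finsetSum _ fun j _ => l3n_int (b i j)
  have iab : Integrable (fun x => K * (∑ j, ‖a j x‖ ^ 3 + ∑ i, ∑ j, ‖b i j x‖ ^ 3)) (volume.restrict Ω) :=
    (ia.add ib).const_mul K
  have mY : AEStronglyMeasurable Y (volume.restrict Ω) := by
    refine E3_meas fun j => ?_
    exact ((dBp_meas Ω _).aestronglyMeasurable.mul (Lp.aestronglyMeasurable (a j))).congr
      ((hY j).mono fun x hx => hx.symm)
  have mM : ∀ i j, AEMeasurable (fun x => M x i j) (volume.restrict Ω) := by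
    intro i j
    exact (((dBp_meas Ω _).aestronglyMeasurable.mul (Lp.aestronglyMeasurable (b i j))).congr
      ((hM i j).mono fun x hx => hx.symm)).aemeasurable
  have mf : AEMeasurable (fun x => frob (M x)) (volume.restrict Ω) := by
    unfold frob
    exact (Finset.aemeasurable_fun_sum _ fun i _ => Finset.aemeasurable_fun_sum _ fun j _ => (mM i j).pow_const 2).sqrt
  refine ⟨?_, integral_nonneg hn, ?_⟩
  · refine iab.mono' ?_ ?_
    · exact ((dBp_meas Ω α).aemeasurable.mul ((mY.norm.aemeasurable.pow_const _).add (mf.pow_const _))).aestronglyMeasurable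
    · filter_upwards [hle] with x hx
      rw [Real.norm_eq_abs, abs_of_nonneg (hn x)]
      exact hx
  · refine (integral_mono_of_nonneg (Eventually.of_forall hn) iab hle).trans (le_of_eq ?_)
    rw [integral_const_mul, integral_add ia ib, integral_finsetSum _ fun j _ => l3n_int (a j),
      integral_finsetSum _ fun i _ => integrable_finsetSum _ fun j _ => l3n_int (b i j)]
    congr 2
    · exact Finset.sum_congr rfl fun j _ => (l3n_pow _).symm
    · refine Finset.sum_congr rfl fun i _ => ?_
      rw [integral_finsetSum _ fun j _ => l3n_int (b i j)]
      exact Finset.sum_congr rfl fun j _ => (l3n_pow _).symm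

lemma LimD.mem {H : Hy Ω α} {v w u g} (L : LimD H v w u g) : MemW1pSigma Ω 3 α (Lv Ω α u) (LG Ω α g) := by
  obtain ⟨K, hK, h⟩ := int_bd H
  refine ⟨?_, L.weak, ?_, ?_⟩
  · exact E3_meas fun j => ((dBp_meas Ω _).aestronglyMeasurable.mul (Lp.aestronglyMeasurable (u j)))
  · exact (h (Lv Ω α u) (LG Ω α g) u g (fun j => Eventually.of_forall fun x => rfl)
      fun i j => Eventually.of_forall fun x => rfl).1
  · refine ⟨fun n => vecOf (v n).1, fun n => vecOf_test (v n).2, ?_⟩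
    have hb := fun n => h (fun x => Lv Ω α u x - vecOf (v n).1 x)
      (fun x i j => LG Ω α g x i j - gradv (vecOf (v n).1) x i j)
      (fun j => u j - opU H j (v n)) (fun i j => g i j - opD H i j (v n)) (by
        intro j
        filter_upwards [Lp.coeFn_sub (u j) (opU H j (v n)), toL_coe (rU Ω α j) (memU H.dom H.a0 H.a2 j) (v n),
          ae_restrict_mem H.dom.isOpen.measurableSet] with x e1 e2 hx
        rw [e1, Pi.sub_apply, opU, e2]
        show dB Ω x ^ (α/6) * u j x - (v n).1 j x = dB Ω x ^ (α/6) * (u j x - dB Ω x ^ (-(α/6)) * (v n).1 j x)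
        linear_combination (v n).1 j x * w6 H hx) (by
        intro i j
        filter_upwards [Lp.coeFn_sub (g i j) (opD H i j (v n)), toL_coe (rD Ω α i j) (memD H.dom H.a0 i j) (v n),
          ae_restrict_mem H.dom.isOpen.measurableSet] with x e1 e2 hx
        rw [e1, Pi.sub_apply, opD, e2, gradv, pd_eq ((vecOf_test (v n).2).smooth.differentiable (by simp))]
        show dB Ω x ^ (-(α/3)) * g i j x - pds ((v n).1 j) i x =
          dB Ω x ^ (-(α/3)) * (g i j x - dB Ω x ^ (α/3) * pds ((v n).1 j) i x)
        linear_combination pds ((v n).1 j) i x * w3 H hx)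
    have hz : Tendsto (fun n => K * (∑ j, ‖u j - opU H j (v n)‖ ^ 3 + ∑ i, ∑ j, ‖g i j - opD H i j (v n)‖ ^ 3))
        atTop (𝓝 (K * (∑ j : Fin 3, 0 ^ 3 + ∑ i : Fin 3, ∑ j : Fin 3, 0 ^ 3))) := by
      refine ((tendsto_finsetSum _ fun j _ => ?_).add (tendsto_finsetSum _ fun i _ => tendsto_finsetSum _ fun j _ => ?_)).const_mul K
      · refine Tendsto.pow ?_ 3
        simpa only [norm_sub_rev] using tendsto_iff_norm_sub_tendsto_zero.1 (L.hu j)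
      · refine Tendsto.pow ?_ 3
        simpa only [norm_sub_rev] using tendsto_iff_norm_sub_tendsto_zero.1 (L.hg i j)
    have hz' : K * (∑ j : Fin 3, (0:ℝ) ^ 3 + ∑ i : Fin 3, ∑ j : Fin 3, (0:ℝ) ^ 3) = 0 := by simp
    rw [hz'] at hz
    exact squeeze_zero (fun n => (hb n).2.1) (fun n => (hb n).2.2) hz

end PU
end

section
section PV
variable {Ω : Set E3} {α : ℝ}

lemma vcurl_eq {φ : E3 → E3} (hd : Differentiable ℝ φ) (x : E3) : vcurl φ x = cu (comps φ) x := by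
  simp only [vcurl, cu, qq, pd_eq hd]

lemma inner_dot (a b : E3) : inner ℝ a b = dot3 a b := by
  simp only [dot3, PiLp.inner_apply, RCLike.inner_apply, conj_trivial]
  exact Finset.sum_congr rfl fun i _ => mul_comm _ _

/-- the limit solves the equation -/
lemma LimD.eqn {H : Hy Ω α} {v w u g} (L : LimD H v w u g) {F : E3 → Fin 3 → Fin 3 → ℝ}
    (hFm : ∀ i j, Measurable fun x => F x i j)
    (hFint : IntegrableOn (fun x => dB Ω x ^ (-α/2) * frob (F x) ^ ((3:ℝ)/2)) Ω)
    (hv : ∀ (k : ℕ) φ, |fA H (v k) φ - fB H (v k) φ - fl H (fun i j => (memF H hFm hFint i j).toLp _)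
      (fun i j => (memS H hFm hFint i j).toLp _) φ| ≤ 1/((k:ℝ)+1) * sN H φ)
    {φ : E3 → E3} (hφ : IsTestSol Ω φ) :
    (- ∫ x in Ω, mdot (fun i j => Lv Ω α u x i * Lv Ω α u x j) (gradv φ x))
          + (∫ x in Ω, dB Ω x ^ α * ‖curlOf (LG Ω α g) x‖ * dot3 (curlOf (LG Ω α g) x) (vcurl φ x))
        = - ∫ x in Ω, mdot (F x) (gradv φ x) := by
  have hd : Differentiable ℝ φ := hφ.smooth.differentiable (by simp)
  obtain ⟨Φ, hΦ⟩ : ∃ Φ : svX Ω, Φ.1 = comps φ := ⟨⟨comps φ, comps_sv hφ⟩, rfl⟩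
  obtain ⟨h, hh⟩ : ∃ h : Fin 3 → Fin 3 → Lp ℝ 3 (volume.restrict Ω), h = fun i j => (memF H hFm hFint i j).toLp _ := ⟨_, rfl⟩
  obtain ⟨k, hk⟩ : ∃ k : Fin 3 → Fin 3 → Lp ℝ 3 (volume.restrict Ω), k = fun i j => (memS H hFm hFint i j).toLp _ := ⟨_, rfl⟩
  rw [← hh, ← hk] at hv
  have lA : Tendsto (fun n => fA H (v n) Φ) atTop (𝓝 (mon w (opW H Φ))) := mon_lim _ L.hw
  have lB : Tendsto (fun n => fB H (v n) Φ) atTop (𝓝 (∑ i, ∑ j, tri (u i) (u j) (opD H i j Φ))) :=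
    tendsto_finsetSum _ fun i _ => tendsto_finsetSum _ fun j _ => tri_lim _ (L.hu i) (L.hu j)
  have lz : Tendsto (fun n => fA H (v n) Φ - fB H (v n) Φ - fl H h k Φ) atTop (𝓝 0) := by
    refine squeeze_zero_norm (fun n => hv n Φ) ?_
    have := (tendsto_one_div_add_atTop_nhds_zero_nat (𝕜 := ℝ)).mul_const (sN H Φ)
    simpa using this
  have heq := tendsto_nhds_unique ((lA.sub lB).sub_const (fl H h k Φ)) lz
  have hfl : fl H h k Φ = -∑ i, ∑ j, tri (h i j) (k i j) (opD H i j Φ) := rfl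
  rw [hfl] at heq
  have gd : ∀ i j x, gradv φ x i j = pds (Φ.1 j) i x := by
    intro i j x
    rw [gradv, pd_eq hd, hΦ]
  have e1 : mon w (opW H Φ) =
      ∫ x in Ω, dB Ω x ^ α * ‖curlOf (LG Ω α g) x‖ * dot3 (curlOf (LG Ω α g) x) (vcurl φ x) := by
    rw [mon]
    refine integral_congr_ae ?_
    filter_upwards [L.curl, toL_coe (rW Ω α) (memW H.dom H.a0) Φ,
      ae_restrict_mem H.dom.isOpen.measurableSet] with x c1 c2 hx
    have hp := dB_pos H.dom hx
    have c3 : rW Ω α Φ x = dB Ω x ^ (α/3) • vcurl φ x := by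
      rw [vcurl_eq hd, ← hΦ]; rfl
    rw [opW, c2, c1, c3, norm_smul, Real.norm_eq_abs, abs_of_pos (Real.rpow_pos_of_pos hp _)]
    rw [real_inner_smul_left, real_inner_smul_left, real_inner_smul_right, inner_dot]
    have c4 : dB Ω x ^ α = dB Ω x ^ (α/3) * dB Ω x ^ (α/3) * dB Ω x ^ (α/3) := by
      rw [← Real.rpow_add hp, ← Real.rpow_add hp]; congr 1; ring
    rw [c4]; ring
  have a2 : ∀ i j, (fun x => u i x * u j x * opD H i j Φ x) =ᵐ[volume.restrict Ω]
      fun x => Lv Ω α u x i * Lv Ω α u x j * gradv φ x i j := by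
    intro i j
    filter_upwards [toL_coe (rD Ω α i j) (memD H.dom H.a0 i j) Φ,
      ae_restrict_mem H.dom.isOpen.measurableSet] with x c2 hx
    rw [opD, c2, gd]
    show _ * (dB Ω x ^ (α/3) * pds (Φ.1 j) i x) = dB Ω x ^ (α/6) * u i x * (dB Ω x ^ (α/6) * u j x) * _
    rw [w66 H hx]; ring
  have a3 : ∀ i j, (fun x => h i j x * k i j x * opD H i j Φ x) =ᵐ[volume.restrict Ω]
      fun x => F x i j * gradv φ x i j := by
    intro i j
    have b1 : h i j =ᵐ[volume.restrict Ω] hF Ω α F i j := by rw [hh]; exact MemLp.coeFn_toLp _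
    have b2 : k i j =ᵐ[volume.restrict Ω] hS Ω α F i j := by rw [hk]; exact MemLp.coeFn_toLp _
    filter_upwards [toL_coe (rD Ω α i j) (memD H.dom H.a0 i j) Φ, b1, b2,
      ae_restrict_mem H.dom.isOpen.measurableSet] with x c2 c3 c4 hx
    rw [opD, c2, gd, c3, c4, hFS H F i j hx]
    show _ * (dB Ω x ^ (α/3) * pds (Φ.1 j) i x) = _
    linear_combination F x i j * pds (Φ.1 j) i x * w3 H hx
  have e2 : ∑ i, ∑ j, tri (u i) (u j) (opD H i j Φ) =
      ∫ x in Ω, mdot (fun i j => Lv Ω α u x i * Lv Ω α u x j) (gradv φ x) := by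
    have ii : ∀ i j, Integrable (fun x => Lv Ω α u x i * Lv Ω α u x j * gradv φ x i j) (volume.restrict Ω) :=
      fun i j => (tri_int _ _ _).congr (a2 i j)
    simp only [mdot]
    rw [integral_finsetSum _ fun i _ => integrable_finsetSum _ fun j _ => ii i j]
    refine Finset.sum_congr rfl fun i _ => ?_
    rw [integral_finsetSum _ fun j _ => ii i j]
    exact Finset.sum_congr rfl fun j _ => integral_congr_ae (a2 i j)
  have e3 : ∑ i, ∑ j, tri (h i j) (k i j) (opD H i j Φ) = ∫ x in Ω, mdot (F x) (gradv φ x) := by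
    have ii : ∀ i j, Integrable (fun x => F x i j * gradv φ x i j) (volume.restrict Ω) :=
      fun i j => (tri_int _ _ _).congr (a3 i j)
    simp only [mdot]
    rw [integral_finsetSum _ fun i _ => integrable_finsetSum _ fun j _ => ii i j]
    refine Finset.sum_congr rfl fun i _ => ?_
    rw [integral_finsetSum _ fun j _ => ii i j]
    exact Finset.sum_congr rfl fun j _ => integral_congr_ae (a3 i j)
  rw [← e1, ← e2, ← e3]
  linarith

end PV
end

/-- For `0 ≤ α < 2` and `F` with `∫_Ω d^{-α/2}|F|^{3/2} < ∞`, there is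
a weak solution `v ∈ W^{1,3}_{0,σ}(Ω, d^α)` of
`div(v ⊗ v) + curl(d^α|ω|ω) + ∇π = div F`, `div v = 0`, in the sense that
`-∫_Ω (v⊗v):∇φ + ∫_Ω d^α|ω|ω·curl φ = -∫_Ω F:∇φ` for all solenoidal test fields `φ`. -/
theorem generalized_BL_existence_divergence_form
    (Ω : Set E3) (hΩ : IsLipschitzDomain Ω) (α : ℝ) (hα0 : 0 ≤ α) (hα : α < 2)
    (F : E3 → Fin 3 → Fin 3 → ℝ)
    (hFmeas : ∀ i j, Measurable fun x => F x i j)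
    (hFint : IntegrableOn (fun x => dB Ω x ^ (-α/2) * frob (F x) ^ ((3:ℝ)/2)) Ω) :
    ∃ (v : E3 → E3) (G : E3 → Fin 3 → Fin 3 → ℝ),
      MemW1pSigma Ω 3 α v G ∧
      ∀ φ : E3 → E3, IsTestSol Ω φ →
        (- ∫ x in Ω, mdot (fun i j => v x i * v x j) (gradv φ x))
          + (∫ x in Ω, dB Ω x ^ α * ‖curlOf G x‖ * dot3 (curlOf G x) (vcurl φ x))
        = - ∫ x in Ω, mdot (F x) (gradv φ x) := by
  have H : Hy Ω α := ⟨hΩ, hα0, hα⟩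
  obtain ⟨κ, M, K, L, hA⟩ := absd H (fun i j => (memF H hFmeas hFint i j).toLp _)
    (fun i j => (memS H hFmeas hFint i j).toLp _) (cptS H)
  obtain ⟨v, hv1, hv2⟩ := abs_exist hA
  obtain ⟨CU, _, hU⟩ := opU_bd H
  obtain ⟨CD, _, hD⟩ := opD_bd H
  obtain ⟨w, hw⟩ := lim_ex H (opW H) (C := 1) (fun V => by rw [one_mul]; exact (sN_eq H V).ge) hv1
  choose u hu using fun j => lim_ex H (opU H j) (fun V => hU V j) hv1
  choose g hg using fun i j => lim_ex H (opD H i j) (fun V => hD V i j) hv1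
  have LD : LimD H v w u g := ⟨hw, hu, hg⟩
  exact ⟨Lv Ω α u, LG Ω α g, LD.mem, fun φ hφ => LD.eqn hFmeas hFint hv2 hφ⟩
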